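/- Let X be a metric surface of locally finite Hausdorff 2-measure and ε > 0. Then there exists a subset X̃ ⊂ X that is homeomorphic to X, every boundary component of which is a piecewise d̄-geodesic curve, together with a continuous retraction R : X → X̃ that is an ε-isometry; moreover, the inclusion map from X̃ into X is proper. -/

import Mathlib

open Set Metric MeasureTheory
open scoped ENNReal unitInterval

/-- The length of a curve `γ : [0,1] → X` in a metric space. -/
noncomputable def curveLength {X : Type*} [MetricSpace X] (γ : I → X) : ℝ≥0∞ :=
  eVariationOn γ Set.univ

/-- The extended length metric `d̄` associated to `(X,d)`. -/
noncomputable def extDist {X : Type*} [MetricSpace X] (x y : X) : ℝ≥0∞ :=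
  ⨅ (γ : I → X) (_ : Continuous γ) (_ : γ 0 = x) (_ : γ 1 = y), curveLength γ

/-- A `d̄`-geodesic: a continuous curve of finite length whose length equals the
`d̄`-distance between its endpoints. -/
def IsGeodesic {X : Type*} [MetricSpace X] (γ : I → X) : Prop :=
  Continuous γ ∧ curveLength γ < ⊤ ∧ curveLength γ = extDist (γ 0) (γ 1)

/-- A `d̄`-geodesic arc from `p` to `q`: the image of an injective `d̄`-geodesic. -/
def IsGeodesicArc {X : Type*} [MetricSpace X] (G : Set X) (p q : X) : Prop :=
  ∃ γ : I → X, IsGeodesic γ ∧ Function.Injective γ ∧ γ 0 = p ∧ γ 1 = q ∧ G = Set.range γ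

/-- A closed Jordan region: a subset homeomorphic to the closed unit disk whose
topological boundary is the image of the unit circle under the homeomorphism. -/
def IsClosedJordanRegion {X : Type*} [TopologicalSpace X] (U : Set X) : Prop :=
  ∃ e : ↥(Metric.closedBall (0 : ℂ) 1) ≃ₜ ↥U,
    frontier U =
      Subtype.val '' (⇑e '' {x : ↥(Metric.closedBall (0 : ℂ) 1) | (x : ℂ) ∈ Metric.sphere (0 : ℂ) 1})

/-- A metric surface: a metric space that is a 2-manifold, possibly with boundary. -/
def IsMetricSurface (X : Type*) [TopologicalSpace X] : Prop :=
  Nonempty (ChartedSpace (EuclideanHalfSpace 2) X)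

/-- The Hausdorff 2-measure, normalized to agree with Lebesgue measure on `ℝ²`. -/
noncomputable def mu2 (X : Type*) [EMetricSpace X] [MeasurableSpace X] [BorelSpace X] :
    Measure X :=
  ENNReal.ofReal (Real.pi / 4) • μH[2]

/-- The manifold boundary of a topological 2-manifold: the set of points having no open
neighborhood homeomorphic to the plane `ℝ² (= ℂ)`. -/
def manifoldBoundary (X : Type*) [TopologicalSpace X] : Set X :=
  {x : X | ¬ ∃ U : Set X, IsOpen U ∧ x ∈ U ∧ Nonempty (↥U ≃ₜ ℂ)}

/-- A set is a piecewise `d̄`-geodesic curve if it is the union of a locally finite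
family of `d̄`-geodesic arcs. -/
def IsPiecewiseGeodesic {X : Type*} [MetricSpace X] (C : Set X) : Prop :=
  ∃ 𝒢 : Set (Set X),
    (∀ G ∈ 𝒢, ∃ p q : X, IsGeodesicArc G p q) ∧
    C = ⋃₀ 𝒢 ∧
    ∀ x ∈ C, ∃ U ∈ nhds x, {G ∈ 𝒢 | (G ∩ U).Nonempty}.Finite

/-- Every boundary component of `X` is a piecewise `d̄`-geodesic curve. -/
def HasPiecewiseGeodesicBoundary (X : Type*) [MetricSpace X] : Prop :=
  ∀ x ∈ manifoldBoundary X,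
    IsPiecewiseGeodesic (connectedComponentIn (manifoldBoundary X) x)

section

open Set Metric MeasureTheory
open scoped ENNReal unitInterval

/-! ### Continuous logarithms on subsets of topological spaces -/

/-- `F` has a continuous logarithm on `K`. -/
def HasLogOn {α : Type*} [TopologicalSpace α] (F : α → ℂ) (K : Set α) : Prop :=
  ∃ L : α → ℂ, ContinuousOn L K ∧ ∀ z ∈ K, Complex.exp (L z) = F z

theorem exists_continuous_eqOn_of_isClosed.{u, v} {α : Type u} {Y : Type v} [TopologicalSpace α]
    [NormalSpace α] [TopologicalSpace Y] [TietzeExtension.{u, v} Y] {s : Set α} (hs : IsClosed s) {f : α → Y}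
    (hf : ContinuousOn f s) : ∃ g : α → Y, Continuous g ∧ EqOn g f s := by
  obtain ⟨g, hg⟩ := ContinuousMap.exists_restrict_eq hs ⟨s.domRestrict f, hf.domRestrict⟩
  exact ⟨g, g.continuous, fun x hx => by simpa using congrArg (fun k => k ⟨x, hx⟩) hg⟩

theorem IsCompact.continuousOn_of_leftInvOn {α β : Type*} [TopologicalSpace α]
    [TopologicalSpace β] [T2Space β] {K : Set α} (hK : IsCompact K) {f : α → β} {g : β → α}
    (hf : ContinuousOn f K) (hg : LeftInvOn g f K) : ContinuousOn g (f '' K) := by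
  rw [continuousOn_iff_isClosed]
  intro t ht
  refine ⟨f '' (K ∩ t), ((hK.inter_right ht).image_of_continuousOn
    (hf.mono inter_subset_left)).isClosed, ?_⟩
  ext y
  constructor
  · rintro ⟨h1, x, hx, rfl⟩
    refine ⟨⟨x, ⟨hx, ?_⟩, rfl⟩, x, hx, rfl⟩
    simpa [hg hx] using h1
  · rintro ⟨⟨x, ⟨hx, hxt⟩, rfl⟩, h⟩
    exact ⟨by simpa [hg hx] using hxt, h⟩

section HasLogOn

variable {α β : Type*} [TopologicalSpace α] [TopologicalSpace β] {F G : α → ℂ} {K A B : Set α}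

theorem HasLogOn.mono (h : HasLogOn F B) (hAB : A ⊆ B) : HasLogOn F A :=
  let ⟨L, hL, hE⟩ := h; ⟨L, hL.mono hAB, fun z hz => hE z (hAB hz)⟩

theorem HasLogOn.congr (h : HasLogOn F A) (hFG : EqOn F G A) : HasLogOn G A :=
  let ⟨L, hL, hE⟩ := h; ⟨L, hL, fun z hz => (hE z hz).trans (hFG hz)⟩

theorem HasLogOn.mul (hF : HasLogOn F A) (hG : HasLogOn G A) :
    HasLogOn (fun z => F z * G z) A :=
  let ⟨L, hL, hE⟩ := hF; let ⟨M, hM, hE'⟩ := hG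
  ⟨fun z => L z + M z, hL.add hM, fun z hz => by rw [Complex.exp_add, hE z hz, hE' z hz]⟩

theorem HasLogOn.inv (hF : HasLogOn F A) : HasLogOn (fun z => (F z)⁻¹) A :=
  let ⟨L, hL, hE⟩ := hF
  ⟨fun z => - L z, hL.neg, fun z hz => by rw [Complex.exp_neg, hE z hz]⟩

theorem HasLogOn.comp {F : β → ℂ} {B : Set β} (h : HasLogOn F B) {f : α → β}
    (hf : ContinuousOn f A) (hm : MapsTo f A B) : HasLogOn (fun z => F (f z)) A :=
  let ⟨L, hL, hE⟩ := h
  ⟨fun z => L (f z), hL.comp hf hm, fun z hz => hE _ (hm hz)⟩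

theorem hasLogOn_of_mem_slitPlane (hF : ContinuousOn F A) (h : ∀ z ∈ A, F z ∈ Complex.slitPlane) :
    HasLogOn F A :=
  ⟨fun z => Complex.log (F z), hF.clog h,
    fun z hz => Complex.exp_log (Complex.slitPlane_ne_zero (h z hz))⟩

/-- Two logarithms of the same function differ by a constant on preconnected sets. -/
theorem exists_int_sub_of_exp_eq {L M : α → ℂ} (hK : IsPreconnected K) (hL : ContinuousOn L K)
    (hM : ContinuousOn M K) (h : ∀ z ∈ K, Complex.exp (L z) = Complex.exp (M z)) :
    ∃ n : ℤ, ∀ z ∈ K, L z = M z + n * (2 * Real.pi * Complex.I) := by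
  have hd : IsDiscrete (range (Int.cast : ℤ → ℝ)) :=
    ⟨Int.isClosedEmbedding_coe_real.isEmbedding.toHomeomorph.discreteTopology_iff.mp inferInstance⟩
  have key : ∀ z ∈ K, ∃ n : ℤ, L z = M z + n * (2 * Real.pi * Complex.I) := fun z hz =>
    Complex.exp_eq_exp_iff_exists_int.mp (h z hz)
  have him : ∀ (z : α) (n : ℤ), L z = M z + n * (2 * Real.pi * Complex.I) →
      (L z - M z).im / (2 * Real.pi) = n := by
    intro z n hn
    rw [hn]
    have : (M z + n * (2 * Real.pi * Complex.I) - M z).im = n * (2 * Real.pi) := by simp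
    rw [this]
    field_simp
  obtain ⟨y, ⟨n, rfl⟩, hn⟩ := hK.eqOn_const_of_mapsTo (T := range (Int.cast : ℤ → ℝ)) hd
    (f := fun z => (L z - M z).im / (2 * Real.pi))
    ((Complex.continuous_im.comp_continuousOn (hL.sub hM)).div_const _)
    (fun z hz => by
      obtain ⟨n, hn⟩ := key z hz
      exact ⟨n, (him z n hn).symm⟩) ⟨0, 0, by simp⟩
  refine ⟨n, fun z hz => ?_⟩
  obtain ⟨m, hm⟩ := key z hz
  have h1 : (m : ℝ) = n := by rw [← him z m hm]; exact hn hz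
  rw [hm, Int.cast_injective h1]

/-- Logarithms on two closed sets with preconnected intersection can be merged. -/
theorem HasLogOn.union (hA : IsClosed A) (hB : IsClosed B) (hAB : IsPreconnected (A ∩ B))
    (h1 : HasLogOn F A) (h2 : HasLogOn F B) : HasLogOn F (A ∪ B) := by
  classical
  obtain ⟨L, hL, hE⟩ := h1
  obtain ⟨M, hM, hE'⟩ := h2
  obtain ⟨n, hn⟩ := exists_int_sub_of_exp_eq hAB (hL.mono inter_subset_left)
    (hM.mono inter_subset_right) (fun z hz => (hE z hz.1).trans (hE' z hz.2).symm)
  have e2 : ∀ z ∈ B, A.piecewise L (fun z => M z + n * (2 * Real.pi * Complex.I)) z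
      = M z + n * (2 * Real.pi * Complex.I) := by
    intro z hz
    by_cases hzA : z ∈ A
    · rw [piecewise_eq_of_mem _ _ _ hzA, hn z ⟨hzA, hz⟩]
    · rw [piecewise_eq_of_notMem _ _ _ hzA]
  refine ⟨A.piecewise L (fun z => M z + n * (2 * Real.pi * Complex.I)), ?_, ?_⟩
  · refine ContinuousOn.union_of_isClosed (hL.congr (piecewise_eqOn _ _ _)) ?_ hA hB
    exact (hM.add continuousOn_const).congr e2
  · rintro z (hz | hz)
    · rw [piecewise_eq_of_mem _ _ _ hz, hE z hz]
    · rw [e2 z hz, Complex.exp_add, Complex.exp_int_mul_two_pi_mul_I, mul_one, hE' z hz]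

end HasLogOn

theorem hasLogOn_univ_complex {F : ℂ → ℂ} (hF : Continuous F) (h0 : ∀ z, F z ≠ 0) :
    HasLogOn F univ := by
  have hs : IsSimplyConnected (univ : Set ℂ) := by
    have : SimplyConnectedSpace (univ : Set ℂ) := by
      have : ContractibleSpace (univ : Set ℂ) := (Homeomorph.Set.univ ℂ).contractibleSpace
      infer_instance
    exact this
  obtain ⟨f, hf, hE⟩ := Complex.exists_continuousOn_eqOn_exp_comp hs isOpen_univ
    hF.continuousOn (by simpa using h0)
  exact ⟨f, hf, hE⟩

/-- A nonvanishing continuous function on a retract of the plane has a logarithm. -/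
theorem hasLogOn_of_retract {K : Set ℂ} {ρ : ℂ → ℂ} (hρ : Continuous ρ) (hm : ∀ z, ρ z ∈ K)
    (hid : ∀ z ∈ K, ρ z = z) {F : ℂ → ℂ} (hF : ContinuousOn F K) (h0 : ∀ z ∈ K, F z ≠ 0) :
    HasLogOn F K :=
  ((hasLogOn_univ_complex (F := fun z => F (ρ z)) (hF.comp_continuous hρ hm)
    fun z => h0 _ (hm z)).mono (subset_univ K)).congr fun z hz => by simp [hid z hz]

/-- The unit square. -/
def unitSquare : Set ℂ := {z | z.re ∈ Icc (0 : ℝ) 1 ∧ z.im ∈ Icc (0 : ℝ) 1}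

/-- The coordinatewise retraction of the plane onto the rectangle `[a,b] × [c,d]`. -/
noncomputable def clampRect (a b c d : ℝ) (z : ℂ) : ℂ :=
  ⟨max a (min b z.re), max c (min d z.im)⟩

theorem continuous_clampRect (a b c d : ℝ) : Continuous (clampRect a b c d) := by
  have : clampRect a b c d = fun z => ((max a (min b z.re) : ℝ) : ℂ)
      + ((max c (min d z.im) : ℝ) : ℂ) * Complex.I := by
    funext z
    apply Complex.ext <;> simp [clampRect]
  rw [this]
  fun_prop

theorem hasLogOn_rect {a b c d : ℝ} (hab : a ≤ b) (hcd : c ≤ d) {F : ℂ → ℂ}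
    (hF : ContinuousOn F {z | z.re ∈ Icc a b ∧ z.im ∈ Icc c d})
    (h0 : ∀ z ∈ {z : ℂ | z.re ∈ Icc a b ∧ z.im ∈ Icc c d}, F z ≠ 0) :
    HasLogOn F {z | z.re ∈ Icc a b ∧ z.im ∈ Icc c d} := by
  refine hasLogOn_of_retract (continuous_clampRect a b c d) (fun z => ?_) (fun z hz => ?_) hF h0
  · simp [clampRect, hab, hcd]
  · obtain ⟨⟨h1, h2⟩, h3, h4⟩ := hz
    apply Complex.ext <;> simp [clampRect, *]

theorem hasLogOn_Icc {a b : ℝ} {F : ℝ → ℂ} (hF : ContinuousOn F (Icc a b))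
    (h0 : ∀ t ∈ Icc a b, F t ≠ 0) : HasLogOn F (Icc a b) := by
  rcases le_or_gt a b with hab | hab
  · have h := hasLogOn_rect (a := a) (b := b) (c := 0) (d := 0) hab le_rfl (F := fun z => F z.re)
      (hF.comp Complex.continuous_re.continuousOn fun _ hz => hz.1) (fun _ hz => h0 _ hz.1)
    simpa using h.comp (f := fun t : ℝ => (t : ℂ)) (A := Icc a b)
      Complex.continuous_ofReal.continuousOn (fun t ht => ⟨by simpa using ht, by simp⟩)
  · exact ⟨0, by simp [hab], by simp [hab]⟩

/-- Nonvanishing continuous functions on arcs have logarithms. -/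
theorem hasLogOn_image_Icc {α : Type*} [TopologicalSpace α] [T2Space α] {a b : ℝ} {c : ℝ → α}
    (hc : ContinuousOn c (Icc a b)) (hi : InjOn c (Icc a b)) {F : α → ℂ}
    (hF : ContinuousOn F (c '' Icc a b)) (h0 : ∀ z ∈ c '' Icc a b, F z ≠ 0) :
    HasLogOn F (c '' Icc a b) := by
  obtain ⟨L, hL, hE⟩ := hasLogOn_Icc (F := fun t => F (c t)) (hF.comp hc (mapsTo_image _ _))
    (fun t ht => h0 _ (mem_image_of_mem c ht))
  have hinv : ContinuousOn (Function.invFunOn c (Icc a b)) (c '' Icc a b) := 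
    isCompact_Icc.continuousOn_of_leftInvOn hc hi.leftInvOn_invFunOn
  refine ⟨fun z => L (Function.invFunOn c (Icc a b) z), hL.comp hinv ?_, ?_⟩
  · rintro _ ⟨t, ht, rfl⟩
    exact Function.invFunOn_mem ⟨t, ht, rfl⟩
  · intro z hz
    rw [hE _ (Function.invFunOn_mem hz)]
    exact congrArg F (Function.invFunOn_eq hz)

theorem not_hasLogOn_sphere {R : ℝ} (hR : 0 < R) : ¬ HasLogOn (fun z : ℂ => z) (sphere 0 R) := by
  rintro ⟨L, hL, hE⟩
  have hm : ∀ t : ℝ, (R * Complex.exp (t * Complex.I) : ℂ) ∈ sphere (0 : ℂ) R := by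
    intro t
    simp [Complex.norm_exp_ofReal_mul_I, abs_of_pos hR]
  obtain ⟨n, hn⟩ := exists_int_sub_of_exp_eq (K := univ)
    (L := fun t : ℝ => L (R * Complex.exp (t * Complex.I)))
    (M := fun t : ℝ => Complex.log R + t * Complex.I) isPreconnected_univ
    (hL.comp (by fun_prop) fun t _ => hm t) (by fun_prop) (fun t _ => by
      rw [hE _ (hm t), Complex.exp_add, Complex.exp_log (by exact_mod_cast hR.ne')])
  have h0 := hn 0 (mem_univ _)
  have h1 := hn (2 * Real.pi) (mem_univ _)
  simp only [Complex.ofReal_mul, Complex.ofReal_ofNat, Complex.exp_two_pi_mul_I] at h1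
  simp only [Complex.ofReal_zero, zero_mul, Complex.exp_zero] at h0
  rw [h0] at h1
  have := congrArg Complex.im h1
  simp at this

end

section

open Set Metric MeasureTheory
open scoped ENNReal unitInterval

/-! ### Separation in the plane -/

theorem not_hasLogOn_frontier_aux {W : Set ℂ} (hb : Bornology.IsBounded W) {u : ℂ}
    (hu : u ∈ W) {Q : ℂ → ℂ} (hQ : Continuous Q) (hQ0 : ∀ z ∈ closure W, Q z ≠ 0) :
    ¬ HasLogOn (fun z => (z - u) / Q z) (frontier W) := by
  classical
  rintro ⟨L, hL, hE⟩
  obtain ⟨M, hM, hML⟩ := exists_continuous_eqOn_of_isClosed isClosed_frontier hL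
  have hG : Continuous (W.piecewise (fun z => Q z * Complex.exp (M z)) (fun z => z - u)) := by
    refine continuous_piecewise (fun z hz => ?_) (by fun_prop) (by fun_prop)
    rw [hML hz, hE z hz]
    have := hQ0 z (frontier_subset_closure hz)
    field_simp
  have h0 : ∀ z, W.piecewise (fun z => Q z * Complex.exp (M z)) (fun z => z - u) z ≠ 0 := by
    intro z
    by_cases hz : z ∈ W
    · rw [piecewise_eq_of_mem _ _ _ hz]
      exact mul_ne_zero (hQ0 z (subset_closure hz)) (Complex.exp_ne_zero _)
    · rw [piecewise_eq_of_notMem _ _ _ hz, sub_ne_zero]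
      rintro rfl
      exact hz hu
  obtain ⟨R, hR, hWR⟩ := hb.subset_ball_lt 0 u
  refine not_hasLogOn_sphere hR (((hasLogOn_univ_complex hG h0).comp (f := fun z => z + u)
    (by fun_prop) (fun z _ => mem_univ _)).congr fun z hz => ?_)
  have : z + u ∉ W := fun h => by
    have := hWR h
    simp at this hz
    linarith
  simp [piecewise_eq_of_notMem _ _ _ this]

/-- If `K` contains the frontier of a bounded open set `W ∋ u`, then `z - u` has no continuous
logarithm on `K`. -/
theorem not_hasLogOn_sub {W K : Set ℂ} (hb : Bornology.IsBounded W)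
    (hK : frontier W ⊆ K) {u : ℂ} (hu : u ∈ W) : ¬ HasLogOn (fun z => z - u) K := fun h =>
  not_hasLogOn_frontier_aux hb hu (Q := fun _ => 1) continuous_const (by simp)
    ((h.mono hK).congr fun z _ => by simp)

/-- If `K` contains the frontier of a bounded open set containing `u` but not `v`, then
`(z - u) / (z - v)` has no continuous logarithm on `K`. -/
theorem not_hasLogOn_sub_div_sub {W K : Set ℂ} (hb : Bornology.IsBounded W)
    (hK : frontier W ⊆ K) {u v : ℂ} (hu : u ∈ W) (hv : v ∉ W) (hvK : v ∉ K) :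
    ¬ HasLogOn (fun z => (z - u) / (z - v)) K := fun h =>
  not_hasLogOn_frontier_aux hb hu (Q := fun z => z - v) (by fun_prop) (fun z hz h0 => by
    rw [sub_eq_zero] at h0
    subst h0
    rw [closure_eq_self_union_frontier] at hz
    exact hz.elim hv fun h => hvK (hK h)) (h.mono hK)

theorem hasLogOn_sub_div_sub {K S : Set ℂ} (hK : IsClosed K) (hS : IsPreconnected S)
    (hSK : Disjoint S K) {u v : ℂ} (hu : u ∈ S) (hv : v ∈ S) :
    HasLogOn (fun z => (z - u) / (z - v)) K := by
  have hne : ∀ x ∈ S, ∀ z ∈ K, z - x ≠ 0 := fun x hx z hz h => by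
    rw [sub_eq_zero] at h
    exact hSK.ne_of_mem hx hz h.symm
  have hsymm : ∀ x y, HasLogOn (fun z => (z - x) / (z - y)) K →
      HasLogOn (fun z => (z - y) / (z - x)) K := fun x y h => h.inv.congr fun z _ => by simp
  refine hS.induction₂' (fun x y => HasLogOn (fun z => (z - x) / (z - y)) K) ?_ ?_ hu hv
  · intro x hx
    have hKn : Kᶜ ∈ nhds x := hK.isOpen_compl.mem_nhds (disjoint_left.mp hSK hx)
    obtain ⟨r, hr, hrK⟩ := Metric.mem_nhds_iff.mp hKn
    filter_upwards [mem_nhdsWithin_of_mem_nhds (ball_mem_nhds x hr), self_mem_nhdsWithin]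
      with y hy hyS
    have : HasLogOn (fun z => (z - y) / (z - x)) K := by
      refine hasLogOn_of_mem_slitPlane ?_ ?_
      · refine ContinuousOn.div (by fun_prop) (by fun_prop) fun z hz => hne x hx z hz
      · intro z hz
        have hzx : r ≤ ‖z - x‖ := by
          by_contra hlt
          exact hrK (by simpa [dist_eq_norm] using hlt) hz
        have h : 1 + (x - y) / (z - x) ∈ Complex.slitPlane := by
          refine Complex.mem_slitPlane_of_norm_lt_one ?_
          rw [norm_div, div_lt_one (by linarith)]
          have : ‖x - y‖ < r := by rw [← dist_eq_norm, dist_comm]; exact hy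
          linarith
        convert h using 1
        have := hne x hx z hz
        field_simp
        ring
    exact ⟨hsymm _ _ this, this⟩
  · intro x y z hx hy hz h1 h2
    exact (h1.mul h2).congr fun w hw => by
      have := hne y hy w hw
      field_simp

/-- A Janiszewski-type theorem: if neither `A` nor `B` separates `u` from `v` and `A ∩ B` is
connected, then `A ∪ B` does not separate `u` from `v`. -/
theorem false_of_frontier_subset_union {A B S S' W : Set ℂ} (hA : IsClosed A) (hB : IsClosed B)
    (hAB : IsPreconnected (A ∩ B)) {u v : ℂ} (hS : IsPreconnected S) (hSA : Disjoint S A)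
    (huS : u ∈ S) (hvS : v ∈ S) (hS' : IsPreconnected S') (hSB : Disjoint S' B) (huS' : u ∈ S')
    (hvS' : v ∈ S') (hb : Bornology.IsBounded W) (hf : frontier W ⊆ A ∪ B)
    (hu : u ∈ W) (hv : v ∉ W) : False := by
  refine not_hasLogOn_sub_div_sub hb hf hu hv ?_
    (HasLogOn.union hA hB hAB (hasLogOn_sub_div_sub hA hS hSA huS hvS)
      (hasLogOn_sub_div_sub hB hS' hSB huS' hvS'))
  rintro (h | h)
  · exact disjoint_left.mp hSA hvS h
  · exact disjoint_left.mp hSB hvS' h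

/-- An arc does not contain the frontier of a nonempty bounded open set disjoint from it. -/
theorem not_frontier_subset_arc {W : Set ℂ} (hb : Bornology.IsBounded W)
    (hne : W.Nonempty) {a b : ℝ} {c : ℝ → ℂ} (hc : ContinuousOn c (Icc a b))
    (hi : InjOn c (Icc a b)) (hd : Disjoint W (c '' Icc a b)) : ¬ frontier W ⊆ c '' Icc a b := by
  intro hf
  obtain ⟨u, hu⟩ := hne
  refine not_hasLogOn_sub hb hf hu (hasLogOn_image_Icc hc hi (by fun_prop) fun z hz h0 => ?_)
  rw [sub_eq_zero] at h0
  exact hd.ne_of_mem hu hz h0.symm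

theorem exists_int_arg_of_exp {α : Type*} [TopologicalSpace α] {S : Set α} (hS : IsPreconnected S)
    {L : α → ℂ} (hL : ContinuousOn L S) (φ : ℝ)
    (h : ∀ z ∈ S, Complex.exp (L z) * Complex.exp (-φ * Complex.I) ∈ Complex.slitPlane) :
    ∃ k : ℤ, ∀ z ∈ S, (L z).im - φ - k * (2 * Real.pi)
      = (Complex.exp (L z) * Complex.exp (-φ * Complex.I)).arg := by
  obtain ⟨k, hk⟩ := exists_int_sub_of_exp_eq hS hL
    (M := fun z => Complex.log (Complex.exp (L z) * Complex.exp (-φ * Complex.I)) + φ * Complex.I)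
    ((ContinuousOn.clog (by fun_prop) h).add continuousOn_const) (fun z hz => by
      rw [Complex.exp_add, Complex.exp_log (Complex.slitPlane_ne_zero (h z hz)), mul_assoc,
        ← Complex.exp_add]
      simp)
  refine ⟨k, fun z hz => ?_⟩
  have := congrArg Complex.im (hk z hz)
  simp only [Complex.add_im, Complex.log_im, Complex.mul_im, Complex.ofReal_re, Complex.I_im,
    mul_one, Complex.ofReal_im, Complex.I_re, mul_zero, add_zero, Complex.intCast_re,
    Complex.intCast_im, zero_mul, Complex.mul_re, Complex.re_ofNat, Complex.im_ofNat,
    sub_zero] at this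
  linarith

theorem exists_int_abs_im_lt {α : Type*} [TopologicalSpace α] {S : Set α} (hS : IsPreconnected S)
    {L : α → ℂ} (hL : ContinuousOn L S) (φ : ℝ)
    (h : ∀ z ∈ S, 0 < (Complex.exp (L z) * Complex.exp (-φ * Complex.I)).re) :
    ∃ k : ℤ, ∀ z ∈ S, |(L z).im - φ - k * (2 * Real.pi)| < Real.pi / 2 := by
  obtain ⟨k, hk⟩ := exists_int_arg_of_exp hS hL φ fun z hz => Or.inl (h z hz)
  exact ⟨k, fun z hz => by
    rw [hk z hz]; exact Complex.abs_arg_lt_pi_div_two_iff.mpr (Or.inl (h z hz))⟩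

theorem exp_neg_pi_div_two : Complex.exp (-((Real.pi / 2 : ℝ) : ℂ) * Complex.I) = -Complex.I := by
  rw [neg_mul, Complex.exp_neg]
  push_cast
  rw [Complex.exp_pi_div_two_mul_I, Complex.inv_I]

theorem exp_pi_div_two_neg_neg :
    Complex.exp (-((-(Real.pi / 2) : ℝ) : ℂ) * Complex.I) = Complex.I := by
  push_cast
  rw [neg_neg, Complex.exp_pi_div_two_mul_I]

/-- A path along the left, top and right sides of the unit square. -/
theorem exists_sides_path : ∃ P : ℝ → ℂ, Continuous P ∧ P 0 = ((0 : ℝ) : ℂ) ∧ P 3 = ((1 : ℝ) : ℂ) ∧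
    (∀ t ∈ Icc (0 : ℝ) 3, P t ∈ unitSquare) ∧
    ∀ t ∈ Icc (0 : ℝ) 3, (P t).re = 0 ∨ (P t).re = 1 ∨ (P t).im = 1 := by
  set P : ℝ → ℂ := fun t => ⟨max 0 (min 1 (t - 1)), max 0 (min 1 (min t (3 - t)))⟩ with hP
  have hPc : Continuous P := by
    have : P = fun t => ((max 0 (min 1 (t - 1)) : ℝ) : ℂ)
        + ((max 0 (min 1 (min t (3 - t))) : ℝ) : ℂ) * Complex.I := by
      funext t
      apply Complex.ext <;> simp [hP]
    rw [this]
    fun_prop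
  refine ⟨P, hPc, ?_, ?_, fun t _ => ?_, fun t ht => ?_⟩
  · apply Complex.ext <;> simp [hP]
  · apply Complex.ext
    · simp [hP]
      norm_num
    · simp [hP]
  · refine ⟨⟨le_max_left _ _, ?_⟩, le_max_left _ _, ?_⟩ <;> simp [hP]
  · rcases le_or_gt t 1 with h1 | h1
    · left
      simp only [hP]
      rw [max_eq_left]
      exact (min_le_right _ _).trans (by linarith)
    · rcases le_or_gt 2 t with h2 | h2
      · right; left
        simp only [hP]
        rw [min_eq_left (by linarith), max_eq_right zero_le_one]
      · right; right
        simp only [hP]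
        rw [min_eq_left (le_min h1.le (by linarith)), max_eq_right zero_le_one]

/-- A planar Poincaré–Miranda theorem: a continuous map of the unit square whose values lie in the
four open half planes along the four consecutive boundary arcs `[0,m₁]`, `[m₁,m₂]`, `[m₂,1]` of
the bottom and the rest of the boundary has a zero. -/
theorem exists_zero_of_four_sides {h g : ℂ → ℝ} {m₁ m₂ : ℝ} (hm0 : 0 ≤ m₁) (hm : m₁ ≤ m₂)
    (hm1 : m₂ ≤ 1) (hh : ContinuousOn h unitSquare) (hg : ContinuousOn g unitSquare)
    (hl : ∀ t ∈ Icc 0 m₁, h (t : ℝ) < 0) (hr : ∀ t ∈ Icc m₂ 1, 0 < h (t : ℝ))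
    (hmid : ∀ t ∈ Icc m₁ m₂, g (t : ℝ) < 0)
    (htop : ∀ z ∈ unitSquare, z.re = 0 ∨ z.re = 1 ∨ z.im = 1 → 0 < g z) :
    ∃ z ∈ unitSquare, h z = 0 ∧ g z = 0 := by
  by_contra! hcon
  set F : ℂ → ℂ := fun z => (h z : ℂ) + (g z : ℂ) * Complex.I with hFdef
  have hFre : ∀ z, (F z).re = h z := fun z => by simp [hFdef]
  have hFim : ∀ z, (F z).im = g z := fun z => by simp [hFdef]
  have hF : ContinuousOn F unitSquare :=
    (Complex.continuous_ofReal.comp_continuousOn hh).add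
      ((Complex.continuous_ofReal.comp_continuousOn hg).mul continuousOn_const)
  have hF0 : ∀ z ∈ unitSquare, F z ≠ 0 := fun z hz h0 => by
    refine hcon z hz ?_ ?_
    · rw [← hFre, h0]; rfl
    · rw [← hFim, h0]; rfl
  obtain ⟨L, hL, hE⟩ := hasLogOn_rect (a := 0) (b := 1) (c := 0) (d := 1) zero_le_one zero_le_one
    hF hF0
  have hbot : ∀ {a b : ℝ}, 0 ≤ a → b ≤ 1 → ∀ t ∈ Icc a b, (t : ℂ) ∈ unitSquare :=
    fun ha hb t ht => ⟨⟨ha.trans ht.1, ht.2.trans hb⟩, by simp⟩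
  have hseg : ∀ {a b : ℝ}, 0 ≤ a → b ≤ 1 →
      ContinuousOn (fun t : ℝ => L t) (Icc a b) := fun ha hb =>
    hL.comp Complex.continuous_ofReal.continuousOn (hbot ha hb)
  obtain ⟨k₁, h₁⟩ := exists_int_abs_im_lt isPreconnected_Icc (hseg le_rfl (hm.trans hm1))
    Real.pi (fun t ht => by
      rw [hE _ (hbot le_rfl (hm.trans hm1) t ht), neg_mul, Complex.exp_neg, Complex.exp_pi_mul_I]
      have := hl t ht
      simp [hFre, inv_neg] at this ⊢
      exact this)
  obtain ⟨k₂, h₂⟩ := exists_int_abs_im_lt isPreconnected_Icc (hseg hm0 hm1)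
    (-(Real.pi / 2)) (fun t ht => by
      rw [hE _ (hbot hm0 hm1 t ht), exp_pi_div_two_neg_neg]
      have := hmid t ht
      simp [hFim] at this ⊢
      exact this)
  obtain ⟨k₃, h₃⟩ := exists_int_abs_im_lt isPreconnected_Icc (hseg (hm0.trans hm) le_rfl)
    0 (fun t ht => by
      rw [hE _ (hbot (hm0.trans hm) le_rfl t ht)]
      have := hr t ht
      simp [hFre] at this ⊢
      exact this)
  obtain ⟨P, hPc, hP0, hP3, hPm, hPs⟩ := exists_sides_path
  obtain ⟨k₄, h₄⟩ := exists_int_abs_im_lt (isPreconnected_Icc (a := (0 : ℝ)) (b := 3))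
    (L := fun t => L (P t)) (hL.comp hPc.continuousOn hPm) (Real.pi / 2) (fun t ht => by
      rw [hE _ (hPm t ht), exp_neg_pi_div_two]
      have := htop _ (hPm t ht) (hPs t ht)
      simp [hFim] at this ⊢
      exact this)
  have a1 := h₁ m₁ ⟨hm0, le_rfl⟩
  have a2 := h₂ m₁ ⟨le_rfl, hm⟩
  have a3 := h₂ m₂ ⟨hm, le_rfl⟩
  have a4 := h₃ m₂ ⟨le_rfl, hm1⟩
  have a5 := h₃ 1 ⟨hm1, le_rfl⟩
  have a6 := h₄ 3 ⟨by norm_num, le_rfl⟩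
  have a7 := h₄ 0 ⟨le_rfl, by norm_num⟩
  have a8 := h₁ 0 ⟨le_rfl, hm0⟩
  simp only [hP0, hP3] at a6 a7
  rw [abs_lt] at a1 a2 a3 a4 a5 a6 a7 a8
  have hπ := Real.pi_pos
  have cmp : ∀ {m n : ℤ} {d : ℝ}, (m : ℝ) * (2 * Real.pi) - n * (2 * Real.pi) < d →
      d ≤ 2 * Real.pi → m ≤ n := by
    intro m n d h1 h2
    by_contra hlt
    have : (n : ℝ) + 1 ≤ m := by exact_mod_cast (not_le.mp hlt)
    nlinarith
  have e1 : k₁ + 1 ≤ k₂ := by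
    have := cmp (m := k₁ + 1) (n := k₂) (d := 2 * Real.pi) (by push_cast; linarith) le_rfl
    exact this
  have e2 : k₂ ≤ k₃ := cmp (d := 2 * Real.pi) (by linarith) le_rfl
  have e3 : k₃ ≤ k₄ := cmp (d := 2 * Real.pi) (by linarith) le_rfl
  have e4 : k₄ ≤ k₁ := cmp (d := 2 * Real.pi) (by linarith) le_rfl
  omega

/-- A path starting on the real line between the endpoints of a cross-cut `c` of the upper half
plane and ending above `c` meets `c`. -/
theorem exists_crossing {c γ : ℝ → ℂ} (hc : ContinuousOn c (Icc 0 1))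
    (hγ : ContinuousOn γ (Icc 0 1)) {p q m : ℝ} (hc0 : c 0 = p) (hc1 : c 1 = q) (hγ0 : γ 0 = m)
    (hpm : p < m) (hmq : m < q) (hci : ∀ s ∈ Icc (0 : ℝ) 1, 0 ≤ (c s).im ∧ (c s).im ≤ (γ 1).im)
    (hγi : ∀ s ∈ Icc (0 : ℝ) 1, 0 ≤ (γ s).im) :
    ∃ s ∈ Icc (0 : ℝ) 1, ∃ t ∈ Icc (0 : ℝ) 1, c s = γ t := by
  by_contra! hcon
  set F : ℂ → ℂ := fun z => c z.re - γ z.im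
  have hF : ContinuousOn F unitSquare :=
    (hc.comp Complex.continuous_re.continuousOn fun z hz => hz.1).sub
      (hγ.comp Complex.continuous_im.continuousOn fun z hz => hz.2)
  have hF0 : ∀ z ∈ unitSquare, F z ≠ 0 := fun z hz h0 =>
    hcon _ hz.1 _ hz.2 (sub_eq_zero.mp h0)
  obtain ⟨L, hL, hE⟩ := hasLogOn_rect (a := 0) (b := 1) (c := 0) (d := 1) zero_le_one zero_le_one
    hF hF0
  obtain ⟨P, hPc, hP0, hP3, hPm, hPs⟩ := exists_sides_path
  have hPF : ∀ t ∈ Icc (0 : ℝ) 3, (F (P t)).im ≤ 0 := by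
    intro t ht
    obtain ⟨h1, h2⟩ := hPm t ht
    rcases hPs t ht with h | h | h
    · simp only [F, h, hc0, Complex.sub_im, Complex.ofReal_im]
      linarith [hγi _ h2]
    · simp only [F, h, hc1, Complex.sub_im, Complex.ofReal_im]
      linarith [hγi _ h2]
    · simp only [F, h, Complex.sub_im]
      linarith [(hci _ h1).2]
  have hbot : ∀ t ∈ Icc (0 : ℝ) 1, (t : ℂ) ∈ unitSquare := fun t ht => ⟨by simpa using ht, by simp⟩
  obtain ⟨k₁, h₁⟩ := exists_int_arg_of_exp (isPreconnected_Icc (a := (0 : ℝ)) (b := 3))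
    (L := fun t => L (P t)) (hL.comp hPc.continuousOn hPm) (-(Real.pi / 2)) (fun t ht => by
      rw [hE _ (hPm t ht), exp_pi_div_two_neg_neg]
      rcases (hPF t ht).lt_or_eq with h | h
      · exact Or.inl (by simpa using h)
      · refine Or.inr fun h' => hF0 _ (hPm t ht) (Complex.ext ?_ h)
        simpa using h')
  obtain ⟨k₂, h₂⟩ := exists_int_arg_of_exp (isPreconnected_Icc (a := (0 : ℝ)) (b := 1))
    (L := fun t : ℝ => L t) (hL.comp Complex.continuous_ofReal.continuousOn hbot) (Real.pi / 2)
    (fun t ht => by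
      have him : 0 ≤ (F t).im := by simpa [F, hγ0] using (hci t ht).1
      rw [hE _ (hbot t ht), exp_neg_pi_div_two]
      rcases him.lt_or_eq with h | h
      · exact Or.inl (by simpa using h)
      · refine Or.inr fun h' => hF0 _ (hbot t ht) (Complex.ext ?_ h.symm)
        simpa using h')
  have hF00 : F ((0 : ℝ) : ℂ) = ((p - m : ℝ) : ℂ) := by simp [F, hc0, hγ0]
  have hF10 : F ((1 : ℝ) : ℂ) = ((q - m : ℝ) : ℂ) := by simp [F, hc1, hγ0]
  have arg1 : (((p - m : ℝ) : ℂ) * Complex.I).arg = -(Real.pi / 2) := by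
    rw [show ((p - m : ℝ) : ℂ) * Complex.I = ((m - p : ℝ) : ℂ) * (-Complex.I) by push_cast; ring,
      Complex.arg_real_mul _ (by linarith), Complex.arg_neg_I]
  have arg2 : (((q - m : ℝ) : ℂ) * Complex.I).arg = Real.pi / 2 := by
    rw [Complex.arg_real_mul _ (by linarith), Complex.arg_I]
  have arg3 : (((p - m : ℝ) : ℂ) * -Complex.I).arg = Real.pi / 2 := by
    rw [show ((p - m : ℝ) : ℂ) * -Complex.I = ((m - p : ℝ) : ℂ) * Complex.I by push_cast; ring,
      Complex.arg_real_mul _ (by linarith), Complex.arg_I]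
  have arg4 : (((q - m : ℝ) : ℂ) * -Complex.I).arg = -(Real.pi / 2) := by
    rw [Complex.arg_real_mul _ (by linarith), Complex.arg_neg_I]
  have b1 := h₁ 0 ⟨le_rfl, by norm_num⟩
  have b2 := h₁ 3 ⟨by norm_num, le_rfl⟩
  have b3 := h₂ 0 ⟨le_rfl, zero_le_one⟩
  have b4 := h₂ 1 ⟨zero_le_one, le_rfl⟩
  simp only [hP0, hP3] at b1 b2
  rw [hE _ (hbot 0 ⟨le_rfl, zero_le_one⟩), hF00, exp_pi_div_two_neg_neg, arg1] at b1
  rw [hE _ (hbot 1 ⟨zero_le_one, le_rfl⟩), hF10, exp_pi_div_two_neg_neg, arg2] at b2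
  rw [hE _ (hbot 0 ⟨le_rfl, zero_le_one⟩), hF00, exp_neg_pi_div_two, arg3] at b3
  rw [hE _ (hbot 1 ⟨zero_le_one, le_rfl⟩), hF10, exp_neg_pi_div_two, arg4] at b4
  linarith [Real.pi_pos]

end

section

open Set Metric MeasureTheory
open scoped ENNReal unitInterval

/-! ### Logarithms on domains with connected complement -/

theorem hasLogOn_of_norm_sub_lt {α : Type*} [TopologicalSpace α] {S : Set α} {F : α → ℂ}
    (hF : ContinuousOn F S) (h : ∀ x ∈ S, ∀ y ∈ S, ‖F x - F y‖ < ‖F y‖) : HasLogOn F S := by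
  rcases S.eq_empty_or_nonempty with rfl | ⟨y, hy⟩
  · exact ⟨0, by simp, by simp⟩
  have hy0 : F y ≠ 0 := fun h0 => by simpa [h0] using h y hy y hy
  have h1 : HasLogOn (fun x => F x / F y) S := by
    refine hasLogOn_of_mem_slitPlane (hF.div_const _) fun x hx => ?_
    have : F x / F y = 1 + (F x - F y) / F y := by field_simp; ring
    rw [this]
    refine Complex.mem_slitPlane_of_norm_lt_one ?_
    rw [norm_div, div_lt_one (norm_pos_iff.mpr hy0)]
    exact h x hx y hy
  have h2 : HasLogOn (fun _ : α => F y) S :=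
    ⟨fun _ => Complex.log (F y), continuousOn_const, fun _ _ => Complex.exp_log hy0⟩
  exact (h1.mul h2).congr fun x _ => by field_simp

theorem hasLogOn_of_isCompact_real {C : Set ℝ} (hC : IsCompact C) {F : ℝ → ℂ}
    (hF : ContinuousOn F C) (h0 : ∀ t ∈ C, F t ≠ 0) : HasLogOn F C := by
  rcases C.eq_empty_or_nonempty with rfl | hne
  · exact ⟨0, by simp, by simp⟩
  obtain ⟨y, hy, hmin⟩ := hC.exists_isMinOn hne hF.norm
  have hy0 : 0 < ‖F y‖ := norm_pos_iff.mpr (h0 y hy)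
  have huc := hC.uniformContinuousOn_of_continuous hF
  rw [Metric.uniformContinuousOn_iff] at huc
  obtain ⟨δ, hδ, hd⟩ := huc _ hy0
  obtain ⟨a, ha⟩ := hC.bddBelow
  obtain ⟨b, hb⟩ := hC.bddAbove
  have small : ∀ s : ℝ, HasLogOn F (C ∩ Icc s (s + δ / 2)) := by
    intro s
    refine hasLogOn_of_norm_sub_lt (hF.mono inter_subset_left) fun x hx z hz => ?_
    refine lt_of_lt_of_le ?_ (hmin hz.1)
    rw [← dist_eq_norm]
    refine hd x hx.1 z hz.1 ?_
    rw [Real.dist_eq, abs_lt]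
    constructor <;> linarith [hx.2.1, hx.2.2, hz.2.1, hz.2.2]
  have key : ∀ n : ℕ, HasLogOn F (C ∩ Iic (a + n * (δ / 2))) := by
    intro n
    induction n with
    | zero =>
      refine (small a).mono fun x hx => ⟨hx.1, ha hx.1, ?_⟩
      have := hx.2
      simp at this
      linarith
    | succ n ih =>
      refine (HasLogOn.union (hC.isClosed.inter isClosed_Iic) (hC.isClosed.inter isClosed_Icc)
        ?_ ih (small (a + n * (δ / 2)))).mono ?_
      · refine Set.Subsingleton.isPreconnected fun x hx z hz => ?_
        have h1 := hx.1.2; have h2 := hx.2.2.1; have h3 := hz.1.2; have h4 := hz.2.2.1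
        simp only [mem_Iic] at h1 h3
        linarith
      · intro x hx
        rcases le_total x (a + n * (δ / 2)) with h | h
        · exact Or.inl ⟨hx.1, h⟩
        · refine Or.inr ⟨hx.1, h, ?_⟩
          have := hx.2
          push_cast at this
          simp only [mem_Iic] at this
          linarith
  obtain ⟨n, hn⟩ := exists_nat_gt ((b - a) / (δ / 2))
  refine (key n).mono fun x hx => ⟨hx, ?_⟩
  rw [div_lt_iff₀ (by positivity)] at hn
  have := hb hx
  simp only [mem_Iic]
  linarith

theorem hasLogOn_of_injOn_real {α : Type*} [TopologicalSpace α] {C : Set α} (hC : IsCompact C)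
    {a : α → ℝ} (ha : ContinuousOn a C) (hi : InjOn a C) {F : α → ℂ} (hF : ContinuousOn F C)
    (h0 : ∀ t ∈ C, F t ≠ 0) : HasLogOn F C := by
  rcases C.eq_empty_or_nonempty with rfl | ⟨x, hx⟩
  · exact ⟨0, by simp, by simp⟩
  have : Nonempty α := ⟨x⟩
  have hl : LeftInvOn (Function.invFunOn a C) a C := hi.leftInvOn_invFunOn
  have hm : MapsTo (Function.invFunOn a C) (a '' C) C := by
    rintro _ ⟨z, hz, rfl⟩
    rwa [hl hz]
  refine ((hasLogOn_of_isCompact_real (hC.image_of_continuousOn ha)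
    (F := fun t => F (Function.invFunOn a C t))
    (hF.comp (hC.continuousOn_of_leftInvOn ha hl) hm) fun t ht => h0 _ (hm ht)).comp ha
      (mapsTo_image _ _)).congr fun z hz => by
        show F _ = F z
        rw [hl hz]

/-- The closed unit grid cell centred at the lattice point `(m, n)`. -/
def gridCell (ν : ℤ × ℤ) : Set ℂ := {z | |z.re - ν.1| ≤ 1 / 2 ∧ |z.im - ν.2| ≤ 1 / 2}

theorem isCompact_gridCell (ν : ℤ × ℤ) : IsCompact (gridCell ν) := by
  have : gridCell ν = (Icc (ν.1 - 1 / 2 : ℝ) (ν.1 + 1 / 2)) ×ℂ (Icc (ν.2 - 1 / 2 : ℝ) (ν.2 + 1 / 2)) := by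
    ext z
    simp only [gridCell, mem_ofPred_eq, Complex.mem_reProdIm, mem_Icc, abs_le]
    constructor <;> rintro ⟨⟨_, _⟩, _, _⟩ <;> refine ⟨⟨?_, ?_⟩, ?_, ?_⟩ <;> linarith
  rw [this]
  exact isCompact_Icc.reProdIm isCompact_Icc

/-- Extension of a nonvanishing function over a grid cell having a free boundary point. -/
theorem exists_extend_gridCell {P : Set ℂ} (hP : IsClosed P) {ν : ℤ × ℤ} {w : ℂ}
    (hPν : ∀ z ∈ P ∩ gridCell ν, |z.re - ν.1| = 1 / 2 ∨ |z.im - ν.2| = 1 / 2)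
    (hw : w ∈ gridCell ν) (hwb : |w.re - ν.1| = 1 / 2 ∨ |w.im - ν.2| = 1 / 2) (hwP : w ∉ P)
    {F : ℂ → ℂ} (hF : ContinuousOn F P) (h0 : ∀ z ∈ P, F z ≠ 0) :
    ∃ G : ℂ → ℂ, ContinuousOn G (P ∪ gridCell ν) ∧ (∀ z ∈ P ∪ gridCell ν, G z ≠ 0) ∧ EqOn G F P := by
  classical
  set o : ℂ := ⟨ν.1, ν.2⟩ with ho
  have hray : ∀ z z' : ℂ, z ∈ gridCell ν → (|z.re - ν.1| = 1 / 2 ∨ |z.im - ν.2| = 1 / 2) →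
      z' ∈ gridCell ν → (|z'.re - ν.1| = 1 / 2 ∨ |z'.im - ν.2| = 1 / 2) →
      ∀ t : ℝ, 0 ≤ t → z - o = t * (z' - o) → z = z' := by
    intro z z' hz hzb hz' hzb' t ht h
    have hre : z.re - ν.1 = t * (z'.re - ν.1) := by simpa [ho] using congrArg Complex.re h
    have him : z.im - ν.2 = t * (z'.im - ν.2) := by simpa [ho] using congrArg Complex.im h
    obtain ⟨a1, a2⟩ := hz
    obtain ⟨b1, b2⟩ := hz'
    have e1 : |z.re - ν.1| = t * |z'.re - ν.1| := by rw [hre, abs_mul, abs_of_nonneg ht]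
    have e2 : |z.im - ν.2| = t * |z'.im - ν.2| := by rw [him, abs_mul, abs_of_nonneg ht]
    have t1 : t = 1 := by
      apply le_antisymm
      · rcases hzb' with h' | h'
        · rw [h'] at e1; linarith
        · rw [h'] at e2; linarith
      · rcases hzb with h' | h'
        · rw [h'] at e1; nlinarith
        · rw [h'] at e2; nlinarith
    subst t1
    apply Complex.ext <;> linarith
  have hne : ∀ z : ℂ, (|z.re - ν.1| = 1 / 2 ∨ |z.im - ν.2| = 1 / 2) → z - o ≠ 0 := by
    intro z hz h
    have hre : z.re - ν.1 = 0 := by simpa [ho] using congrArg Complex.re h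
    have him : z.im - ν.2 = 0 := by simpa [ho] using congrArg Complex.im h
    rw [hre, him] at hz
    norm_num at hz
  have hwo := hne w hwb
  have hC : IsCompact (P ∩ gridCell ν) := (isCompact_gridCell ν).inter_left hP
  have hslit : ∀ z ∈ P ∩ gridCell ν, -((z - o) / (w - o)) ∈ Complex.slitPlane := by
    intro z hz
    by_contra hcon
    rw [Complex.mem_slitPlane_iff, not_or, not_not, not_lt, Complex.neg_re, Complex.neg_im,
      neg_nonpos, neg_eq_zero] at hcon
    obtain ⟨h1, h2⟩ := hcon
    have h3 : (z - o) / (w - o) = (((z - o) / (w - o)).re : ℝ) :=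
      Complex.ext (by simp) (by simpa using h2)
    have := hray z w hz.2 (hPν z hz) hw hwb _ h1 (by rw [← h3]; field_simp)
    exact hwP (this ▸ hz.1)
  have hlog : HasLogOn F (P ∩ gridCell ν) := by
    refine hasLogOn_of_injOn_real hC (a := fun z => (-((z - o) / (w - o))).arg) ?_ ?_
      (hF.mono inter_subset_left) fun z hz => h0 z hz.1
    · intro z hz
      exact ((Complex.continuousAt_arg (hslit z hz)).comp
        (f := fun z => -((z - o) / (w - o))) (by fun_prop)).continuousWithinAt
    · intro z hz z' hz' h
      have n1 := Complex.slitPlane_ne_zero (hslit z hz)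
      have n2 := Complex.slitPlane_ne_zero (hslit z' hz')
      rw [Complex.arg_eq_arg_iff n1 n2] at h
      refine hray z z' hz.2 (hPν z hz) hz'.2 (hPν z' hz')
        (‖-((z - o) / (w - o))‖ / ‖-((z' - o) / (w - o))‖) (by positivity) ?_
      have hn : (‖-((z' - o) / (w - o))‖ : ℂ) ≠ 0 := by
        exact_mod_cast norm_ne_zero_iff.mpr n2
      have hn' : (‖-((z - o) / (w - o))‖ : ℂ) ≠ 0 := by
        exact_mod_cast norm_ne_zero_iff.mpr n1
      push_cast
      have h' := congrArg (fun u => -u * (w - o)) h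
      field_simp at h' ⊢
      linear_combination h'
  obtain ⟨L, hL, hE⟩ := hlog
  obtain ⟨M, hM, hML⟩ := exists_continuous_eqOn_of_isClosed hC.isClosed hL
  have e : ∀ z ∈ gridCell ν, P.piecewise F (fun z => Complex.exp (M z)) z = Complex.exp (M z) := by
    intro z hz
    by_cases hzP : z ∈ P
    · rw [piecewise_eq_of_mem _ _ _ hzP, hML ⟨hzP, hz⟩, hE z ⟨hzP, hz⟩]
    · rw [piecewise_eq_of_notMem _ _ _ hzP]
  refine ⟨P.piecewise F (fun z => Complex.exp (M z)), ?_, ?_, piecewise_eqOn _ _ _⟩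
  · refine ContinuousOn.union_of_isClosed (hF.congr (piecewise_eqOn _ _ _)) ?_ hP
      (isCompact_gridCell ν).isClosed
    exact (hM.cexp.continuousOn).congr e
  · rintro z (hz | hz)
    · rw [piecewise_eq_of_mem _ _ _ hz]; exact h0 z hz
    · rw [e z hz]; exact Complex.exp_ne_zero _

theorem eq_of_abs_sub_le_half {m n : ℤ} (h : |(m : ℝ) - n| ≤ 1 / 2) : m = n := by
  have : |m - n| < 1 := by
    have : (|m - n| : ℝ) < 1 := by linarith
    exact_mod_cast this
  have := Int.abs_lt_one_iff.mp this
  omega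

/-- The midpoint of two edge-adjacent cells lies in no other cell. -/
theorem midpoint_gridCell {ν τ : ℤ × ℤ}
    (h : (ν.1 = τ.1 ∧ |ν.2 - τ.2| = 1) ∨ (ν.2 = τ.2 ∧ |ν.1 - τ.1| = 1)) :
    ∃ w : ℂ, w ∈ gridCell ν ∧ (|w.re - ν.1| = 1 / 2 ∨ |w.im - ν.2| = 1 / 2) ∧
      ∀ κ, w ∈ gridCell κ → κ = ν ∨ κ = τ := by
  obtain ⟨m, n⟩ := ν
  obtain ⟨m', n'⟩ := τ
  have key : ∀ n n' k : ℤ, |n - n'| = 1 → |((n + n' : ℝ) / 2) - k| ≤ 1 / 2 → k = n ∨ k = n' := by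
    intro n n' k h1 h2
    rw [abs_le] at h2
    have a1 : n + n' - 2 * k ≤ 1 := by
      have : ((n + n' - 2 * k : ℤ) : ℝ) ≤ 1 := by push_cast; linarith [h2.2]
      exact_mod_cast this
    have a2 : -1 ≤ n + n' - 2 * k := by
      have : (-1 : ℝ) ≤ ((n + n' - 2 * k : ℤ) : ℝ) := by push_cast; linarith [h2.1]
      exact_mod_cast this
    rcases abs_eq (zero_le_one) |>.mp h1 with h | h <;> omega
  have half : ∀ n n' : ℤ, |n - n'| = 1 → |((n + n' : ℝ) / 2) - n| = 1 / 2 := by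
    intro n n' h1
    have : (|n - n'| : ℝ) = 1 := by exact_mod_cast h1
    rw [show ((n + n' : ℝ) / 2) - n = -((n - n') / 2) by ring, abs_neg, abs_div, this]
    norm_num
  rcases h with ⟨h1, h2⟩ | ⟨h1, h2⟩ <;> simp only at h1 h2 <;> subst h1
  · refine ⟨⟨m, (n + n') / 2⟩, ⟨by simp, (half n n' h2).le⟩, Or.inr (half n n' h2), ?_⟩
    rintro ⟨k, l⟩ ⟨hk, hl⟩
    have := eq_of_abs_sub_le_half hk
    subst this
    rcases key n n' l h2 hl with h | h <;> subst h <;> simp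
  · refine ⟨⟨(m + m') / 2, n⟩, ⟨(half m m' h2).le, by simp⟩, Or.inl (half m m' h2), ?_⟩
    rintro ⟨k, l⟩ ⟨hk, hl⟩
    have := eq_of_abs_sub_le_half hl
    subst this
    rcases key m m' k h2 hk with h | h <;> subst h <;> simp

theorem boundary_of_mem_gridCell {ν τ : ℤ × ℤ} (h : ν ≠ τ) {z : ℂ} (hz : z ∈ gridCell ν)
    (hz' : z ∈ gridCell τ) : |z.re - ν.1| = 1 / 2 ∨ |z.im - ν.2| = 1 / 2 := by
  by_contra! hcon
  obtain ⟨h1, h2⟩ := hcon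
  have key : ∀ (x : ℝ) (m n : ℤ), |x - m| ≤ 1 / 2 → |x - m| ≠ 1 / 2 → |x - n| ≤ 1 / 2 → m = n := by
    intro x m n a b c
    have a' := lt_of_le_of_ne a b
    have : |m - n| < 1 := by
      have : (|m - n| : ℝ) < 1 := by
        calc |(m : ℝ) - n| = |(x - n) - (x - m)| := by ring_nf
          _ ≤ |x - n| + |x - m| := abs_sub _ _
          _ < 1 := by linarith
      exact_mod_cast this
    have := Int.abs_lt_one_iff.mp this
    omega
  exact h (Prod.ext (key _ _ _ hz.1 h1 hz'.1) (key _ _ _ hz.2 h2 hz'.2))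

theorem adjacent_of_common_point {A : Set ℂ} {R O : Set (ℤ × ℤ)} {a : ℂ} (haA : a ∈ A)
    {ν τ : ℤ × ℤ} (hν : a ∈ gridCell ν) (hτ : a ∈ gridCell τ) (hνO : ν ∉ O) (hτO : τ ∈ O)
    (hR : ∀ κ, (gridCell κ ∩ A).Nonempty → κ ∉ O → κ ∈ R) :
    ∃ ν ∈ R, ∃ τ ∈ O, ν ∉ O ∧
      ((ν.1 = τ.1 ∧ |ν.2 - τ.2| = 1) ∨ (ν.2 = τ.2 ∧ |ν.1 - τ.1| = 1)) := by
  have near : ∀ (x : ℝ) (m n : ℤ), |x - m| ≤ 1 / 2 → |x - n| ≤ 1 / 2 → m ≠ n → |m - n| = 1 := by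
    intro x m n a b h
    have : |m - n| ≤ 1 := by
      have : (|m - n| : ℝ) ≤ 1 := by
        calc |(m : ℝ) - n| = |(x - n) - (x - m)| := by ring_nf
          _ ≤ |x - n| + |x - m| := abs_sub _ _
          _ ≤ 1 := by linarith
      exact_mod_cast this
    have h2 : 0 < |m - n| := abs_pos.mpr (sub_ne_zero.mpr h)
    omega
  have hmid : a ∈ gridCell (τ.1, ν.2) := ⟨hτ.1, hν.2⟩
  by_cases hO : (τ.1, ν.2) ∈ O
  · have hne : ν.1 ≠ τ.1 := fun h => hνO (by
      have : ν = (τ.1, ν.2) := Prod.ext h rfl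
      rwa [this])
    exact ⟨ν, hR ν ⟨a, hν, haA⟩ hνO, _, hO, hνO, Or.inr ⟨rfl, near _ _ _ hν.1 hτ.1 hne⟩⟩
  · have hne : ν.2 ≠ τ.2 := fun h => hO (by
      have : (τ.1, ν.2) = τ := Prod.ext rfl h
      rwa [this])
    exact ⟨_, hR _ ⟨a, hmid, haA⟩ hO, τ, hτO, hO, Or.inl ⟨rfl, near _ _ _ hν.2 hτ.2 hne⟩⟩

end

section

open Set Metric MeasureTheory
open scoped ENNReal unitInterval

theorem exists_int_near {N : ℕ} {x : ℝ} (hx : |x| ≤ N + 1 / 2) :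
    ∃ m ∈ Finset.Icc (-(N : ℤ)) N, |x - m| ≤ 1 / 2 := by
  rw [abs_le] at hx
  have hr := abs_le.mp (abs_sub_round x)
  by_cases h1 : (N : ℤ) < round x
  · have : (N : ℝ) + 1 ≤ round x := by exact_mod_cast h1
    exact ⟨N, by simp, by rw [abs_le]; push_cast; constructor <;> linarith⟩
  by_cases h2 : round x < -(N : ℤ)
  · have : (round x : ℝ) + 1 ≤ -N := by exact_mod_cast h2
    exact ⟨-N, by simp, by rw [abs_le]; push_cast; constructor <;> linarith⟩
  · exact ⟨round x, by simp; omega, abs_sub_round x⟩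

/-- The union of the grid cells with indices in a finite set. -/
def gridUnion (R : Finset (ℤ × ℤ)) : Set ℂ := ⋃ ν ∈ R, gridCell ν

theorem mem_gridUnion {R : Finset (ℤ × ℤ)} {z : ℂ} :
    z ∈ gridUnion R ↔ ∃ ν ∈ R, z ∈ gridCell ν := by simp [gridUnion]

theorem isClosed_gridUnion (R : Finset (ℤ × ℤ)) : IsClosed (gridUnion R) :=
  R.finite_toSet.isClosed_biUnion fun ν _ => (isCompact_gridCell ν).isClosed

theorem hasLogOn_of_two_lt_dist {A : Set ℂ} (hAc : IsPreconnected A)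
    (hunb : ¬ Bornology.IsBounded A) {F : ℂ → ℂ} (hF : ContinuousOn F Aᶜ)
    (h0 : ∀ z ∈ Aᶜ, F z ≠ 0) {K : Set ℂ} (hK : IsCompact K)
    (hfar : ∀ z ∈ K, ∀ a ∈ A, 2 < dist z a) : HasLogOn F K := by
  classical
  obtain ⟨N, hN⟩ : ∃ N : ℕ, ∀ z ∈ K, ‖z‖ ≤ N := by
    obtain ⟨C, hC⟩ := hK.isBounded.exists_norm_le
    obtain ⟨N, hN⟩ := exists_nat_ge C
    exact ⟨N, fun z hz => (hC z hz).trans hN⟩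
  set Q : Finset (ℤ × ℤ) := Finset.Icc (-(N : ℤ)) N ×ˢ Finset.Icc (-(N : ℤ)) N with hQ
  have hmemQ : ∀ z : ℂ, |z.re| ≤ N + 1 / 2 → |z.im| ≤ N + 1 / 2 → ∃ ν ∈ Q, z ∈ gridCell ν := by
    intro z h1 h2
    obtain ⟨m, hm, hm'⟩ := exists_int_near h1
    obtain ⟨n, hn, hn'⟩ := exists_int_near h2
    exact ⟨(m, n), Finset.mk_mem_product hm hn, hm', hn'⟩
  have hQbd : ∀ ν ∈ Q, -(N : ℝ) ≤ ν.1 ∧ (ν.1 : ℝ) ≤ N ∧ -(N : ℝ) ≤ ν.2 ∧ (ν.2 : ℝ) ≤ N := by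
    intro ν hν
    simp only [hQ, Finset.mem_product, Finset.mem_Icc] at hν
    obtain ⟨⟨h1, h2⟩, h3, h4⟩ := hν
    exact ⟨by exact_mod_cast h1, by exact_mod_cast h2, by exact_mod_cast h3, by exact_mod_cast h4⟩
  set bad : Finset (ℤ × ℤ) := Q.filter (fun ν => (gridCell ν ∩ A).Nonempty) with hbad
  let Cl : Finset (ℤ × ℤ) → Prop := fun R => ∀ G : ℂ → ℂ, ContinuousOn G (gridUnion (Q \ R)) →
    (∀ z ∈ gridUnion (Q \ R), G z ≠ 0) → HasLogOn G (gridUnion (Q \ R))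
  have hCl0 : Cl ∅ := by
    have hU : gridUnion (Q \ ∅) = {z : ℂ | z.re ∈ Icc (-(N + 1 / 2) : ℝ) (N + 1 / 2) ∧
        z.im ∈ Icc (-(N + 1 / 2) : ℝ) (N + 1 / 2)} := by
      ext z
      rw [mem_gridUnion, Finset.sdiff_empty]
      constructor
      · rintro ⟨ν, hν, h1, h2⟩
        obtain ⟨b1, b2, b3, b4⟩ := hQbd ν hν
        rw [abs_le] at h1 h2
        exact ⟨⟨by linarith, by linarith⟩, by linarith, by linarith⟩
      · rintro ⟨h1, h2⟩
        exact hmemQ z (abs_le.mpr h1) (abs_le.mpr h2)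
    intro G hG hG0
    rw [hU] at hG hG0 ⊢
    have : -((N : ℝ) + 1 / 2) ≤ N + 1 / 2 := by linarith [N.cast_nonneg (α := ℝ)]
    exact hasLogOn_rect this this hG hG0
  obtain ⟨R, hR, hmax⟩ := Finset.exists_max_image (bad.powerset.filter Cl) Finset.card
    ⟨∅, by simp [hCl0]⟩
  rw [Finset.mem_filter, Finset.mem_powerset] at hR
  obtain ⟨hRb, hRCl⟩ := hR
  have hRbad : R = bad := by
    by_contra hne
    obtain ⟨ν₀, hν₀b, hν₀R⟩ : ∃ ν ∈ bad, ν ∉ R := by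
      by_contra! h
      exact hne (Finset.Subset.antisymm hRb h)
    have hfarA : ∃ a ∈ A, (N : ℝ) + 1 / 2 ≤ |a.re| ∨ (N : ℝ) + 1 / 2 ≤ |a.im| := by
      by_contra! h
      refine hunb ((isBounded_iff_forall_norm_le).mpr ⟨2 * (N + 1 / 2), fun a ha => ?_⟩)
      obtain ⟨h1, h2⟩ := h a ha
      linarith [Complex.norm_le_abs_re_add_abs_im a]
    set C1 : Set ℂ := gridUnion R ∪
      ({z | (N : ℝ) + 1 / 2 ≤ |z.re|} ∪ {z | (N : ℝ) + 1 / 2 ≤ |z.im|}) with hC1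
    have hC1c : IsClosed C1 := (isClosed_gridUnion R).union
      ((isClosed_le continuous_const (by fun_prop)).union
        (isClosed_le continuous_const (by fun_prop)))
    obtain ⟨a, haA, ha1, ha2⟩ := isPreconnected_closed_iff.mp hAc C1 (gridUnion (bad \ R)) hC1c
      (isClosed_gridUnion _) (by
        intro a ha
        by_cases hb : (N : ℝ) + 1 / 2 ≤ |a.re| ∨ (N : ℝ) + 1 / 2 ≤ |a.im|
        · exact Or.inl (Or.inr hb)
        · push Not at hb
          obtain ⟨ν, hν, haν⟩ := hmemQ a hb.1.le hb.2.le
          by_cases hνR : ν ∈ R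
          · exact Or.inl (Or.inl (mem_gridUnion.mpr ⟨ν, hνR, haν⟩))
          · exact Or.inr (mem_gridUnion.mpr ⟨ν, Finset.mem_sdiff.mpr
              ⟨Finset.mem_filter.mpr ⟨hν, a, haν, ha⟩, hνR⟩, haν⟩))
      (by obtain ⟨a, ha, h⟩ := hfarA; exact ⟨a, ha, Or.inr h⟩)
      (by
        obtain ⟨a, ha, haA⟩ := (Finset.mem_filter.mp hν₀b).2
        exact ⟨a, haA, mem_gridUnion.mpr ⟨ν₀, Finset.mem_sdiff.mpr ⟨hν₀b, hν₀R⟩, ha⟩⟩)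
    obtain ⟨ν, hν, haν⟩ := mem_gridUnion.mp ha2
    rw [Finset.mem_sdiff] at hν
    have hνQ : ν ∈ Q := (Finset.mem_filter.mp hν.1).1
    obtain ⟨τ, hτO, haτ⟩ : ∃ τ : ℤ × ℤ, τ ∈ {κ | κ ∈ R ∨ κ ∉ Q} ∧ a ∈ gridCell τ := by
      rcases ha1 with h | h
      · obtain ⟨τ, hτ, h'⟩ := mem_gridUnion.mp h
        exact ⟨τ, Or.inl hτ, h'⟩
      · obtain ⟨b1, b2, b3, b4⟩ := hQbd ν hνQ
        obtain ⟨c1, c2⟩ := haν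
        have d1 := abs_le.mp c1
        have d2 := abs_le.mp c2
        have hout : ∀ τ : ℤ × ℤ, (τ.1 = N + 1 ∨ τ.1 = -N - 1 ∨ τ.2 = N + 1 ∨ τ.2 = -N - 1) →
            τ ∈ {κ | κ ∈ R ∨ κ ∉ Q} := by
          intro τ h
          refine Or.inr fun hq => ?_
          simp only [hQ, Finset.mem_product, Finset.mem_Icc] at hq
          omega
        rcases h with h | h <;> rw [mem_ofPred_eq] at h <;> rcases le_abs.mp h with h | h
        · exact ⟨(N + 1, ν.2), hout _ (by simp), by
            rw [abs_le]; push_cast; constructor <;> linarith, c2⟩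
        · exact ⟨(-N - 1, ν.2), hout _ (by simp), by
            rw [abs_le]; push_cast; constructor <;> linarith, c2⟩
        · exact ⟨(ν.1, N + 1), hout _ (by simp), c1, by
            rw [abs_le]; push_cast; constructor <;> linarith⟩
        · exact ⟨(ν.1, -N - 1), hout _ (by simp), c1, by
            rw [abs_le]; push_cast; constructor <;> linarith⟩
    obtain ⟨ν, hνb, τ, hτ, hνO, hadj⟩ := adjacent_of_common_point (R := (bad : Set (ℤ × ℤ))) haA
      haν haτ (fun h => h.elim hν.2 fun h => h hνQ) hτO (fun κ hκ hκO => by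
        have : κ ∈ Q := by
          by_contra h
          exact hκO (Or.inr h)
        exact Finset.mem_filter.mpr ⟨this, hκ⟩)
    obtain ⟨w, hwν, hwb, hw⟩ := midpoint_gridCell hadj
    have hνQ' : ν ∈ Q := (Finset.mem_filter.mp hνb).1
    have hνR : ν ∉ R := fun h => hνO (Or.inl h)
    have hU : gridUnion (Q \ R) = gridUnion (Q \ insert ν R) ∪ gridCell ν := by
      ext z
      simp only [mem_union, mem_gridUnion, Finset.mem_sdiff, Finset.mem_insert, not_or]
      constructor
      · rintro ⟨κ, ⟨h1, h2⟩, h3⟩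
        by_cases h : κ = ν
        · exact Or.inr (h ▸ h3)
        · exact Or.inl ⟨κ, ⟨h1, h, h2⟩, h3⟩
      · rintro (⟨κ, ⟨h1, -, h2⟩, h3⟩ | h)
        · exact ⟨κ, ⟨h1, h2⟩, h3⟩
        · exact ⟨ν, ⟨hνQ', hνR⟩, h⟩
    have hnew : Cl (insert ν R) := by
      intro G hG hG0
      obtain ⟨H, hH, hH0, hHG⟩ := exists_extend_gridCell (isClosed_gridUnion (Q \ insert ν R))
        (ν := ν) (w := w) (by
          rintro z ⟨hz, hzν⟩
          obtain ⟨κ, hκ, hzκ⟩ := mem_gridUnion.mp hz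
          refine boundary_of_mem_gridCell (fun h => ?_) hzν hzκ
          subst h
          simp at hκ) hwν hwb (by
          intro h
          obtain ⟨κ, hκ, hwκ⟩ := mem_gridUnion.mp h
          simp only [Finset.mem_sdiff, Finset.mem_insert, not_or] at hκ
          rcases hw κ hwκ with h | h
          · exact hκ.2.1 h
          · subst h
            exact hτ.elim hκ.2.2 fun h => h hκ.1) hG hG0
      rw [← hU] at hH hH0
      refine ((hRCl H hH hH0).mono ?_).congr hHG
      rw [hU]
      exact subset_union_left
    have := hmax (insert ν R) (by
      rw [Finset.mem_filter, Finset.mem_powerset]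
      exact ⟨Finset.insert_subset hνb hRb, hnew⟩)
    rw [Finset.card_insert_of_notMem hνR] at this
    omega
  have hgood : gridUnion (Q \ R) ⊆ Aᶜ := by
    intro z hz hzA
    obtain ⟨ν, hν, hzν⟩ := mem_gridUnion.mp hz
    rw [Finset.mem_sdiff, hRbad] at hν
    exact hν.2 (Finset.mem_filter.mpr ⟨hν.1, z, hzν, hzA⟩)
  refine (hRCl F (hF.mono hgood) fun z hz => h0 z (hgood hz)).mono fun z hz => ?_
  obtain ⟨ν, hν, hzν⟩ := hmemQ z
    (by linarith [hN z hz, Complex.abs_re_le_norm z]) (by linarith [hN z hz, Complex.abs_im_le_norm z])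
  refine mem_gridUnion.mpr ⟨ν, ?_, hzν⟩
  rw [Finset.mem_sdiff, hRbad]
  refine ⟨hν, fun hb => ?_⟩
  obtain ⟨a, ha, haA⟩ := (Finset.mem_filter.mp hb).2
  have h1 := hfar z hz a haA
  have h2 : dist z a ≤ 2 := by
    rw [dist_eq_norm]
    refine (Complex.norm_le_abs_re_add_abs_im _).trans ?_
    have e1 := abs_le.mp hzν.1; have e2 := abs_le.mp hzν.2
    have e3 := abs_le.mp ha.1; have e4 := abs_le.mp ha.2
    have f1 : |(z - a).re| ≤ 1 := by rw [Complex.sub_re, abs_le]; constructor <;> linarith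
    have f2 : |(z - a).im| ≤ 1 := by rw [Complex.sub_im, abs_le]; constructor <;> linarith
    linarith
  linarith

/-- Nonvanishing continuous functions have logarithms on compact subsets of an open set whose
complement is connected and unbounded. -/
theorem hasLogOn_of_isCompact_subset {Ω : Set ℂ} (hΩ : IsOpen Ω) (hAc : IsPreconnected Ωᶜ)
    (hunb : ¬ Bornology.IsBounded Ωᶜ) {F : ℂ → ℂ} (hF : ContinuousOn F Ω)
    (h0 : ∀ z ∈ Ω, F z ≠ 0) {K : Set ℂ} (hK : IsCompact K) (hKΩ : K ⊆ Ω) : HasLogOn F K := by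
  obtain ⟨δ, hδ, hd⟩ : ∃ δ > 0, ∀ z ∈ K, ∀ a ∈ Ωᶜ, δ < dist z a := by
    obtain ⟨δ, hδ, h⟩ := hK.exists_thickening_subset_open hΩ hKΩ
    refine ⟨δ / 2, by positivity, fun z hz a ha => ?_⟩
    by_contra hlt
    exact ha (h (mem_thickening_iff.mpr ⟨z, hz, by rw [dist_comm]; linarith⟩))
  set s : ℂ := ((2 / δ : ℝ) : ℂ) with hs
  have hs0 : s ≠ 0 := by rw [hs]; exact_mod_cast (by positivity : (2 / δ : ℝ) ≠ 0)
  have hsn : ‖s‖ = 2 / δ := by rw [hs, Complex.norm_real, Real.norm_of_nonneg (by positivity)]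
  have hmemA : ∀ z : ℂ, z ∈ (fun z => s * z) '' Ωᶜ ↔ s⁻¹ * z ∈ Ωᶜ := by
    intro z
    constructor
    · rintro ⟨a, ha, rfl⟩
      simpa [hs0] using ha
    · exact fun h => ⟨_, h, by field_simp⟩
  have key := hasLogOn_of_two_lt_dist (A := (fun z => s * z) '' Ωᶜ) (F := fun z => F (s⁻¹ * z))
    (hAc.image _ (by fun_prop)) (fun hb => hunb (by
      obtain ⟨C, hC⟩ := hb.exists_norm_le
      refine isBounded_iff_forall_norm_le.mpr ⟨C / (2 / δ), fun a ha => ?_⟩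
      have := hC _ (mem_image_of_mem _ ha)
      rw [norm_mul, hsn] at this
      rw [le_div_iff₀ (by positivity)]
      linarith)) (K := (fun z => s * z) '' K)
    (hF.comp (by fun_prop) fun z hz => by
      have := (hmemA z).not.mp hz
      simpa using this)
    (fun z hz => h0 _ (by
      have := (hmemA z).not.mp hz
      simpa using this)) (hK.image (by fun_prop)) (by
      rintro _ ⟨z, hz, rfl⟩ _ ⟨a, ha, rfl⟩
      have := hd z hz a ha
      rw [dist_eq_norm] at this ⊢
      rw [← mul_sub, norm_mul, hsn]
      rw [div_mul_eq_mul_div, lt_div_iff₀ hδ]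
      linarith)
  refine (key.comp (f := fun z => s * z) (by fun_prop) (mapsTo_image _ _)).congr fun z _ => ?_
  simp [hs0]

end

section

open Set Metric MeasureTheory Filter Topology
open scoped ENNReal unitInterval

/-- Nonvanishing continuous functions on a connected open set with connected unbounded complement
have continuous logarithms. -/
theorem hasLogOn_of_isConnected {Ω : Set ℂ} (hΩ : IsOpen Ω) (hc : IsConnected Ω)
    (hAc : IsPreconnected Ωᶜ) (hunb : ¬ Bornology.IsBounded Ωᶜ) {F : ℂ → ℂ} (hF : ContinuousOn F Ω)
    (h0 : ∀ z ∈ Ω, F z ≠ 0) : HasLogOn F Ω := by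
  classical
  have : LocallyPathConnectedSpace Ω := hΩ.locallyPathConnectedSpace
  have : ConnectedSpace Ω := isConnected_iff_connectedSpace.mp hc
  have : PathConnectedSpace Ω := pathConnectedSpace_iff_connectedSpace.mpr inferInstance
  obtain ⟨x₀, hx₀⟩ := hc.nonempty
  let p : ℂ → {z : ℂ // z ≠ 0} := fun z => ⟨_, z.exp_ne_zero⟩
  have hcov : IsCoveringMap p := Complex.isCoveringMap_exp
  let f : C(Ω, {z : ℂ // z ≠ 0}) := ⟨fun z => ⟨F z, h0 z z.2⟩,
    (continuousOn_iff_continuous_domRestrict.mp hF).subtype_mk _⟩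
  have he : p (Complex.log (F x₀)) = f ⟨x₀, hx₀⟩ :=
    Subtype.ext (Complex.exp_log (h0 x₀ hx₀))
  obtain ⟨L, ⟨-, hL⟩, -⟩ := hcov.isLocalHomeomorph.existsUnique_continuousMap_lifts f ⟨x₀, hx₀⟩
    (Complex.log (F x₀)) he (fun γ γ_0 => by
      obtain ⟨Γ, h1, h2⟩ := hcov.exists_path_lifts (f.comp γ) (Complex.log (F x₀))
        (by simp [γ_0, he])
      exact ⟨Γ, h2, h1⟩)
    (fun γ γ' Γ Γ' γ_0 γ'_0 Γ_0 Γ'_0 hΓ hΓ' h1 => by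
      set K : Set ℂ := range (fun t => (γ t : ℂ)) ∪ range (fun t => (γ' t : ℂ))
      have hcγ : Continuous fun t => (γ t : ℂ) := by fun_prop
      have hcγ' : Continuous fun t => (γ' t : ℂ) := by fun_prop
      obtain ⟨M, hM, hE⟩ := hasLogOn_of_isCompact_subset hΩ hAc hunb hF h0 (K := K)
        ((isCompact_range hcγ).union (isCompact_range hcγ')) (by
          rintro _ (⟨t, rfl⟩ | ⟨t, rfl⟩) <;> exact Subtype.prop _)
      have lift : ∀ (γ : C(I, Ω)) (Γ : C(I, ℂ)), p ∘ Γ = f.comp γ → (∀ t, (γ t : ℂ) ∈ K) →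
          ∃ n : ℤ, ∀ t, Γ t = M (γ t) + n * (2 * Real.pi * Complex.I) := by
        intro γ Γ hΓ hK
        obtain ⟨n, hn⟩ := exists_int_sub_of_exp_eq (K := univ) (L := fun t => Γ t)
          (M := fun t => M (γ t)) isPreconnected_univ (by fun_prop)
          (hM.comp (by fun_prop) fun t _ => hK t) (fun t _ => by
            rw [hE _ (hK t)]
            exact congrArg Subtype.val (congrFun hΓ t))
        exact ⟨n, fun t => hn t (mem_univ _)⟩
      obtain ⟨n, hn⟩ := lift γ Γ hΓ fun t => Or.inl ⟨t, rfl⟩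
      obtain ⟨n', hn'⟩ := lift γ' Γ' hΓ' fun t => Or.inr ⟨t, rfl⟩
      have e1 := hn 0
      have e2 := hn' 0
      rw [Γ_0, γ_0] at e1
      rw [Γ'_0, γ'_0] at e2
      rw [hn 1, hn' 1, h1]
      linear_combination e2 - e1)
  refine ⟨fun z => if hz : z ∈ Ω then L ⟨z, hz⟩ else 0, ?_, fun z hz => ?_⟩
  · rw [continuousOn_iff_continuous_domRestrict]
    convert L.continuous using 1
    ext z
    simp
  · simp only [hz, dif_pos]
    exact congrArg Subtype.val (congrFun hL ⟨z, hz⟩)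

/-- A nonvanishing holomorphic function with a continuous logarithm has a holomorphic square
root. -/
theorem exists_differentiableOn_sq {Ω : Set ℂ} (hΩ : IsOpen Ω) {F : ℂ → ℂ}
    (hF : DifferentiableOn ℂ F Ω) (hlog : HasLogOn F Ω) :
    ∃ G : ℂ → ℂ, DifferentiableOn ℂ G Ω ∧ ∀ z ∈ Ω, G z ^ 2 = F z := by
  obtain ⟨L, hL, hE⟩ := hlog
  refine ⟨fun z => Complex.exp (L z / 2), ?_, fun z hz => ?_⟩
  · have hLd : DifferentiableOn ℂ L Ω := by
      intro z hz
      have h1 : HasStrictDerivAt Complex.exp (Complex.exp (L z)) (L z) :=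
        Complex.hasStrictDerivAt_exp _
      have hc : ContinuousAt L z := hL.continuousAt (hΩ.mem_nhds hz)
      have h2 := h1.to_localInverse (Complex.exp_ne_zero _)
      set g := h1.localInverse Complex.exp _ (L z) (Complex.exp_ne_zero _)
      have h3 : ∀ᶠ w in 𝓝 z, L w = g (F w) := by
        have := hc.eventually (h1.eventually_left_inverse (Complex.exp_ne_zero _))
        filter_upwards [this, hΩ.mem_nhds hz] with w hw hwΩ
        rw [← hE w hwΩ]
        exact hw.symm
      rw [hE z hz] at h2
      exact (((h2.hasDerivAt.differentiableAt).comp z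
        ((hF z hz).differentiableAt (hΩ.mem_nhds hz))).congr_of_eventuallyEq h3).differentiableWithinAt
    exact (hLd.div_const 2).cexp
  · rw [← Complex.exp_nat_mul, ← hE z hz]
    congr 1
    push_cast
    ring

/-- A locally uniform form of Montel's theorem along an ultrafilter. -/
theorem exists_tendstoLocallyUniformlyOn_ultrafilter {ι : Type*} (u : Ultrafilter ι) {Ω : Set ℂ}
    (hΩ : IsOpen Ω) {f : ι → ℂ → ℂ} (hf : ∀ n, DifferentiableOn ℂ (f n) Ω)
    (hm : ∀ n, MapsTo (f n) Ω (ball 0 1)) :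
    ∃ g : ℂ → ℂ, TendstoLocallyUniformlyOn f g u Ω := by
  have hpt : ∀ z : ℂ, ∃ w : ℂ, z ∈ Ω → Tendsto (fun n => f n z) u (𝓝 w) := by
    intro z
    by_cases hz : z ∈ Ω
    · obtain ⟨w, -, hw⟩ := (isCompact_closedBall (0 : ℂ) 1).ultrafilter_le_nhds
        (u.map fun n => f n z) (by
          rw [le_principal_iff]
          exact Filter.mem_map.mpr
            (Filter.univ_mem' fun n => ball_subset_closedBall (hm n hz)))
      exact ⟨w, fun _ => hw⟩
    · exact ⟨0, fun h => absurd h hz⟩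
  choose g hg using hpt
  refine ⟨g, ?_⟩
  rw [Metric.tendstoLocallyUniformlyOn_iff]
  intro ε hε x hx
  obtain ⟨r, hr, hrΩ⟩ := Metric.isOpen_iff.mp hΩ x hx
  have hlip : ∀ n, ∀ y ∈ ball x r, dist (f n y) (f n x) ≤ 2 / r * dist y x := by
    intro n y hy
    refine Complex.dist_le_div_mul_dist_of_mapsTo_ball ((hf n).mono hrΩ) (fun z hz => ?_) hy
    have h1 := hm n (hrΩ hz)
    have h2 := hm n hx
    rw [mem_ball_zero_iff] at h1 h2
    rw [mem_closedBall, dist_eq_norm]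
    linarith [norm_sub_le (f n z) (f n x)]
  have hlim : ∀ y ∈ ball x r, dist (g y) (g x) ≤ 2 / r * dist y x := fun y hy =>
    le_of_tendsto ((hg y (hrΩ hy)).dist (hg x hx)) (Eventually.of_forall fun n => hlip n y hy)
  set δ := min r (ε * r / 8) with hδ
  have hδ0 : 0 < δ := lt_min hr (by positivity)
  refine ⟨ball x δ, mem_nhdsWithin_of_mem_nhds (ball_mem_nhds x hδ0), ?_⟩
  filter_upwards [(hg x hx).eventually (ball_mem_nhds (g x) (by positivity : 0 < ε / 3))] with n hn
  intro y hy
  have hyr : y ∈ ball x r := ball_subset_ball (min_le_left _ _) hy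
  have hyd : 2 / r * dist y x < ε / 3 := by
    have : dist y x < ε * r / 8 := lt_of_lt_of_le hy (min_le_right _ _)
    calc 2 / r * dist y x < 2 / r * (ε * r / 8) := by gcongr
      _ = ε / 4 := by field_simp; ring
      _ < ε / 3 := by linarith
  have h1 := hlip n y hyr
  have h2 := hlim y hyr
  calc dist (g y) (f n y) ≤ dist (g y) (g x) + dist (g x) (f n x) + dist (f n x) (f n y) :=
        dist_triangle4 _ _ _ _
    _ < ε := by
        have e1 := dist_comm (g x) (f n x)
        have e2 := dist_comm (f n x) (f n y)
        linarith

/-- Hurwitz: a locally uniform limit of injective holomorphic functions on a connected open set is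
injective or constant. -/
theorem injOn_of_tendstoLocallyUniformlyOn {ι : Type*} {u : Filter ι} [u.NeBot] {Ω : Set ℂ}
    (hΩ : IsOpen Ω) (hc : IsPreconnected Ω) {f : ι → ℂ → ℂ} {g : ℂ → ℂ}
    (hf : ∀ n, DifferentiableOn ℂ (f n) Ω) (hi : ∀ n, InjOn (f n) Ω)
    (hfg : TendstoLocallyUniformlyOn f g u Ω) :
    InjOn g Ω ∨ ∃ w, ∀ z ∈ Ω, g z = w := by
  have hg : DifferentiableOn ℂ g Ω :=
    hfg.differentiableOn (Eventually.of_forall hf) hΩ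
  by_contra! hcon
  obtain ⟨hni, hnc⟩ := hcon
  simp only [InjOn, not_forall] at hni
  obtain ⟨a, ha, b, hb, hab, hne⟩ := hni
  have hga : AnalyticOnNhd ℂ g Ω := hg.analyticOnNhd hΩ
  have hG : AnalyticAt ℂ (fun z => g z - g b) b := (hga b hb).sub analyticAt_const
  have hev : ∀ᶠ z in 𝓝[≠] b, g z - g b ≠ 0 := by
    rcases hG.eventually_eq_zero_or_eventually_ne_zero with h | h
    · exfalso
      obtain ⟨z, hz, hzw⟩ := hnc (g b)
      refine hzw (hga.eqOn_of_preconnected_of_eventuallyEq (analyticOnNhd_const (v := g b)) hc hb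
        ?_ hz)
      filter_upwards [h] with y hy
      exact sub_eq_zero.mp hy
    · exact h
  rw [eventually_nhdsWithin_iff, Metric.eventually_nhds_iff_ball] at hev
  obtain ⟨r₁, hr₁, h₁⟩ := hev
  obtain ⟨r₂, hr₂, h₂⟩ := Metric.isOpen_iff.mp hΩ b hb
  have hab' : 0 < dist a b := dist_pos.mpr hne
  set r := min (min r₁ r₂) (dist a b) / 2 with hr
  have hr0 : 0 < r := by positivity
  have hrr₁ : r < r₁ := by
    have := (min_le_left (min r₁ r₂) (dist a b)).trans (min_le_left _ _)
    rw [hr]; linarith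
  have hrr₂ : r < r₂ := by
    have := (min_le_left (min r₁ r₂) (dist a b)).trans (min_le_right _ _)
    rw [hr]; linarith
  have hrab : r < dist a b := by
    have := min_le_right (min r₁ r₂) (dist a b)
    rw [hr]; linarith
  have hcb : closedBall b r ⊆ Ω := (closedBall_subset_ball hrr₂).trans h₂
  have hsph : ∀ z ∈ sphere b r, g z - g b ≠ 0 := fun z hz =>
    h₁ z (by rw [mem_ball, mem_sphere.mp hz]; exact hrr₁) (ne_of_mem_sphere hz hr0.ne')
  obtain ⟨y, hy, hmin⟩ := (isCompact_sphere b r).exists_isMinOn (NormedSpace.sphere_nonempty.mpr hr0.le)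
    (f := fun z => ‖g z - g b‖)
    ((hg.continuousOn.mono (sphere_subset_closedBall.trans hcb)).sub continuousOn_const).norm
  set m := ‖g y - g b‖ with hm
  have hm0 : 0 < m := norm_pos_iff.mpr (hsph y hy)
  have hK : IsCompact (closedBall b r ∪ {a}) := (isCompact_closedBall b r).union isCompact_singleton
  have hunif := (tendstoLocallyUniformlyOn_iff_forall_isCompact hΩ).mp hfg _
    (union_subset hcb (singleton_subset_iff.mpr ha)) hK
  rw [Metric.tendstoUniformlyOn_iff] at hunif
  obtain ⟨n, hn⟩ := (hunif (m / 4) (by positivity)).exists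
  have hna := hn a (Or.inr rfl)
  have hnb := hn b (Or.inl (mem_closedBall_self hr0.le))
  rw [dist_eq_norm] at hna hnb
  have hG0 : ∀ z ∈ closedBall b r, f n z - f n a ≠ 0 := by
    intro z hz h
    have := hi n (hcb hz) ha (sub_eq_zero.mp h)
    subst this
    rw [mem_closedBall] at hz
    linarith
  have hd : DiffContOnCl ℂ (fun z => (f n z - f n a)⁻¹) (ball b r) := by
    refine DifferentiableOn.diffContOnCl ?_
    rw [closure_ball b hr0.ne']
    exact (((hf n).mono hcb).sub_const _).inv hG0
  have hbd := Complex.norm_le_of_forall_mem_frontier_norm_le (C := 2 / m) isBounded_ball hd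
    (fun z hz => by
      rw [frontier_ball b hr0.ne'] at hz
      have hz' := hn z (Or.inl (sphere_subset_closedBall hz))
      have hge : m ≤ ‖g z - g b‖ := hmin hz
      rw [dist_eq_norm] at hz'
      rw [norm_inv, inv_le_comm₀ (norm_pos_iff.mpr (hG0 z (sphere_subset_closedBall hz)))
        (by positivity), inv_div]
      have : ‖g z - g b‖ ≤ ‖g z - f n z‖ + ‖f n z - f n a‖ + ‖f n a - g a‖ := by
        rw [← hab]
        calc ‖g z - g a‖ = ‖(g z - f n z) + (f n z - f n a) + (f n a - g a)‖ := by ring_nf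
          _ ≤ _ := norm_add₃_le
      rw [norm_sub_rev] at hna
      linarith) (z := b) (subset_closure (mem_ball_self hr0))
  rw [norm_inv, inv_le_comm₀ (norm_pos_iff.mpr (hG0 b (mem_closedBall_self hr0.le)))
    (by positivity), inv_div] at hbd
  have : ‖f n b - f n a‖ ≤ ‖g b - f n b‖ + ‖g a - f n a‖ := by
    calc ‖f n b - f n a‖ = ‖(g a - f n a) - (g b - f n b)‖ := by rw [hab]; ring_nf
      _ ≤ ‖g a - f n a‖ + ‖g b - f n b‖ := norm_sub_le _ _
      _ = _ := add_comm _ _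
  linarith

end

section

open Set Metric MeasureTheory Filter Topology
open scoped ENNReal unitInterval ComplexConjugate

/-- The disc automorphism exchanging `a` and `0`, up to sign. -/
noncomputable def discMap (a z : ℂ) : ℂ := (z - a) / (1 - conj a * z)

theorem one_sub_conj_mul_ne_zero {a z : ℂ} (ha : ‖a‖ < 1) (hz : ‖z‖ < 1) :
    1 - conj a * z ≠ 0 := by
  intro h
  have : ‖conj a * z‖ = 1 := by rw [← sub_eq_zero.mp h, norm_one]
  rw [norm_mul, RCLike.norm_conj] at this
  nlinarith [norm_nonneg a, norm_nonneg z]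

theorem norm_discMap_lt_one {a z : ℂ} (ha : ‖a‖ < 1) (hz : ‖z‖ < 1) : ‖discMap a z‖ < 1 := by
  have h0 := one_sub_conj_mul_ne_zero ha hz
  rw [discMap, norm_div, div_lt_one (norm_pos_iff.mpr h0)]
  refine lt_of_pow_lt_pow_left₀ 2 (norm_nonneg _) ?_
  rw [← Complex.normSq_eq_norm_sq, ← Complex.normSq_eq_norm_sq, Complex.normSq_apply,
    Complex.normSq_apply]
  have h1 : a.re ^ 2 + a.im ^ 2 < 1 := by
    have := Complex.normSq_eq_norm_sq a
    rw [Complex.normSq_apply] at this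
    nlinarith [norm_nonneg a]
  have h2 : z.re ^ 2 + z.im ^ 2 < 1 := by
    have := Complex.normSq_eq_norm_sq z
    rw [Complex.normSq_apply] at this
    nlinarith [norm_nonneg z]
  simp
  nlinarith [mul_pos (sub_pos.mpr h1) (sub_pos.mpr h2)]

theorem discMap_injOn {a : ℂ} (ha : ‖a‖ < 1) : InjOn (discMap a) (ball 0 1) := by
  intro z hz w hw h
  rw [mem_ball_zero_iff] at hz hw
  have h1 := one_sub_conj_mul_ne_zero ha hz
  have h2 := one_sub_conj_mul_ne_zero ha hw
  rw [discMap, discMap, div_eq_div_iff h1 h2] at h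
  have h3 : (1 - conj a * a) * (z - w) = 0 := by linear_combination h
  rcases mul_eq_zero.mp h3 with h4 | h4
  · exact absurd h4 (one_sub_conj_mul_ne_zero ha ha)
  · exact sub_eq_zero.mp h4

theorem hasDerivAt_discMap {a z : ℂ} (ha : ‖a‖ < 1) (hz : ‖z‖ < 1) :
    HasDerivAt (discMap a) ((1 - conj a * a) / (1 - conj a * z) ^ 2) z := by
  have h1 := one_sub_conj_mul_ne_zero ha hz
  have hd : HasDerivAt (fun z => 1 - conj a * z) (-conj a) z := by
    simpa using ((hasDerivAt_id z).const_mul (conj a)).const_sub 1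
  refine (((hasDerivAt_id' z).sub_const a).fun_div hd h1).congr_deriv ?_
  congr 1
  ring

/-- The Riemann mapping theorem for bounded domains with square roots. -/
theorem exists_bijOn_ball_of_sqrt {Ω : Set ℂ} (hΩ : IsOpen Ω) (hc : IsConnected Ω)
    (hb : Bornology.IsBounded Ω)
    (hsq : ∀ F : ℂ → ℂ, DifferentiableOn ℂ F Ω → (∀ z ∈ Ω, F z ≠ 0) →
      ∃ G : ℂ → ℂ, DifferentiableOn ℂ G Ω ∧ ∀ z ∈ Ω, G z ^ 2 = F z) :
    ∃ φ : ℂ → ℂ, DifferentiableOn ℂ φ Ω ∧ BijOn φ Ω (ball 0 1) := by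
  obtain ⟨x₀, hx₀⟩ := hc.nonempty
  obtain ⟨r, hr, hrΩ⟩ := Metric.isOpen_iff.mp hΩ x₀ hx₀
  set 𝓕 : Set (ℂ → ℂ) := {f | DifferentiableOn ℂ f Ω ∧ InjOn f Ω ∧ MapsTo f Ω (ball 0 1) ∧
    f x₀ = 0} with h𝓕
  have hbdd : ∀ f ∈ 𝓕, ‖deriv f x₀‖ ≤ 1 / r := by
    rintro f ⟨h1, -, h3, h4⟩
    refine Complex.norm_deriv_le_div_of_mapsTo_ball (h1.mono hrΩ) (fun z hz => ?_) hr
    rw [h4]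
    exact ball_subset_closedBall (h3 (hrΩ hz))
  obtain ⟨R, hR, hΩR⟩ := hb.subset_ball_lt 0 x₀
  set f₀ : ℂ → ℂ := fun z => (z - x₀) / R with hf₀
  have hRc : (R : ℂ) ≠ 0 := by exact_mod_cast hR.ne'
  have hf₀𝓕 : f₀ ∈ 𝓕 := by
    refine ⟨by fun_prop, fun z _ w _ h => ?_, fun z hz => ?_, by simp [hf₀]⟩
    · simp only [hf₀] at h
      field_simp at h
      simpa using h
    · rw [mem_ball_zero_iff, hf₀, norm_div, Complex.norm_real, Real.norm_of_nonneg hR.le,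
        div_lt_one hR, ← dist_eq_norm]
      exact hΩR hz
  have hf₀d : 0 < ‖deriv f₀ x₀‖ := by
    have : HasDerivAt f₀ (1 / R) x₀ := ((hasDerivAt_id x₀).sub_const x₀).div_const _
    rw [this.deriv]
    exact norm_pos_iff.mpr (by simpa using hRc)
  set S : Set ℝ := (fun f => ‖deriv f x₀‖) '' 𝓕 with hS
  have hSne : S.Nonempty := ⟨_, f₀, hf₀𝓕, rfl⟩
  have hSb : BddAbove S := ⟨1 / r, by rintro _ ⟨f, hf, rfl⟩; exact hbdd f hf⟩
  obtain ⟨s, -, hs, hsS⟩ := exists_seq_tendsto_sSup hSne hSb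
  choose f hf𝓕 hfs using hsS
  let u : Ultrafilter ℕ := Ultrafilter.of atTop
  obtain ⟨g, hg⟩ := exists_tendstoLocallyUniformlyOn_ultrafilter u hΩ (fun n => (hf𝓕 n).1)
    fun n => (hf𝓕 n).2.2.1
  have hgd : DifferentiableOn ℂ g Ω :=
    hg.differentiableOn (Eventually.of_forall fun n => (hf𝓕 n).1) hΩ
  have hgM : ‖deriv g x₀‖ = sSup S := by
    have h1 : Tendsto (fun n => ‖deriv (f n) x₀‖) u (𝓝 ‖deriv g x₀‖) :=
      ((hg.deriv (Eventually.of_forall fun n => (hf𝓕 n).1) hΩ).tendsto_at hx₀).norm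
    have h2 : Tendsto (fun n => ‖deriv (f n) x₀‖) u (𝓝 (sSup S)) := by
      simp only [hfs]
      exact hs.mono_left (Ultrafilter.of_le atTop)
    exact tendsto_nhds_unique h1 h2
  have hgpos : 0 < ‖deriv g x₀‖ := by
    rw [hgM]
    exact hf₀d.trans_le (le_csSup hSb ⟨f₀, hf₀𝓕, rfl⟩)
  have hg0 : g x₀ = 0 := by
    refine tendsto_nhds_unique (hg.tendsto_at hx₀) ?_
    simp only [(hf𝓕 _).2.2.2]
    exact tendsto_const_nhds
  have hnc : ¬ ∃ w, ∀ z ∈ Ω, g z = w := by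
    rintro ⟨w, hw⟩
    have : deriv g x₀ = 0 := by
      have : g =ᶠ[𝓝 x₀] fun _ => w := by
        filter_upwards [hΩ.mem_nhds hx₀] with z hz using hw z hz
      rw [this.deriv_eq, deriv_const]
    simp [this] at hgpos
  have hgi : InjOn g Ω := (injOn_of_tendstoLocallyUniformlyOn hΩ hc.isPreconnected
    (fun n => (hf𝓕 n).1) (fun n => (hf𝓕 n).2.1) hg).resolve_right hnc
  have hgle : ∀ z ∈ Ω, ‖g z‖ ≤ 1 := fun z hz =>
    le_of_tendsto (hg.tendsto_at hz).norm (Eventually.of_forall fun n => by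
      simpa using ((hf𝓕 n).2.2.1 hz : f n z ∈ ball 0 1) |> mem_ball_zero_iff.mp |>.le)
  have hgm : MapsTo g Ω (ball 0 1) := by
    intro z hz
    have hopen : IsOpen (g '' Ω) := by
      rcases (hgd.analyticOnNhd hΩ).is_constant_or_isOpen hc.isPreconnected with h | h
      · exact absurd h hnc
      · exact h Ω subset_rfl hΩ
    have hsub : g '' Ω ⊆ closedBall 0 1 := by
      rintro _ ⟨y, hy, rfl⟩
      simpa using hgle y hy
    have := interior_maximal hsub hopen (mem_image_of_mem g hz)
    rwa [interior_closedBall _ one_ne_zero] at this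
  have hg𝓕 : g ∈ 𝓕 := ⟨hgd, hgi, hgm, hg0⟩
  refine ⟨g, hgd, hgm, hgi, ?_⟩
  intro a ha
  by_contra hna
  have ha1 : ‖a‖ < 1 := mem_ball_zero_iff.mp ha
  have ha0 : a ≠ 0 := fun h => hna ⟨x₀, hx₀, by rw [hg0, h]⟩
  have hgn : ∀ z ∈ Ω, ‖g z‖ < 1 := fun z hz => mem_ball_zero_iff.mp (hgm hz)
  have hD : DifferentiableOn ℂ (fun z => discMap a (g z)) Ω := fun z hz =>
    ((hasDerivAt_discMap ha1 (hgn z hz)).differentiableAt.comp z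
      ((hgd z hz).differentiableAt (hΩ.mem_nhds hz))).differentiableWithinAt
  obtain ⟨h, hhd, hh⟩ := hsq _ hD (fun z hz h0 => by
    rw [discMap, div_eq_zero_iff] at h0
    rcases h0 with h0 | h0
    · exact hna ⟨z, hz, sub_eq_zero.mp h0⟩
    · exact one_sub_conj_mul_ne_zero ha1 (hgn z hz) h0)
  have hhn : ∀ z ∈ Ω, ‖h z‖ < 1 := by
    intro z hz
    have h1 := norm_discMap_lt_one ha1 (hgn z hz)
    rw [← hh z hz, norm_pow] at h1
    by_contra hge
    push Not at hge
    nlinarith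
  set b := h x₀ with hbdef
  have hb1 : ‖b‖ < 1 := hhn x₀ hx₀
  have hb2 : b ^ 2 = -a := by
    rw [hbdef, hh x₀ hx₀, hg0, discMap]
    simp
  have hbn : ‖b‖ ^ 2 = ‖a‖ := by rw [← norm_pow, hb2, norm_neg]
  have hb0 : 0 < ‖b‖ := by
    have : 0 < ‖a‖ := norm_pos_iff.mpr ha0
    rcases (norm_nonneg b).lt_or_eq with h | h
    · exact h
    · rw [← h] at hbn; norm_num at hbn; exact absurd (norm_eq_zero.mp hbn.symm) ha0
  set k : ℂ → ℂ := fun z => discMap b (h z) with hk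
  have hk𝓕 : k ∈ 𝓕 := by
    refine ⟨fun z hz => ((hasDerivAt_discMap hb1 (hhn z hz)).differentiableAt.comp z
      ((hhd z hz).differentiableAt (hΩ.mem_nhds hz))).differentiableWithinAt, ?_, ?_, ?_⟩
    · intro z hz w hw hzw
      have h1 := discMap_injOn hb1 (mem_ball_zero_iff.mpr (hhn z hz))
        (mem_ball_zero_iff.mpr (hhn w hw)) hzw
      have h2 : discMap a (g z) = discMap a (g w) := by rw [← hh z hz, ← hh w hw, h1]
      exact hgi hz hw (discMap_injOn ha1 (hgm hz) (hgm hw) h2)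
    · exact fun z hz => mem_ball_zero_iff.mpr (norm_discMap_lt_one hb1 (hhn z hz))
    · simp [hk, discMap, ← hbdef]
  have hdg : HasDerivAt g (deriv g x₀) x₀ :=
    ((hgd x₀ hx₀).differentiableAt (hΩ.mem_nhds hx₀)).hasDerivAt
  have hdh : HasDerivAt h (deriv h x₀) x₀ :=
    ((hhd x₀ hx₀).differentiableAt (hΩ.mem_nhds hx₀)).hasDerivAt
  have hdk := (hasDerivAt_discMap hb1 (z := h x₀) hb1).comp x₀ hdh
  have hrel : 2 * b * deriv h x₀ = (1 - conj a * a) * deriv g x₀ := by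
    have e1 : HasDerivAt (fun z => h z ^ 2) (2 * b * deriv h x₀) x₀ := by
      simpa [← hbdef] using hdh.fun_pow 2
    have hg1 : ‖g x₀‖ < 1 := hgn x₀ hx₀
    have e2 := (hasDerivAt_discMap ha1 hg1).comp x₀ hdg
    have e3 : (fun z => h z ^ 2) =ᶠ[𝓝 x₀] (discMap a ∘ g) := by
      filter_upwards [hΩ.mem_nhds hx₀] with z hz using hh z hz
    rw [e1.unique (e2.congr_of_eventuallyEq e3), hg0]
    simp
  have hconj : ∀ c : ℂ, conj c * c = ((‖c‖ ^ 2 : ℝ) : ℂ) := fun c => by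
    rw [mul_comm, Complex.mul_conj, Complex.normSq_eq_norm_sq]
  have hkd : ‖deriv k x₀‖ * (1 - ‖b‖ ^ 2) = ‖deriv h x₀‖ := by
    have e : deriv k x₀ = (1 - conj b * b) / (1 - conj b * b) ^ 2 * deriv h x₀ := hdk.deriv
    have hpos : 0 < 1 - ‖b‖ ^ 2 := by nlinarith
    rw [e, hconj, norm_mul, norm_div, norm_pow]
    have : ‖(1 : ℂ) - ((‖b‖ ^ 2 : ℝ) : ℂ)‖ = 1 - ‖b‖ ^ 2 := by
      rw [← Complex.ofReal_one, ← Complex.ofReal_sub, Complex.norm_real, Real.norm_of_nonneg hpos.le]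
    rw [this]
    field_simp
  have hhd' : 2 * ‖b‖ * ‖deriv h x₀‖ = (1 - ‖a‖ ^ 2) * ‖deriv g x₀‖ := by
    have := congrArg norm hrel
    rw [norm_mul, norm_mul, norm_mul, hconj] at this
    have e : ‖(1 : ℂ) - ((‖a‖ ^ 2 : ℝ) : ℂ)‖ = 1 - ‖a‖ ^ 2 := by
      rw [← Complex.ofReal_one, ← Complex.ofReal_sub, Complex.norm_real,
        Real.norm_of_nonneg (by nlinarith [norm_nonneg a])]
    rw [e] at this
    simpa using this
  have hle : ‖deriv k x₀‖ ≤ ‖deriv g x₀‖ := by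
    rw [hgM]
    exact le_csSup hSb ⟨k, hk𝓕, rfl⟩
  rw [← hbn] at hhd'
  set t := ‖b‖
  have h1 : 2 * t * ‖deriv k x₀‖ = (1 + t ^ 2) * ‖deriv g x₀‖ := by
    have hpos : 0 < 1 - t ^ 2 := by nlinarith
    have : 2 * t * (‖deriv k x₀‖ * (1 - t ^ 2)) = (1 + t ^ 2) * ‖deriv g x₀‖ * (1 - t ^ 2) := by
      rw [hkd, hhd']; ring
    nlinarith [this]
  nlinarith [mul_pos (sub_pos.mpr hb1) (sub_pos.mpr hb1), mul_pos hb0 hgpos]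

theorem isOpen_image_of_injOn {Ω : Set ℂ} (hΩ : IsOpen Ω) {φ : ℂ → ℂ}
    (hφ : DifferentiableOn ℂ φ Ω) (hi : InjOn φ Ω) {N : Set ℂ} (hN : IsOpen N) (hNΩ : N ⊆ Ω) :
    IsOpen (φ '' N) := by
  rw [isOpen_iff_mem_nhds]
  rintro _ ⟨z, hz, rfl⟩
  rcases ((hφ.analyticOnNhd hΩ) z (hNΩ hz)).eventually_constant_or_nhds_le_map_nhds with h | h
  · exfalso
    have h' := h.and (hN.mem_nhds hz)
    obtain ⟨w, ⟨hw1, hw2⟩, hw3⟩ := ((h'.filter_mono nhdsWithin_le_nhds).and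
      (self_mem_nhdsWithin (a := z) (s := {z}ᶜ))).exists
    exact hw3 (hi (hNΩ hw2) (hNΩ hz) hw1)
  · exact h (image_mem_map (hN.mem_nhds hz))

theorem exists_differentiableOn_inverse {Ω : Set ℂ} (hΩ : IsOpen Ω) {φ : ℂ → ℂ} {D : Set ℂ}
    (hφ : DifferentiableOn ℂ φ Ω) (hb : BijOn φ Ω D) :
    ∃ f : ℂ → ℂ, DifferentiableOn ℂ f D ∧ BijOn f D Ω := by
  have hinv : InvOn (Function.invFunOn φ Ω) φ Ω D := hb.invOn_invFunOn
  have hbij : BijOn (Function.invFunOn φ Ω) D Ω := (hinv.symm.bijOn ?_ hb.mapsTo)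
  · refine ⟨Function.invFunOn φ Ω, ?_, hbij⟩
    set f := Function.invFunOn φ Ω
    have hD : IsOpen D := by
      rw [← hb.image_eq]
      exact isOpen_image_of_injOn hΩ hφ hb.injOn hΩ subset_rfl
    have hfc : ∀ w ∈ D, ContinuousAt f w := by
      intro w hw
      rw [ContinuousAt, tendsto_def]
      intro s hs
      obtain ⟨N, hNs, hNo, hwN⟩ := _root_.mem_nhds_iff.mp hs
      have ho := isOpen_image_of_injOn hΩ hφ hb.injOn (hNo.inter hΩ) inter_subset_right
      refine mem_of_superset (ho.mem_nhds ⟨f w, ⟨hwN, hbij.mapsTo hw⟩, hinv.2 hw⟩) ?_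
      rintro _ ⟨z, ⟨hzN, hzΩ⟩, rfl⟩
      rw [mem_preimage, hinv.1 hzΩ]
      exact hNs hzN
    have hd : ∀ w ∈ D, deriv φ (f w) ≠ 0 → DifferentiableAt ℂ f w := by
      intro w hw h0
      have hd : HasDerivAt φ (deriv φ (f w)) (f w) :=
        ((hφ _ (hbij.mapsTo hw)).differentiableAt (hΩ.mem_nhds (hbij.mapsTo hw))).hasDerivAt
      refine (HasDerivAt.of_local_left_inverse (hfc w hw) hd h0 ?_).differentiableAt
      filter_upwards [hD.mem_nhds hw] with y hy using hinv.2 hy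
    intro w hw
    refine DifferentiableAt.differentiableWithinAt (AnalyticAt.differentiableAt
      (Complex.analyticAt_of_differentiable_on_punctured_nhds_of_continuousAt ?_ (hfc w hw)))
    have ha : AnalyticAt ℂ (deriv φ) (f w) := ((hφ.analyticOnNhd hΩ) _ (hbij.mapsTo hw)).deriv
    rcases ha.eventually_eq_zero_or_eventually_ne_zero with h | h
    · exfalso
      obtain ⟨ρ, hρ, hball⟩ := Metric.eventually_nhds_iff_ball.mp
        (h.and (hΩ.mem_nhds (hbij.mapsTo hw)))
      have h1 : f w + (ρ / 2 : ℝ) ∈ ball (f w) ρ := by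
        simp [abs_of_pos hρ]
        linarith
      have h2 := (convex_ball (f w) ρ).is_const_of_fderivWithin_eq_zero (𝕜 := ℂ)
        (hφ.mono fun z hz => (hball z hz).2) (fun z hz => by
          rw [fderivWithin_of_isOpen isOpen_ball hz]
          ext
          simpa using (hball z hz).1) (mem_ball_self hρ) h1
      have h3 := hb.injOn (hbij.mapsTo hw) (hball _ h1).2 h2
      have h4 : ((ρ / 2 : ℝ) : ℂ) = 0 := by linear_combination -h3
      have : ρ / 2 = 0 := by exact_mod_cast h4
      linarith
    · have ht : Tendsto f (𝓝[≠] w) (𝓝[≠] (f w)) := by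
        refine tendsto_nhdsWithin_iff.mpr ⟨(hfc w hw).tendsto.mono_left nhdsWithin_le_nhds, ?_⟩
        filter_upwards [self_mem_nhdsWithin, nhdsWithin_le_nhds (hD.mem_nhds hw)] with y hy hyD h
        exact hy (hbij.injOn hyD hw h)
      filter_upwards [ht.eventually h, nhdsWithin_le_nhds (hD.mem_nhds hw)] with y hy hyD
      exact hd y hyD hy
  · intro w hw
    obtain ⟨z, hz, rfl⟩ := hb.surjOn hw
    rwa [hinv.1 hz]

/-- The Riemann mapping theorem for bounded connected open sets with connected complement. -/
theorem exists_riemann_map {Ω : Set ℂ} (hΩ : IsOpen Ω) (hc : IsConnected Ω)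
    (hb : Bornology.IsBounded Ω) (hAc : IsPreconnected Ωᶜ) :
    ∃ f : ℂ → ℂ, DifferentiableOn ℂ f (ball 0 1) ∧ BijOn f (ball 0 1) Ω := by
  have hunb : ¬ Bornology.IsBounded Ωᶜ := fun h =>
    NormedSpace.unbounded_univ ℝ ℂ (by simpa using hb.union h)
  obtain ⟨φ, h1, h2⟩ := exists_bijOn_ball_of_sqrt hΩ hc hb fun F hF h0 =>
    exists_differentiableOn_sq hΩ hF (hasLogOn_of_isConnected hΩ hc hAc hunb hF.continuousOn h0)
  exact exists_differentiableOn_inverse hΩ h1 h2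

end

section

open Set Metric MeasureTheory Filter Topology
open scoped ENNReal unitInterval

/-- The area of the image of an injective holomorphic map. -/
theorem volume_image_eq_lintegral_norm_deriv_sq {F : ℂ → ℂ} {U : Set ℂ} (hU : IsOpen U)
    (hF : DifferentiableOn ℂ F U) (hinj : InjOn F U) :
    volume (F '' U) = ∫⁻ z in U, ENNReal.ofReal (‖deriv F z‖ ^ 2) := by
  have key := lintegral_image_eq_lintegral_abs_det_fderiv_mul (volume : Measure ℂ)
    hU.measurableSet (f := F)
    (f' := fun z => (ContinuousLinearMap.toSpanSingleton ℂ (deriv F z)).restrictScalars ℝ)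
    (fun z hz => ((hF.differentiableAt
      (hU.mem_nhds hz)).hasDerivAt.hasFDerivAt.restrictScalars ℝ).hasFDerivWithinAt) hinj
    (fun _ => 1)
  simp only [lintegral_const, mul_one, Measure.restrict_apply MeasurableSet.univ, univ_inter,
    one_mul] at key
  rw [key]
  refine lintegral_congr fun z => ?_
  congr 1
  have : ((ContinuousLinearMap.toSpanSingleton ℂ (deriv F z)).restrictScalars ℝ).det
      = ‖deriv F z‖ ^ 2 := by
    have h1 : (((ContinuousLinearMap.toSpanSingleton ℂ (deriv F z)).restrictScalars ℝ :
        ℂ →L[ℝ] ℂ) : ℂ →ₗ[ℝ] ℂ) = LinearMap.mulLeft ℝ (deriv F z) := by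
      ext
      simp [mul_comm]
    rw [ContinuousLinearMap.det, h1, ← Complex.normSq_eq_norm_sq, ← Algebra.norm_complex_apply,
      Algebra.norm_apply]
    rfl
  rw [this, abs_of_nonneg (by positivity)]

theorem not_integrable_inv_lintegral {C ρ : ℝ} (hC : 0 < C) (hρ : 0 < ρ) :
    ∫⁻ r in Ioo 0 ρ, ENNReal.ofReal (C / r) = ⊤ := by
  by_contra h
  have hm : AEStronglyMeasurable (fun r : ℝ => r⁻¹) (volume.restrict (Ioc 0 ρ)) :=
    measurable_inv.aestronglyMeasurable
  have : IntervalIntegrable (fun x : ℝ => x⁻¹) volume 0 ρ := by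
    rw [intervalIntegrable_iff_integrableOn_Ioo_of_le hρ.le]
    have h2 : IntegrableOn (fun r : ℝ => C / r) (Ioo 0 ρ) := by
      refine ⟨(measurable_const.div measurable_id).aestronglyMeasurable, ?_⟩
      rw [hasFiniteIntegral_iff_ofReal]
      · exact lt_top_iff_ne_top.2 h
      · filter_upwards [ae_restrict_mem measurableSet_Ioo] with r hr
        exact (div_pos hC hr.1).le
    have h3 := h2.const_mul C⁻¹
    refine h3.congr ?_
    filter_upwards with r
    field_simp
  rw [intervalIntegrable_inv_iff] at this
  rcases this with h | h
  · exact hρ.ne h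
  · exact h left_mem_uIcc

theorem mem_ball_one_iff_polar {r θ : ℝ} (hr : 0 < r) :
    ((r : ℂ) * Complex.exp (θ * Complex.I) ∈ ball (1 : ℂ) 1) ↔ r < 2 * Real.cos θ := by
  rw [mem_ball_iff_norm, ← sq_lt_one_iff₀ (norm_nonneg _), ← Complex.normSq_eq_norm_sq,
    Complex.normSq_apply]
  have h1 : ((r : ℂ) * Complex.exp (θ * Complex.I)).re = r * Real.cos θ := by
    simp [Complex.exp_ofReal_mul_I_re]
  have h2 : ((r : ℂ) * Complex.exp (θ * Complex.I)).im = r * Real.sin θ := by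
    simp [Complex.exp_ofReal_mul_I_im]
  rw [Complex.sub_re, Complex.sub_im, h1, h2, Complex.one_re, Complex.one_im]
  have : (r * Real.cos θ - 1) * (r * Real.cos θ - 1) + (r * Real.sin θ - 0) * (r * Real.sin θ - 0)
      = r * (r - 2 * Real.cos θ) + 1 := by
    have := Real.sin_sq_add_cos_sq θ
    linear_combination r ^ 2 * this
  rw [this]
  constructor
  · intro h
    by_contra h'
    push Not at h'
    nlinarith
  · intro h
    nlinarith

theorem cos_ge_min_of_mem_Icc {a b t : ℝ} (ha : a ∈ Ioo (-Real.pi) Real.pi)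
    (hb : b ∈ Ioo (-Real.pi) Real.pi) (ht : t ∈ Icc a b) :
    min (Real.cos a) (Real.cos b) ≤ Real.cos t := by
  rcases le_total 0 t with h | h
  · exact (min_le_right _ _).trans (Real.cos_le_cos_of_nonneg_of_le_pi h hb.2.le ht.2)
  · refine (min_le_left _ _).trans ?_
    rw [← Real.cos_neg a, ← Real.cos_neg t]
    exact Real.cos_le_cos_of_nonneg_of_le_pi (by linarith) (by linarith [ha.1]) (by linarith [ht.1])

/-- Length–area estimate on a single circular arc. -/
theorem arc_length_area {F : ℂ → ℂ} (hF : DifferentiableOn ℂ F (ball 1 1)) {η r : ℝ} (hη : 0 < η)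
    (hr : 0 < r) {a b : ℝ} (ha : a ∈ Ioo (-Real.pi) Real.pi) (hb : b ∈ Ioo (-Real.pi) Real.pi)
    (hab : a ≤ b) (ha' : r < 2 * Real.cos a) (hb' : r < 2 * Real.cos b)
    (hd : η ≤ ‖F (r * Complex.exp (b * Complex.I)) - F (r * Complex.exp (a * Complex.I))‖) :
    ENNReal.ofReal (η ^ 2 / Real.pi / r) ≤ ∫⁻ θ in Ioo (-Real.pi) Real.pi, ENNReal.ofReal r *
      (ball (1 : ℂ) 1).indicator (fun z => ENNReal.ofReal (‖deriv F z‖ ^ 2))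
        (r * Complex.exp (θ * Complex.I)) := by
  set P : ℝ → ℂ := fun θ => r * Complex.exp (θ * Complex.I) with hP
  have hPm : ∀ θ ∈ Icc a b, P θ ∈ ball (1 : ℂ) 1 := fun θ hθ => by
    rw [hP, mem_ball_one_iff_polar hr]
    have := cos_ge_min_of_mem_Icc ha hb hθ
    rcases min_le_iff.1 this with h | h <;> linarith
  have hPc : Continuous P := by fun_prop
  have hPd : ∀ θ, HasDerivAt P (P θ * Complex.I) θ := fun θ => by
    have h1 : HasDerivAt (fun t : ℝ => (t : ℂ) * Complex.I) (1 * Complex.I) θ :=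
      (Complex.ofRealCLM.hasDerivAt (x := θ)).mul_const Complex.I
    have := (h1.cexp).const_mul (r : ℂ)
    rw [show P θ * Complex.I = (r : ℂ) * (Complex.exp (θ * Complex.I) * (1 * Complex.I)) by
      rw [hP]; ring]
    exact this
  have hdc : ContinuousOn (deriv F) (ball 1 1) := (hF.deriv isOpen_ball).continuousOn
  have hcomp : ContinuousOn (fun θ => deriv F (P θ)) (Icc a b) :=
    hdc.comp hPc.continuousOn hPm
  have hder : ∀ θ ∈ uIcc a b, HasDerivAt (fun t => F (P t)) (deriv F (P θ) * (P θ * Complex.I)) θ := by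
    intro θ hθ
    rw [uIcc_of_le hab] at hθ
    have := (hF.differentiableAt (isOpen_ball.mem_nhds (hPm θ hθ))).hasDerivAt
    exact HasDerivAt.comp (h := P) (h₂ := F) θ this (hPd θ)
  have hcont : ContinuousOn (fun θ => deriv F (P θ) * (P θ * Complex.I)) (uIcc a b) := by
    rw [uIcc_of_le hab]
    exact hcomp.mul (hPc.mul continuous_const).continuousOn
  have hcint := intervalIntegral.integral_eq_sub_of_hasDerivAt hder hcont.intervalIntegrable
  have hnP : ∀ θ, ‖P θ‖ = r := fun θ => by
    simp only [hP, norm_mul, Complex.norm_exp_ofReal_mul_I, Complex.norm_real, mul_one,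
      Real.norm_eq_abs, abs_of_pos hr]
  have h1 : η ≤ ∫ θ in a..b, r * ‖deriv F (P θ)‖ := by
    refine hd.trans ?_
    rw [show F (r * Complex.exp (b * Complex.I)) - F (r * Complex.exp (a * Complex.I))
      = F (P b) - F (P a) from rfl, ← hcint]
    refine (intervalIntegral.norm_integral_le_integral_norm hab).trans (le_of_eq ?_)
    refine intervalIntegral.integral_congr fun θ _ => ?_
    simp only [norm_mul, hnP, Complex.norm_I]; ring
  have hci1 : ContinuousOn (fun θ => r * ‖deriv F (P θ)‖) (uIcc a b) := by
    rw [uIcc_of_le hab]; exact continuousOn_const.mul hcomp.norm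
  have hci2 : ContinuousOn (fun θ => r * ‖deriv F (P θ)‖ ^ 2) (uIcc a b) := by
    rw [uIcc_of_le hab]; exact continuousOn_const.mul (hcomp.norm.pow 2)
  have hpi := Real.pi_pos
  have hba : b - a ≤ Real.pi := by
    have hca : 0 < Real.cos a := by linarith
    have hcb : 0 < Real.cos b := by linarith
    have hb2 : b < Real.pi / 2 := by
      by_contra h
      push Not at h
      exact absurd hcb (not_lt.2 (Real.cos_nonpos_of_pi_div_two_le_of_le h (by linarith [hb.2])))
    have ha2 : -(Real.pi / 2) < a := by
      by_contra h
      push Not at h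
      rw [← Real.cos_neg] at hca
      exact absurd hca (not_lt.2 (Real.cos_nonpos_of_pi_div_two_le_of_le (by linarith)
        (by linarith [ha.1])))
    linarith
  have h2 : ∫ θ in a..b, r * ‖deriv F (P θ)‖ ≤
      ∫ θ in a..b, (η / (2 * Real.pi) + (Real.pi / (2 * η) * r) * (r * ‖deriv F (P θ)‖ ^ 2)) := by
    refine intervalIntegral.integral_mono_on hab hci1.intervalIntegrable
      ((continuousOn_const.add (continuousOn_const.mul hci2)).intervalIntegrable) fun θ _ => ?_
    have h3 : 0 ≤ (η / Real.pi - r * ‖deriv F (P θ)‖) ^ 2 * (Real.pi / (2 * η)) := by positivity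
    have h4 : (η / Real.pi - r * ‖deriv F (P θ)‖) ^ 2 * (Real.pi / (2 * η)) =
      η / (2 * Real.pi) + (Real.pi / (2 * η) * r) * (r * ‖deriv F (P θ)‖ ^ 2)
        - r * ‖deriv F (P θ)‖ := by
      field_simp
      ring
    linarith
  rw [intervalIntegral.integral_add intervalIntegrable_const
    (hci2.intervalIntegrable.const_mul _), intervalIntegral.integral_const,
    intervalIntegral.integral_const_mul (Real.pi / (2 * η) * r), smul_eq_mul] at h2
  have h3 : η ^ 2 / Real.pi / r ≤ ∫ θ in a..b, r * ‖deriv F (P θ)‖ ^ 2 := by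
    set Q := ∫ θ in a..b, r * ‖deriv F (P θ)‖ ^ 2
    have h4 : (b - a) * (η / (2 * Real.pi)) ≤ Real.pi * (η / (2 * Real.pi)) := by gcongr
    have h5 : Real.pi * (η / (2 * Real.pi)) = η / 2 := by field_simp
    have h6 : η / 2 ≤ Real.pi / (2 * η) * r * Q := by linarith
    rw [div_div, div_le_iff₀ (by positivity)]
    have h7 : η / 2 * (2 * η) ≤ Real.pi / (2 * η) * r * Q * (2 * η) := by gcongr
    have h8 : Real.pi / (2 * η) * r * Q * (2 * η) = Q * (Real.pi * r) := by field_simp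
    nlinarith
  calc ENNReal.ofReal (η ^ 2 / Real.pi / r) ≤ ENNReal.ofReal (∫ θ in a..b, r * ‖deriv F (P θ)‖ ^ 2) :=
        ENNReal.ofReal_le_ofReal h3
    _ = ∫⁻ θ in Ioc a b, ENNReal.ofReal (r * ‖deriv F (P θ)‖ ^ 2) := by
        rw [intervalIntegral.integral_of_le hab, ofReal_integral_eq_lintegral_ofReal]
        · exact (intervalIntegrable_iff_integrableOn_Ioc_of_le hab).1 hci2.intervalIntegrable
        · filter_upwards with θ
          positivity
    _ = ∫⁻ θ in Ioc a b, ENNReal.ofReal r *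
          (ball (1 : ℂ) 1).indicator (fun z => ENNReal.ofReal (‖deriv F z‖ ^ 2)) (P θ) := by
        refine setLIntegral_congr_fun measurableSet_Ioc fun θ hθ => ?_
        rw [indicator_of_mem (hPm θ (Ioc_subset_Icc_self hθ)), ENNReal.ofReal_mul hr.le]
    _ ≤ _ := lintegral_mono_set
        (show Ioc a b ⊆ Ioo (-Real.pi) Real.pi from
          fun θ hθ => ⟨ha.1.trans hθ.1, hθ.2.trans_lt hb.2⟩)

theorem exists_radius_dist_image_le_aux {F : ℂ → ℂ} (hF : DifferentiableOn ℂ F (ball 1 1))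
    (hinj : InjOn F (ball 1 1)) (hb : Bornology.IsBounded (F '' ball 1 1)) {η ρ : ℝ} (hη : 0 < η)
    (hρ : 0 < ρ) : ∃ r ∈ Ioo 0 ρ, ∀ z ∈ ball (1 : ℂ) 1 ∩ sphere 0 r,
      ∀ w ∈ ball (1 : ℂ) 1 ∩ sphere 0 r, dist (F z) (F w) ≤ η := by
  by_contra hcon
  push Not at hcon
  set H : ℂ → ℝ≥0∞ := (ball (1 : ℂ) 1).indicator (fun z => ENNReal.ofReal (‖deriv F z‖ ^ 2)) with hH
  have hHm : Measurable H := by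
    refine Measurable.indicator ?_ measurableSet_ball
    exact ENNReal.measurable_ofReal.comp (((measurable_deriv F).norm).pow_const 2)
  have hfin : ∫⁻ z, H z < ⊤ := by
    rw [hH, lintegral_indicator measurableSet_ball,
      ← volume_image_eq_lintegral_norm_deriv_sq isOpen_ball hF hinj]
    exact hb.measure_lt_top
  refine hfin.ne (top_le_iff.1 ?_)
  rw [← Complex.lintegral_comp_polarCoord_symm, polarCoord_target, Measure.volume_eq_prod,
    setLIntegral_prod]
  swap
  · refine Measurable.aemeasurable ?_
    simp only [Complex.polarCoord_symm_apply, smul_eq_mul]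
    refine Measurable.mul (by fun_prop) (hHm.comp ?_)
    fun_prop
  rw [← not_integrable_inv_lintegral (C := η ^ 2 / Real.pi) (ρ := ρ) (by positivity) hρ]
  refine (setLIntegral_mono_ae' measurableSet_Ioo (ae_of_all _ fun r hr => ?_)).trans
    (lintegral_mono_set fun r hr => hr.1)
  obtain ⟨z, hz, w, hw, hzw⟩ := hcon r hr
  have harg : ∀ z ∈ ball (1 : ℂ) 1 ∩ sphere 0 r, z.arg ∈ Ioo (-Real.pi) Real.pi ∧
      r < 2 * Real.cos z.arg ∧ (r : ℂ) * Complex.exp (z.arg * Complex.I) = z := by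
    intro z hz
    have hzr : ‖z‖ = r := by simpa using hz.2
    have h1 : (r : ℂ) * Complex.exp (z.arg * Complex.I) = z := by
      rw [← hzr, Complex.norm_mul_exp_arg_mul_I]
    have h2 : r < 2 * Real.cos z.arg := by
      rw [← mem_ball_one_iff_polar hr.1, h1]; exact hz.1
    refine ⟨⟨Complex.neg_pi_lt_arg z, lt_of_le_of_ne (Complex.arg_le_pi z) ?_⟩, h2, h1⟩
    intro h
    rw [h, Real.cos_pi] at h2
    linarith [hr.1]
  obtain ⟨hz1, hz2, hz3⟩ := harg z hz
  obtain ⟨hw1, hw2, hw3⟩ := harg w hw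
  simp only [Complex.polarCoord_symm_apply, smul_eq_mul, Complex.ofReal_cos, Complex.ofReal_sin,
    ← Complex.exp_mul_I]
  rcases le_total z.arg w.arg with h | h
  · refine arc_length_area hF hη hr.1 hz1 hw1 h hz2 hw2 ?_
    rw [hz3, hw3, ← dist_eq_norm, dist_comm]
    exact hzw.le
  · refine arc_length_area hF hη hr.1 hw1 hz1 h hw2 hz2 ?_
    rw [hz3, hw3, ← dist_eq_norm]
    exact hzw.le

/-- Length–area lemma: an injective bounded holomorphic function on the disc has small
oscillation on arbitrarily small circular crosscuts around any boundary point. -/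
theorem exists_radius_dist_image_le {f : ℂ → ℂ} (hf : DifferentiableOn ℂ f (ball 0 1))
    (hinj : InjOn f (ball 0 1)) (hb : Bornology.IsBounded (f '' ball 0 1)) {ζ : ℂ} (hζ : ‖ζ‖ = 1)
    {η ρ : ℝ} (hη : 0 < η) (hρ : 0 < ρ) : ∃ r ∈ Ioo 0 ρ, ∀ z ∈ ball (0 : ℂ) 1 ∩ sphere ζ r,
      ∀ w ∈ ball (0 : ℂ) 1 ∩ sphere ζ r, dist (f z) (f w) ≤ η := by
  have hζ0 : ζ ≠ 0 := by rintro rfl; simp at hζ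
  have hmap : ∀ z, -ζ * (z - 1) ∈ ball (0 : ℂ) 1 ↔ z ∈ ball (1 : ℂ) 1 := fun z => by
    simp [hζ, dist_eq_norm]
  have hinv : ∀ z : ℂ, -ζ * ((1 - ζ⁻¹ * z) - 1) = z := fun z => by field_simp; ring
  have hmaps : MapsTo (fun z => -ζ * (z - 1)) (ball (1 : ℂ) 1) (ball 0 1) := fun z hz => (hmap z).2 hz
  obtain ⟨r, hr, H⟩ := exists_radius_dist_image_le_aux (F := fun z => f (-ζ * (z - 1)))
    (hf.comp (by fun_prop) hmaps)
    (fun z hz w hw h => by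
      have := hinj (hmaps hz) (hmaps hw) h
      have := mul_left_cancel₀ (neg_ne_zero.2 hζ0) this
      simpa using this)
    (hb.subset (by rintro _ ⟨z, hz, rfl⟩; exact ⟨_, hmaps hz, rfl⟩)) hη hρ
  refine ⟨r, hr, fun z hz w hw => ?_⟩
  have hmem : ∀ z ∈ ball (0 : ℂ) 1 ∩ sphere ζ r, 1 - ζ⁻¹ * z ∈ ball (1 : ℂ) 1 ∩ sphere 0 r := by
    intro z hz
    refine ⟨(hmap _).1 (by rw [hinv]; exact hz.1), ?_⟩
    have h1 : ‖z - ζ‖ = r := by simpa [dist_eq_norm] using hz.2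
    have h2 : 1 - ζ⁻¹ * z = -ζ⁻¹ * (z - ζ) := by field_simp; ring
    rw [mem_sphere_zero_iff_norm, h2, norm_mul, h1, norm_neg, norm_inv, hζ, inv_one, one_mul]
  have := H _ (hmem z hz) _ (hmem w hw)
  simpa only [hinv] using this

end

section

open Set Metric MeasureTheory Filter Topology
open scoped ENNReal unitInterval

/-- Polar coordinates on `ℂ`. -/
noncomputable def polarMap (p : ℝ × ℝ) : ℂ := p.1 * Complex.exp (p.2 * Complex.I)

theorem continuous_polarMap : Continuous polarMap := by unfold polarMap; fun_prop

theorem norm_polarMap {ρ θ : ℝ} (h : 0 ≤ ρ) : ‖polarMap (ρ, θ)‖ = ρ := by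
  simp [polarMap, Complex.norm_exp_ofReal_mul_I, abs_of_nonneg h]

theorem exists_polarMap_eq (z : ℂ) (a : ℝ) :
    ∃ θ ∈ Ico a (a + 2 * Real.pi), polarMap (‖z‖, θ) = z := by
  refine ⟨toIcoMod Real.two_pi_pos a z.arg, toIcoMod_mem_Ico _ _ _, ?_⟩
  have h := toIcoMod_add_toIcoDiv_zsmul Real.two_pi_pos a z.arg
  generalize toIcoDiv Real.two_pi_pos a z.arg = n at h
  generalize toIcoMod Real.two_pi_pos a z.arg = θ at h
  conv_rhs => rw [← Complex.norm_mul_exp_arg_mul_I z]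
  unfold polarMap
  simp only
  congr 1
  rw [Complex.exp_eq_exp_iff_exists_int]
  refine ⟨-n, ?_⟩
  rw [← h]
  simp only [zsmul_eq_mul]
  push_cast
  ring

theorem polarMap_eq_polarMap {ρ ρ' θ θ' : ℝ} (h0 : 0 < ρ) (h0' : 0 ≤ ρ')
    (h : polarMap (ρ, θ) = polarMap (ρ', θ')) :
    ρ = ρ' ∧ ∃ n : ℤ, θ = θ' + n * (2 * Real.pi) := by
  have h1 : ρ = ρ' := by rw [← norm_polarMap (θ := θ) h0.le, h, norm_polarMap h0']
  refine ⟨h1, ?_⟩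
  subst h1
  unfold polarMap at h
  have h2 := mul_left_cancel₀ (by exact_mod_cast h0.ne') h
  obtain ⟨n, hn⟩ := Complex.exp_eq_exp_iff_exists_int.1 h2
  refine ⟨n, ?_⟩
  have := congrArg Complex.im hn
  simpa using this

theorem isPreconnected_compl_closedBall (x : ℂ) (R : ℝ) : IsPreconnected (closedBall x R)ᶜ := by
  rcases lt_or_ge R 0 with hR | hR
  · rw [closedBall_eq_empty.2 hR, compl_empty]; exact isPreconnected_univ
  have : (closedBall x R)ᶜ = (fun p => x + polarMap p) '' (Ioi R ×ˢ univ) := by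
    ext z
    constructor
    · intro hz
      obtain ⟨θ, -, hθ⟩ := exists_polarMap_eq (z - x) 0
      refine ⟨(‖z - x‖, θ), ⟨?_, trivial⟩, ?_⟩
      · simpa [dist_eq_norm] using hz
      · simp only [hθ]; ring
    · rintro ⟨⟨ρ, θ⟩, ⟨h1, -⟩, rfl⟩
      have h1' : R < ρ := h1
      simp [dist_eq_norm, norm_polarMap (hR.trans h1'.le), h1']
  rw [this]
  exact (isPreconnected_Ioi.prod isPreconnected_univ).image _
    (continuous_const.add continuous_polarMap).continuousOn

theorem sector_eq {a b : ℝ} (hab : a < b) (hb : b < a + 2 * Real.pi) :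
    polarMap '' (Ioo 0 1 ×ˢ Ioo a b) =
      ball 0 1 \ polarMap '' (Icc 0 1 ×ˢ Icc b (a + 2 * Real.pi)) := by
  have hpi := Real.pi_pos
  ext z
  constructor
  · rintro ⟨⟨ρ, θ⟩, ⟨h1, h2⟩, rfl⟩
    simp only at h1 h2
    refine ⟨by simpa [norm_polarMap h1.1.le] using h1.2, ?_⟩
    rintro ⟨⟨ρ', θ'⟩, ⟨h3, h4⟩, h5⟩
    simp only at h3 h4
    obtain ⟨-, n, hn⟩ := polarMap_eq_polarMap h1.1 h3.1 h5.symm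
    have : -1 < (n : ℝ) := by nlinarith [h2.1, h4.2]
    have h' : (n : ℝ) < 0 := by nlinarith [h2.2, h4.1]
    have : -1 < n := by exact_mod_cast this
    have : n < 0 := by exact_mod_cast h'
    omega
  · rintro ⟨hz, hz'⟩
    obtain ⟨θ, hθ, h⟩ := exists_polarMap_eq z a
    have hz1 : ‖z‖ < 1 := by simpa using hz
    have hz0 : 0 < ‖z‖ := by
      rcases (norm_nonneg z).eq_or_lt with h0 | h0
      · refine absurd ⟨(0, b), ⟨by simp, ⟨le_rfl, hb.le⟩⟩, ?_⟩ hz'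
        rw [norm_eq_zero.1 h0.symm]; simp [polarMap]
      · exact h0
    refine ⟨(‖z‖, θ), ⟨⟨hz0, hz1⟩, ?_, ?_⟩, h⟩
    · refine lt_of_le_of_ne hθ.1 fun h' => hz' ⟨(‖z‖, a + 2 * Real.pi),
        ⟨⟨hz0.le, hz1.le⟩, hb.le, le_rfl⟩, ?_⟩
      refine Eq.trans ?_ h
      have h'' : a = θ := h'
      subst h''
      unfold polarMap
      simp only
      congr 1
      rw [Complex.exp_eq_exp_iff_exists_int]
      exact ⟨1, by push_cast; ring⟩
    · by_contra h'
      push Not at h'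
      exact hz' ⟨(‖z‖, θ), ⟨⟨hz0.le, hz1.le⟩, h', hθ.2.le⟩, h⟩

theorem mul_polarMap_one_mem_sphere {a : ℂ} (ha : a ∈ sphere (0 : ℂ) 1) (t : ℝ) :
    a * polarMap (1, t) ∈ sphere (0 : ℂ) 1 := by
  rw [mem_sphere_zero_iff_norm] at *
  rw [norm_mul, ha, norm_polarMap zero_le_one, one_mul]

theorem exists_mul_polarMap_one {a b : ℂ} (ha : a ∈ sphere (0 : ℂ) 1)
    (hb : b ∈ sphere (0 : ℂ) 1) : a * polarMap (1, (b / a).arg) = b := by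
  rw [mem_sphere_zero_iff_norm] at *
  have h0 : a ≠ 0 := by rintro rfl; simp at ha
  have : polarMap (1, (b / a).arg) = b / a := by
    have := Complex.norm_mul_exp_arg_mul_I (b / a)
    rw [norm_div, ha, hb, div_one] at this
    exact this
  rw [this]; field_simp

/-- Points of a Jordan curve close to a given one lie on a small subarc around it. -/
theorem exists_small_subarc {j : ℂ → ℂ} (hj : ContinuousOn j (sphere 0 1))
    (hinj : InjOn j (sphere 0 1)) {ε : ℝ} (hε : 0 < ε) :
    ∃ δ > 0, ∀ x ∈ j '' sphere 0 1, ∃ A ⊆ j '' sphere 0 1, IsClosed A ∧ IsPreconnected A ∧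
      A ⊆ closedBall x ε ∧ ∀ y ∈ j '' sphere 0 1, dist y x < δ → y ∈ A := by
  have hcs : IsCompact (sphere (0 : ℂ) 1) := isCompact_sphere 0 1
  obtain ⟨δ₁, hδ₁, h₁⟩ := Metric.uniformContinuousOn_iff.1
    (hcs.uniformContinuousOn_of_continuous hj) ε hε
  have hpc : Continuous fun t : ℝ => polarMap (1, t) :=
    continuous_polarMap.comp (by fun_prop)
  have hp0 : polarMap (1, 0) = 1 := by simp [polarMap]
  obtain ⟨τ₀, hτ₀, hτ⟩ := Metric.continuousAt_iff.1 (hpc.continuousAt (x := 0)) δ₁ hδ₁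
  set τ := τ₀ / 2
  have hτp : 0 < τ := by positivity
  obtain ⟨δ₂, hδ₂, h₂⟩ := Metric.continuousAt_iff.1
    (Complex.continuousAt_arg (x := 1) (by simp)) τ hτp
  have hinvc := hcs.continuousOn_of_leftInvOn hj hinj.leftInvOn_invFunOn
  have hcJ : IsCompact (j '' sphere 0 1) := hcs.image_of_continuousOn hj
  obtain ⟨δ, hδ, h₃⟩ := Metric.uniformContinuousOn_iff.1
    (hcJ.uniformContinuousOn_of_continuous hinvc) δ₂ hδ₂
  refine ⟨δ, hδ, ?_⟩
  rintro _ ⟨a, ha, rfl⟩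
  have ham : MapsTo (fun t : ℝ => a * polarMap (1, t)) (Icc (-τ) τ) (sphere 0 1) :=
    fun t _ => mul_polarMap_one_mem_sphere ha t
  have hcont : ContinuousOn (fun t : ℝ => j (a * polarMap (1, t))) (Icc (-τ) τ) :=
    hj.comp (continuous_const.mul hpc).continuousOn ham
  have hna : ‖a‖ = 1 := by simpa using ha
  have ha0 : a ≠ 0 := by rintro rfl; simp at hna
  refine ⟨(fun t : ℝ => j (a * polarMap (1, t))) '' Icc (-τ) τ, ?_,
    (isCompact_Icc.image_of_continuousOn hcont).isClosed,
    isPreconnected_Icc.image _ hcont, ?_, ?_⟩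
  · rintro _ ⟨t, ht, rfl⟩
    exact ⟨_, ham ht, rfl⟩
  · rintro _ ⟨t, ht, rfl⟩
    refine (h₁ _ (ham ht) _ ha ?_).le
    have h4 := @hτ t (by
      rw [Real.dist_eq, sub_zero]
      exact (abs_le.2 ht).trans_lt (half_lt_self hτ₀))
    rw [hp0] at h4
    rw [dist_eq_norm] at h4 ⊢
    rwa [show a * polarMap (1, t) - a = a * (polarMap (1, t) - 1) by ring, norm_mul, hna, one_mul]
  · rintro _ ⟨b, hb, rfl⟩ hd
    have h4 := h₃ _ ⟨b, hb, rfl⟩ _ ⟨a, ha, rfl⟩ hd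
    rw [hinj.leftInvOn_invFunOn hb, hinj.leftInvOn_invFunOn ha] at h4
    have h5 : dist (b / a) 1 < δ₂ := by
      rw [dist_eq_norm] at h4 ⊢
      rwa [show b / a - 1 = (b - a) / a by field_simp, norm_div, hna, div_one]
    have h6 := h₂ h5
    rw [Complex.arg_one, Real.dist_eq, sub_zero] at h6
    refine ⟨(b / a).arg, abs_le.1 h6.le, ?_⟩
    simp only [exists_mul_polarMap_one ha hb]

theorem isPreconnected_jordan_diff_singleton {j : ℂ → ℂ} (hj : ContinuousOn j (sphere 0 1))
    (hinj : InjOn j (sphere 0 1)) (w : ℂ) (hw : w ∈ j '' sphere 0 1) :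
    IsPreconnected (j '' sphere 0 1 \ {w}) := by
  obtain ⟨a, ha, rfl⟩ := hw
  have hpc : Continuous fun t : ℝ => polarMap (1, t) := continuous_polarMap.comp (by fun_prop)
  have hna : ‖a‖ = 1 := by simpa using ha
  have ha0 : a ≠ 0 := by rintro rfl; simp at hna
  have : j '' sphere 0 1 \ {j a} = (fun t : ℝ => j (a * polarMap (1, t))) '' Ioo 0 (2 * Real.pi) := by
    ext x
    constructor
    · rintro ⟨⟨b, hb, rfl⟩, hx⟩
      have hnb : ‖b‖ = 1 := by simpa using hb
      obtain ⟨θ, hθ, h⟩ := exists_polarMap_eq (b / a) 0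
      rw [norm_div, hna, hnb, div_one] at h
      refine ⟨θ, ⟨lt_of_le_of_ne hθ.1 ?_, by simpa using hθ.2⟩, ?_⟩
      · rintro rfl
        apply hx
        have : b / a = 1 := by rw [← h]; simp [polarMap]
        rw [(div_eq_one_iff_eq ha0).1 this]; rfl
      · simp only [h]; congr 1; field_simp
    · rintro ⟨t, ht, rfl⟩
      refine ⟨⟨_, mul_polarMap_one_mem_sphere ha t, rfl⟩, fun h => ?_⟩
      have h1 := hinj (mul_polarMap_one_mem_sphere ha t) ha h
      have h2 : polarMap (1, t) = polarMap (1, 0) := by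
        have : polarMap (1, t) = 1 := mul_left_cancel₀ ha0 (by rw [h1, mul_one])
        rw [this]; simp [polarMap]
      obtain ⟨-, n, hn⟩ := polarMap_eq_polarMap one_pos zero_le_one h2
      have hpi := Real.pi_pos
      have h3 : (0 : ℝ) < n := by nlinarith [ht.1]
      have h4 : (n : ℝ) < 1 := by nlinarith [ht.2]
      have : 0 < n := by exact_mod_cast h3
      have : n < 1 := by exact_mod_cast h4
      omega
  rw [this]
  exact isPreconnected_Ioo.image _ (hj.comp (continuous_const.mul hpc).continuousOn
    fun t _ => mul_polarMap_one_mem_sphere ha t)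

end

section

open Set Metric MeasureTheory Filter Topology
open scoped ENNReal unitInterval

/-- A point of the image of an injective holomorphic map has a neighbourhood whose preimage lies
in a given neighbourhood of its preimage. -/
theorem mem_of_mem_closure_image {f : ℂ → ℂ} (hf : DifferentiableOn ℂ f (ball 0 1))
    (hinj : InjOn f (ball 0 1)) {y : ℂ} (hy : y ∈ ball (0 : ℂ) 1) {E : Set ℂ}
    (hE : E ⊆ ball 0 1) (h : f y ∈ closure (f '' E)) : y ∈ closure E := by
  rw [_root_.mem_closure_iff]
  intro o ho hyo
  have hop : IsOpen (f '' (o ∩ ball 0 1)) :=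
    isOpen_image_of_injOn isOpen_ball hf hinj (ho.inter isOpen_ball) inter_subset_right
  obtain ⟨_, ⟨z, hz, rfl⟩, ⟨e, he, hez⟩⟩ := _root_.mem_closure_iff.1 h _ hop ⟨y, ⟨hyo, hy⟩, rfl⟩
  rw [hinj (hE he) hz.2 hez] at he
  exact ⟨z, hz.1, he⟩

section Caratheodory

variable {f : ℂ → ℂ} {j : ℂ → ℂ} {Ω : Set ℂ}

theorem exists_mem_jordan_inter_closure_crosscut (hf : DifferentiableOn ℂ f (ball 0 1))
    (hbij : BijOn f (ball 0 1) Ω) (hb : Bornology.IsBounded Ω) (hfr : frontier Ω ⊆ j '' sphere 0 1)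
    {ζ : ℂ} (hζ : ‖ζ‖ = 1) {r : ℝ} (hr : r ∈ Ioo 0 1) :
    (j '' sphere 0 1 ∩ closure (f '' (ball 0 1 ∩ sphere ζ r))).Nonempty := by
  by_contra hne
  rw [not_nonempty_iff_eq_empty] at hne
  set C := ball (0 : ℂ) 1 ∩ sphere ζ r
  have hC : C ⊆ ball 0 1 := inter_subset_left
  have hSsub : f '' C ⊆ Ω := by rw [← hbij.image_eq]; exact image_mono hC
  have hcl : closure (f '' C) ⊆ Ω := by
    intro x hx
    by_contra hxΩ
    have : x ∈ frontier Ω := ⟨closure_mono hSsub hx, fun h => hxΩ (interior_subset h)⟩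
    exact (hne ▸ (⟨hfr this, hx⟩ : x ∈ j '' sphere 0 1 ∩ closure (f '' C)) : x ∈ (∅ : Set ℂ))
  obtain ⟨h, hd, hl⟩ : ∃ h : ℂ → ℂ, ContinuousOn h (f '' ball 0 1) ∧ LeftInvOn h f (ball 0 1) := by
    refine ⟨Function.invFunOn f (ball 0 1), ?_, hbij.injOn.leftInvOn_invFunOn⟩
    rintro _ ⟨y, hy, rfl⟩
    rw [ContinuousWithinAt, hbij.injOn.leftInvOn_invFunOn hy, _root_.tendsto_nhds]
    intro o ho hyo
    have hop : IsOpen (f '' (o ∩ ball 0 1)) :=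
      isOpen_image_of_injOn isOpen_ball hf hbij.injOn (ho.inter isOpen_ball) inter_subset_right
    refine mem_nhdsWithin_of_mem_nhds (mem_of_superset (hop.mem_nhds ⟨y, ⟨hyo, hy⟩, rfl⟩) ?_)
    rintro _ ⟨z, hz, rfl⟩
    rw [mem_preimage, hbij.injOn.leftInvOn_invFunOn hz.2]
    exact hz.1
  have hcpt : IsCompact (closure (f '' C)) :=
    isCompact_of_isClosed_isBounded isClosed_closure (hb.subset hcl)
  have hS : f '' C = closure (f '' C) := by
    refine subset_antisymm subset_closure fun x hx => ?_
    obtain ⟨y, hy, rfl⟩ := hbij.surjOn (hcl hx)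
    refine ⟨y, ⟨hy, ?_⟩, rfl⟩
    exact (isClosed_sphere.closure_subset_iff.2 inter_subset_right)
      (mem_of_mem_closure_image hf hbij.injOn hy hC hx)
  have hCc : IsCompact C := by
    have : C = h '' closure (f '' C) := by
      rw [← hS]
      exact ((hl.mono hC).image_image).symm
    rw [this]
    exact hcpt.image_of_continuousOn (hd.mono (by rw [hbij.image_eq]; exact hcl))
  have hpre := isPreconnected_sphere (E := ℂ) (by rw [Complex.rank_real_complex]; norm_num) ζ r
  have key := hpre (ball 0 1) Cᶜ isOpen_ball hCc.isClosed.isOpen_compl ?_ ?_ ?_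
  · obtain ⟨x, hx, hx1, hx2⟩ := key
    exact hx2 ⟨hx1, hx⟩
  · intro x hx
    by_cases hx1 : x ∈ ball (0 : ℂ) 1
    · exact Or.inl hx1
    · exact Or.inr fun h => hx1 h.1
  · refine ⟨(1 - r : ℝ) * ζ, ?_, ?_⟩
    · rw [mem_sphere_iff_norm, show ((1 - r : ℝ) : ℂ) * ζ - ζ = ((-r : ℝ) : ℂ) * ζ by push_cast; ring,
        norm_mul, hζ, Complex.norm_real]
      simp [abs_of_pos hr.1]
    · rw [mem_ball_zero_iff, norm_mul, hζ, Complex.norm_real, Real.norm_eq_abs,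
        abs_of_pos (by linarith [hr.2])]
      linarith [hr.1]
  · refine ⟨(1 + r : ℝ) * ζ, ?_, ?_⟩
    · rw [mem_sphere_iff_norm, show ((1 + r : ℝ) : ℂ) * ζ - ζ = ((r : ℝ) : ℂ) * ζ by push_cast; ring,
        norm_mul, hζ, Complex.norm_real]
      simp [abs_of_pos hr.1]
    · intro h
      have := h.1
      rw [mem_ball_zero_iff, norm_mul, hζ, Complex.norm_real, Real.norm_eq_abs,
        abs_of_pos (by linarith [hr.1])] at this
      linarith [hr.1]

theorem exists_radius_image_small (hf : DifferentiableOn ℂ f (ball 0 1))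
    (hbij : BijOn f (ball 0 1) Ω) (hΩ : IsOpen Ω) (hΩc : IsPreconnected Ω)
    (hb : Bornology.IsBounded Ω) (hj : ContinuousOn j (sphere 0 1)) (hjinj : InjOn j (sphere 0 1))
    (hfr : frontier Ω = j '' sphere 0 1) {ζ : ℂ} (hζ : ‖ζ‖ = 1) {ε : ℝ} (hε : 0 < ε) :
    ∃ r > 0, ∃ x, ∀ z ∈ ball (0 : ℂ) 1 ∩ ball ζ r, dist (f z) x ≤ ε := by
  have h00 : (0 : ℂ) ∈ ball (0 : ℂ) 1 := by simp
  have hdisj : Disjoint Ω (j '' sphere 0 1) := by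
    rw [← hfr]; exact disjoint_left.2 fun x hx hx' => hx'.2 (by rwa [hΩ.interior_eq])
  have hcJ : IsCompact (j '' sphere 0 1) := (isCompact_sphere 0 1).image_of_continuousOn hj
  have hw0 : f 0 ∈ Ω := hbij.mapsTo h00
  obtain ⟨d, hd, hdb⟩ := Metric.isOpen_iff.1 hΩ _ hw0
  set ε₁ := min ε d / 4
  have hε₁ : 0 < ε₁ := by have := lt_min hε hd; positivity
  obtain ⟨δ, hδ, Hδ⟩ := exists_small_subarc hj hjinj hε₁
  obtain ⟨r, hr, Hr⟩ := exists_radius_dist_image_le hf hbij.injOn (hbij.image_eq.symm ▸ hb) hζ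
    (η := min δ ε₁ / 2) (by have := lt_min hδ hε₁; positivity) one_pos
  set C := ball (0 : ℂ) 1 ∩ sphere ζ r
  have hη : min δ ε₁ / 2 < δ := by have := min_le_left δ ε₁; linarith
  have hη' : min δ ε₁ / 2 ≤ ε₁ := by have := min_le_right δ ε₁; linarith
  obtain ⟨x, hxJ, hxS⟩ := exists_mem_jordan_inter_closure_crosscut hf hbij hb hfr.subset hζ hr
  have hdiam : ∀ y ∈ closure (f '' C), dist y x ≤ min δ ε₁ / 2 := by
    have h1 : ∀ s ∈ f '' C, ∀ y ∈ closure (f '' C), dist y s ≤ min δ ε₁ / 2 := by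
      rintro _ ⟨z, hz, rfl⟩
      have : closure (f '' C) ⊆ closedBall (f z) (min δ ε₁ / 2) := by
        refine closure_minimal ?_ isClosed_closedBall
        rintro _ ⟨w, hw, rfl⟩
        exact Hr w hw z hz
      exact fun y hy => this hy
    intro y hy
    have : closure (f '' C) ⊆ closedBall y (min δ ε₁ / 2) := by
      refine closure_minimal (fun s hs => ?_) isClosed_closedBall
      rw [mem_closedBall, dist_comm]
      exact h1 s hs y hy
    have := this hxS
    rwa [mem_closedBall, dist_comm] at this
  obtain ⟨A, hAJ, hAc, hAp, hAb, hAδ⟩ := Hδ x hxJ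
  refine ⟨r, hr.1, x, fun z hz => ?_⟩
  by_contra hcon
  push Not at hcon
  have hεε : 2 * ε₁ < ε := by
    have := min_le_left ε d
    have : ε₁ ≤ ε / 4 := by simp only [ε₁]; linarith
    linarith
  have hdε : 2 * ε₁ < d := by
    have := min_le_right ε d
    have : ε₁ ≤ d / 4 := by simp only [ε₁]; linarith
    linarith
  have hsub : j '' sphere 0 1 ∪ (closure (f '' C) ∪ A) = j '' sphere 0 1 ∪ closure (f '' C) := by
    rw [← union_assoc, union_eq_left.2 (hAJ.trans subset_union_left)]
  have hfront : frontier (f '' (ball 0 1 ∩ ball ζ r)) ⊆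
      j '' sphere 0 1 ∪ (closure (f '' C) ∪ A) := by
    rw [hsub]
    have hop : IsOpen (f '' (ball 0 1 ∩ ball ζ r)) := isOpen_image_of_injOn isOpen_ball hf
      hbij.injOn (isOpen_ball.inter isOpen_ball) inter_subset_left
    rw [hop.frontier_eq]
    rintro y ⟨hy1, hy2⟩
    by_cases hyΩ : y ∈ Ω
    · right
      obtain ⟨v, hv, rfl⟩ := hbij.surjOn hyΩ
      have hv1 := mem_of_mem_closure_image hf hbij.injOn hv inter_subset_left hy1
      have hv2 : v ∈ closedBall ζ r :=
        (isClosed_closedBall.closure_subset_iff.2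
          (inter_subset_right.trans ball_subset_closedBall)) hv1
      refine subset_closure ⟨v, ⟨hv, ?_⟩, rfl⟩
      refine le_antisymm hv2 (not_lt.1 fun h => hy2 ⟨v, ⟨hv, h⟩, rfl⟩)
    · left
      rw [← hfr, hΩ.frontier_eq]
      exact ⟨closure_mono (by rw [← hbij.image_eq]; exact image_mono inter_subset_left) hy1, hyΩ⟩
  have hBball : closure (f '' C) ∪ A ⊆ closedBall x (2 * ε₁) := by
    rintro y (hy | hy)
    · exact (hdiam y hy).trans (by linarith)
    · exact (mem_closedBall.1 (hAb hy)).trans (by linarith)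
  refine false_of_frontier_subset_union (A := j '' sphere 0 1) (B := closure (f '' C) ∪ A) (S := Ω)
    (S' := (closedBall x (2 * ε₁))ᶜ) (W := f '' (ball 0 1 ∩ ball ζ r)) (u := f z) (v := f 0)
    hcJ.isClosed (isClosed_closure.union hAc) ?_ hΩc hdisj (hbij.mapsTo hz.1) hw0
    (isPreconnected_compl_closedBall _ _) ?_ ?_ ?_
    (hb.subset (by rw [← hbij.image_eq]; exact image_mono inter_subset_left)) hfront
    ⟨z, hz, rfl⟩ ?_
  · have : j '' sphere 0 1 ∩ (closure (f '' C) ∪ A) = A := by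
      refine subset_antisymm ?_ fun y hy => ⟨hAJ hy, Or.inr hy⟩
      rintro y ⟨hy, h | h⟩
      · exact hAδ y hy ((hdiam y h).trans_lt hη)
      · exact h
    rwa [this]
  · exact disjoint_left.2 fun y hy hy' => hy (hBball hy')
  · simp only [mem_compl_iff, mem_closedBall, not_le]; linarith
  · simp only [mem_compl_iff, mem_closedBall, not_le]
    by_contra h
    push Not at h
    exact disjoint_left.1 hdisj (hdb (by rw [mem_ball, dist_comm]; linarith)) hxJ
  · rintro ⟨v, hv, hv'⟩
    rw [hbij.injOn hv.1 h00 hv'] at hv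
    have : dist (0 : ℂ) ζ < r := hv.2
    rw [dist_zero_left, hζ] at this
    linarith [hr.2]

theorem exists_continuousOn_closedBall (hf : DifferentiableOn ℂ f (ball 0 1))
    (hbij : BijOn f (ball 0 1) Ω) (hΩ : IsOpen Ω) (hΩc : IsPreconnected Ω)
    (hb : Bornology.IsBounded Ω) (hj : ContinuousOn j (sphere 0 1)) (hjinj : InjOn j (sphere 0 1))
    (hfr : frontier Ω = j '' sphere 0 1) :
    ∃ g : ℂ → ℂ, ContinuousOn g (closedBall 0 1) ∧ EqOn g f (ball 0 1) ∧
      g '' sphere 0 1 = j '' sphere 0 1 := by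
  have hcl : closure (ball (0 : ℂ) 1) = closedBall 0 1 := closure_ball 0 one_ne_zero
  have hlim : ∀ x ∈ closedBall (0 : ℂ) 1, ∃ y, Tendsto f (𝓝[ball 0 1] x) (𝓝 y) := by
    intro x hx
    by_cases hx1 : x ∈ ball (0 : ℂ) 1
    · exact ⟨f x, hf.continuousOn x hx1⟩
    have hxn : ‖x‖ = 1 := le_antisymm (by simpa using hx) (by simpa using hx1)
    have : (𝓝[ball 0 1] x).NeBot := mem_closure_iff_nhdsWithin_neBot.1 (hcl ▸ hx)
    rw [← cauchy_map_iff_exists_tendsto, Metric.cauchy_iff]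
    refine ⟨inferInstance, fun ε hε => ?_⟩
    obtain ⟨r, hr, y, hy⟩ := exists_radius_image_small hf hbij hΩ hΩc hb hj hjinj hfr hxn
      (ε := ε / 3) (by positivity)
    refine ⟨f '' (ball 0 1 ∩ ball x r), image_mem_map (inter_mem self_mem_nhdsWithin
      (mem_nhdsWithin_of_mem_nhds (ball_mem_nhds x hr))), ?_⟩
    rintro _ ⟨z, hz, rfl⟩ _ ⟨w, hw, rfl⟩
    have := dist_triangle_right (f z) (f w) y
    linarith [hy z hz, hy w hw]
  have hg : ContinuousOn (extendFrom (ball 0 1) f) (closedBall 0 1) :=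
    continuousOn_extendFrom hcl.symm.subset hlim
  have heq : EqOn (extendFrom (ball 0 1) f) f (ball 0 1) := fun x hx =>
    extendFrom_eq (subset_closure hx) (hf.continuousOn x hx)
  refine ⟨_, hg, heq, ?_⟩
  generalize extendFrom (ball 0 1) f = g at hg heq
  have him : g '' ball 0 1 = Ω := by rw [heq.image_eq, hbij.image_eq]
  have hsub : g '' sphere 0 1 ⊆ j '' sphere 0 1 := by
    rintro _ ⟨x, hx, rfl⟩
    have hx' : x ∈ closedBall (0 : ℂ) 1 := sphere_subset_closedBall hx
    rw [← hfr, hΩ.frontier_eq]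
    refine ⟨?_, fun h => ?_⟩
    · rw [← him]
      exact (hg.mono (hcl ▸ le_rfl)).image_closure ⟨x, hcl ▸ hx', rfl⟩
    · obtain ⟨y, hy, hxy⟩ := hbij.surjOn h
      have hne : ‖y‖ < 1 := by simpa using hy
      obtain ⟨s, hs1, hs2⟩ := exists_between hne
      have hE : ball (0 : ℂ) 1 \ closedBall 0 s ⊆ ball 0 1 := sdiff_subset
      have hxE : x ∈ closure (ball (0 : ℂ) 1 \ closedBall 0 s) := by
        rw [sdiff_eq, inter_comm]
        refine isClosed_closedBall.isOpen_compl.inter_closure ⟨?_, hcl ▸ hx'⟩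
        have : ‖x‖ = 1 := by simpa using hx
        simp [this, hs2]
      have h1 : f y ∈ closure (f '' (ball (0 : ℂ) 1 \ closedBall 0 s)) := by
        rw [hxy, ← (heq.mono hE).image_eq]
        exact (hg.mono ((closure_mono hE).trans hcl.subset)).image_closure ⟨x, hxE, rfl⟩
      have h2 := mem_of_mem_closure_image hf hbij.injOn hy hE h1
      have h3 : closure (ball (0 : ℂ) 1 \ closedBall 0 s) ⊆ (ball 0 s)ᶜ := by
        refine closure_minimal (fun z hz h => hz.2 (ball_subset_closedBall h))
          isOpen_ball.isClosed_compl
      exact h3 h2 (by simpa using hs1)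
  refine subset_antisymm hsub fun x hx => ?_
  have hcpt : IsClosed (g '' closedBall 0 1) :=
    ((isCompact_closedBall (0 : ℂ) 1).image_of_continuousOn hg).isClosed
  have h1 : closure Ω ⊆ g '' closedBall 0 1 := by
    rw [← him]; exact closure_minimal (image_mono ball_subset_closedBall) hcpt
  rw [← hfr, hΩ.frontier_eq] at hx
  obtain ⟨y, hy, rfl⟩ := h1 hx.1
  refine ⟨y, ?_, rfl⟩
  rw [mem_sphere_zero_iff_norm]
  refine le_antisymm (by simpa using hy) (not_lt.1 fun h => hx.2 ?_)
  rw [← him]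
  exact ⟨y, by simpa using h, rfl⟩

end Caratheodory

end

section

open Set Metric MeasureTheory Filter Topology
open scoped ENNReal unitInterval

/-- A holomorphic function that is constant on a boundary arc is constant. -/
theorem eq_of_eqOn_arc {g : ℂ → ℂ} (hg : ContinuousOn g (closedBall 0 1))
    (hd : DifferentiableOn ℂ g (ball 0 1)) {a b : ℝ} (hab : a < b) {w : ℂ}
    (h : ∀ θ ∈ Ioo a b, g (polarMap (1, θ)) = w) : g 0 = w := by
  obtain ⟨N, hN⟩ := exists_nat_gt (2 * Real.pi / (b - a))
  have hpi := Real.pi_pos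
  have hba : 0 < b - a := by linarith
  have hN0 : (0 : ℝ) < N := lt_trans (by positivity) hN
  have hNn : N ≠ 0 := by rintro rfl; simp at hN0
  set e : ℕ → ℂ := fun k => polarMap (1, k * (2 * Real.pi / N)) with he
  have hne : ∀ k, ‖e k‖ = 1 := fun k => norm_polarMap zero_le_one
  have hm1 : ∀ k, MapsTo (fun z => e k * z) (ball (0 : ℂ) 1) (ball 0 1) := fun k z hz => by
    rw [mem_ball_zero_iff] at hz ⊢; rwa [norm_mul, hne, one_mul]
  have hm2 : ∀ k, MapsTo (fun z => e k * z) (closedBall (0 : ℂ) 1) (closedBall 0 1) := fun k z hz => by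
    rw [mem_closedBall_zero_iff] at hz ⊢; rwa [norm_mul, hne, one_mul]
  set P : ℂ → ℂ := fun z => ∏ k ∈ Finset.range N, (g (e k * z) - w) with hP
  have hPd : DiffContOnCl ℂ P (ball 0 1) := by
    refine ⟨?_, ?_⟩
    · refine DifferentiableOn.fun_finsetProd fun k _ => ?_
      exact (hd.comp (by fun_prop) (hm1 k)).sub_const w
    · rw [closure_ball 0 one_ne_zero]
      refine continuousOn_finsetProd _ fun k _ => ?_
      exact (hg.comp (by fun_prop) (hm2 k)).sub continuousOn_const
  have hzero : ∀ z ∈ frontier (ball (0 : ℂ) 1), ‖P z‖ ≤ 0 := by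
    intro z hz
    rw [frontier_ball 0 one_ne_zero, mem_sphere_zero_iff_norm] at hz
    obtain ⟨θ, hθ, hzθ⟩ := exists_polarMap_eq z (a - 2 * Real.pi)
    rw [hz] at hzθ
    have hstep : 2 * Real.pi / N < b - a := by
      rw [div_lt_iff₀ hba] at hN
      rw [div_lt_iff₀ hN0]
      linarith
    set s := 2 * Real.pi / N with hs
    have hs0 : 0 < s := by positivity
    have hsN : N * s = 2 * Real.pi := by rw [hs]; field_simp
    have hex : ∃ k : ℕ, a < θ + k * s := ⟨N + 1, by push_cast; nlinarith [hθ.1]⟩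
    classical
    set k := Nat.find hex
    have hk : a < θ + k * s := Nat.find_spec hex
    have hk0 : k ≠ 0 := by
      intro h0
      rw [h0] at hk
      have := hθ.2
      simp only [Nat.cast_zero, zero_mul, add_zero] at hk
      linarith
    obtain ⟨m, hm⟩ := Nat.exists_eq_succ_of_ne_zero hk0
    have hm' : θ + m * s ≤ a := not_lt.1 (Nat.find_min hex (by omega : m < k))
    have hkb : θ + k * s < b := by
      rw [hm]; push_cast; linarith
    have hval : ∀ n : ℕ, e n * z = polarMap (1, θ + n * s) := by
      intro n
      rw [← hzθ]
      simp only [he, polarMap, Complex.ofReal_one, one_mul, ← Complex.exp_add]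
      congr 1
      push_cast
      ring
    have hper : polarMap (1, θ + (k % N : ℕ) * s) = polarMap (1, θ + k * s) := by
      simp only [polarMap]
      congr 1
      rw [Complex.exp_eq_exp_iff_exists_int]
      have h1 : (k : ℝ) = N * (k / N : ℕ) + (k % N : ℕ) := by exact_mod_cast (Nat.div_add_mod k N).symm
      generalize k / N = q at h1
      refine ⟨-(q : ℤ), ?_⟩
      have h2 : θ + (k % N : ℕ) * s = θ + k * s - q * (2 * Real.pi) := by
        rw [h1, ← hsN]; ring
      rw [h2]
      push_cast
      ring
    rw [hP]
    simp only
    rw [Finset.prod_eq_zero (Finset.mem_range.2 (Nat.mod_lt k (Nat.pos_of_ne_zero hNn))), norm_zero]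
    rw [hval, hper, h _ ⟨hk, hkb⟩, sub_self]
  have := Complex.norm_le_of_forall_mem_frontier_norm_le isBounded_ball hPd hzero
    (subset_closure (mem_ball_self one_pos))
  rw [norm_le_zero_iff] at this
  simp only [hP, mul_zero, Finset.prod_const, Finset.card_range] at this
  exact sub_eq_zero.1 (pow_eq_zero_iff hNn |>.1 this)

theorem two_sectors {α : ℝ} {z : ℂ}
    (h1 : z ∈ polarMap '' (Icc 0 1 ×ˢ Icc 0 α))
    (h2 : z ∈ polarMap '' (Icc 0 1 ×ˢ Icc α (2 * Real.pi))) :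
    ∃ ρ ∈ Icc (0 : ℝ) 1, z = polarMap (ρ, 0) ∨ z = polarMap (ρ, α) := by
  obtain ⟨⟨ρ, θ⟩, ⟨hρ, hθ⟩, rfl⟩ := h1
  obtain ⟨⟨ρ', θ'⟩, ⟨hρ', hθ'⟩, h⟩ := h2
  simp only at hρ hθ hρ' hθ'
  refine ⟨ρ, hρ, ?_⟩
  rcases hρ.1.eq_or_lt with h0 | h0
  · left; simp [← h0, polarMap]
  obtain ⟨-, n, hn⟩ := polarMap_eq_polarMap h0 hρ'.1 h.symm
  have hpi := Real.pi_pos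
  have h3 : (n : ℝ) < 1 := by nlinarith [hθ.2, hθ'.1]
  have h4 : -2 < (n : ℝ) := by nlinarith [hθ.1, hθ'.2]
  have h5 : n < 1 := by exact_mod_cast h3
  have h6 : -2 < n := by exact_mod_cast h4
  rcases (by omega : n = 0 ∨ n = -1) with rfl | rfl
  · right
    simp only [Int.cast_zero, zero_mul, add_zero] at hn
    rw [show θ = α by linarith [hθ.2, hθ'.1]]
  · left
    push_cast at hn
    rw [show θ = 0 by linarith [hθ.1, hθ'.2]]

section Caratheodory

variable {g : ℂ → ℂ} {j : ℂ → ℂ} {Ω : Set ℂ}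

theorem caratheodory_injective_aux (hd : DifferentiableOn ℂ g (ball 0 1))
    (hg : ContinuousOn g (closedBall 0 1))
    (hbij : BijOn g (ball 0 1) Ω) (hΩ : IsOpen Ω) (hΩc : IsPreconnected Ω)
    (hb : Bornology.IsBounded Ω) (hj : ContinuousOn j (sphere 0 1)) (hjinj : InjOn j (sphere 0 1))
    (hfr : frontier Ω = j '' sphere 0 1) (hgs : g '' sphere 0 1 = j '' sphere 0 1)
    {α : ℝ} (hα : α ∈ Ioo 0 (2 * Real.pi)) (h : g (polarMap (1, 0)) = g (polarMap (1, α))) :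
    False := by
  have hpi := Real.pi_pos
  set J := j '' sphere 0 1
  set w := g (polarMap (1, 0)) with hw
  have hsph : ∀ θ, polarMap (1, θ) ∈ sphere (0 : ℂ) 1 := fun θ => by
    simp [norm_polarMap zero_le_one]
  have hgJ : ∀ θ, g (polarMap (1, θ)) ∈ J := fun θ => hgs ▸ ⟨_, hsph θ, rfl⟩
  have hwJ : w ∈ J := hgJ 0
  have hdisj : Disjoint Ω J := by
    rw [← hfr]; exact disjoint_left.2 fun x hx hx' => hx'.2 (by rwa [hΩ.interior_eq])
  have hcJ : IsCompact J := (isCompact_sphere 0 1).image_of_continuousOn hj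
  have h0Ω : g 0 ∈ Ω := hbij.mapsTo (mem_ball_self one_pos)
  have hx : ∀ a b : ℝ, a < b → ∃ θ ∈ Ioo a b, g (polarMap (1, θ)) ≠ w := by
    intro a b hab
    by_contra! hc
    exact disjoint_left.1 hdisj h0Ω (eq_of_eqOn_arc hg hd hab hc ▸ hwJ)
  obtain ⟨θ₁, hθ₁, hx₁⟩ := hx 0 α hα.1
  obtain ⟨θ₂, hθ₂, hx₂⟩ := hx α (2 * Real.pi) hα.2
  set V₁ := polarMap '' (Ioo 0 1 ×ˢ Ioo 0 α) with hV₁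
  set V₂ := polarMap '' (Ioo 0 1 ×ˢ Ioo α (2 * Real.pi)) with hV₂
  set C₁ := polarMap '' (Icc 0 1 ×ˢ Icc 0 α) with hC₁
  set C₂ := polarMap '' (Icc 0 1 ×ˢ Icc α (2 * Real.pi)) with hC₂
  have hcC : ∀ a b, IsCompact (polarMap '' (Icc 0 1 ×ˢ Icc a b)) := fun a b =>
    (isCompact_Icc.prod isCompact_Icc).image continuous_polarMap
  have hV₁' : V₁ = ball 0 1 \ C₂ := by
    have := sector_eq hα.1 (by linarith [hα.2])
    rwa [zero_add] at this
  have hC₁e : polarMap '' (Icc 0 1 ×ˢ Icc (2 * Real.pi) (α + 2 * Real.pi)) = C₁ := by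
    have hper : ∀ ρ θ : ℝ, polarMap (ρ, θ + 2 * Real.pi) = polarMap (ρ, θ) := fun ρ θ => by
      simp only [polarMap]
      congr 1
      rw [Complex.exp_eq_exp_iff_exists_int]
      exact ⟨1, by push_cast; ring⟩
    ext z
    constructor
    · rintro ⟨⟨ρ, θ⟩, ⟨h1, h2⟩, rfl⟩
      refine ⟨(ρ, θ - 2 * Real.pi), ⟨h1, by linarith [h2.1], by linarith [h2.2]⟩, ?_⟩
      rw [← hper, sub_add_cancel]
    · rintro ⟨⟨ρ, θ⟩, ⟨h1, h2⟩, rfl⟩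
      exact ⟨(ρ, θ + 2 * Real.pi), ⟨h1, by linarith [h2.1], by linarith [h2.2]⟩, hper ρ θ⟩
  have hV₂' : V₂ = ball 0 1 \ C₁ := by
    have := sector_eq hα.2 (by linarith [hα.1])
    rwa [hC₁e] at this
  have hV₁b : V₁ ⊆ ball 0 1 := hV₁' ▸ sdiff_subset
  have hV₂b : V₂ ⊆ ball 0 1 := hV₂' ▸ sdiff_subset
  have hopen : ∀ V : Set ℂ, IsOpen V → V ⊆ ball 0 1 → IsOpen (g '' V) := fun V hV hVb =>
    isOpen_image_of_injOn isOpen_ball hd hbij.injOn hV hVb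
  have hV₁o : IsOpen V₁ := hV₁' ▸ isOpen_ball.sdiff (hcC _ _).isClosed
  have hC₁b : C₁ ⊆ closedBall 0 1 := by
    rintro _ ⟨⟨ρ, θ⟩, ⟨h1, -⟩, rfl⟩
    simpa [norm_polarMap h1.1] using h1.2
  set R := polarMap '' (Icc 0 1 ×ˢ {0, α}) with hR
  have hRc : IsCompact R := (isCompact_Icc.prod (by simp)).image continuous_polarMap
  have hRb : R ⊆ closedBall 0 1 := by
    rintro _ ⟨⟨ρ, θ⟩, ⟨h1, -⟩, rfl⟩
    simpa [norm_polarMap h1.1] using h1.2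
  have hRball : ∀ z ∈ R, z ∈ ball (0 : ℂ) 1 ∨ g z = w := by
    rintro _ ⟨⟨ρ, θ⟩, ⟨h1, h2⟩, rfl⟩
    simp only at h1 h2
    rcases h1.2.eq_or_lt with h3 | h3
    · right
      rw [h3]
      rcases h2 with rfl | h2
      · rfl
      · rw [mem_singleton_iff.1 h2, h]
    · left; simpa [norm_polarMap h1.1] using h3
  have hRV₁ : ∀ z ∈ R, z ∉ V₁ := by
    rintro _ ⟨⟨ρ, θ⟩, ⟨h1, h2⟩, rfl⟩ hV
    rw [hV₁'] at hV
    simp only at h1 h2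
    rcases h2 with rfl | h2
    · refine hV.2 ⟨(ρ, 2 * Real.pi), ⟨h1, hα.2.le, le_rfl⟩, ?_⟩
      simp [polarMap]
    · exact hV.2 ⟨(ρ, θ), ⟨h1, by rw [mem_singleton_iff.1 h2]; exact ⟨le_rfl, hα.2.le⟩⟩, rfl⟩
  have hRV₂ : ∀ z ∈ R, z ∉ V₂ := by
    rintro _ ⟨⟨ρ, θ⟩, ⟨h1, h2⟩, rfl⟩ hV
    rw [hV₂'] at hV
    simp only at h1 h2
    refine hV.2 ⟨(ρ, θ), ⟨h1, ?_⟩, rfl⟩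
    rcases h2 with rfl | h2
    · exact ⟨le_rfl, hα.1.le⟩
    · rw [mem_singleton_iff.1 h2]; exact ⟨hα.1.le, le_rfl⟩
  have hLJ : ∀ x ∈ g '' R, x ∈ J → x = w := by
    rintro _ ⟨z, hz, rfl⟩ hzJ
    rcases hRball z hz with h1 | h1
    · exact absurd hzJ (disjoint_left.1 hdisj (hbij.mapsTo h1))
    · exact h1
  have hgdisj : ∀ V ⊆ ball (0 : ℂ) 1, (∀ z ∈ R, z ∉ V) → Disjoint (g '' V) (g '' R) := by
    intro V hVb hV
    rw [disjoint_left]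
    rintro _ ⟨v, hv, rfl⟩ ⟨z, hz, hzv⟩
    rcases hRball z hz with h1 | h1
    · exact hV z hz (hbij.injOn h1 (hVb hv) hzv ▸ hv)
    · exact disjoint_left.1 hdisj (hbij.mapsTo (hVb hv)) (by rw [← hzv, h1]; exact hwJ)
  have hpre : ∀ a b, polarMap '' (Ioo 0 1 ×ˢ Ioo a b) ⊆ ball 0 1 → ∀ θ ∈ Ioo a b,
      IsPreconnected (insert (g (polarMap (1, θ))) (g '' (polarMap '' (Ioo 0 1 ×ˢ Ioo a b)))) := by
    intro a b hVb θ hθ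
    have hp : IsPreconnected (g '' (polarMap '' (Ioo 0 1 ×ˢ Ioo a b))) := by
      refine IsPreconnected.image ?_ g (hg.mono (hVb.trans ball_subset_closedBall))
      exact (isPreconnected_Ioo.prod isPreconnected_Ioo).image _ continuous_polarMap.continuousOn
    refine hp.subset_closure (subset_insert _ _) (insert_subset ?_ subset_closure)
    have hcl : closure (polarMap '' (Ioo 0 1 ×ˢ Ioo a b)) ⊆ closedBall 0 1 :=
      closure_minimal (hVb.trans ball_subset_closedBall) isClosed_closedBall
    refine (hg.mono hcl).image_closure ⟨polarMap (1, θ), ?_, rfl⟩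
    refine image_closure_subset_closure_image continuous_polarMap ⟨(1, θ), ?_, rfl⟩
    rw [closure_prod_eq]
    exact ⟨by rw [closure_Ioo zero_ne_one]; simp, subset_closure hθ⟩
  have hhalf : ∀ a b θ, θ ∈ Ioo a b → polarMap (1 / 2, θ) ∈ polarMap '' (Ioo 0 1 ×ˢ Ioo a b) :=
    fun a b θ hθ => ⟨(1 / 2, θ), ⟨by norm_num, hθ⟩, rfl⟩
  set u := g (polarMap (1 / 2, θ₁))
  set v := g (polarMap (1 / 2, θ₂))
  have huV : u ∈ g '' V₁ := ⟨_, hhalf _ _ _ hθ₁, rfl⟩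
  have hvV : v ∈ g '' V₂ := ⟨_, hhalf _ _ _ hθ₂, rfl⟩
  refine false_of_frontier_subset_union (A := g '' R) (B := J) (W := g '' V₁) (u := u) (v := v)
    (S := insert (g (polarMap (1, θ₁))) (g '' V₁) ∪ (J \ {w}) ∪ insert (g (polarMap (1, θ₂))) (g '' V₂))
    (S' := Ω) (hRc.image_of_continuousOn (hg.mono hRb)).isClosed hcJ.isClosed ?_ ?_ ?_
    (Or.inl (Or.inl (Or.inr huV))) (Or.inr (Or.inr hvV)) hΩc hdisj
    (hbij.mapsTo (hV₁b (hhalf _ _ _ hθ₁))) (hbij.mapsTo (hV₂b (hhalf _ _ _ hθ₂)))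
    (hb.subset (by rw [← hbij.image_eq]; exact image_mono hV₁b)) ?_ huV ?_
  · have : g '' R ∩ J = {w} := by
      refine subset_antisymm (fun x hx => hLJ x hx.1 hx.2) ?_
      rintro _ rfl
      exact ⟨⟨_, ⟨(1, 0), ⟨by simp, by simp⟩, rfl⟩, rfl⟩, hwJ⟩
    rw [this]; exact isPreconnected_singleton
  · refine IsPreconnected.union (g (polarMap (1, θ₂))) (Or.inr ⟨hgJ _, hx₂⟩) (mem_insert _ _)
      (IsPreconnected.union (g (polarMap (1, θ₁))) (mem_insert _ _) ⟨hgJ _, hx₁⟩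
        (hpre 0 α hV₁b θ₁ hθ₁) (isPreconnected_jordan_diff_singleton hj hjinj w hwJ))
      (hpre α _ hV₂b θ₂ hθ₂)
  · have hJ' : Disjoint (J \ {w}) (g '' R) :=
      disjoint_left.2 fun x hx hx' => hx.2 (hLJ x hx' hx.1)
    have h1 : ∀ θ, g (polarMap (1, θ)) ≠ w → g (polarMap (1, θ)) ∉ g '' R :=
      fun θ hθ hx' => hθ (hLJ _ hx' (hgJ θ))
    rw [disjoint_union_left, disjoint_union_left, disjoint_insert_left, disjoint_insert_left]
    exact ⟨⟨⟨h1 _ hx₁, hgdisj V₁ hV₁b hRV₁⟩, hJ'⟩, h1 _ hx₂, hgdisj V₂ hV₂b hRV₂⟩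
  · rw [(hopen V₁ hV₁o hV₁b).frontier_eq]
    rintro x ⟨hx1, hx2⟩
    have hVC : V₁ ⊆ C₁ := image_mono (Set.prod_mono Ioo_subset_Icc_self Ioo_subset_Icc_self)
    have hcl : closure (g '' V₁) ⊆ g '' C₁ := closure_minimal (image_mono hVC)
      ((hcC _ _).image_of_continuousOn (hg.mono hC₁b)).isClosed
    obtain ⟨z, hz, rfl⟩ := hcl hx1
    by_cases hzb : z ∈ ball (0 : ℂ) 1
    · left
      have hzC₂ : z ∈ C₂ := by
        by_contra hzC
        exact hx2 ⟨z, by rw [hV₁']; exact ⟨hzb, hzC⟩, rfl⟩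
      obtain ⟨ρ, hρ, h3 | h3⟩ := two_sectors hz hzC₂
      · exact ⟨z, ⟨(ρ, 0), ⟨hρ, by simp⟩, h3.symm⟩, rfl⟩
      · exact ⟨z, ⟨(ρ, α), ⟨hρ, by simp⟩, h3.symm⟩, rfl⟩
    · right
      rw [← hgs]
      refine ⟨z, ?_, rfl⟩
      rw [mem_sphere_zero_iff_norm]
      exact le_antisymm (by simpa using hC₁b hz) (by simpa using hzb)
  · rintro ⟨z, hz, hzv⟩
    have h3 := hbij.injOn (hV₁b hz) (hV₂b (hhalf _ _ _ hθ₂)) hzv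
    have h4 : polarMap (1 / 2, θ₂) ∈ V₂ := hhalf _ _ _ hθ₂
    rw [hV₂'] at h4
    exact h4.2 (h3 ▸ image_mono (Set.prod_mono Ioo_subset_Icc_self Ioo_subset_Icc_self) hz)

theorem caratheodory_injOn (hd : DifferentiableOn ℂ g (ball 0 1))
    (hg : ContinuousOn g (closedBall 0 1))
    (hbij : BijOn g (ball 0 1) Ω) (hΩ : IsOpen Ω) (hΩc : IsPreconnected Ω)
    (hb : Bornology.IsBounded Ω) (hj : ContinuousOn j (sphere 0 1)) (hjinj : InjOn j (sphere 0 1))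
    (hfr : frontier Ω = j '' sphere 0 1) (hgs : g '' sphere 0 1 = j '' sphere 0 1) :
    InjOn g (closedBall 0 1) := by
  have hdisj : Disjoint Ω (j '' sphere 0 1) := by
    rw [← hfr]; exact disjoint_left.2 fun x hx hx' => hx'.2 (by rwa [hΩ.interior_eq])
  have hmix : ∀ x ∈ ball (0 : ℂ) 1, ∀ y ∈ sphere (0 : ℂ) 1, g x ≠ g y := fun x hx y hy h =>
    disjoint_left.1 hdisj (hbij.mapsTo hx) (by rw [h, ← hgs]; exact ⟨y, hy, rfl⟩)
  intro x hx y hy hxy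
  rw [← ball_union_sphere] at hx hy
  rcases hx with hx | hx <;> rcases hy with hy | hy
  · exact hbij.injOn hx hy hxy
  · exact absurd hxy (hmix x hx y hy)
  · exact absurd hxy.symm (hmix y hy x hx)
  by_contra hne
  have hnx : ‖x‖ = 1 := by simpa using hx
  have hny : ‖y‖ = 1 := by simpa using hy
  have hx0 : x ≠ 0 := by rintro rfl; simp at hnx
  obtain ⟨α, hα, hyα⟩ := exists_polarMap_eq (y / x) 0
  rw [norm_div, hnx, hny, div_one] at hyα
  rw [zero_add] at hα
  have hα0 : α ≠ 0 := by
    rintro rfl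
    have : y / x = 1 := by rw [← hyα]; simp [polarMap]
    exact hne ((div_eq_one_iff_eq hx0).1 this).symm
  have hm1 : BijOn (fun z => x * z) (ball (0 : ℂ) 1) (ball 0 1) := by
    refine ⟨fun z hz => ?_, fun z _ z' _ h => mul_left_cancel₀ hx0 h, fun z hz => ⟨z / x, ?_, ?_⟩⟩
    · rw [mem_ball_zero_iff] at hz ⊢; rwa [norm_mul, hnx, one_mul]
    · rw [mem_ball_zero_iff] at hz ⊢; rwa [norm_div, hnx, div_one]
    · simp only; field_simp
  have hm2 : MapsTo (fun z => x * z) (closedBall (0 : ℂ) 1) (closedBall 0 1) := fun z hz => by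
    rw [mem_closedBall_zero_iff] at hz ⊢; rwa [norm_mul, hnx, one_mul]
  have hm3 : (fun z => x * z) '' sphere (0 : ℂ) 1 = sphere 0 1 := by
    ext z
    constructor
    · rintro ⟨v, hv, rfl⟩
      rw [mem_sphere_zero_iff_norm] at hv ⊢; rw [norm_mul, hnx, one_mul, hv]
    · intro hz
      refine ⟨z / x, ?_, by simp only; field_simp⟩
      rw [mem_sphere_zero_iff_norm] at hz ⊢; rw [norm_div, hnx, div_one, hz]
  refine caratheodory_injective_aux (g := fun z => g (x * z)) (j := j) (Ω := Ω)
    (hd.comp (by fun_prop) hm1.mapsTo) (hg.comp (by fun_prop) hm2) (hbij.comp hm1) hΩ hΩc hb hj hjinj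
    hfr ?_ (α := α) ⟨lt_of_le_of_ne hα.1 hα0.symm, hα.2⟩ ?_
  · rw [← hgs]
    conv_rhs => rw [← hm3, image_image]
  · have h1 : x * (y / x) = y := by field_simp
    simp only [hyα, h1]
    simp [polarMap, hxy]

/-- **Carathéodory's theorem**: a bounded simply connected domain whose frontier is a Jordan curve
is the interior of a closed disc. -/
theorem exists_closedBall_parametrization (hΩ : IsOpen Ω) (hΩc : IsConnected Ω)
    (hb : Bornology.IsBounded Ω) (hcompl : IsPreconnected Ωᶜ) (hj : ContinuousOn j (sphere 0 1))
    (hjinj : InjOn j (sphere 0 1)) (hfr : frontier Ω = j '' sphere 0 1) :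
    ∃ g : ℂ → ℂ, ContinuousOn g (closedBall 0 1) ∧ InjOn g (closedBall 0 1) ∧
      g '' ball 0 1 = Ω ∧ g '' sphere 0 1 = j '' sphere 0 1 := by
  obtain ⟨f, hf, hbij⟩ := exists_riemann_map hΩ hΩc hb hcompl
  obtain ⟨g, hg, heq, hgs⟩ := exists_continuousOn_closedBall hf hbij hΩ hΩc.isPreconnected hb hj
    hjinj hfr
  have hbij' : BijOn g (ball 0 1) Ω := hbij.congr heq.symm
  exact ⟨g, hg, caratheodory_injOn (hf.congr heq) hg hbij' hΩ hΩc.isPreconnected hb hj hjinj hfr hgs,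
    hbij'.image_eq, hgs⟩

end Caratheodory

end

section

open Set Metric MeasureTheory Filter Topology
open scoped ENNReal unitInterval

theorem unitSquare_eq : unitSquare = Icc 0 1 ×ℂ Icc 0 1 := rfl

theorem isCompact_unitSquare : IsCompact unitSquare :=
  isCompact_Icc.reProdIm isCompact_Icc

theorem isClosed_unitSquare : IsClosed unitSquare := isCompact_unitSquare.isClosed

theorem convex_unitSquare : Convex ℝ unitSquare := by
  exact ((convex_Icc (0 : ℝ) 1).linear_preimage Complex.reLm).inter
    ((convex_Icc (0 : ℝ) 1).linear_preimage Complex.imLm)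

theorem interior_unitSquare : interior unitSquare = Ioo 0 1 ×ℂ Ioo 0 1 := by
  rw [unitSquare_eq, Complex.interior_reProdIm, interior_Icc]

theorem nonempty_interior_unitSquare : (interior unitSquare).Nonempty := by
  rw [interior_unitSquare]
  refine ⟨⟨1 / 2, 1 / 2⟩, ?_⟩
  constructor <;> norm_num

theorem closure_interior_unitSquare : closure (interior unitSquare) = unitSquare := by
  rw [convex_unitSquare.closure_interior_eq_closure_of_nonempty_interior
    nonempty_interior_unitSquare, isClosed_unitSquare.closure_eq]

theorem mem_frontier_unitSquare {z : ℂ} (hz : z ∈ unitSquare) :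
    z ∈ frontier unitSquare ↔ z.re = 0 ∨ z.re = 1 ∨ z.im = 0 ∨ z.im = 1 := by
  rw [isClosed_unitSquare.frontier_eq, interior_unitSquare]
  obtain ⟨⟨h1, h2⟩, h3, h4⟩ := hz
  constructor
  · rintro ⟨-, h⟩
    by_contra! hc
    exact h ⟨⟨lt_of_le_of_ne h1 (Ne.symm hc.1), lt_of_le_of_ne h2 hc.2.1⟩,
      lt_of_le_of_ne h3 (Ne.symm hc.2.2.1), lt_of_le_of_ne h4 hc.2.2.2⟩
  · intro h
    refine ⟨⟨⟨h1, h2⟩, h3, h4⟩, ?_⟩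
    rintro ⟨⟨h5, h6⟩, h7, h8⟩
    rcases h with h | h | h | h <;> linarith

/-- The complement of a set with connected frontier is connected. -/
theorem isPreconnected_compl_of_frontier {Ω : Set ℂ} (hΩ : IsOpen Ω) (hne : Ω.Nonempty)
    (hfr : IsPreconnected (frontier Ω)) : IsPreconnected Ωᶜ := by
  have hfrc : frontier Ω ⊆ Ωᶜ := by rw [hΩ.frontier_eq]; exact fun x hx => hx.2
  obtain ⟨w, hw⟩ := hne
  have key : ∀ y ∈ Ωᶜ, ∃ t ⊆ Ωᶜ, IsPreconnected t ∧ y ∈ t ∧ (t ∩ frontier Ω).Nonempty := by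
    intro y hy
    set γ : ℝ → ℂ := fun s => AffineMap.lineMap y w s with hγ
    have hγc : Continuous γ := AffineMap.lineMap_continuous
    have hcpt : IsCompact (Icc (0 : ℝ) 1 ∩ γ ⁻¹' closure Ω) :=
      isCompact_Icc.inter_right (isClosed_closure.preimage hγc)
    obtain ⟨s, ⟨hs, hsΩ⟩, hmin⟩ := hcpt.exists_isLeast
      ⟨1, ⟨by norm_num, le_rfl⟩, subset_closure (by simpa [hγ] using hw)⟩
    have hnot : ∀ t ∈ Icc 0 s, γ t ∈ Ωᶜ := by
      intro t ht htΩ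
      rcases ht.2.eq_or_lt with rfl | hlt
      · rcases ht.1.eq_or_lt with h0 | h0
        · apply hy; rw [← h0] at htΩ; simpa [hγ] using htΩ
        · have : ∀ᶠ t' in 𝓝[<] t, γ t' ∈ Ω ∧ 0 < t' := by
            refine nhdsWithin_le_nhds ?_
            exact (hγc.continuousAt.eventually (hΩ.mem_nhds htΩ)).and (lt_mem_nhds h0)
          obtain ⟨t', ⟨h1, h2⟩, h3⟩ := (this.and self_mem_nhdsWithin).exists
          have h3' : t' < t := h3
          have := hmin ⟨⟨h2.le, h3'.le.trans hs.2⟩, subset_closure h1⟩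
          linarith
      · have := hmin ⟨⟨ht.1, ht.2.trans hs.2⟩, subset_closure htΩ⟩
        linarith
    refine ⟨γ '' Icc 0 s, ?_, isPreconnected_Icc.image _ hγc.continuousOn,
      ⟨0, ⟨le_rfl, hs.1⟩, by simp [hγ]⟩, γ s, ⟨s, ⟨hs.1, le_rfl⟩, rfl⟩, ?_⟩
    · rintro _ ⟨t, ht, rfl⟩; exact hnot t ht
    · rw [hΩ.frontier_eq]; exact ⟨hsΩ, hnot s ⟨hs.1, le_rfl⟩⟩
  rcases (frontier Ω).eq_empty_or_nonempty with he | ⟨x₀, hx₀⟩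
  · have : Ωᶜ = ∅ := by
      by_contra hc
      obtain ⟨y, hy⟩ := nonempty_iff_ne_empty.2 hc
      obtain ⟨t, -, -, -, x, -, hx⟩ := key y hy
      rw [he] at hx; exact hx
    rw [this]; exact isPreconnected_empty
  · refine isPreconnected_of_forall x₀ fun y hy => ?_
    obtain ⟨t, ht, htp, hyt, x, hxt, hx⟩ := key y hy
    exact ⟨t ∪ frontier Ω, union_subset ht hfrc, Or.inr hx₀, Or.inl hyt,
      htp.union x hxt hx hfr⟩

/-- A bounded nonempty set disjoint from a Jordan curve that contains its frontier has the whole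
curve as frontier. -/
theorem frontier_eq_jordan {j : ℂ → ℂ} (hj : ContinuousOn j (sphere 0 1))
    (hjinj : InjOn j (sphere 0 1)) {W : Set ℂ} (hb : Bornology.IsBounded W) (hne : W.Nonempty)
    (hd : Disjoint W (j '' sphere 0 1)) (hf : frontier W ⊆ j '' sphere 0 1) :
    frontier W = j '' sphere 0 1 := by
  refine subset_antisymm hf ?_
  by_contra hcon
  rw [not_subset] at hcon
  obtain ⟨_, ⟨a, ha, rfl⟩, hx⟩ := hcon
  have hpi := Real.pi_pos
  have hpc : Continuous fun t : ℝ => polarMap (1, t) := continuous_polarMap.comp (by fun_prop)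
  have hcont : Continuous fun t : ℝ => j (a * polarMap (1, t)) :=
    hj.comp_continuous (continuous_const.mul hpc) fun t => mul_polarMap_one_mem_sphere ha t
  have hna : ‖a‖ = 1 := by simpa using ha
  have ha0 : a ≠ 0 := by rintro rfl; simp at hna
  have hx0 : ∀ᶠ t in 𝓝 (0 : ℝ), j (a * polarMap (1, t)) ∉ frontier W := by
    refine hcont.continuousAt.eventually (isClosed_frontier.isOpen_compl.mem_nhds ?_)
    simpa [polarMap] using hx
  obtain ⟨δ, hδ, hδ'⟩ := Metric.eventually_nhds_iff.1 hx0
  set s := min (δ / 2) 1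
  have hs0 : 0 < s := by positivity
  have hsδ : s < δ := (min_le_left _ _).trans_lt (by linarith)
  refine not_frontier_subset_arc hb hne (a := s) (b := 2 * Real.pi - s)
    (c := fun t : ℝ => j (a * polarMap (1, t))) hcont.continuousOn ?_ ?_ ?_
  · intro t ht t' ht' h
    have h1 := hjinj (mul_polarMap_one_mem_sphere ha t) (mul_polarMap_one_mem_sphere ha t') h
    obtain ⟨-, n, hn⟩ := polarMap_eq_polarMap one_pos zero_le_one (mul_left_cancel₀ ha0 h1)
    have h2 : -1 < (n : ℝ) := by nlinarith [ht.1, ht'.2]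
    have h3 : (n : ℝ) < 1 := by nlinarith [ht.2, ht'.1]
    have h4 : -1 < n := by exact_mod_cast h2
    have h5 : n < 1 := by exact_mod_cast h3
    obtain rfl : n = 0 := by omega
    simpa using hn
  · refine hd.mono_right ?_
    rintro _ ⟨t, -, rfl⟩
    exact ⟨_, mul_polarMap_one_mem_sphere ha t, rfl⟩
  · intro y hy
    obtain ⟨b, hb', rfl⟩ := hf hy
    have hnb : ‖b‖ = 1 := by simpa using hb'
    obtain ⟨θ, hθ, h⟩ := exists_polarMap_eq (b / a) 0
    rw [norm_div, hna, hnb, div_one] at h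
    have hbθ : a * polarMap (1, θ) = b := by rw [h]; field_simp
    rw [zero_add] at hθ
    refine ⟨θ, ⟨?_, ?_⟩, by simp only [hbθ]⟩
    · by_contra! hc
      refine hδ' (y := θ) ?_ (by rwa [hbθ])
      rw [Real.dist_eq, sub_zero, abs_of_nonneg hθ.1]; linarith
    · by_contra! hc
      refine hδ' (y := θ - 2 * Real.pi) ?_ ?_
      · rw [Real.dist_eq, sub_zero, abs_lt]; constructor <;> linarith [hθ.2]
      · have : polarMap (1, θ - 2 * Real.pi) = polarMap (1, θ) := by
          simp only [polarMap]
          congr 1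
          rw [Complex.exp_eq_exp_iff_exists_int]
          exact ⟨-1, by push_cast; ring⟩
        rwa [this, hbθ]

/-- Radial extension of a self-homeomorphism of the circle. -/
theorem exists_radial_extension {φ : ℂ → ℂ} (hφ : ContinuousOn φ (sphere 0 1))
    (hbij : BijOn φ (sphere 0 1) (sphere 0 1)) :
    ∃ Φ : ℂ → ℂ, ContinuousOn Φ (closedBall 0 1) ∧ BijOn Φ (closedBall 0 1) (closedBall 0 1) ∧
      EqOn Φ φ (sphere 0 1) := by
  have hnorm : ∀ z : ℂ, z ≠ 0 → z / ‖z‖ ∈ sphere (0 : ℂ) 1 := fun z hz => by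
    have : ‖z‖ ≠ 0 := norm_ne_zero_iff.2 hz
    simp [this]
  have hφn : ∀ z : ℂ, z ≠ 0 → ‖φ (z / ‖z‖)‖ = 1 := fun z hz => by
    simpa using hbij.mapsTo (hnorm z hz)
  set Φ : ℂ → ℂ := fun z => ‖z‖ * φ (z / ‖z‖) with hΦ
  have hΦn : ∀ z, ‖Φ z‖ = ‖z‖ := fun z => by
    rcases eq_or_ne z 0 with rfl | hz
    · simp [hΦ]
    · simp [hΦ, hφn z hz]
  refine ⟨Φ, ?_, ⟨?_, ?_, ?_⟩, ?_⟩
  · intro z hz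
    refine ContinuousAt.continuousWithinAt ?_
    rcases eq_or_ne z 0 with rfl | hz
    · have h0 : Φ 0 = 0 := by simp [hΦ]
      rw [ContinuousAt, h0, tendsto_zero_iff_norm_tendsto_zero]
      simp only [hΦn]
      exact tendsto_norm_zero
    · have hc : ContinuousOn Φ {0}ᶜ := by
        refine ContinuousOn.mul (by fun_prop) (hφ.comp ?_ fun w hw => hnorm w hw)
        refine continuousOn_id.div (by fun_prop) fun w hw => ?_
        simpa using hw
      exact hc.continuousAt (isOpen_compl_singleton.mem_nhds hz)
  · intro z hz
    simpa [hΦn] using hz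
  · intro z _ w _ h
    have hn : ‖z‖ = ‖w‖ := by rw [← hΦn z, ← hΦn w, h]
    rcases eq_or_ne z 0 with rfl | hz
    · rw [norm_zero] at hn; exact (norm_eq_zero.1 hn.symm).symm
    have hw : w ≠ 0 := by rintro rfl; exact hz (norm_eq_zero.1 (by simpa using hn))
    have hz' : (‖w‖ : ℂ) ≠ 0 := by exact_mod_cast norm_ne_zero_iff.2 hw
    simp only [hΦ, hn] at h
    have h1 := mul_left_cancel₀ hz' h
    have h2 := hbij.injOn (by have := hnorm z hz; rwa [hn] at this) (hnorm w hw) h1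
    field_simp at h2
    exact h2
  · intro w hw
    rcases eq_or_ne w 0 with rfl | hw0
    · exact ⟨0, by simp, by simp [hΦ]⟩
    obtain ⟨v, hv, hvw⟩ := hbij.surjOn (hnorm w hw0)
    have hv1 : ‖v‖ = 1 := by simpa using hv
    have hw' : (‖w‖ : ℂ) ≠ 0 := by exact_mod_cast norm_ne_zero_iff.2 hw0
    refine ⟨‖w‖ * v, by simpa [hv1] using hw, ?_⟩
    have hn : ‖(‖w‖ : ℂ) * v‖ = ‖w‖ := by simp [hv1]
    simp only [hΦ, hn]
    rw [mul_div_cancel_left₀ _ hw', hvw]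
    field_simp
  · intro z hz
    have : ‖z‖ = 1 := by simpa using hz
    simp [hΦ, this]

/-- A homeomorphism from a Jordan curve `k '' frontier T` bounding a closed disc extends to the
square. -/
theorem exists_extension_unitSquare {g k : ℂ → ℂ} (hg : ContinuousOn g (closedBall 0 1))
    (hginj : InjOn g (closedBall 0 1)) (hk : ContinuousOn k (frontier unitSquare))
    (hkinj : InjOn k (frontier unitSquare)) (hgs : g '' sphere 0 1 = k '' frontier unitSquare) :
    ∃ θ : ℂ → ℂ, ContinuousOn θ unitSquare ∧ InjOn θ unitSquare ∧
      θ '' unitSquare = g '' closedBall 0 1 ∧ EqOn θ k (frontier unitSquare) := by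
  obtain ⟨e, -, he2, he3⟩ := exists_homeomorph_image_interior_closure_frontier_eq_unitBall
    convex_unitSquare nonempty_interior_unitSquare isCompact_unitSquare.isBounded
  rw [isClosed_unitSquare.closure_eq] at he2
  set h := Function.invFunOn g (closedBall 0 1)
  have hl : LeftInvOn h g (closedBall 0 1) := hginj.leftInvOn_invFunOn
  have hh : ContinuousOn h (g '' closedBall 0 1) :=
    (isCompact_closedBall (0 : ℂ) 1).continuousOn_of_leftInvOn hg hl
  have hsym : ∀ z ∈ sphere (0 : ℂ) 1, e.symm z ∈ frontier unitSquare := by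
    rw [← he3]; rintro _ ⟨z, hz, rfl⟩; simpa using hz
  have hsb : sphere (0 : ℂ) 1 ⊆ closedBall 0 1 := sphere_subset_closedBall
  have hkm : ∀ z ∈ sphere (0 : ℂ) 1, ∃ y ∈ sphere (0 : ℂ) 1, g y = k (e.symm z) := fun z hz =>
    hgs.symm.subset ⟨_, hsym z hz, rfl⟩
  have hφval : ∀ z ∈ sphere (0 : ℂ) 1, h (k (e.symm z)) ∈ sphere (0 : ℂ) 1 ∧
      g (h (k (e.symm z))) = k (e.symm z) := fun z hz => by
    obtain ⟨y, hy, hgy⟩ := hkm z hz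
    rw [← hgy, hl (hsb hy)]
    exact ⟨hy, rfl⟩
  have hφc : ContinuousOn (fun z => h (k (e.symm z))) (sphere 0 1) := by
    refine hh.comp (hk.comp e.symm.continuous.continuousOn hsym) fun z hz => ?_
    obtain ⟨y, hy, hgy⟩ := hkm z hz
    exact ⟨y, hsb hy, hgy⟩
  obtain ⟨Φ, hΦc, hΦb, hΦe⟩ := exists_radial_extension hφc
    ⟨fun z hz => (hφval z hz).1, fun z hz w hw hzw => by
      have h1 : k (e.symm z) = k (e.symm w) := by
        rw [← (hφval z hz).2, ← (hφval w hw).2]; exact congrArg g hzw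
      exact e.symm.injective (hkinj (hsym z hz) (hsym w hw) h1), fun y hy => by
      obtain ⟨v, hv, hvy⟩ := hgs.subset ⟨y, hy, rfl⟩
      refine ⟨e v, he3 ▸ ⟨v, hv, rfl⟩, ?_⟩
      simp only [Homeomorph.symm_apply_apply, hvy]
      exact hl (hsb hy)⟩
  have heb : BijOn e unitSquare (closedBall 0 1) := by
    rw [← he2]; exact e.injective.injOn.bijOn_image
  refine ⟨fun z => g (Φ (e z)), ?_, ?_, ?_, ?_⟩
  · exact hg.comp (hΦc.comp e.continuous.continuousOn heb.mapsTo) fun z hz =>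
      hΦb.mapsTo (heb.mapsTo hz)
  · exact hginj.comp (hΦb.injOn.comp heb.injOn heb.mapsTo) fun z hz => hΦb.mapsTo (heb.mapsTo hz)
  · rw [show (fun z => g (Φ (e z))) = g ∘ Φ ∘ e from rfl, image_comp, image_comp, heb.image_eq,
      hΦb.image_eq]
  · intro z hz
    have hez : e z ∈ sphere (0 : ℂ) 1 := he3 ▸ ⟨z, hz, rfl⟩
    simp only [hΦe hez]
    rw [(hφval _ hez).2, e.symm_apply_apply]

end

section

open Set Metric MeasureTheory Filter Topology
open scoped ENNReal unitInterval

/-- The map sending the segment `[p, q]` of the real line to the arc `c` and fixing all other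
points. -/
noncomputable def crosscutMap (c : ℝ → ℂ) (p q : ℝ) (z : ℂ) : ℂ :=
  open Classical in if z.im = 0 ∧ z.re ∈ Icc p q then c ((z.re - p) / (q - p)) else z

/-- The part of the frontier of the square outside of the open segment `(p, q)`. -/
def crosscutRest (p q : ℝ) : Set ℂ :=
  {z ∈ frontier unitSquare | ¬ (z.im = 0 ∧ z.re ∈ Ioo p q)}

section Crosscut

variable {c : ℝ → ℂ} {p q : ℝ}

theorem crosscutMap_of_mem {z : ℂ} (h : z.im = 0 ∧ z.re ∈ Icc p q) :
    crosscutMap c p q z = c ((z.re - p) / (q - p)) := by rw [crosscutMap, if_pos h]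

theorem crosscutMap_of_mem_rest (hpq : p < q) (hc0 : c 0 = p) (hc1 : c 1 = q) {z : ℂ}
    (hz : z ∈ crosscutRest p q) : crosscutMap c p q z = z := by
  by_cases h : z.im = 0 ∧ z.re ∈ Icc p q
  · rw [crosscutMap_of_mem h]
    have h2 : z.re = p ∨ z.re = q := by
      by_contra! hc
      exact hz.2 ⟨h.1, lt_of_le_of_ne h.2.1 hc.1.symm, lt_of_le_of_ne h.2.2 hc.2⟩
    have hqp : q - p ≠ 0 := by linarith
    rcases h2 with h2 | h2
    · rw [h2, sub_self, zero_div, hc0]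
      apply Complex.ext <;> simp [h2, h.1]
    · rw [h2, div_self hqp, hc1]
      apply Complex.ext <;> simp [h2, h.1]
  · rw [crosscutMap, if_neg h]

theorem isClosed_crosscutRest (hp : 0 ≤ p) (hq : q ≤ 1) : IsClosed (crosscutRest p q) := by
  have h : crosscutRest p q = unitSquare ∩ (({z : ℂ | z.im = 1} ∪ {z : ℂ | z.re = 0} ∪
      {z : ℂ | z.re = 1}) ∪ ({z : ℂ | z.im = 0} ∩ ({z : ℂ | z.re ≤ p} ∪ {z : ℂ | q ≤ z.re}))) := by
    ext z
    constructor
    · rintro ⟨hz, hz'⟩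
      have hT := isClosed_unitSquare.frontier_subset hz
      refine ⟨hT, ?_⟩
      rcases (mem_frontier_unitSquare hT).1 hz with h | h | h | h
      · exact Or.inl (Or.inl (Or.inr h))
      · exact Or.inl (Or.inr h)
      · refine Or.inr ⟨h, ?_⟩
        by_contra hc
        simp only [mem_union, mem_ofPred_eq, not_or, not_le] at hc
        exact hz' ⟨h, hc⟩
      · exact Or.inl (Or.inl (Or.inl h))
    · rintro ⟨hT, h⟩
      refine ⟨(mem_frontier_unitSquare hT).2 ?_, ?_⟩
      · rcases h with ((h | h) | h) | h
        · exact Or.inr (Or.inr (Or.inr h))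
        · exact Or.inl h
        · exact Or.inr (Or.inl h)
        · exact Or.inr (Or.inr (Or.inl h.1))
      · rintro ⟨h1, h2⟩
        rcases h with ((h | h) | h) | ⟨-, h | h⟩ <;> rw [mem_ofPred_eq] at h <;>
          linarith [h2.1, h2.2]
  rw [h]
  have hre := Complex.continuous_re
  have him := Complex.continuous_im
  refine isClosed_unitSquare.inter ((((isClosed_eq him continuous_const).union
    (isClosed_eq hre continuous_const)).union (isClosed_eq hre continuous_const)).union
    ((isClosed_eq him continuous_const).inter
      ((isClosed_le hre continuous_const).union (isClosed_le continuous_const hre))))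

theorem mem_frontier_of_segment (hp : 0 < p) (hq : q < 1) {z : ℂ}
    (h : z.im = 0 ∧ z.re ∈ Icc p q) : z ∈ frontier unitSquare := by
  refine (mem_frontier_unitSquare ⟨⟨by linarith [h.2.1], by linarith [h.2.2]⟩, ?_⟩).2
    (Or.inr (Or.inr (Or.inl h.1)))
  rw [h.1]; simp

theorem frontier_eq_segment_union_rest (hp : 0 < p) (hq : q < 1) :
    frontier unitSquare = {z : ℂ | z.im = 0 ∧ z.re ∈ Icc p q} ∪ crosscutRest p q := by
  ext z
  constructor
  · intro hz
    by_cases h : z.im = 0 ∧ z.re ∈ Ioo p q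
    · exact Or.inl ⟨h.1, Ioo_subset_Icc_self h.2⟩
    · exact Or.inr ⟨hz, h⟩
  · rintro (h | h)
    · exact mem_frontier_of_segment hp hq h
    · exact h.1

theorem segment_param_mem (hpq : p < q) {x : ℝ} (hx : x ∈ Icc p q) :
    (x - p) / (q - p) ∈ Icc (0 : ℝ) 1 := by
  have : 0 < q - p := by linarith
  exact ⟨div_nonneg (by linarith [hx.1]) this.le, (div_le_one this).2 (by linarith [hx.2])⟩

theorem continuousOn_crosscutMap (hp : 0 < p) (hpq : p < q) (hq : q < 1)
    (hc : ContinuousOn c (Icc 0 1)) (hc0 : c 0 = p) (hc1 : c 1 = q) :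
    ContinuousOn (crosscutMap c p q) (frontier unitSquare) := by
  rw [frontier_eq_segment_union_rest hp hq]
  refine ContinuousOn.union_of_isClosed ?_ ?_ ?_ (isClosed_crosscutRest hp.le hq.le)
  · have h1 : ContinuousOn (fun z : ℂ => c ((z.re - p) / (q - p)))
        {z : ℂ | z.im = 0 ∧ z.re ∈ Icc p q} :=
      hc.comp (by fun_prop) fun z hz => segment_param_mem hpq hz.2
    exact h1.congr fun z hz => crosscutMap_of_mem hz
  · exact continuousOn_id.congr fun z hz => crosscutMap_of_mem_rest hpq hc0 hc1 hz
  · exact (isClosed_eq Complex.continuous_im continuous_const).inter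
      (isClosed_Icc.preimage Complex.continuous_re)

theorem image_crosscutMap (hp : 0 < p) (hpq : p < q) (hq : q < 1) (hc0 : c 0 = p)
    (hc1 : c 1 = q) : crosscutMap c p q '' frontier unitSquare = c '' Icc 0 1 ∪ crosscutRest p q := by
  rw [frontier_eq_segment_union_rest hp hq, image_union]
  congr 1
  · ext x
    constructor
    · rintro ⟨z, hz, rfl⟩
      rw [crosscutMap_of_mem hz]
      exact ⟨_, segment_param_mem hpq hz.2, rfl⟩
    · rintro ⟨t, ht, rfl⟩
      have hqp : 0 < q - p := by linarith
      have hm : ((p + t * (q - p) : ℝ) : ℂ).im = 0 ∧ ((p + t * (q - p) : ℝ) : ℂ).re ∈ Icc p q := by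
        refine ⟨Complex.ofReal_im _, ?_, ?_⟩ <;> rw [Complex.ofReal_re] <;> nlinarith [ht.1, ht.2]
      refine ⟨((p + t * (q - p) : ℝ) : ℂ), hm, ?_⟩
      rw [crosscutMap_of_mem hm, Complex.ofReal_re]
      congr 1
      field_simp
      ring
  · exact (EqOn.image_eq (f₂ := id) fun z hz => crosscutMap_of_mem_rest hpq hc0 hc1 hz).trans
      (image_id _)

theorem injOn_crosscutMap (hpq : p < q)
    (hi : InjOn c (Icc 0 1)) (hc0 : c 0 = p) (hc1 : c 1 = q)
    (hcint : ∀ t ∈ Ioo (0 : ℝ) 1, c t ∈ interior unitSquare) :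
    InjOn (crosscutMap c p q) (frontier unitSquare) := by
  have hqp : 0 < q - p := by linarith
  have key : ∀ z w : ℂ, (z.im = 0 ∧ z.re ∈ Icc p q) → w ∈ crosscutRest p q →
      crosscutMap c p q z = crosscutMap c p q w → z = w := by
    intro z w hz hw h
    rw [crosscutMap_of_mem_rest hpq hc0 hc1 hw] at h
    by_cases hz' : z ∈ crosscutRest p q
    · rwa [crosscutMap_of_mem_rest hpq hc0 hc1 hz'] at h
    have hzo : z.re ∈ Ioo p q := by
      rcases hz.2.1.eq_or_lt with h1 | h1
      · rw [crosscutMap_of_mem hz, ← h1, sub_self, zero_div, hc0] at h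
        refine absurd ?_ hz'
        rwa [show z = w by rw [← h]; apply Complex.ext <;> simp [hz.1, ← h1]]
      rcases hz.2.2.eq_or_lt with h2 | h2
      · rw [crosscutMap_of_mem hz, h2, div_self hqp.ne', hc1] at h
        refine absurd ?_ hz'
        rwa [show z = w by rw [← h]; apply Complex.ext <;> simp [hz.1, h2]]
      exact ⟨h1, h2⟩
    rw [crosscutMap_of_mem hz] at h
    have h3 := hcint ((z.re - p) / (q - p)) ⟨div_pos (by linarith [hzo.1]) hqp,
      (div_lt_one hqp).2 (by linarith [hzo.2])⟩
    rw [h] at h3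
    exact absurd h3 hw.1.2
  intro z hz w hw h
  by_cases hzs : z.im = 0 ∧ z.re ∈ Icc p q <;> by_cases hws : w.im = 0 ∧ w.re ∈ Icc p q
  · rw [crosscutMap_of_mem hzs, crosscutMap_of_mem hws] at h
    have h1 := hi (segment_param_mem hpq hzs.2) (segment_param_mem hpq hws.2) h
    rw [div_left_inj' hqp.ne'] at h1
    apply Complex.ext
    · linarith
    · rw [hzs.1, hws.1]
  · exact key z w hzs ⟨hw, fun h => hws ⟨h.1, Ioo_subset_Icc_self h.2⟩⟩ h
  · exact (key w z hws ⟨hz, fun h => hzs ⟨h.1, Ioo_subset_Icc_self h.2⟩⟩ h.symm).symm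
  · rwa [crosscutMap_of_mem_rest hpq hc0 hc1 ⟨hz, fun h => hzs ⟨h.1, Ioo_subset_Icc_self h.2⟩⟩,
      crosscutMap_of_mem_rest hpq hc0 hc1 ⟨hw, fun h => hws ⟨h.1, Ioo_subset_Icc_self h.2⟩⟩] at h

/-- The region above a crosscut. -/
theorem exists_crosscut_region (hp : 0 < p) (hpq : p < q) (hq : q < 1)
    (hc : ContinuousOn c (Icc 0 1)) (hc0 : c 0 = p) (hc1 : c 1 = q)
    (hcint : ∀ t ∈ Ioo (0 : ℝ) 1, c t ∈ interior unitSquare) :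
    ∃ Ω : Set ℂ, IsOpen Ω ∧ IsConnected Ω ∧ Ω ⊆ interior unitSquare \ c '' Icc 0 1 ∧
      frontier Ω ⊆ c '' Icc 0 1 ∪ crosscutRest p q ∧
      ∀ x ∈ closure Ω, x ∉ c '' Icc 0 1 → x ∉ closure (unitSquare \ closure Ω) := by
  have hK : IsCompact (c '' Icc 0 1) := isCompact_Icc.image_of_continuousOn hc
  have himc : ∀ t ∈ Icc (0 : ℝ) 1, 0 ≤ (c t).im ∧ (c t).im < 1 := by
    intro t ht
    rcases ht.1.eq_or_lt with h | h
    · rw [← h, hc0]; simp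
    rcases ht.2.eq_or_lt with h' | h'
    · rw [h', hc1]; simp
    have := hcint t ⟨h, h'⟩
    rw [interior_unitSquare] at this
    exact ⟨this.2.1.le, this.2.2⟩
  obtain ⟨tm, htm, hmax⟩ := isCompact_Icc.exists_isMaxOn (nonempty_Icc.2 zero_le_one)
    (Complex.continuous_im.comp_continuousOn hc)
  obtain ⟨y₀, hy₀, hy₁⟩ := exists_between (himc tm htm).2
  have hmax' : ∀ t ∈ Icc (0 : ℝ) 1, (c t).im < y₀ := fun t ht => lt_of_le_of_lt (hmax ht) hy₀
  set z₀ : ℂ := ⟨1 / 2, y₀⟩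
  set U := interior unitSquare \ c '' Icc 0 1 with hU
  have hUo : IsOpen U := isOpen_interior.sdiff hK.isClosed
  have hz₀ : z₀ ∈ U := by
    refine ⟨?_, ?_⟩
    · rw [interior_unitSquare]
      exact ⟨by norm_num [z₀], (himc tm htm).1.trans_lt hy₀, hy₁⟩
    · rintro ⟨t, ht, h⟩
      have := hmax' t ht
      rw [h] at this
      exact lt_irrefl _ this
  set Ω := connectedComponentIn U z₀ with hΩ
  have hΩo : IsOpen Ω := hUo.connectedComponentIn
  have hΩc : IsConnected Ω := isConnected_connectedComponentIn_iff.2 hz₀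
  have hΩU : Ω ⊆ U := connectedComponentIn_subset U z₀
  have habs : ∀ H : Set ℂ, IsPreconnected H → H ⊆ U → (H ∩ Ω).Nonempty → H ⊆ Ω := by
    rintro H hH hHU ⟨x, hxH, hxΩ⟩
    rw [hΩ, connectedComponentIn_eq hxΩ]
    exact hH.subset_connectedComponentIn hxH hHU
  have hball : ∀ x ∈ closure Ω, x ∉ c '' Icc 0 1 → ∃ δ > 0, ball x δ ∩ interior unitSquare ⊆ Ω := by
    intro x hx hxc
    obtain ⟨δ, hδ, hδ'⟩ := Metric.isOpen_iff.1 hK.isClosed.isOpen_compl x hxc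
    refine ⟨δ, hδ, habs _ ((convex_ball x δ).inter convex_unitSquare.interior).isPreconnected
      (fun z hz => ⟨hz.2, hδ' hz.1⟩) ?_⟩
    obtain ⟨y, hy, hyΩ⟩ := _root_.mem_closure_iff.1 hx _ isOpen_ball (mem_ball_self hδ)
    exact ⟨y, ⟨hy, (hΩU hyΩ).1⟩, hyΩ⟩
  refine ⟨Ω, hΩo, hΩc, hΩU, ?_, ?_⟩
  · rw [hΩo.frontier_eq]
    rintro x ⟨hx, hxΩ⟩
    by_cases hxc : x ∈ c '' Icc 0 1
    · exact Or.inl hxc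
    right
    obtain ⟨δ, hδ, hδΩ⟩ := hball x hx hxc
    have hxT : x ∈ unitSquare := by
      rw [← closure_interior_unitSquare]; exact closure_mono (fun z hz => (hΩU hz).1) hx
    refine ⟨?_, ?_⟩
    · rw [isClosed_unitSquare.frontier_eq]
      exact ⟨hxT, fun h => hxΩ (hδΩ ⟨mem_ball_self hδ, h⟩)⟩
    · rintro ⟨hxi, hxr⟩
      set s := min (δ / 2) (1 / 2) with hs
      have hs0 : 0 < s := by positivity
      have hsδ : s < δ := (min_le_left _ _).trans_lt (by linarith)
      have hs1 : s < 1 := (min_le_right _ _).trans_lt (by norm_num)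
      set h : ℂ := ⟨x.re, s⟩
      have hseg : segment ℝ x h ⊆ insert x Ω := by
        rintro _ ⟨a, b, ha, hb, hab, rfl⟩
        rcases hb.eq_or_lt with h0 | h0
        · left; rw [← h0] at hab ⊢; rw [show a = 1 by linarith]; simp
        right
        have hre : (a • x + b • h).re = x.re := by
          simp [h]; rw [← add_mul, hab, one_mul]
        have him : (a • x + b • h).im = b * s := by simp [h, hxi]
        have hb1 : b ≤ 1 := by linarith
        refine hδΩ ⟨?_, ?_⟩
        · rw [mem_ball_iff_norm]
          have : a • x + b • h - x = ⟨0, b * s⟩ := by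
            apply Complex.ext
            · rw [Complex.sub_re, hre, sub_self]
            · rw [Complex.sub_im, him, hxi, sub_zero]
          rw [this]
          have h4 : ‖(⟨0, b * s⟩ : ℂ)‖ = b * s := by
            have h5 : (⟨0, b * s⟩ : ℂ) = ((b * s : ℝ) : ℂ) * Complex.I := by
              apply Complex.ext <;> simp
            rw [h5, norm_mul, Complex.norm_I, mul_one, Complex.norm_real, Real.norm_eq_abs,
              abs_of_pos (by positivity)]
          rw [h4]
          nlinarith
        · rw [interior_unitSquare]
          refine ⟨?_, ?_⟩
          · rw [mem_preimage, hre]; exact ⟨by linarith [hxr.1], by linarith [hxr.2]⟩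
          · rw [mem_preimage, him]; exact ⟨by positivity, by nlinarith⟩
      have hhΩ : h ∈ Ω := by
        rcases hseg (right_mem_segment ℝ x h) with h1 | h1
        · have := congrArg Complex.im h1
          simp only [h, hxi] at this
          linarith
        · exact h1
      have hj1 : JoinedIn (insert x Ω) x h := JoinedIn.of_segment_subset hseg
      have hj2 : JoinedIn (insert x Ω) h z₀ :=
        (((hΩo.isConnected_iff_isPathConnected).1 hΩc).joinedIn h hhΩ z₀
          (mem_connectedComponentIn hz₀)).mono (subset_insert _ _)
      obtain ⟨γ, hγ⟩ := hj1.trans hj2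
      have hγmem : ∀ t ∈ Icc (0 : ℝ) 1, γ.extend t ∈ insert x Ω := fun t ht => by
        rw [γ.extend_apply ht]; exact hγ _
      have hins : insert x Ω ⊆ unitSquare := insert_subset hxT fun z hz =>
        interior_subset (hΩU hz).1
      obtain ⟨t, ht, t', ht', heq⟩ := exists_crossing hc γ.continuous_extend.continuousOn hc0 hc1
        (m := x.re) (by rw [γ.extend_zero]; apply Complex.ext <;> simp [hxi]) hxr.1 hxr.2
        (fun s hs => ⟨(himc s hs).1, by rw [γ.extend_one]; exact (hmax' s hs).le⟩)
        (fun s hs => (hins (hγmem s hs)).2.1)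
      rcases hγmem t' ht' with h1 | h1
      · exact hxc ⟨t, ht, heq.trans h1⟩
      · exact (hΩU h1).2 ⟨t, ht, heq⟩
  · intro x hx hxc hx'
    obtain ⟨δ, hδ, hδΩ⟩ := hball x hx hxc
    obtain ⟨y, hy, hyT, hyΩ⟩ := _root_.mem_closure_iff.1 hx' _ isOpen_ball (mem_ball_self hδ)
    refine hyΩ (closure_mono hδΩ (isOpen_ball.inter_closure ⟨hy, ?_⟩))
    rwa [closure_interior_unitSquare]

/-- Cutting the square along a crosscut `c` based on its lower side: the part above `c` is again a
square, and the square retracts onto it. -/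
theorem exists_crosscut_square (hp : 0 < p) (hpq : p < q) (hq : q < 1)
    (hc : ContinuousOn c (Icc 0 1)) (hi : InjOn c (Icc 0 1)) (hc0 : c 0 = p) (hc1 : c 1 = q)
    (hcint : ∀ t ∈ Ioo (0 : ℝ) 1, c t ∈ interior unitSquare) :
    ∃ θ ρ : ℂ → ℂ, ContinuousOn θ unitSquare ∧ InjOn θ unitSquare ∧
      θ '' unitSquare ⊆ unitSquare ∧ (∀ z ∈ crosscutRest p q, θ z = z) ∧
      θ '' {z | z.im = 0 ∧ z.re ∈ Icc p q} = c '' Icc 0 1 ∧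
      ContinuousOn ρ unitSquare ∧ MapsTo ρ unitSquare (θ '' unitSquare) ∧
      EqOn ρ id (θ '' unitSquare) ∧
      θ '' unitSquare ∩ closure (unitSquare \ θ '' unitSquare) ⊆ c '' Icc 0 1 := by
  obtain ⟨Ω, hΩo, hΩc, hΩU, hΩf, hΩcl⟩ := exists_crosscut_region hp hpq hq hc hc0 hc1 hcint
  set k := crosscutMap c p q
  have hk : ContinuousOn k (frontier unitSquare) := continuousOn_crosscutMap hp hpq hq hc hc0 hc1
  have hki : InjOn k (frontier unitSquare) := injOn_crosscutMap hpq hi hc0 hc1 hcint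
  have hkim : k '' frontier unitSquare = c '' Icc 0 1 ∪ crosscutRest p q :=
    image_crosscutMap hp hpq hq hc0 hc1
  obtain ⟨e, -, -, he3⟩ := exists_homeomorph_image_interior_closure_frontier_eq_unitBall
    convex_unitSquare nonempty_interior_unitSquare isCompact_unitSquare.isBounded
  have hsym : BijOn e.symm (sphere 0 1) (frontier unitSquare) := by
    rw [← he3]
    refine ⟨?_, e.symm.injective.injOn, fun z hz => ⟨e z, ⟨z, hz, rfl⟩, by simp⟩⟩
    rintro _ ⟨z, hz, rfl⟩
    simpa using hz
  have hj : ContinuousOn (k ∘ e.symm) (sphere 0 1) :=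
    hk.comp e.symm.continuous.continuousOn hsym.mapsTo
  have hji : InjOn (k ∘ e.symm) (sphere 0 1) := hki.comp hsym.injOn hsym.mapsTo
  have hjim : (k ∘ e.symm) '' sphere 0 1 = c '' Icc 0 1 ∪ crosscutRest p q := by
    rw [image_comp, hsym.image_eq, hkim]
  have hb : Bornology.IsBounded Ω := isCompact_unitSquare.isBounded.subset fun z hz =>
    interior_subset (hΩU hz).1
  have hfr : frontier Ω = (k ∘ e.symm) '' sphere 0 1 := by
    refine frontier_eq_jordan hj hji hb hΩc.nonempty ?_ (hjim ▸ hΩf)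
    rw [hjim, disjoint_left]
    rintro z hz (h | h)
    · exact (hΩU hz).2 h
    · exact h.1.2 (hΩU hz).1
  have hfrp : IsPreconnected (frontier Ω) := by
    rw [hfr]
    exact (isPreconnected_sphere (by rw [Complex.rank_real_complex]; norm_num) 0 1).image _ hj
  obtain ⟨g, hg, hgi, hgΩ, hgs⟩ := exists_closedBall_parametrization hΩo hΩc hb
    (isPreconnected_compl_of_frontier hΩo hΩc.nonempty hfrp) hj hji hfr
  obtain ⟨θ, hθ, hθi, hθim, hθk⟩ := exists_extension_unitSquare hg hgi hk hki
    (by rw [hgs, hjim, hkim])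
  have him : θ '' unitSquare = closure Ω := by
    rw [hθim, ← ball_union_sphere, image_union, hgΩ, hgs, ← hfr, closure_eq_self_union_frontier]
  have hsub : closure Ω ⊆ unitSquare := by
    rw [← closure_interior_unitSquare]; exact closure_mono fun z hz => (hΩU hz).1
  have hmeet : closure Ω ∩ closure (unitSquare \ closure Ω) ⊆ c '' Icc 0 1 := fun x hx => by
    by_contra hxc
    exact hΩcl x hx.1 hxc hx.2
  set τ := Function.invFunOn c (Icc 0 1)
  have hK : IsCompact (c '' Icc 0 1) := isCompact_Icc.image_of_continuousOn hc
  have hτ : ContinuousOn τ (c '' Icc 0 1) :=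
    isCompact_Icc.continuousOn_of_leftInvOn hc hi.leftInvOn_invFunOn
  obtain ⟨τ', hτ'c, hτ'⟩ := exists_continuous_eqOn_of_isClosed hK.isClosed hτ
  have hcΩ : c '' Icc 0 1 ⊆ closure Ω := by
    rw [closure_eq_self_union_frontier, hfr, hjim]
    exact fun x hx => Or.inr (Or.inl hx)
  set ret : ℂ → ℂ := fun z => c (projIcc 0 1 zero_le_one (τ' z))
  have hretc : Continuous ret := by
    refine hc.comp_continuous ?_ fun z => (projIcc (0 : ℝ) 1 zero_le_one (τ' z)).2
    exact continuous_subtype_val.comp (continuous_projIcc.comp hτ'c)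
  have hret : ∀ z ∈ c '' Icc 0 1, ret z = z := by
    intro z hz
    have h1 : τ z ∈ Icc (0 : ℝ) 1 := Function.invFunOn_mem hz
    simp only [ret]
    rw [hτ' hz, projIcc_of_mem _ h1]
    exact Function.invFunOn_eq hz
  have hretm : ∀ z, ret z ∈ closure Ω := fun z => hcΩ ⟨_, (projIcc (0 : ℝ) 1 _ _).2, rfl⟩
  classical
  set ρ : ℂ → ℂ := fun z => if z ∈ closure Ω then z else ret z
  have hρ1 : EqOn ρ id (closure Ω) := fun z hz => if_pos hz
  have hρ2 : EqOn ρ ret (closure (unitSquare \ closure Ω)) := fun z hz => by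
    by_cases h : z ∈ closure Ω
    · rw [hρ1 h, hret z (hmeet ⟨h, hz⟩)]; rfl
    · exact if_neg h
  refine ⟨θ, ρ, hθ, hθi, him ▸ hsub, fun z hz => ?_, ?_, ?_, ?_, him ▸ hρ1, him ▸ hmeet⟩
  · rw [hθk hz.1]; exact crosscutMap_of_mem_rest hpq hc0 hc1 hz
  · have hsf : {z : ℂ | z.im = 0 ∧ z.re ∈ Icc p q} ⊆ frontier unitSquare :=
      fun z hz => mem_frontier_of_segment hp hq hz
    rw [(hθk.mono hsf).image_eq]
    ext x
    constructor
    · rintro ⟨z, hz, rfl⟩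
      exact ⟨_, segment_param_mem hpq hz.2, (crosscutMap_of_mem hz).symm⟩
    · intro hx
      obtain ⟨z, hz, rfl⟩ := hkim.symm.subset (Or.inl hx : x ∈ c '' Icc 0 1 ∪ crosscutRest p q)
      refine ⟨z, ?_, rfl⟩
      by_contra hzs
      have hzr : z ∈ crosscutRest p q := ⟨hz, fun h => hzs ⟨h.1, Ioo_subset_Icc_self h.2⟩⟩
      rw [show k z = z from crosscutMap_of_mem_rest hpq hc0 hc1 hzr] at hx
      obtain ⟨t, ht, rfl⟩ := hx
      rcases ht.1.eq_or_lt with h0 | h0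
      · apply hzs; rw [← h0, hc0]; simp [hpq.le]
      rcases ht.2.eq_or_lt with h1 | h1
      · apply hzs; rw [h1, hc1]; simp [hpq.le]
      exact hz.2 (hcint t ⟨h0, h1⟩)
  · have : unitSquare ⊆ closure Ω ∪ closure (unitSquare \ closure Ω) := fun z hz => by
      by_cases h : z ∈ closure Ω
      · exact Or.inl h
      · exact Or.inr (subset_closure ⟨hz, h⟩)
    exact ((continuousOn_id.congr hρ1).union_of_isClosed (hretc.continuousOn.congr hρ2)
      isClosed_closure isClosed_closure).mono this
  · intro z _
    rw [him]
    by_cases h : z ∈ closure Ω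
    · rw [hρ1 h]; exact h
    · rw [show ρ z = ret z from if_neg h]; exact hretm z

end Crosscut

end

section

open Set Metric MeasureTheory Filter Topology
open scoped ENNReal unitInterval

/-- A set of finite Hausdorff `2`-measure has, for every `δ`, a countable cover by sets of diameter
at most `δ` and square sum bounded independently of `δ`. -/
theorem exists_cover_sum_sq {X : Type*} [MetricSpace X] [MeasurableSpace X] [BorelSpace X]
    {E : Set X} (hE : μH[2] E < ⊤) {δ : ℝ≥0∞} (hδ : 0 < δ) :
    ∃ t : ℕ → Set X, E ⊆ ⋃ n, t n ∧ (∀ n, ediam (t n) ≤ δ) ∧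
      ∑' n, ediam (t n) ^ (2 : ℝ) < μH[2] E + 1 := by
  have h1 := Measure.hausdorffMeasure_apply (2 : ℝ) E
  have h2 : ⨅ (t : ℕ → Set X) (_ : E ⊆ ⋃ n, t n) (_ : ∀ n, ediam (t n) ≤ δ),
      ∑' n, ⨆ _ : (t n).Nonempty, ediam (t n) ^ (2 : ℝ) ≤ μH[2] E := by
    rw [h1]
    exact le_iSup₂ (f := fun (r : ℝ≥0∞) (_ : 0 < r) => ⨅ (t : ℕ → Set X) (_ : E ⊆ ⋃ n, t n)
      (_ : ∀ n, ediam (t n) ≤ r), ∑' n, ⨆ _ : (t n).Nonempty, ediam (t n) ^ (2 : ℝ)) δ hδ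
  have h3 := h2.trans_lt (ENNReal.lt_add_right hE.ne one_ne_zero)
  simp only [iInf_lt_iff] at h3
  obtain ⟨t, ht, htd, hts⟩ := h3
  refine ⟨t, ht, htd, lt_of_le_of_lt (ENNReal.tsum_le_tsum fun n => ?_) hts⟩
  rcases (t n).eq_empty_or_nonempty with h | h
  · simp [h]
  · exact le_iSup (f := fun _ : (t n).Nonempty => ediam (t n) ^ (2 : ℝ)) h

/-- Some level set of a `1`-Lipschitz function on a set of finite Hausdorff `2`-measure has covers
of arbitrarily small mesh with uniformly bounded sum of diameters. -/
theorem exists_level_cover {X : Type*} [MetricSpace X] [MeasurableSpace X] [BorelSpace X]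
    {E : Set X} (hE : μH[2] E < ⊤) {g : X → ℝ} (hg : LipschitzWith 1 g) {a b : ℝ} (hab : a < b) :
    ∃ r ∈ Ioo a b, ∃ L : ℝ≥0∞, L < ⊤ ∧ ∀ δ : ℝ≥0∞, 0 < δ → ∃ t : ℕ → Set X,
      (E ∩ {x | g x = r}) ⊆ ⋃ n, t n ∧ (∀ n, ediam (t n) ≤ δ) ∧ ∑' n, ediam (t n) ≤ L := by
  have hcov : ∀ k : ℕ, ∃ t : ℕ → Set X, E ⊆ ⋃ n, t n ∧ (∀ n, ediam (t n) ≤ (k + 1 : ℝ≥0∞)⁻¹) ∧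
      ∑' n, ediam (t n) ^ (2 : ℝ) < μH[2] E + 1 := fun k =>
    exists_cover_sum_sq hE (ENNReal.inv_pos.2 (by finiteness))
  choose t ht htd hts using hcov
  have hfin : ∀ k n, ediam (t k n) ≠ ⊤ := fun k n => ne_top_of_le_ne_top (by
    refine ENNReal.inv_ne_top.2 ?_
    positivity) (htd k n)
  have hI : ∀ k n, ∃ J : Set ℝ, MeasurableSet J ∧ g '' t k n ⊆ J ∧
      volume J ≤ 2 * ediam (t k n) := by
    intro k n
    rcases (t k n).eq_empty_or_nonempty with h | ⟨x, hx⟩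
    · exact ⟨∅, MeasurableSet.empty, by simp [h], by simp⟩
    refine ⟨closedBall (g x) (ediam (t k n)).toReal, measurableSet_closedBall, ?_, ?_⟩
    · rintro _ ⟨y, hy, rfl⟩
      rw [mem_closedBall]
      have h1 : edist (g y) (g x) ≤ ediam (t k n) := by
        have := hg y x
        rw [ENNReal.coe_one, one_mul] at this
        exact this.trans (edist_le_ediam_of_mem hy hx)
      rw [edist_dist] at h1
      exact (ENNReal.ofReal_le_iff_le_toReal (hfin k n)).1 h1
    · rw [Real.volume_closedBall, ENNReal.ofReal_mul (by norm_num), ENNReal.ofReal_toReal (hfin k n)]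
      simp
  choose J hJm hJ hJv using hI
  set F : ℕ → ℝ → ℝ≥0∞ := fun k r => ∑' n, (J k n).indicator (fun _ => ediam (t k n)) r with hF
  have hFm : ∀ k, Measurable (F k) := fun k =>
    Measurable.tsum fun n => measurable_const.indicator (hJm k n)
  have hFi : ∀ k, ∫⁻ r, F k r ≤ 2 * (μH[2] E + 1) := by
    intro k
    rw [hF, lintegral_tsum fun n => (measurable_const.indicator (hJm k n)).aemeasurable]
    calc ∑' n, ∫⁻ r, (J k n).indicator (fun _ => ediam (t k n)) r
        = ∑' n, ediam (t k n) * volume (J k n) := by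
          congr 1; ext n; rw [lintegral_indicator (hJm k n), setLIntegral_const]
      _ ≤ ∑' n, 2 * ediam (t k n) ^ (2 : ℝ) := by
          refine ENNReal.tsum_le_tsum fun n => ?_
          refine (mul_le_mul_right (hJv k n) _).trans (le_of_eq ?_)
          rw [ENNReal.rpow_two]; ring
      _ = 2 * ∑' n, ediam (t k n) ^ (2 : ℝ) := ENNReal.tsum_mul_left
      _ ≤ _ := mul_le_mul_right (hts k).le _
  have hfatou : ∫⁻ r, liminf (fun k => F k r) atTop < ⊤ := by
    refine (lintegral_liminf_le hFm).trans_lt ?_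
    refine lt_of_le_of_lt (liminf_le_of_le (by isBoundedDefault) fun c hc => ?_)
      (show 2 * (μH[2] E + 1) < ⊤ by finiteness)
    obtain ⟨k, hk⟩ := hc.exists
    exact hk.trans (hFi k)
  have hae := ae_lt_top' (Measurable.liminf hFm).aemeasurable hfatou.ne
  have hpos : volume (Ioo a b) ≠ 0 := by
    rw [Real.volume_Ioo]; simpa using hab
  obtain ⟨r, hr, hrL⟩ : ∃ r ∈ Ioo a b, liminf (fun k => F k r) atTop < ⊤ := by
    by_contra! hc
    refine hpos (measure_mono_null (fun r hr => ?_) (ae_iff.1 hae))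
    exact not_lt.2 (hc r hr)
  obtain ⟨L, hL1, hL2⟩ := exists_between hrL
  refine ⟨r, hr, L, hL2, fun δ hδ => ?_⟩
  have hfreq : ∃ᶠ k in atTop, F k r < L := frequently_lt_of_liminf_lt (by isBoundedDefault) hL1
  have hev : ∀ᶠ k : ℕ in atTop, (k + 1 : ℝ≥0∞)⁻¹ ≤ δ := by
    have h1 : Tendsto (fun k : ℕ => (k + 1 : ℝ≥0∞)⁻¹) atTop (𝓝 0) := by
      have := (tendsto_add_atTop_iff_nat 1).2 ENNReal.tendsto_inv_nat_nhds_zero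
      simpa using this
    exact (h1.eventually (gt_mem_nhds hδ)).mono fun k hk => hk.le
  obtain ⟨k, hk1, hk2⟩ := (hfreq.and_eventually hev).exists
  classical
  refine ⟨fun n => if r ∈ J k n then t k n else ∅, ?_, fun n => ?_, ?_⟩
  · rintro x ⟨hxE, hxr⟩
    obtain ⟨n, hn⟩ := mem_iUnion.1 (ht k hxE)
    refine mem_iUnion.2 ⟨n, ?_⟩
    have : r ∈ J k n := hJ k n ⟨x, hn, hxr⟩
    rwa [if_pos this]
  · dsimp only
    split_ifs
    · exact (htd k n).trans hk2
    · simp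
  · refine le_trans (le_of_eq ?_) hk1.le
    simp only [hF]
    congr 1
    ext n
    by_cases h : r ∈ J k n <;> simp [h]

end

section

open Set Metric MeasureTheory Filter Topology
open scoped ENNReal unitInterval

/-- Finite chains in `K` with steps at most `δ` and total length `ℓ`. -/
inductive MetricChain {X : Type*} [MetricSpace X] (K : Set X) (δ : ℝ) : X → X → ℝ → Prop
  | refl {x : X} (hx : x ∈ K) : MetricChain K δ x x 0
  | head {x y z : X} {ℓ : ℝ} (hx : x ∈ K) (hd : dist x y ≤ δ) (h : MetricChain K δ y z ℓ) :
      MetricChain K δ x z (dist x y + ℓ)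

section Chains

variable {X : Type*} [MetricSpace X] {K A B : Set X}

theorem MetricChain.nonneg {δ ℓ : ℝ} {x z : X} (h : MetricChain K δ x z ℓ) : 0 ≤ ℓ := by
  induction h with
  | refl => exact le_rfl
  | head _ _ _ ih => exact add_nonneg dist_nonneg ih

theorem MetricChain.exists_step_curve {δ ℓ : ℝ} (hδ : 0 ≤ δ) {x z : X} (h : MetricChain K δ x z ℓ) :
    ∃ γ : ℝ → X, (∀ s, γ s ∈ K) ∧ (∀ s ≤ 0, γ s = x) ∧ (∀ s, ℓ ≤ s → γ s = z) ∧
      (∀ s, 0 ≤ s → dist x (γ s) ≤ s) ∧ ∀ s s', s ≤ s' → dist (γ s) (γ s') ≤ s' - s + δ := by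
  induction h with
  | refl hx =>
    refine ⟨fun _ => _, fun _ => hx, fun _ _ => rfl, fun _ _ => rfl, fun s hs => by simpa using hs,
      fun s s' h => ?_⟩
    rw [dist_self]; linarith
  | @head x y z ℓ hx hd hch ih =>
    obtain ⟨γ, hK, h0, h1, hs, hq⟩ := ih
    have hd0 : 0 ≤ dist x y := dist_nonneg
    have hℓ := hch.nonneg
    have hγ0 : γ 0 = y := h0 0 le_rfl
    have key : ∀ s, dist x y ≤ s → dist x (γ (s - dist x y)) ≤ s := fun s hs' => by
      have h2 := hs (s - dist x y) (by linarith)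
      have h3 := dist_triangle x y (γ (s - dist x y))
      linarith
    refine ⟨fun s => if s < dist x y then x else γ (s - dist x y), fun s => ?_, fun s hs' => ?_,
      fun s hs' => ?_, fun s hs' => ?_, fun s s' hss => ?_⟩
    · dsimp only
      split_ifs
      · exact hx
      · exact hK _
    · dsimp only
      split_ifs with hlt
      · rfl
      · push Not at hlt
        have h2 : dist x y = 0 := by linarith
        rw [h0 _ (by linarith), dist_eq_zero.1 h2]
    · dsimp only
      rw [if_neg (by linarith), h1 _ (by linarith)]
    · dsimp only
      split_ifs with hlt
      · rw [dist_self]; exact hs'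
      · exact key s (not_lt.1 hlt)
    · dsimp only
      split_ifs with h2 h3 h3
      · rw [dist_self]; linarith
      · have := key s' (not_lt.1 h3)
        linarith
      · exact absurd h3 (by linarith)
      · have := hq (s - dist x y) (s' - dist x y) (by linarith)
        linarith

/-- Limits of almost Lipschitz maps into a compact set. -/
theorem exists_lipschitz_of_almost (hK : IsCompact K) (hA : IsClosed A) (hB : IsClosed B) {L : ℝ}
    (h : ∀ δ > 0, ∃ γ : ℝ → X, (∀ s ∈ Icc (0 : ℝ) 1, γ s ∈ K) ∧ γ 0 ∈ A ∧ γ 1 ∈ B ∧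
      ∀ s ∈ Icc (0 : ℝ) 1, ∀ s' ∈ Icc (0 : ℝ) 1, s ≤ s' →
        dist (γ s) (γ s') ≤ L * (s' - s) + δ) :
    ∃ γ : ℝ → X, (∀ s ∈ Icc (0 : ℝ) 1, γ s ∈ K) ∧ γ 0 ∈ A ∧ γ 1 ∈ B ∧
      ∀ s ∈ Icc (0 : ℝ) 1, ∀ s' ∈ Icc (0 : ℝ) 1, dist (γ s) (γ s') ≤ L * |s - s'| := by
  choose γ hγK hγ0 hγ1 hγd using fun n : ℕ => h (1 / ((n : ℝ) + 1)) (by positivity)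
  set U : Ultrafilter ℕ := hyperfilter ℕ
  have hU : (U : Filter ℕ) ≤ atTop := by
    rw [← Nat.cofinite_eq_atTop]; exact hyperfilter_le_cofinite
  have hlim : ∀ s : ℝ, ∃ x : X, s ∈ Icc (0 : ℝ) 1 →
      x ∈ K ∧ Tendsto (fun n => γ n s) U (𝓝 x) := by
    intro s
    by_cases hs : s ∈ Icc (0 : ℝ) 1
    · obtain ⟨x, hx, hxU⟩ := hK.ultrafilter_le_nhds (U.map fun n => γ n s)
        (le_principal_iff.2 (show (fun n => γ n s) ⁻¹' K ∈ U from univ_mem' fun n => hγK n s hs))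
      exact ⟨x, fun _ => ⟨hx, hxU⟩⟩
    · exact ⟨γ 0 0, fun h => absurd h hs⟩
  choose c hc using hlim
  have h0 : (0 : ℝ) ∈ Icc (0 : ℝ) 1 := by simp
  have h1 : (1 : ℝ) ∈ Icc (0 : ℝ) 1 := by simp
  have hle : ∀ s ∈ Icc (0 : ℝ) 1, ∀ s' ∈ Icc (0 : ℝ) 1, s ≤ s' →
      dist (c s) (c s') ≤ L * (s' - s) := by
    intro s hs s' hs' hss
    have hd := ((hc s hs).2.dist (hc s' hs').2)
    have hr : Tendsto (fun n : ℕ => L * (s' - s) + 1 / ((n : ℝ) + 1)) U (𝓝 (L * (s' - s) + 0)) :=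
      (tendsto_const_nhds.add tendsto_one_div_add_atTop_nhds_zero_nat).mono_left hU
    rw [add_zero] at hr
    exact le_of_tendsto_of_tendsto' hd hr fun n => hγd n s hs s' hs' hss
  refine ⟨c, fun s hs => (hc s hs).1,
    hA.mem_of_tendsto (hc 0 h0).2 (Eventually.of_forall hγ0),
    hB.mem_of_tendsto (hc 1 h1).2 (Eventually.of_forall hγ1), fun s hs s' hs' => ?_⟩
  rcases le_total s s' with hss | hss
  · rw [abs_sub_comm, abs_of_nonneg (sub_nonneg.2 hss)]; exact hle s hs s' hs' hss
  · rw [abs_of_nonneg (sub_nonneg.2 hss), dist_comm]; exact hle s' hs' s hs hss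

/-- Two sets in a compact set with a countable cover are joined by a chain of length at most the
sum of the diameters, or separated by a partition. -/
theorem exists_chain_or_partition {t : ℕ → Set X} (hto : ∀ n, IsOpen (t n))
    (hK : IsCompact K) (ht : K ⊆ ⋃ n, t n) {δ : ℝ} (hδ : 0 ≤ δ)
    (htd : ∀ n, ediam (t n) ≤ ENNReal.ofReal δ) {L : ℝ} (hL0 : 0 ≤ L)
    (htL : ∑' n, ediam (t n) ≤ ENNReal.ofReal L) :
    (∃ x ∈ A, ∃ y ∈ B, ∃ ℓ ≤ L, MetricChain K δ x y ℓ) ∨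
    ∃ K₁ K₂ : Set X, IsClosed K₁ ∧ IsClosed K₂ ∧ Disjoint K₁ K₂ ∧ K = K₁ ∪ K₂ ∧
      A ∩ K ⊆ K₁ ∧ B ∩ K ⊆ K₂ := by
  set G : SimpleGraph ℕ := SimpleGraph.fromRel fun i k => (t i ∩ t k ∩ K).Nonempty with hG
  have hGadj : ∀ i k, G.Adj i k → (t i ∩ t k ∩ K).Nonempty := by
    rintro i k ⟨-, h | h⟩
    · exact h
    · rwa [inter_comm (t i)]
  have hdist : ∀ n, ∀ x ∈ t n, ∀ y ∈ t n, ENNReal.ofReal (dist x y) ≤ ediam (t n) :=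
    fun n x hx y hy => by rw [← edist_dist]; exact edist_le_ediam_of_mem hx hy
  have hdδ : ∀ n, ∀ x ∈ t n, ∀ y ∈ t n, dist x y ≤ δ := fun n x hx y hy =>
    (ENNReal.ofReal_le_ofReal_iff hδ).1 ((hdist n x hx y hy).trans (htd n))
  have hwalk : ∀ i k (p : G.Walk i k), ∀ x ∈ t i ∩ K, ∀ y ∈ t k ∩ K, ∃ ℓ : ℝ,
      MetricChain K δ x y ℓ ∧ ENNReal.ofReal ℓ ≤ (p.support.map fun n => ediam (t n)).sum := by
    intro i k p
    induction p with
    | nil =>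
      intro x hx y hy
      refine ⟨dist x y + 0, .head hx.2 (hdδ _ x hx.1 y hy.1) (.refl hy.2), ?_⟩
      simpa using hdist _ x hx.1 y hy.1
    | cons hadj p ih =>
      intro x hx y hy
      obtain ⟨m, hm, hmK⟩ := hGadj _ _ hadj
      obtain ⟨ℓ, hℓ, hℓs⟩ := ih m ⟨hm.2, hmK⟩ y hy
      refine ⟨dist x m + ℓ, .head hx.2 (hdδ _ x hx.1 m hm.1) hℓ, ?_⟩
      rw [ENNReal.ofReal_add dist_nonneg hℓ.nonneg, SimpleGraph.Walk.support_cons, List.map_cons,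
        List.sum_cons]
      exact add_le_add (hdist _ x hx.1 m hm.1) hℓs
  set R : Set ℕ := {k | ∃ i, (A ∩ K ∩ t i).Nonempty ∧ G.Reachable i k}
  by_cases hcon : ∃ k ∈ R, (B ∩ K ∩ t k).Nonempty
  · left
    obtain ⟨k, ⟨i, ⟨x, hx⟩, hik⟩, y, hy⟩ := hcon
    classical
    obtain ⟨p, hp⟩ := hik.exists_isPath
    obtain ⟨ℓ, hℓ, hℓs⟩ := hwalk i k p x ⟨hx.2, hx.1.2⟩ y ⟨hy.2, hy.1.2⟩
    refine ⟨x, hx.1.1, y, hy.1.1, ℓ, ?_, hℓ⟩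
    rw [← ENNReal.ofReal_le_ofReal_iff hL0]
    refine hℓs.trans (le_trans ?_ htL)
    rw [← List.sum_toFinset _ hp.support_nodup]
    exact ENNReal.sum_le_tsum _
  · right
    push Not at hcon
    set U₁ := ⋃ k ∈ R, t k
    set U₂ := ⋃ k ∈ Rᶜ, t k
    have hU₁ : IsOpen U₁ := isOpen_biUnion fun k _ => hto k
    have hU₂ : IsOpen U₂ := isOpen_biUnion fun k _ => hto k
    have hcov : ∀ x ∈ K, x ∈ U₁ ∨ x ∈ U₂ := fun x hx => by
      obtain ⟨n, hn⟩ := mem_iUnion.1 (ht hx)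
      by_cases hnR : n ∈ R
      · exact Or.inl (mem_biUnion hnR hn)
      · exact Or.inr (mem_biUnion (show n ∈ Rᶜ from hnR) hn)
    have hdisj : ∀ x ∈ K, x ∈ U₁ → x ∉ U₂ := by
      intro x hx h1 h2
      obtain ⟨i, hi, hxi⟩ := mem_iUnion₂.1 h1
      obtain ⟨k, hk, hxk⟩ := mem_iUnion₂.1 h2
      have hne : i ≠ k := by rintro rfl; exact hk hi
      obtain ⟨a, ha, hai⟩ := hi
      refine hk ⟨a, ha, hai.trans (SimpleGraph.Adj.reachable ?_)⟩
      rw [hG, SimpleGraph.fromRel_adj]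
      exact ⟨hne, Or.inl ⟨x, ⟨hxi, hxk⟩, hx⟩⟩
    refine ⟨K \ U₂, K \ U₁, hK.isClosed.sdiff hU₂, hK.isClosed.sdiff hU₁, ?_, ?_, ?_, ?_⟩
    · exact disjoint_left.2 fun x hx hx' => (hcov x hx.1).elim hx'.2 hx.2
    · ext x
      constructor
      · intro hx
        rcases hcov x hx with h | h
        · exact Or.inl ⟨hx, hdisj x hx h⟩
        · exact Or.inr ⟨hx, fun h' => hdisj x hx h' h⟩
      · rintro (h | h) <;> exact h.1
    · rintro x ⟨hxA, hxK⟩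
      obtain ⟨n, hn⟩ := mem_iUnion.1 (ht hxK)
      refine ⟨hxK, hdisj x hxK (mem_biUnion (x := n) ⟨n, ⟨x, ⟨hxA, hxK⟩, hn⟩, .refl _⟩ hn)⟩
    · rintro x ⟨hxB, hxK⟩
      refine ⟨hxK, fun h => ?_⟩
      obtain ⟨k, hk, hxk⟩ := mem_iUnion₂.1 h
      have := hcon k hk
      exact (this ▸ (⟨⟨hxB, hxK⟩, hxk⟩ : x ∈ B ∩ K ∩ t k) : x ∈ (∅ : Set X))

/-- Open covers with controlled diameters. -/
theorem exists_open_cover {t : ℕ → Set X} {δ L : ℝ≥0∞} (htd : ∀ n, ediam (t n) ≤ δ)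
    (htL : ∑' n, ediam (t n) ≤ L) {η : ℝ≥0∞} (hη : 0 < η) : ∃ u : ℕ → Set X, (∀ n, IsOpen (u n)) ∧
      (∀ n, t n ⊆ u n) ∧ (∀ n, ediam (u n) ≤ δ + η) ∧ ∑' n, ediam (u n) ≤ L + η := by
  obtain ⟨e, he, hes⟩ := ENNReal.exists_pos_sum_of_countable' (ENNReal.half_pos hη.ne').ne' ℕ
  have hes' : 2 * ∑' n, e n ≤ η := by
    have := mul_le_mul_right hes.le 2
    rwa [ENNReal.mul_div_cancel two_ne_zero ENNReal.ofNat_ne_top] at this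
  have hefin : ∀ n, e n ≠ ⊤ := fun n => by
    have h1 : e n ≤ ∑' n, e n := ENNReal.le_tsum n
    exact ne_top_of_lt (h1.trans_lt hes)
  have hdiam : ∀ n, ediam (thickening (e n).toReal (t n)) ≤ ediam (t n) + 2 * e n := fun n => by
    have := ediam_thickening_le (s := t n) (e n).toNNReal
    simp only [ENNReal.coe_toNNReal (hefin n)] at this
    exact this
  refine ⟨fun n => thickening (e n).toReal (t n), fun n => isOpen_thickening,
    fun n => self_subset_thickening (ENNReal.toReal_pos (he n).ne' (hefin n)) _, fun n => ?_, ?_⟩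
  · refine (hdiam n).trans (add_le_add (htd n) (le_trans ?_ hes'))
    gcongr
    exact ENNReal.le_tsum n
  · refine (ENNReal.tsum_le_tsum hdiam).trans ?_
    rw [ENNReal.tsum_add, ENNReal.tsum_mul_left]
    exact add_le_add htL hes'

end Chains

/-- A topological rectangle of finite area contains a Lipschitz curve joining the left to the right
part of its lower side around the middle part. -/
theorem exists_lipschitz_crossing {X : Type*} [MetricSpace X] [MeasurableSpace X] [BorelSpace X]
    {ψ : ℂ → X} (hψ : ContinuousOn ψ unitSquare) (hinj : InjOn ψ unitSquare) {m₁ m₂ : ℝ}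
    (hm0 : 0 < m₁) (hm : m₁ < m₂) (hm1 : m₂ < 1) (hμ : μH[2] (ψ '' unitSquare) < ⊤) :
    ∃ K : Set X, IsCompact K ∧ K ⊆ ψ '' {z ∈ unitSquare | ¬ (z.re = 0 ∨ z.re = 1 ∨ z.im = 1) ∧
        ¬ (z.im = 0 ∧ z.re ∈ Icc m₁ m₂)} ∧
      ∃ γ : ℝ → X, ∃ L : ℝ, 0 ≤ L ∧ (∀ s ∈ Icc (0 : ℝ) 1, γ s ∈ K) ∧
      γ 0 ∈ ψ '' {z | z.im = 0 ∧ z.re ∈ Icc 0 m₁} ∧ γ 1 ∈ ψ '' {z | z.im = 0 ∧ z.re ∈ Icc m₂ 1} ∧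
      ∀ s ∈ Icc (0 : ℝ) 1, ∀ s' ∈ Icc (0 : ℝ) 1, dist (γ s) (γ s') ≤ L * |s - s'| := by
  have hre := Complex.continuous_re
  have him := Complex.continuous_im
  have hseg : ∀ a b : ℝ, 0 ≤ a → b ≤ 1 → {z : ℂ | z.im = 0 ∧ z.re ∈ Icc a b} ⊆ unitSquare := by
    rintro a b ha hb z ⟨h1, h2⟩
    exact ⟨⟨ha.trans h2.1, h2.2.trans hb⟩, by rw [h1]; simp⟩
  have hcpt : ∀ S : Set ℂ, IsClosed S → S ⊆ unitSquare → IsCompact (ψ '' S) := fun S hS hST =>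
    (isCompact_unitSquare.of_isClosed_subset hS hST).image_of_continuousOn (hψ.mono hST)
  have hsegc : ∀ a b : ℝ, IsClosed {z : ℂ | z.im = 0 ∧ z.re ∈ Icc a b} := fun a b =>
    (isClosed_eq him continuous_const).inter (isClosed_Icc.preimage hre)
  set left := ψ '' {z | z.im = 0 ∧ z.re ∈ Icc 0 m₁} with hleft
  set mid := ψ '' {z | z.im = 0 ∧ z.re ∈ Icc m₁ m₂} with hmid
  set right := ψ '' {z | z.im = 0 ∧ z.re ∈ Icc m₂ 1} with hright
  set S3 := {z : ℂ | z ∈ unitSquare ∧ (z.re = 0 ∨ z.re = 1 ∨ z.im = 1)} with hS3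
  have hlc : IsCompact left := hcpt _ (hsegc _ _) (hseg _ _ le_rfl (by linarith))
  have hmc : IsCompact mid := hcpt _ (hsegc _ _) (hseg _ _ hm0.le hm1.le)
  have hrc : IsCompact right := hcpt _ (hsegc _ _) (hseg _ _ (by linarith) le_rfl)
  have hS3c : IsCompact (ψ '' S3) := by
    refine hcpt _ ?_ fun z hz => hz.1
    exact isClosed_unitSquare.inter ((isClosed_eq hre continuous_const).union
      ((isClosed_eq hre continuous_const).union (isClosed_eq him continuous_const)))
  have hmne : mid.Nonempty := ⟨ψ m₁, ⟨(m₁ : ℂ), ⟨by simp, by simp [hm.le]⟩, rfl⟩⟩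
  set g : X → ℝ := fun x => infDist x mid with hg
  have hgl : LipschitzWith 1 g := lipschitz_infDist_pt mid
  have hdisj3 : Disjoint (ψ '' S3) mid := by
    rw [disjoint_left]
    rintro _ ⟨z, hz, rfl⟩ ⟨w, hw, hzw⟩
    have := hinj (hseg _ _ hm0.le hm1.le hw) hz.1 hzw
    subst this
    rcases hz.2 with h | h | h
    · rw [mem_ofPred_eq, h] at hw; linarith [hw.2.1]
    · rw [mem_ofPred_eq, h] at hw; linarith [hw.2.2]
    · rw [mem_ofPred_eq, h] at hw; linarith [hw.1]
  obtain ⟨b, hb, hgb⟩ : ∃ b > 0, ∀ x ∈ ψ '' S3, b ≤ g x := by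
    have hne : (ψ '' S3).Nonempty :=
      ⟨ψ 0, 0, ⟨hseg 0 1 le_rfl le_rfl ⟨by simp, by simp⟩, by simp⟩, rfl⟩
    obtain ⟨x, hx, hmin⟩ := hS3c.exists_isMinOn hne hgl.continuous.continuousOn
    refine ⟨g x, ?_, fun y hy => hmin hy⟩
    exact (hmc.isClosed.notMem_iff_infDist_pos hmne).1 (disjoint_left.1 hdisj3 hx)
  obtain ⟨r, hr, L₀, hL₀, hcov⟩ := exists_level_cover hμ hgl hb
  set K := ψ '' unitSquare ∩ {x | g x = r} with hK
  have hKc : IsCompact K := (isCompact_unitSquare.image_of_continuousOn hψ).inter_right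
    (isClosed_eq hgl.continuous continuous_const)
  refine ⟨K, hKc, ?_, ?_⟩
  · rintro _ ⟨⟨z, hz, rfl⟩, hzr⟩
    rw [mem_ofPred_eq] at hzr
    refine ⟨z, ⟨hz, fun h => ?_, fun h => ?_⟩, rfl⟩
    · linarith [hgb _ ⟨z, ⟨hz, h⟩, rfl⟩, hr.2]
    · have : g (ψ z) = 0 := infDist_zero_of_mem ⟨z, h, rfl⟩
      linarith [hr.1]
  have hnopart : ∀ K₁ K₂ : Set X, IsClosed K₁ → IsClosed K₂ → Disjoint K₁ K₂ → K = K₁ ∪ K₂ →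
      left ∩ K ⊆ K₁ → right ∩ K ⊆ K₂ → False := by
    intro K₁ K₂ h1 h2 hd hKu hl hrr
    have hlr : Disjoint left right := by
      rw [disjoint_left]
      rintro _ ⟨z, hz, rfl⟩ ⟨w, hw, hzw⟩
      have := hinj (hseg m₂ 1 (by linarith) le_rfl hw) (hseg 0 m₁ le_rfl (by linarith) hz) hzw
      subst this
      linarith [hz.2.2, hw.2.1]
    set A := K₁ ∪ left
    set B := K₂ ∪ right
    have hA : IsClosed A := h1.union hlc.isClosed
    have hB : IsClosed B := h2.union hrc.isClosed
    have hAB : Disjoint A B := by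
      rw [disjoint_left]
      rintro x (hx | hx) (hx' | hx')
      · exact disjoint_left.1 hd hx hx'
      · exact disjoint_left.1 hd hx (hrr ⟨hx', hKu ▸ Or.inl hx⟩)
      · exact disjoint_left.1 hd (hl ⟨hx, hKu ▸ Or.inr hx'⟩) hx'
      · exact disjoint_left.1 hlr hx hx'
    have hAne : A.Nonempty := ⟨ψ 0, Or.inr ⟨0, ⟨by simp, by simp [hm0.le]⟩, rfl⟩⟩
    have hBne : B.Nonempty := ⟨ψ 1, Or.inr ⟨1, ⟨by simp, by simp [hm1.le]⟩, rfl⟩⟩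
    set h : X → ℝ := fun x => infDist x A - infDist x B
    have hh : Continuous h := (continuous_infDist_pt A).sub (continuous_infDist_pt B)
    have hhA : ∀ x ∈ A, h x < 0 := fun x hx => by
      have := (hB.notMem_iff_infDist_pos hBne).1 (disjoint_left.1 hAB hx)
      simp only [h, infDist_zero_of_mem hx]; linarith
    have hhB : ∀ x ∈ B, 0 < h x := fun x hx => by
      have := (hA.notMem_iff_infDist_pos hAne).1 (disjoint_right.1 hAB hx)
      simp only [h, infDist_zero_of_mem hx]; linarith
    obtain ⟨z, hz, hz1, hz2⟩ := exists_zero_of_four_sides (h := fun z => h (ψ z))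
      (g := fun z => g (ψ z) - r) (m₁ := m₁) (m₂ := m₂) hm0.le hm.le hm1.le
      (hh.comp_continuousOn hψ) ((hgl.continuous.comp_continuousOn hψ).sub continuousOn_const)
      (fun t ht => hhA _ (Or.inr ⟨t, ⟨by simp, by simpa using ht⟩, rfl⟩))
      (fun t ht => hhB _ (Or.inr ⟨t, ⟨by simp, by simpa using ht⟩, rfl⟩))
      (fun t ht => by
        have : g (ψ t) = 0 := infDist_zero_of_mem ⟨t, ⟨by simp, by simpa using ht⟩, rfl⟩
        linarith [hr.1])
      (fun z hz h3 => by linarith [hgb _ ⟨z, ⟨hz, h3⟩, rfl⟩, hr.2])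
    have hzK : ψ z ∈ K := ⟨⟨z, hz, rfl⟩, sub_eq_zero.1 hz2⟩
    rw [hKu] at hzK
    rcases hzK with h3 | h3
    · exact (hhA _ (Or.inl h3)).ne hz1
    · exact (hhB _ (Or.inl h3)).ne' hz1
  set L := L₀.toReal + 1 with hL
  have hLp : 0 < L := by positivity
  have hLe : L₀ + 1 = ENNReal.ofReal L := by
    rw [hL, ENNReal.ofReal_add ENNReal.toReal_nonneg zero_le_one, ENNReal.ofReal_toReal hL₀.ne,
      ENNReal.ofReal_one]
  obtain ⟨γ, hγ⟩ := exists_lipschitz_of_almost hKc hlc.isClosed hrc.isClosed (L := L) fun δ hδ => by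
    obtain ⟨t, ht, htd, hts⟩ := hcov (ENNReal.ofReal (δ / 2)) (by simpa using hδ)
    obtain ⟨u, huo, htu, hud, hus⟩ := exists_open_cover htd hts
      (η := min 1 (ENNReal.ofReal (δ / 2))) (by simp [hδ])
    have hud' : ∀ n, ediam (u n) ≤ ENNReal.ofReal δ := fun n => by
      refine (hud n).trans ((add_le_add_right (min_le_right _ _) _).trans (le_of_eq ?_))
      rw [← ENNReal.ofReal_add (by positivity) (by positivity), add_halves]
    have hus' : ∑' n, ediam (u n) ≤ ENNReal.ofReal L :=
      hus.trans ((add_le_add_right (min_le_left _ _) _).trans hLe.le)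
    rcases exists_chain_or_partition (A := left) (B := right) huo hKc
      (ht.trans (iUnion_mono htu)) hδ.le hud' hLp.le hus' with
      ⟨x, hx, y, hy, ℓ, hℓ, hch⟩ | ⟨K₁, K₂, h1, h2, h3, h4, h5, h6⟩
    · obtain ⟨γ, hγK, hγ0, hγ1, -, hγd⟩ := hch.exists_step_curve hδ.le
      refine ⟨fun s => γ (L * s), fun s _ => hγK _, ?_, ?_, fun s _ s' _ hss => ?_⟩
      · dsimp only
        rw [mul_zero, hγ0 0 le_rfl]; exact hx
      · dsimp only
        rw [mul_one, hγ1 L hℓ]; exact hy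
      · have := hγd (L * s) (L * s') (by gcongr)
        linarith
    · exact (hnopart K₁ K₂ h1 h2 h3 h4 h5 h6).elim
  exact ⟨γ, L, hLp.le, hγ⟩

end

section

open Set Metric MeasureTheory Filter Topology
open scoped ENNReal unitInterval

section ExtDist

variable {X : Type*} [MetricSpace X]

theorem extDist_le_eVariationOn {γ : ℝ → X} {a b : ℝ} (hab : a ≤ b)
    (hγ : ContinuousOn γ (Icc a b)) : extDist (γ a) (γ b) ≤ eVariationOn γ (Icc a b) := by
  set φ : I → ℝ := fun t => a + t * (b - a) with hφ
  have hm : MapsTo φ univ (Icc a b) := fun t _ => by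
    have h0 := t.2.1
    have h1 := t.2.2
    constructor <;> simp only [hφ] <;> nlinarith
  have hc : Continuous (γ ∘ φ) := hγ.comp_continuous (by fun_prop) fun t => hm (mem_univ t)
  have hmono : MonotoneOn φ univ := fun s _ t _ hst => by
    have : (s : ℝ) ≤ t := hst
    simp only [hφ]
    nlinarith
  refine le_trans ?_ (eVariationOn.comp_le_of_monotoneOn γ φ hmono hm)
  exact iInf₂_le_of_le (γ ∘ φ) hc (iInf₂_le_of_le (by simp [hφ]) (by simp [hφ]) le_rfl)

theorem exists_curve_of_extDist_lt {x y : X} {ℓ : ℝ≥0∞} (h : extDist x y < ℓ) :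
    ∃ γ : ℝ → X, Continuous γ ∧ γ 0 = x ∧ γ 1 = y ∧ eVariationOn γ (Icc 0 1) < ℓ := by
  unfold extDist at h
  simp only [iInf_lt_iff] at h
  obtain ⟨c, hc, h0, h1, hl⟩ := h
  refine ⟨IccExtend zero_le_one c, hc.Icc_extend', ?_, ?_, lt_of_le_of_lt ?_ hl⟩
  · rw [IccExtend_left]; exact h0
  · rw [IccExtend_right]; exact h1
  · exact eVariationOn.comp_le_of_monotoneOn c _
      ((monotone_projIcc zero_le_one).monotoneOn _) (mapsTo_univ _ _)

theorem edist_le_extDist (x y : X) : edist x y ≤ extDist x y := by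
  refine le_iInf₂ fun γ _ => le_iInf₂ fun h0 h1 => ?_
  rw [← h0, ← h1]
  exact eVariationOn.edist_le γ (mem_univ _) (mem_univ _)

theorem extDist_self (x : X) : extDist x x = 0 := by
  have h := extDist_le_eVariationOn (γ := fun _ => x) (zero_le_one' ℝ) continuousOn_const
  rw [eVariationOn.constant_on] at h
  · exact le_antisymm h zero_le
  · exact subsingleton_singleton.anti (by rintro _ ⟨_, _, rfl⟩; rfl)

theorem extDist_comm (x y : X) : extDist x y = extDist y x := by
  have key : ∀ x y : X, extDist y x ≤ extDist x y := by
    intro x y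
    refine le_of_forall_gt fun ℓ hℓ => ?_
    obtain ⟨γ, hγ, h0, h1, hl⟩ := exists_curve_of_extDist_lt hℓ
    have hm : MapsTo (fun t : ℝ => 1 - t) (Icc 0 1) (Icc 0 1) := fun t ht =>
      ⟨by linarith [ht.2], by linarith [ht.1]⟩
    have h2 := extDist_le_eVariationOn (γ := γ ∘ fun t => 1 - t) (zero_le_one' ℝ)
      (hγ.comp (by fun_prop)).continuousOn
    simp only [Function.comp_apply, sub_zero, sub_self, h0, h1] at h2
    refine (h2.trans (eVariationOn.comp_le_of_antitoneOn γ _ (fun s _ t _ hst => ?_) hm)).trans_lt hl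
    exact by linarith
  exact le_antisymm (key y x) (key x y)

theorem extDist_triangle (x y z : X) : extDist x z ≤ extDist x y + extDist y z := by
  rcases eq_or_ne (extDist x y) ⊤ with hx | hx
  · rw [hx]; simp
  rcases eq_or_ne (extDist y z) ⊤ with hz | hz
  · rw [hz]; simp
  refine ENNReal.le_of_forall_pos_le_add fun ε hε _ => ?_
  have hε2 : (ε / 2 : ℝ≥0∞) ≠ 0 := (ENNReal.half_pos (by exact_mod_cast hε.ne')).ne'
  obtain ⟨γ₁, hγ₁, h10, h11, hl1⟩ := exists_curve_of_extDist_lt (ENNReal.lt_add_right hx hε2)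
  obtain ⟨γ₂, hγ₂, h20, h21, hl2⟩ := exists_curve_of_extDist_lt (ENNReal.lt_add_right hz hε2)
  set f : ℝ → X := fun t => if t ≤ 1 then γ₁ t else γ₂ (t - 1) with hf
  have hfc : Continuous f := by
    refine Continuous.if_le hγ₁ (hγ₂.comp (by fun_prop)) continuous_id continuous_const ?_
    intro t ht
    simp [show t = 1 from ht, h11, h20]
  have h01 : eVariationOn f (Icc 0 1) = eVariationOn γ₁ (Icc 0 1) :=
    eVariationOn.eq_of_eqOn fun t ht => if_pos ht.2
  have h12 : eVariationOn f (Icc 1 2) ≤ eVariationOn γ₂ (Icc 0 1) := by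
    have : EqOn f (γ₂ ∘ fun t => t - 1) (Icc 1 2) := fun t ht => by
      rcases ht.1.eq_or_lt with h | h
      · simp [hf, ← h, h11, h20]
      · simp [hf, not_le.2 h]
    rw [eVariationOn.eq_of_eqOn this]
    refine eVariationOn.comp_le_of_monotoneOn γ₂ _ (fun s _ t _ hst => ?_) fun t ht =>
      ⟨by linarith [ht.1], by linarith [ht.2]⟩
    exact by linarith
  have h02 := extDist_le_eVariationOn (γ := f) (a := 0) (b := 2) (by norm_num) hfc.continuousOn
  have hadd := eVariationOn.Icc_add_Icc f (s := univ) (a := 0) (b := 1) (c := 2) (by norm_num)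
    (by norm_num) (mem_univ _)
  simp only [univ_inter] at hadd
  have hf0 : f 0 = x := by simp [hf, h10]
  have hf2 : f 2 = z := by
    simp only [hf]; rw [if_neg (by norm_num), show (2 : ℝ) - 1 = 1 by norm_num, h21]
  rw [hf0, hf2, ← hadd, h01] at h02
  calc extDist x z ≤ eVariationOn γ₁ (Icc 0 1) + eVariationOn f (Icc 1 2) := h02
    _ ≤ (extDist x y + ε / 2) + (extDist y z + ε / 2) :=
        add_le_add hl1.le (h12.trans hl2.le)
    _ = extDist x y + extDist y z + ε := by
        rw [add_add_add_comm, ENNReal.add_halves]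

/-- A curve of length at most `ℓ` can be run through with Lipschitz constant `ℓ`. -/
theorem exists_lipschitz_reparametrization {γ : ℝ → X} (hγ : Continuous γ) {ℓ : ℝ} (hℓ : 0 ≤ ℓ)
    (h : eVariationOn γ (Icc 0 1) ≤ ENNReal.ofReal ℓ) :
    ∃ c : ℝ → X, c 0 = γ 0 ∧ c 1 = γ 1 ∧ ∀ s ∈ Icc (0 : ℝ) 1, ∀ s' ∈ Icc (0 : ℝ) 1, s ≤ s' →
      dist (c s) (c s') ≤ ℓ * (s' - s) := by
  set v : ℝ → ℝ≥0∞ := fun t => eVariationOn γ (Icc 0 t) with hv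
  have hvadd : ∀ t t', 0 ≤ t → t ≤ t' → v t + eVariationOn γ (Icc t t') = v t' := by
    intro t t' h0 htt
    have := eVariationOn.Icc_add_Icc γ (s := univ) h0 htt (mem_univ _)
    simpa only [univ_inter] using this
  have hv0 : v 0 = 0 := by
    simp only [hv, Icc_self]
    exact eVariationOn.subsingleton _ subsingleton_singleton
  set E : ℝ → Set ℝ := fun s => {t ∈ Icc (0 : ℝ) 1 | v t ≤ ENNReal.ofReal (s * ℓ)} with hE
  have hE0 : ∀ s, (0 : ℝ) ∈ E s := fun s => ⟨by simp, by rw [hv0]; exact zero_le⟩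
  have hEb : ∀ s, BddAbove (E s) := fun s => ⟨1, fun t ht => ht.1.2⟩
  set τ : ℝ → ℝ := fun s => sSup (E s) with hτ
  have hτ0 : ∀ s, 0 ≤ τ s := fun s => le_csSup (hEb s) (hE0 s)
  have hτ1 : ∀ s, τ s ≤ 1 := fun s => csSup_le ⟨0, hE0 s⟩ fun t ht => ht.1.2
  refine ⟨fun s => γ (τ s), ?_, ?_, ?_⟩
  · rcases (hτ0 0).eq_or_lt with h0 | h0
    · simp only [← h0]
    · have hcl : IsClosed {t | γ t = γ 0} := isClosed_eq hγ continuous_const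
      have hsub : Ioo 0 (τ 0) ⊆ {t | γ t = γ 0} := by
        intro t ht
        obtain ⟨t', ht', htt⟩ := exists_lt_of_lt_csSup ⟨0, hE0 0⟩ ht.2
        have h1 := ht'.2
        rw [zero_mul, ENNReal.ofReal_zero, ← hvadd t t' ht.1.le htt.le] at h1
        have h2 : v t = 0 := le_antisymm (le_self_add.trans h1) zero_le
        have h3 : edist (γ t) (γ 0) ≤ v t :=
          eVariationOn.edist_le γ ⟨ht.1.le, le_rfl⟩ ⟨le_rfl, ht.1.le⟩
        rw [h2] at h3
        exact edist_le_zero.1 h3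
      have := closure_minimal hsub hcl
      rw [closure_Ioo h0.ne] at this
      exact this ⟨h0.le, le_rfl⟩
  · have : τ 1 = 1 := le_antisymm (hτ1 1) (le_csSup (hEb 1) ⟨by simp, by rwa [one_mul]⟩)
    simp only [this]
  · intro s hs s' hs' hss
    have hmono : τ s ≤ τ s' := by
      refine csSup_le_csSup (hEb s') ⟨0, hE0 s⟩ fun t ht => ⟨ht.1, ht.2.trans ?_⟩
      exact ENNReal.ofReal_le_ofReal (by gcongr)
    rcases hmono.eq_or_lt with heq | hlt
    · simp only [heq, dist_self]
      exact mul_nonneg hℓ (by linarith)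
    have key : ∀ t t', τ s < t → t < t' → t' < τ s' → dist (γ t) (γ t') ≤ ℓ * (s' - s) := by
      intro t t' h1 h2 h3
      have ht0 : 0 ≤ t := (hτ0 s).trans h1.le
      have ht1 : t ≤ 1 := by linarith [hτ1 s']
      have h4 : ENNReal.ofReal (s * ℓ) < v t := by
        by_contra! hc
        exact absurd (le_csSup (hEb s) ⟨⟨ht0, ht1⟩, hc⟩) (not_le.2 h1)
      obtain ⟨t'', ht'', htt⟩ := exists_lt_of_lt_csSup ⟨0, hE0 s'⟩ h3
      have h5 : v t' ≤ ENNReal.ofReal (s' * ℓ) := by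
        refine le_trans ?_ ht''.2
        rw [← hvadd t' t'' (ht0.trans h2.le) htt.le]
        exact le_self_add
      have h6 : edist (γ t) (γ t') ≤ eVariationOn γ (Icc t t') :=
        eVariationOn.edist_le γ ⟨le_rfl, h2.le⟩ ⟨h2.le, le_rfl⟩
      have h7 : ENNReal.ofReal (s * ℓ) + edist (γ t) (γ t') ≤ ENNReal.ofReal (s' * ℓ) := by
        refine le_trans (add_le_add h4.le h6) ?_
        rw [hvadd t t' ht0 h2.le]; exact h5
      rw [edist_dist, ← ENNReal.ofReal_add (mul_nonneg hs.1 hℓ) dist_nonneg,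
        ENNReal.ofReal_le_ofReal_iff (mul_nonneg hs'.1 hℓ)] at h7
      linarith
    have key2 : ∀ t' ∈ Ioo (τ s) (τ s'), dist (γ (τ s)) (γ t') ≤ ℓ * (s' - s) := by
      intro t' ht'
      have hcl : IsClosed {t | dist (γ t) (γ t') ≤ ℓ * (s' - s)} :=
        isClosed_le (hγ.dist continuous_const) continuous_const
      have := closure_minimal (fun t (ht : t ∈ Ioo (τ s) t') => key t t' ht.1 ht.2 ht'.2) hcl
      rw [closure_Ioo ht'.1.ne] at this
      exact this ⟨le_rfl, ht'.1.le⟩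
    have hcl : IsClosed {t | dist (γ (τ s)) (γ t) ≤ ℓ * (s' - s)} :=
      isClosed_le (continuous_const.dist hγ) continuous_const
    have := closure_minimal (fun t (ht : t ∈ Ioo (τ s) (τ s')) => key2 t ht) hcl
    rw [closure_Ioo hlt.ne] at this
    exact this ⟨hlt.le, le_rfl⟩

theorem lipschitzOnWith_of_dist_le {γ : ℝ → X} {D : ℝ} (hD : 0 ≤ D)
    (h : ∀ s ∈ Icc (0 : ℝ) 1, ∀ s' ∈ Icc (0 : ℝ) 1, dist (γ s) (γ s') ≤ D * |s - s'|) :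
    LipschitzOnWith D.toNNReal γ (Icc 0 1) := by
  refine LipschitzOnWith.of_dist_le_mul fun s hs t ht => ?_
  rw [Real.coe_toNNReal D hD]
  exact h s hs t ht

theorem eVariationOn_le_of_lipschitz {γ : ℝ → X} {D : ℝ} (hD : 0 ≤ D)
    (h : ∀ s ∈ Icc (0 : ℝ) 1, ∀ s' ∈ Icc (0 : ℝ) 1, dist (γ s) (γ s') ≤ D * |s - s'|) {s t : ℝ}
    (hs : s ∈ Icc (0 : ℝ) 1) (ht : t ∈ Icc (0 : ℝ) 1) (hst : s ≤ t) :
    eVariationOn γ (Icc s t) ≤ ENNReal.ofReal (D * (t - s)) := by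
  have hlip := (lipschitzOnWith_of_dist_le hD h).mono (Icc_subset_Icc hs.1 ht.2)
  refine (hlip.comp_eVariationOn_le (g := id) (s := Icc s t) fun x hx => hx).trans (le_of_eq ?_)
  have h2 := (monotone_id.monotoneOn (Icc s t)).eVariationOn_eq (a := s) (b := t) ⟨le_rfl, hst⟩
    ⟨hst, le_rfl⟩
  rw [inter_self] at h2
  rw [ENNReal.ofReal_mul hD, h2]
  rfl

theorem extDist_le_of_lipschitz {γ : ℝ → X} {D : ℝ} (hD : 0 ≤ D)
    (h : ∀ s ∈ Icc (0 : ℝ) 1, ∀ s' ∈ Icc (0 : ℝ) 1, dist (γ s) (γ s') ≤ D * |s - s'|) {s t : ℝ}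
    (hs : s ∈ Icc (0 : ℝ) 1) (ht : t ∈ Icc (0 : ℝ) 1) :
    extDist (γ s) (γ t) ≤ ENNReal.ofReal (D * |s - t|) := by
  have key : ∀ s t : ℝ, s ∈ Icc (0 : ℝ) 1 → t ∈ Icc (0 : ℝ) 1 → s ≤ t →
      extDist (γ s) (γ t) ≤ ENNReal.ofReal (D * (t - s)) := fun s t hs ht hst =>
    (extDist_le_eVariationOn hst ((lipschitzOnWith_of_dist_le hD h).continuousOn.mono
      (Icc_subset_Icc hs.1 ht.2))).trans (eVariationOn_le_of_lipschitz hD h hs ht hst)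
  rcases le_total s t with hst | hst
  · rw [abs_sub_comm, abs_of_nonneg (sub_nonneg.2 hst)]; exact key s t hs ht hst
  · rw [abs_of_nonneg (sub_nonneg.2 hst), extDist_comm]; exact key t s ht hs hst

/-- A constant speed parametrization of a `d̄`-geodesic arc of length `D` by `[0,1]`. -/
def IsGeoParam (γ : ℝ → X) (D : ℝ) : Prop :=
  0 < D ∧ ∀ s ∈ Icc (0 : ℝ) 1, ∀ t ∈ Icc (0 : ℝ) 1,
    extDist (γ s) (γ t) = ENNReal.ofReal (D * |s - t|)

theorem exists_isGeoParam {p q : X} (hpq : p ≠ q) {ρ : ℝ} (h : extDist p q < ENNReal.ofReal ρ)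
    (hK : IsCompact (closedBall p ρ)) :
    ∃ γ D, IsGeoParam γ D ∧ D < ρ ∧ γ 0 = p ∧ γ 1 = q := by
  have hfin : extDist p q ≠ ⊤ := ne_top_of_lt h
  have hpos : 0 < extDist p q := lt_of_lt_of_le (edist_pos.2 hpq) (edist_le_extDist p q)
  set D := (extDist p q).toReal with hD
  have hD0 : 0 < D := ENNReal.toReal_pos hpos.ne' hfin
  have hDe : ENNReal.ofReal D = extDist p q := ENNReal.ofReal_toReal hfin
  have hDρ : D < ρ := by
    rw [← hDe] at h
    exact (ENNReal.ofReal_lt_ofReal_iff_of_nonneg hD0.le).1 h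
  obtain ⟨γ, -, h0, h1, hγ⟩ := exists_lipschitz_of_almost hK (isClosed_singleton (x := p))
    (isClosed_singleton (x := q)) (L := D) fun δ hδ => by
      obtain ⟨ℓ, hℓ1, hℓ2⟩ := exists_between (lt_min (show D < D + δ by linarith) hDρ)
      have hℓ0 : 0 < ℓ := hD0.trans hℓ1
      obtain ⟨c, hc, hc0, hc1, hcl⟩ := exists_curve_of_extDist_lt (x := p) (y := q)
        (ℓ := ENNReal.ofReal ℓ) (by rw [← hDe]; exact (ENNReal.ofReal_lt_ofReal_iff hℓ0).2 hℓ1)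
      obtain ⟨c', hc'0, hc'1, hc'⟩ := exists_lipschitz_reparametrization hc hℓ0.le hcl.le
      refine ⟨c', fun s hs => ?_, by rw [hc'0, hc0]; rfl, by rw [hc'1, hc1]; rfl,
        fun s hs s' hs' hss => ?_⟩
      · have := hc' 0 (by simp) s hs hs.1
        rw [hc'0, hc0] at this
        rw [mem_closedBall, dist_comm]
        have h2 := min_le_right (D + δ) ρ
        nlinarith [hs.1, hs.2]
      · have h2 := min_le_left (D + δ) ρ
        refine (hc' s hs s' hs' hss).trans ?_
        nlinarith [hs.1, hs'.2]
  rw [mem_singleton_iff] at h0 h1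
  have hle : ∀ s ∈ Icc (0 : ℝ) 1, ∀ t ∈ Icc (0 : ℝ) 1,
      extDist (γ s) (γ t) ≤ ENNReal.ofReal (D * |s - t|) := fun s hs t ht =>
    extDist_le_of_lipschitz hD0.le hγ hs ht
  have key : ∀ s ∈ Icc (0 : ℝ) 1, ∀ t ∈ Icc (0 : ℝ) 1, s ≤ t →
      ENNReal.ofReal (D * (t - s)) ≤ extDist (γ s) (γ t) := by
    intro s hs t ht hst
    have h2 := hle 0 (by simp) s hs
    have h3 := hle t ht 1 (by simp)
    rw [abs_sub_comm, sub_zero, abs_of_nonneg hs.1, h0] at h2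
    rw [abs_sub_comm, abs_of_nonneg (by linarith [ht.2]), h1] at h3
    have h4 : ENNReal.ofReal D ≤ ENNReal.ofReal (D * s) + (extDist (γ s) (γ t) +
        ENNReal.ofReal (D * (1 - t))) := by
      rw [hDe]
      refine (extDist_triangle p (γ s) q).trans (add_le_add h2 ?_)
      exact (extDist_triangle (γ s) (γ t) q).trans (add_le_add le_rfl h3)
    have hef : extDist (γ s) (γ t) ≠ ⊤ := ne_top_of_le_ne_top ENNReal.ofReal_ne_top (hle s hs t ht)
    rw [← ENNReal.ofReal_toReal hef] at h4 ⊢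
    have hn := ENNReal.toReal_nonneg (a := extDist (γ s) (γ t))
    have hn1 : 0 ≤ D * s := mul_nonneg hD0.le hs.1
    have hn2 : 0 ≤ D * (1 - t) := mul_nonneg hD0.le (by linarith [ht.2])
    rw [← ENNReal.ofReal_add hn hn2, ← ENNReal.ofReal_add hn1 (by positivity),
      ENNReal.ofReal_le_ofReal_iff (by positivity)] at h4
    refine ENNReal.ofReal_le_ofReal ?_
    linarith
  refine ⟨γ, D, ⟨hD0, fun s hs t ht => le_antisymm (hle s hs t ht) ?_⟩, hDρ, h0, h1⟩
  rcases le_total s t with hst | hst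
  · rw [abs_sub_comm, abs_of_nonneg (sub_nonneg.2 hst)]; exact key s hs t ht hst
  · rw [abs_of_nonneg (sub_nonneg.2 hst), extDist_comm]; exact key t ht s hs hst

theorem IsGeoParam.dist_le {γ : ℝ → X} {D : ℝ} (h : IsGeoParam γ D) {s t : ℝ}
    (hs : s ∈ Icc (0 : ℝ) 1) (ht : t ∈ Icc (0 : ℝ) 1) : dist (γ s) (γ t) ≤ D * |s - t| := by
  have h1 := edist_le_extDist (γ s) (γ t)
  rw [h.2 s hs t ht, edist_dist] at h1
  exact (ENNReal.ofReal_le_ofReal_iff (mul_nonneg h.1.le (abs_nonneg _))).1 h1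

theorem IsGeoParam.continuousOn {γ : ℝ → X} {D : ℝ} (h : IsGeoParam γ D) :
    ContinuousOn γ (Icc 0 1) :=
  (lipschitzOnWith_of_dist_le h.1.le fun _ hs _ ht => h.dist_le hs ht).continuousOn

theorem IsGeoParam.injOn {γ : ℝ → X} {D : ℝ} (h : IsGeoParam γ D) : InjOn γ (Icc 0 1) := by
  intro s hs t ht hst
  have h1 := h.2 s hs t ht
  rw [hst, extDist_self, eq_comm, ENNReal.ofReal_eq_zero] at h1
  have h2 : |s - t| ≤ 0 := by
    by_contra! hc
    linarith [mul_pos h.1 hc]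
  linarith [abs_nonpos_iff.1 h2]

/-- The image of an injective `d̄`-geodesic, through a constant speed parametrization. -/
def GeoSet (G : Set X) (p q : X) : Prop :=
  ∃ γ D, IsGeoParam γ D ∧ γ 0 = p ∧ γ 1 = q ∧ G = γ '' Icc 0 1

theorem IsGeoParam.geoSet_Icc {γ : ℝ → X} {D : ℝ} (h : IsGeoParam γ D) {a b : ℝ} (ha : 0 ≤ a)
    (hab : a < b) (hb : b ≤ 1) : GeoSet (γ '' Icc a b) (γ a) (γ b) := by
  have hba : 0 < b - a := by linarith
  have hm : ∀ t ∈ Icc (0 : ℝ) 1, a + t * (b - a) ∈ Icc a b := fun t ht =>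
    ⟨by nlinarith [ht.1], by nlinarith [ht.2]⟩
  have hm' : ∀ t ∈ Icc (0 : ℝ) 1, a + t * (b - a) ∈ Icc (0 : ℝ) 1 := fun t ht =>
    ⟨ha.trans (hm t ht).1, (hm t ht).2.trans hb⟩
  refine ⟨fun t => γ (a + t * (b - a)), D * (b - a), ⟨mul_pos h.1 hba, fun s hs t ht => ?_⟩, by simp,
    by simp, ?_⟩
  · simp only [h.2 _ (hm' s hs) _ (hm' t ht)]
    congr 1
    rw [show a + s * (b - a) - (a + t * (b - a)) = (b - a) * (s - t) by ring, abs_mul,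
      abs_of_pos hba]
    ring
  · ext x
    constructor
    · rintro ⟨u, hu, rfl⟩
      refine ⟨(u - a) / (b - a), ⟨div_nonneg (by linarith [hu.1]) hba.le,
        (div_le_one hba).2 (by linarith [hu.2])⟩, ?_⟩
      simp only
      congr 1
      field_simp
      ring
    · rintro ⟨t, ht, rfl⟩
      exact ⟨_, hm t ht, rfl⟩

theorem GeoSet.isGeodesicArc {G : Set X} {p q : X} (h : GeoSet G p q) : IsGeodesicArc G p q := by
  obtain ⟨γ, D, hγ, rfl, rfl, rfl⟩ := h
  have hc : Continuous fun t : I => γ t :=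
    hγ.continuousOn.comp_continuous continuous_subtype_val fun t => t.2
  have hle : curveLength (fun t : I => γ t) ≤ ENNReal.ofReal D := by
    refine (eVariationOn.comp_le_of_monotoneOn γ (t := univ) (s := Icc 0 1) (fun t : I => (t : ℝ))
      (fun s _ t _ hst => hst) fun t _ => t.2).trans ?_
    simpa using eVariationOn_le_of_lipschitz hγ.1.le (fun s hs t ht => hγ.dist_le hs ht)
      (s := 0) (t := 1) (by simp) (by simp) zero_le_one
  have hext : extDist (γ 0) (γ 1) = ENNReal.ofReal D := by
    rw [hγ.2 0 (by simp) 1 (by simp)]; simp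
  refine ⟨fun t => γ t, ⟨hc, hle.trans_lt ENNReal.ofReal_lt_top, le_antisymm ?_ ?_⟩, ?_, by simp,
    by simp, ?_⟩
  · simpa [hext] using hle
  · exact iInf₂_le_of_le _ hc (iInf₂_le_of_le rfl rfl le_rfl)
  · intro s t hst
    exact Subtype.ext (hγ.injOn s.2 t.2 hst)
  · ext x
    simp

theorem GeoSet.isCompact {G : Set X} {p q : X} (h : GeoSet G p q) : IsCompact G := by
  obtain ⟨γ, D, hγ, rfl, rfl, rfl⟩ := h
  exact isCompact_Icc.image_of_continuousOn hγ.continuousOn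

end ExtDist

end

section

open Set Metric MeasureTheory Filter Topology
open scoped ENNReal unitInterval

section PolyArc

variable {X : Type*} [MetricSpace X]

/-- Arcs composed of finitely many `d̄`-geodesic arcs. -/
inductive PolyArc : Set X → X → X → Prop
  | single {G : Set X} {a b : X} (h : GeoSet G a b) : PolyArc G a b
  | cons {G S : Set X} {a m b : X} (hG : GeoSet G a m) (hS : PolyArc S m b) (h : G ∩ S = {m}) :
      PolyArc (G ∪ S) a b

theorem PolyArc.exists_param {S : Set X} {a b : X} (h : PolyArc S a b) :
    ∃ c : ℝ → X, ContinuousOn c (Icc 0 1) ∧ InjOn c (Icc 0 1) ∧ c 0 = a ∧ c 1 = b ∧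
      S = c '' Icc 0 1 := by
  induction h with
  | single h =>
    obtain ⟨γ, D, hγ, h0, h1, rfl⟩ := h
    exact ⟨γ, hγ.continuousOn, hγ.injOn, h0, h1, rfl⟩
  | @cons G S a m b hG hS h ih =>
    obtain ⟨γ, D, hγ, hγ0, hγ1, rfl⟩ := hG
    obtain ⟨c, hc, hci, hc0, hc1, rfl⟩ := ih
    have hm1 : ∀ t ∈ Icc (0 : ℝ) (1 / 2), 2 * t ∈ Icc (0 : ℝ) 1 := fun t ht =>
      ⟨by linarith [ht.1], by linarith [ht.2]⟩
    have hm2 : ∀ t ∈ Icc (1 / 2 : ℝ) 1, 2 * t - 1 ∈ Icc (0 : ℝ) 1 := fun t ht =>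
      ⟨by linarith [ht.1], by linarith [ht.2]⟩
    have h01 : Icc (0 : ℝ) 1 = Icc 0 (1 / 2) ∪ Icc (1 / 2) 1 :=
      (Icc_union_Icc_eq_Icc (by norm_num) (by norm_num)).symm
    set f : ℝ → X := fun t => if t ≤ 1 / 2 then γ (2 * t) else c (2 * t - 1) with hf
    have hf1 : EqOn f (fun t => γ (2 * t)) (Icc 0 (1 / 2)) := fun t ht => if_pos ht.2
    have hf2 : EqOn f (fun t => c (2 * t - 1)) (Icc (1 / 2) 1) := fun t ht => by
      rcases ht.1.eq_or_lt with h | h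
      · simp [hf, ← h, hγ1, hc0]
      · exact if_neg (not_le.2 h)
    have key : ∀ t ∈ Icc (0 : ℝ) (1 / 2), ∀ t' ∈ Icc (1 / 2 : ℝ) 1, f t = f t' → t = t' := by
      intro t ht t' ht' htt
      rw [hf1 ht, hf2 ht'] at htt
      have hmem : γ (2 * t) ∈ γ '' Icc 0 1 ∩ c '' Icc 0 1 :=
        ⟨⟨_, hm1 t ht, rfl⟩, ⟨_, hm2 t' ht', htt.symm⟩⟩
      rw [h, mem_singleton_iff] at hmem
      have h1 := hγ.injOn (hm1 t ht) (show (1 : ℝ) ∈ Icc (0 : ℝ) 1 by simp) (hmem.trans hγ1.symm)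
      have h2 := hci (hm2 t' ht') (show (0 : ℝ) ∈ Icc (0 : ℝ) 1 by simp)
        (htt.symm.trans (hmem.trans hc0.symm))
      linarith
    refine ⟨f, ?_, ?_, ?_, ?_, ?_⟩
    · rw [h01]
      refine ContinuousOn.union_of_isClosed ?_ ?_ isClosed_Icc isClosed_Icc
      · exact (hγ.continuousOn.comp (by fun_prop) hm1).congr hf1
      · exact (hc.comp (by fun_prop) hm2).congr hf2
    · intro t ht t' ht' htt
      rw [h01] at ht ht'
      rcases ht with ht | ht <;> rcases ht' with ht' | ht'
      · rw [hf1 ht, hf1 ht'] at htt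
        linarith [hγ.injOn (hm1 t ht) (hm1 t' ht') htt]
      · exact key t ht t' ht' htt
      · exact (key t' ht' t ht htt.symm).symm
      · rw [hf2 ht, hf2 ht'] at htt
        linarith [hci (hm2 t ht) (hm2 t' ht') htt]
    · rw [hf1 ⟨le_rfl, by norm_num⟩]; simp [hγ0]
    · rw [hf2 ⟨by norm_num, le_rfl⟩]; norm_num [hc1]
    · conv_rhs => rw [h01, image_union, hf1.image_eq, hf2.image_eq]
      congr 1
      · ext x
        constructor
        · rintro ⟨u, hu, rfl⟩
          exact ⟨u / 2, ⟨by linarith [hu.1], by linarith [hu.2]⟩, by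
            simp only; congr 1; ring⟩
        · rintro ⟨t, ht, rfl⟩; exact ⟨_, hm1 t ht, rfl⟩
      · ext x
        constructor
        · rintro ⟨u, hu, rfl⟩
          exact ⟨(u + 1) / 2, ⟨by linarith [hu.1], by linarith [hu.2]⟩, by
            simp only; congr 1; ring⟩
        · rintro ⟨t, ht, rfl⟩; exact ⟨_, hm2 t ht, rfl⟩

theorem PolyArc.isCompact {S : Set X} {a b : X} (h : PolyArc S a b) : IsCompact S := by
  obtain ⟨c, hc, -, -, -, rfl⟩ := h.exists_param
  exact isCompact_Icc.image_of_continuousOn hc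

/-- A preconnected set covered by two closed sets and avoiding their intersection lies in one. -/
theorem IsPreconnected.subset_or_subset_of_closed {Z : Type*} [TopologicalSpace Z] {P A B : Set Z}
    (hP : IsPreconnected P) (hA : IsClosed A) (hB : IsClosed B) (hPAB : P ⊆ A ∪ B)
    (h : P ∩ (A ∩ B) = ∅) : P ⊆ A ∨ P ⊆ B := by
  by_contra! hc
  obtain ⟨⟨x, hx, hxA⟩, ⟨y, hy, hyB⟩⟩ := not_subset.1 hc.1, not_subset.1 hc.2
  have := isPreconnected_closed_iff.1 hP A B hA hB hPAB
    ⟨y, hy, (hPAB hy).resolve_right hyB⟩ ⟨x, hx, (hPAB hx).resolve_left hxA⟩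
  rw [h] at this
  exact this.ne_empty rfl

theorem PolyArc.exists_vertices {S : Set X} {a b : X} (h : PolyArc S a b) :
    ∃ V : Set X, V.Finite ∧ a ∈ V ∧ b ∈ V ∧ ∀ P : Set X, IsPreconnected P → P ⊆ S \ V →
      ∃ G ⊆ S, ∃ p q, GeoSet G p q ∧ P ⊆ G := by
  induction h with
  | @single G a b h =>
    exact ⟨{a, b}, by simp, by simp, by simp, fun P _ hPS => ⟨G, le_rfl, a, b, h,
      hPS.trans sdiff_subset⟩⟩
  | @cons G S a m b hG hS h ih =>
    obtain ⟨V, hV, hmV, hbV, H⟩ := ih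
    refine ⟨insert a V, hV.insert a, mem_insert _ _, mem_insert_of_mem _ hbV, fun P hP hPS => ?_⟩
    rcases hP.subset_or_subset_of_closed hG.isCompact.isClosed hS.isCompact.isClosed
      (hPS.trans sdiff_subset) (by
        rw [h, inter_singleton_eq_empty]
        exact fun hm => (hPS hm).2 (mem_insert_of_mem _ hmV)) with h1 | h1
    · exact ⟨G, subset_union_left, a, m, hG, h1⟩
    · obtain ⟨G', hG', p, q, hpq, hPG⟩ := H P hP fun x hx =>
        ⟨h1 hx, fun hxV => (hPS hx).2 (mem_insert_of_mem _ hxV)⟩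
      exact ⟨G', hG'.trans subset_union_right, p, q, hpq, hPG⟩

theorem IsGeoParam.exists_last_hit {γ : ℝ → X} {D : ℝ} (h : IsGeoParam γ D) {A : Set X}
    (hA : IsClosed A) (h0 : γ 0 ∈ A) {t : ℝ} (ht : t ∈ Icc (0 : ℝ) 1) (htA : γ t ∉ A) :
    ∃ s ∈ Ico 0 t, γ s ∈ A ∧ ∀ u ∈ Ioc s t, γ u ∉ A := by
  have hsub : Icc 0 t ⊆ Icc 0 1 := Icc_subset_Icc_right ht.2
  have hcl : IsCompact (Icc 0 t ∩ γ ⁻¹' A) :=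
    isCompact_Icc.of_isClosed_subset
      ((h.continuousOn.mono hsub).preimage_isClosed_of_isClosed isClosed_Icc hA) inter_subset_left
  obtain ⟨s, ⟨hs, hsA⟩, hmax⟩ := hcl.exists_isGreatest ⟨0, ⟨le_rfl, ht.1⟩, h0⟩
  refine ⟨s, ⟨hs.1, lt_of_le_of_ne hs.2 fun hst => htA (hst ▸ hsA)⟩, hsA, fun u hu huA => ?_⟩
  exact absurd (hmax ⟨⟨hs.1.trans hu.1.le, hu.2⟩, huA⟩) (not_le.2 hu.1)

theorem IsGeoParam.exists_first_hit {γ : ℝ → X} {D : ℝ} (h : IsGeoParam γ D) {B : Set X}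
    (hB : IsClosed B) (hne : (γ '' Icc 0 1 ∩ B).Nonempty) :
    ∃ t ∈ Icc (0 : ℝ) 1, γ t ∈ B ∧ ∀ u ∈ Ico 0 t, γ u ∉ B := by
  have hcl : IsCompact (Icc 0 1 ∩ γ ⁻¹' B) :=
    isCompact_Icc.of_isClosed_subset
      (h.continuousOn.preimage_isClosed_of_isClosed isClosed_Icc hB) inter_subset_left
  obtain ⟨_, ⟨u, hu, rfl⟩, huB⟩ := hne
  obtain ⟨t, ⟨ht, htB⟩, hmin⟩ := hcl.exists_isLeast ⟨u, hu, huB⟩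
  exact ⟨t, ht, htB, fun u hu huB => absurd (hmin ⟨⟨hu.1, hu.2.le.trans ht.2⟩, huB⟩)
    (not_le.2 hu.2)⟩

/-- Loop erasure: a finite concatenation of geodesics from `A` to `B` contains a polygonal arc
meeting `A` and `B` only at its endpoints. -/
theorem exists_polyArc_of_reflTransGen {U : Set X} {x z : X}
    (h : Relation.ReflTransGen (fun x y => ∃ G ⊆ U, GeoSet G x y) x z) :
    ∀ A B : Set X, IsClosed A → IsClosed B → Disjoint A B → x ∈ A → z ∈ B →
      ∃ S ⊆ U, ∃ a ∈ A, ∃ b ∈ B, PolyArc S a b ∧ S ∩ A = {a} ∧ S ∩ B = {b} := by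
  induction h using Relation.ReflTransGen.head_induction_on with
  | refl =>
    intro A B _ _ hd hxA hzB
    exact absurd hzB (disjoint_left.1 hd hxA)
  | @head x y hxy hyz ih =>
    intro A B hA hB hd hxA hzB
    obtain ⟨G, hGU, γ, D, hγ, hγ0, hγ1, rfl⟩ := hxy
    have h0A : γ 0 ∈ A := hγ0 ▸ hxA
    have himg : ∀ s t, 0 ≤ s → t ≤ 1 → γ '' Icc s t ⊆ γ '' Icc 0 1 := fun s t hs ht =>
      image_mono (Icc_subset_Icc hs ht)
    by_cases hne : (γ '' Icc 0 1 ∩ B).Nonempty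
    · obtain ⟨t, ht, htB, htu⟩ := hγ.exists_first_hit hB hne
      obtain ⟨s, hs, hsA, hsu⟩ := hγ.exists_last_hit hA h0A ht (disjoint_right.1 hd htB)
      refine ⟨γ '' Icc s t, (himg s t hs.1 ht.2).trans hGU, γ s, hsA, γ t, htB,
        .single (hγ.geoSet_Icc hs.1 hs.2 ht.2), ?_, ?_⟩
      · ext w
        constructor
        · rintro ⟨⟨u, hu, rfl⟩, hw⟩
          rcases hu.1.eq_or_lt with h1 | h1
          · rw [h1]; rfl
          · exact absurd hw (hsu u ⟨h1, hu.2⟩)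
        · rintro rfl
          exact ⟨⟨s, ⟨le_rfl, hs.2.le⟩, rfl⟩, hsA⟩
      · ext w
        constructor
        · rintro ⟨⟨u, hu, rfl⟩, hw⟩
          rcases hu.2.eq_or_lt with h1 | h1
          · rw [h1]; rfl
          · exact absurd hw (htu u ⟨hs.1.trans hu.1, h1⟩)
        · rintro rfl
          exact ⟨⟨t, ⟨hs.2.le, le_rfl⟩, rfl⟩, htB⟩
    · have hGB : Disjoint (γ '' Icc 0 1) B := disjoint_iff_inter_eq_empty.2
        (not_nonempty_iff_eq_empty.1 hne)
      have hGc : IsClosed (γ '' Icc 0 1) :=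
        (isCompact_Icc.image_of_continuousOn hγ.continuousOn).isClosed
      obtain ⟨S, hSU, a, ha, b, hb, hS, hSA, hSB⟩ := ih (A ∪ γ '' Icc 0 1) B (hA.union hGc) hB
        (disjoint_union_left.2 ⟨hd, hGB⟩) (Or.inr ⟨1, by simp, hγ1⟩) hzB
      have haS : a ∈ S := (hSA.symm.subset rfl).1
      by_cases haA : a ∈ A
      · refine ⟨S, hSU, a, haA, b, hb, hS, ?_, hSB⟩
        refine subset_antisymm (fun w hw => hSA.subset ⟨hw.1, Or.inl hw.2⟩) ?_
        rintro _ rfl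
        exact ⟨haS, haA⟩
      · obtain ⟨t, ht, rfl⟩ := ha.resolve_left haA
        obtain ⟨s, hs, hsA, hsu⟩ := hγ.exists_last_hit hA h0A ht haA
        have hsub := himg s t hs.1 ht.2
        refine ⟨γ '' Icc s t ∪ S, union_subset (hsub.trans hGU) hSU, γ s, hsA, b, hb,
          .cons (hγ.geoSet_Icc hs.1 hs.2 ht.2) hS ?_, ?_, ?_⟩
        · refine subset_antisymm (fun w hw => hSA.subset ⟨hw.2, Or.inr (hsub hw.1)⟩) ?_
          rintro _ rfl
          exact ⟨⟨t, ⟨hs.2.le, le_rfl⟩, rfl⟩, haS⟩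
        · ext w
          constructor
          · rintro ⟨⟨u, hu, rfl⟩ | hwS, hw⟩
            · rcases hu.1.eq_or_lt with h1 | h1
              · rw [h1]; rfl
              · exact absurd hw (hsu u ⟨h1, hu.2⟩)
            · have := hSA.subset ⟨hwS, Or.inl hw⟩
              rw [mem_singleton_iff] at this
              exact absurd (this ▸ hw) haA
          · rintro rfl
            exact ⟨Or.inl ⟨s, ⟨le_rfl, hs.2.le⟩, rfl⟩, hsA⟩
        · refine subset_antisymm ?_ ?_
          · rintro w ⟨hw | hwS, hw'⟩
            · exact absurd hw' (disjoint_left.1 hGB (hsub hw))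
            · exact hSB.subset ⟨hwS, hw'⟩
          · rintro _ rfl
            exact ⟨Or.inr (hSB.symm.subset rfl).1, hb⟩

end PolyArc

end

section

open Set Metric MeasureTheory Filter Topology
open scoped ENNReal unitInterval

/-- The left, right and upper sides of the unit square. -/
def threeSides : Set ℂ := {z ∈ unitSquare | z.re = 0 ∨ z.re = 1 ∨ z.im = 1}

theorem isClosed_threeSides : IsClosed threeSides :=
  isClosed_unitSquare.inter ((isClosed_eq Complex.continuous_re continuous_const).union
    ((isClosed_eq Complex.continuous_re continuous_const).union
      (isClosed_eq Complex.continuous_im continuous_const)))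

/-- The segment `[a, b]` of the real line. -/
def realSeg (a b : ℝ) : Set ℂ := {z | z.im = 0 ∧ z.re ∈ Icc a b}

theorem isClosed_realSeg (a b : ℝ) : IsClosed (realSeg a b) :=
  (isClosed_eq Complex.continuous_im continuous_const).inter
    (isClosed_Icc.preimage Complex.continuous_re)

theorem realSeg_subset_unitSquare {a b : ℝ} (ha : 0 ≤ a) (hb : b ≤ 1) :
    realSeg a b ⊆ unitSquare := by
  rintro z ⟨h1, h2⟩
  exact ⟨⟨ha.trans h2.1, h2.2.trans hb⟩, by rw [h1]; simp⟩

theorem isCompact_image_of_subset_unitSquare {X : Type*} [TopologicalSpace X] {ψ : ℂ → X}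
    (hψ : ContinuousOn ψ unitSquare) {S : Set ℂ} (hS : IsClosed S) (hST : S ⊆ unitSquare) :
    IsCompact (ψ '' S) :=
  (isCompact_unitSquare.of_isClosed_subset hS hST).image_of_continuousOn (hψ.mono hST)

/-- A subdivision of a Lipschitz curve into a chain of short geodesics. -/
theorem reflTransGen_geoSet_of_lipschitz {X : Type*} [MetricSpace X] {K : Set X} {γ : ℝ → X}
    {L η : ℝ} (hL : 0 ≤ L) (hη : 0 < η) (hK : IsCompact (cthickening η K))
    (hγK : ∀ s ∈ Icc (0 : ℝ) 1, γ s ∈ K)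
    (hγ : ∀ s ∈ Icc (0 : ℝ) 1, ∀ s' ∈ Icc (0 : ℝ) 1, dist (γ s) (γ s') ≤ L * |s - s'|) :
    Relation.ReflTransGen (fun x y => ∃ G ⊆ thickening η K, GeoSet G x y) (γ 0) (γ 1) := by
  obtain ⟨n, hn⟩ := exists_nat_gt (L / η)
  have hn0 : (0 : ℝ) < n := lt_of_le_of_lt (by positivity) hn
  have hmem : ∀ i : ℕ, i ≤ n → (i : ℝ) / n ∈ Icc (0 : ℝ) 1 := fun i hi =>
    ⟨by positivity, (div_le_one hn0).2 (by exact_mod_cast hi)⟩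
  have key : ∀ i : ℕ, i ≤ n → Relation.ReflTransGen
      (fun x y => ∃ G ⊆ thickening η K, GeoSet G x y) (γ 0) (γ ((i : ℝ) / n)) := by
    intro i
    induction i with
    | zero => intro _; simpa using Relation.ReflTransGen.refl
    | succ i ih =>
      intro hi
      have hi' : i ≤ n := by omega
      refine (ih hi').trans ?_
      rcases eq_or_ne (γ ((i : ℝ) / n)) (γ (((i + 1 : ℕ) : ℝ) / n)) with heq | hne
      · rw [heq]
      refine Relation.ReflTransGen.single ?_
      have h1 := extDist_le_of_lipschitz hL hγ (hmem i hi') (hmem (i + 1) hi)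
      have h2 : |(i : ℝ) / n - ((i + 1 : ℕ) : ℝ) / n| = 1 / n := by
        rw [abs_sub_comm, show ((i + 1 : ℕ) : ℝ) / n - (i : ℝ) / n = 1 / n by push_cast; ring,
          abs_of_pos (by positivity)]
      rw [h2] at h1
      have h3 : L * (1 / n) < η := by
        rw [mul_one_div, div_lt_iff₀ hn0]
        rw [div_lt_iff₀ hη] at hn
        linarith
      have hxK := hγK _ (hmem i hi')
      obtain ⟨c, D, hc, hD, hc0, hc1⟩ := exists_isGeoParam hne
        (h1.trans_lt ((ENNReal.ofReal_lt_ofReal_iff hη).2 h3))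
        (hK.of_isClosed_subset isClosed_closedBall (closedBall_subset_cthickening hxK η))
      refine ⟨c '' Icc 0 1, ?_, c, D, hc, hc0, hc1, rfl⟩
      rintro _ ⟨s, hs, rfl⟩
      refine mem_thickening_iff.2 ⟨_, hxK, ?_⟩
      have h4 := hc.dist_le hs (show (0 : ℝ) ∈ Icc (0 : ℝ) 1 by simp)
      rw [hc0, sub_zero, abs_of_nonneg hs.1] at h4
      nlinarith [hs.2, hc.1]
  have := key n le_rfl
  rwa [div_self hn0.ne'] at this

/-- A topological rectangle in a closed set `Y` contains a polygonal arc joining the left to the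
right part of its lower side and running in its interior otherwise. -/
theorem exists_polyArc_crossing {X : Type*} [MetricSpace X] [MeasurableSpace X] [BorelSpace X]
    [LocallyCompactSpace X] {Y : Set X} (hY : IsClosed Y) {ψ : ℂ → X}
    (hψ : ContinuousOn ψ unitSquare) (hinj : InjOn ψ unitSquare) (hψY : ψ '' unitSquare ⊆ Y)
    {m₁ m₂ : ℝ} (hm0 : 0 < m₁) (hm : m₁ < m₂) (hm1 : m₂ < 1) (hμ : μH[2] (ψ '' unitSquare) < ⊤)
    (hfr : ∀ z ∈ unitSquare, ψ z ∈ frontier Y → z ∈ frontier unitSquare)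
    (hsides : ψ '' unitSquare ∩ closure (Y \ ψ '' unitSquare) ⊆ ψ '' threeSides) :
    ∃ p ∈ Ioo 0 m₁, ∃ q ∈ Ioo m₂ 1, ∃ S : Set X, PolyArc S (ψ (p : ℝ)) (ψ (q : ℝ)) ∧
      ∀ x ∈ S, x = ψ (p : ℝ) ∨ x = ψ (q : ℝ) ∨ x ∈ ψ '' interior unitSquare := by
  obtain ⟨K, hKc, hKsub, γ, L, hL, hγK, hγ0, hγ1, hγ⟩ :=
    exists_lipschitz_crossing hψ hinj hm0 hm hm1 hμ
  have h3T : threeSides ⊆ unitSquare := fun z hz => hz.1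
  set left := ψ '' realSeg 0 m₁
  set mid := ψ '' realSeg m₁ m₂
  set right := ψ '' realSeg m₂ 1
  have hlT := realSeg_subset_unitSquare le_rfl (show m₁ ≤ 1 by linarith)
  have hmT := realSeg_subset_unitSquare hm0.le hm1.le
  have hrT := realSeg_subset_unitSquare (show 0 ≤ m₂ by linarith) le_rfl
  have hlc : IsCompact left := isCompact_image_of_subset_unitSquare hψ (isClosed_realSeg _ _) hlT
  have hmc : IsCompact mid := isCompact_image_of_subset_unitSquare hψ (isClosed_realSeg _ _) hmT
  have hrc : IsCompact right := isCompact_image_of_subset_unitSquare hψ (isClosed_realSeg _ _) hrT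
  have h3c : IsCompact (ψ '' threeSides) :=
    isCompact_image_of_subset_unitSquare hψ isClosed_threeSides h3T
  have hlr : Disjoint left right := by
    rw [disjoint_left]
    rintro _ ⟨z, hz, rfl⟩ ⟨w, hw, hzw⟩
    have := hinj (hrT hw) (hlT hz) hzw
    subst this
    linarith [hz.2.2, hw.2.1]
  obtain ⟨δ, hδ, hδd⟩ := hlr.exists_cthickenings hlc hrc.isClosed
  have hlth : left ⊆ thickening δ left := self_subset_thickening hδ _
  have hrth : right ⊆ thickening δ right := self_subset_thickening hδ _
  have hlcth : left ⊆ cthickening δ left := self_subset_cthickening _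
  have hrcth : right ⊆ cthickening δ right := self_subset_cthickening _
  -- a frontier point of the square off the three sides and the middle lies left or right
  have hbottom : ∀ z ∈ frontier unitSquare, z ∉ threeSides → z ∉ realSeg m₁ m₂ →
      (z ∈ realSeg 0 m₁ ∧ z.re ∈ Ioo 0 m₁) ∨ (z ∈ realSeg m₂ 1 ∧ z.re ∈ Ioo m₂ 1) := by
    intro z hz h3 hmid
    have hzT := isClosed_unitSquare.frontier_subset hz
    have him : z.im = 0 := by
      rcases (mem_frontier_unitSquare hzT).1 hz with h | h | h | h
      · exact absurd ⟨hzT, Or.inl h⟩ h3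
      · exact absurd ⟨hzT, Or.inr (Or.inl h)⟩ h3
      · exact h
      · exact absurd ⟨hzT, Or.inr (Or.inr h)⟩ h3
    have h0 : 0 < z.re := lt_of_le_of_ne hzT.1.1 fun h => h3 ⟨hzT, Or.inl h.symm⟩
    have h1 : z.re < 1 := lt_of_le_of_ne hzT.1.2 fun h => h3 ⟨hzT, Or.inr (Or.inl h)⟩
    rcases lt_or_ge z.re m₁ with h | h
    · exact Or.inl ⟨⟨him, h0.le, h.le⟩, h0, h⟩
    rcases lt_or_ge m₂ z.re with h' | h'
    · exact Or.inr ⟨⟨him, h'.le, h1.le⟩, h', h1⟩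
    · exact absurd ⟨him, h, h'⟩ hmid
  set A := left ∪ (closure Yᶜ ∩ cthickening δ left)
  set B := right ∪ (closure Yᶜ ∩ cthickening δ right)
  have hA : IsClosed A := hlc.isClosed.union (isClosed_closure.inter isClosed_cthickening)
  have hB : IsClosed B := hrc.isClosed.union (isClosed_closure.inter isClosed_cthickening)
  have hAsub : A ⊆ cthickening δ left := union_subset hlcth inter_subset_right
  have hBsub : B ⊆ cthickening δ right := union_subset hrcth inter_subset_right
  have hAB : Disjoint A B := hδd.mono hAsub hBsub
  set C₁ := closure (Y \ ψ '' unitSquare) ∪ ψ '' threeSides ∪ mid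
  set C₂ := closure Yᶜ \ (thickening δ left ∪ thickening δ right)
  have hC : IsClosed (C₁ ∪ C₂) := ((isClosed_closure.union h3c.isClosed).union hmc.isClosed).union
    (isClosed_closure.sdiff (isOpen_thickening.union isOpen_thickening))
  have hKC : Disjoint K (C₁ ∪ C₂) := by
    rw [disjoint_left]
    intro x hx hxC
    obtain ⟨z, ⟨hzT, hz3, hzm⟩, rfl⟩ := hKsub hx
    have hz3' : z ∉ threeSides := fun h => hz3 h.2
    have hnot3 : ψ z ∉ ψ '' threeSides := by
      rintro ⟨w, hw, hwz⟩
      exact hz3' (hinj (h3T hw) hzT hwz ▸ hw)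
    rcases hxC with ((h | h) | h) | ⟨h1, h2⟩
    · exact hnot3 (hsides ⟨⟨z, hzT, rfl⟩, h⟩)
    · exact hnot3 h
    · obtain ⟨w, hw, hwz⟩ := h
      exact hzm (hinj (hmT hw) hzT hwz ▸ hw)
    · have hzf : ψ z ∈ frontier Y := by
        rw [frontier_eq_closure_inter_closure]
        exact ⟨subset_closure (hψY ⟨z, hzT, rfl⟩), h1⟩
      rcases hbottom z (hfr z hzT hzf) hz3' hzm with h | h
      · exact h2 (Or.inl (hlth ⟨z, h.1, rfl⟩))
      · exact h2 (Or.inr (hrth ⟨z, h.1, rfl⟩))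
  obtain ⟨η₁, hη₁, hη₁d⟩ := hKC.exists_thickenings hKc hC
  obtain ⟨η₂, hη₂, hη₂c⟩ := hKc.exists_isCompact_cthickening
  set η := min η₁ η₂
  have hη : 0 < η := lt_min hη₁ hη₂
  obtain ⟨S, hSU, a, haA, b, hbB, hS, hSA, hSB⟩ := exists_polyArc_of_reflTransGen
    (reflTransGen_geoSet_of_lipschitz hL hη (hη₂c.of_isClosed_subset isClosed_cthickening
      (cthickening_mono (min_le_right _ _) _)) hγK hγ) A B hA hB hAB (Or.inl hγ0) (Or.inl hγ1)
  have hSC : ∀ x ∈ S, x ∉ C₁ ∪ C₂ := fun x hx hxC =>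
    disjoint_left.1 hη₁d (thickening_mono (min_le_left _ _) _ (hSU hx))
      (self_subset_thickening hη₁ _ hxC)
  obtain ⟨c, hc, hci, hc0, hc1, hSc⟩ := hS.exists_param
  have hcY : ∀ t ∈ Ioo (0 : ℝ) 1, c t ∈ Y := by
    intro t ht
    by_contra htY
    have htI := Ioo_subset_Icc_self ht
    have htS : c t ∈ S := hSc ▸ ⟨t, htI, rfl⟩
    have htcl : c t ∈ closure Yᶜ := subset_closure htY
    have htC₂ : c t ∈ thickening δ left ∪ thickening δ right := by
      by_contra h
      exact hSC _ htS (Or.inr ⟨htcl, h⟩)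
    rcases htC₂ with h | h
    · have h1 := hSA.subset ⟨htS, Or.inr ⟨htcl, thickening_subset_cthickening _ _ h⟩⟩
      rw [mem_singleton_iff, ← hc0] at h1
      exact ht.1.ne' (hci htI (by simp) h1)
    · have h1 := hSB.subset ⟨htS, Or.inr ⟨htcl, thickening_subset_cthickening _ _ h⟩⟩
      rw [mem_singleton_iff, ← hc1] at h1
      exact ht.2.ne (hci htI (by simp) h1)
  have hSY : S ⊆ Y := by
    rw [hSc]
    have h1 : closure (Ioo (0 : ℝ) 1) = Icc 0 1 := closure_Ioo zero_ne_one
    rw [← h1]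
    refine (ContinuousOn.image_closure (h1 ▸ hc)).trans ?_
    refine closure_minimal ?_ hY
    rintro _ ⟨t, ht, rfl⟩
    exact hcY t ht
  have hSψ : ∀ x ∈ S, ∃ z ∈ unitSquare, z ∉ threeSides ∧ z ∉ realSeg m₁ m₂ ∧ ψ z = x := by
    intro x hx
    have h1 := hSC x hx
    have hxψ : x ∈ ψ '' unitSquare := by
      by_contra h
      exact h1 (Or.inl (Or.inl (Or.inl (subset_closure ⟨hSY hx, h⟩))))
    obtain ⟨z, hz, rfl⟩ := hxψ
    exact ⟨z, hz, fun h => h1 (Or.inl (Or.inl (Or.inr ⟨z, h, rfl⟩))),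
      fun h => h1 (Or.inl (Or.inr ⟨z, h, rfl⟩)), rfl⟩
  have haS : a ∈ S := (hSA.symm.subset rfl).1
  have hbS : b ∈ S := (hSB.symm.subset rfl).1
  have hfrY : ∀ z ∈ unitSquare, ψ z ∈ closure Yᶜ → z ∈ frontier unitSquare := fun z hz h =>
    hfr z hz (by
      rw [frontier_eq_closure_inter_closure]
      exact ⟨subset_closure (hψY ⟨z, hz, rfl⟩), h⟩)
  have hfrz : ∀ z ∈ unitSquare, z ∉ interior unitSquare → z ∈ frontier unitSquare :=
    fun z hz h => by rw [isClosed_unitSquare.frontier_eq]; exact ⟨hz, h⟩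
  have hfrl : ∀ a b, 0 ≤ a → b ≤ 1 → realSeg a b ⊆ frontier unitSquare := fun a b ha hb z hz =>
    (mem_frontier_unitSquare (realSeg_subset_unitSquare ha hb hz)).2 (Or.inr (Or.inr (Or.inl hz.1)))
  have haz : ∃ p ∈ Ioo 0 m₁, a = ψ (p : ℝ) := by
    obtain ⟨z, hz, hz3, hzm, rfl⟩ := hSψ a haS
    have hzf : z ∈ frontier unitSquare := by
      rcases haA with ⟨w, hw, hwz⟩ | h
      · rw [← hinj (hlT hw) hz hwz]; exact hfrl _ _ le_rfl (by linarith) hw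
      · exact hfrY z hz h.1
    rcases hbottom z hzf hz3 hzm with h | h
    · exact ⟨z.re, h.2, by congr 1; apply Complex.ext <;> simp [h.1.1]⟩
    · exact absurd (hBsub (Or.inl ⟨z, h.1, rfl⟩)) (disjoint_left.1 hδd (hAsub haA))
  have hbz : ∃ q ∈ Ioo m₂ 1, b = ψ (q : ℝ) := by
    obtain ⟨z, hz, hz3, hzm, rfl⟩ := hSψ b hbS
    have hzf : z ∈ frontier unitSquare := by
      rcases hbB with ⟨w, hw, hwz⟩ | h
      · rw [← hinj (hrT hw) hz hwz]; exact hfrl _ _ (by linarith) le_rfl hw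
      · exact hfrY z hz h.1
    rcases hbottom z hzf hz3 hzm with h | h
    · exact absurd (hBsub hbB) (disjoint_left.1 hδd (hAsub (Or.inl ⟨z, h.1, rfl⟩)))
    · exact ⟨z.re, h.2, by congr 1; apply Complex.ext <;> simp [h.1.1]⟩
  obtain ⟨p, hp, rfl⟩ := haz
  obtain ⟨q, hq, rfl⟩ := hbz
  refine ⟨p, hp, q, hq, S, hS, fun x hx => ?_⟩
  obtain ⟨z, hz, hz3, hzm, rfl⟩ := hSψ x hx
  by_cases hzi : z ∈ interior unitSquare
  · exact Or.inr (Or.inr ⟨z, hzi, rfl⟩)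
  rcases hbottom z (hfrz z hz hzi) hz3 hzm with h | h
  · exact Or.inl (hSA.subset ⟨hx, Or.inl ⟨z, h.1, rfl⟩⟩)
  · exact Or.inr (Or.inl (hSB.subset ⟨hx, Or.inl ⟨z, h.1, rfl⟩⟩))

end

section

open Set Metric MeasureTheory Filter Topology
open scoped ENNReal unitInterval

/-- A topological rectangle in `Y`, attached to the rest of `Y` along its three upper sides. -/
structure IsRect {X : Type*} [TopologicalSpace X] (Y : Set X) (ψ : ℂ → X) : Prop where
  cont : ContinuousOn ψ unitSquare
  inj : InjOn ψ unitSquare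
  sub : ψ '' unitSquare ⊆ Y
  frontier : ∀ z ∈ unitSquare, ψ z ∈ _root_.frontier Y → z ∈ _root_.frontier unitSquare
  sides : ψ '' unitSquare ∩ closure (Y \ ψ '' unitSquare) ⊆ ψ '' threeSides

theorem IsRect.isCompact {X : Type*} [TopologicalSpace X] {Y : Set X} {ψ : ℂ → X}
    (h : IsRect Y ψ) : IsCompact (ψ '' unitSquare) :=
  isCompact_unitSquare.image_of_continuousOn h.cont

theorem threeSides_subset_crosscutRest {p q : ℝ} (hp : 0 < p) (hq : q < 1) :
    threeSides ⊆ crosscutRest p q := by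
  rintro z ⟨hz, h⟩
  refine ⟨(mem_frontier_unitSquare hz).2 ?_, ?_⟩
  · rcases h with h | h | h
    · exact Or.inl h
    · exact Or.inr (Or.inl h)
    · exact Or.inr (Or.inr (Or.inr h))
  · rintro ⟨h1, h2⟩
    rcases h with h | h | h
    · linarith [h2.1]
    · linarith [h2.2]
    · linarith

/-- Cutting a rectangle in `Y` along a polygonal arc. -/
theorem IsRect.exists_cut {X : Type*} [MetricSpace X] [MeasurableSpace X] [BorelSpace X]
    [LocallyCompactSpace X] {Y : Set X} (hY : IsClosed Y) {ψ : ℂ → X} (h : IsRect Y ψ)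
    {m₁ m₂ : ℝ} (hm0 : 0 < m₁) (hm : m₁ < m₂) (hm1 : m₂ < 1) (hμ : μH[2] (ψ '' unitSquare) < ⊤) :
    ∃ p ∈ Ioo 0 m₁, ∃ q ∈ Ioo m₂ 1, ∃ S : Set X, PolyArc S (ψ (p : ℝ)) (ψ (q : ℝ)) ∧
      S ⊆ ψ '' unitSquare ∧ ∃ Φ R : X → X,
        ContinuousOn Φ (ψ '' unitSquare) ∧ InjOn Φ (ψ '' unitSquare) ∧
        MapsTo Φ (ψ '' unitSquare) (ψ '' unitSquare) ∧
        (∀ z ∈ crosscutRest p q, Φ (ψ z) = ψ z) ∧ Φ '' (ψ '' realSeg p q) = S ∧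
        ContinuousOn R (ψ '' unitSquare) ∧
        MapsTo R (ψ '' unitSquare) (Φ '' (ψ '' unitSquare)) ∧
        EqOn R id (Φ '' (ψ '' unitSquare)) ∧
        Φ '' (ψ '' unitSquare) ∩ closure (ψ '' unitSquare \ Φ '' (ψ '' unitSquare)) ⊆ S := by
  obtain ⟨p, hp, q, hq, S, hS, hSint⟩ := exists_polyArc_crossing hY h.cont h.inj h.sub hm0 hm hm1 hμ
    h.frontier h.sides
  have hpT : ∀ t ∈ Icc (0 : ℝ) 1, ((t : ℝ) : ℂ) ∈ unitSquare := fun t ht =>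
    ⟨by simpa using ht, by simp⟩
  have hp01 : p ∈ Icc (0 : ℝ) 1 := ⟨hp.1.le, by linarith [hp.2]⟩
  have hq01 : q ∈ Icc (0 : ℝ) 1 := ⟨by linarith [hq.1], hq.2.le⟩
  have hSQ : S ⊆ ψ '' unitSquare := fun x hx => by
    rcases hSint x hx with rfl | rfl | ⟨z, hz, rfl⟩
    · exact ⟨p, hpT p hp01, rfl⟩
    · exact ⟨q, hpT q hq01, rfl⟩
    · exact ⟨z, interior_subset hz, rfl⟩
  obtain ⟨c, hc, hci, hc0, hc1, hSc⟩ := hS.exists_param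
  set e := Function.invFunOn ψ unitSquare
  have he : LeftInvOn e ψ unitSquare := h.inj.leftInvOn_invFunOn
  have hec : ContinuousOn e (ψ '' unitSquare) :=
    isCompact_unitSquare.continuousOn_of_leftInvOn h.cont he
  have hr : ∀ x ∈ ψ '' unitSquare, ψ (e x) = x := fun x hx => Function.invFunOn_eq hx
  have heT : ∀ x ∈ ψ '' unitSquare, e x ∈ unitSquare := fun x hx => Function.invFunOn_mem hx
  have hcQ : MapsTo c (Icc 0 1) (ψ '' unitSquare) := fun t ht => hSQ (hSc ▸ ⟨t, ht, rfl⟩)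
  obtain ⟨θ, ρ, hθ, hθi, hθT, hθr, hθs, hρ, hρm, hρi, hcl⟩ := exists_crosscut_square (c := e ∘ c)
    hp.1 (hp.2.trans (hm.trans hq.1)) hq.2 (hec.comp hc hcQ)
    (fun s hs t ht hst => hci hs ht (by
      have := congrArg ψ hst
      simpa only [Function.comp_apply, hr _ (hcQ hs), hr _ (hcQ ht)] using this))
    (by simp only [Function.comp_apply, hc0, he (hpT p hp01)])
    (by simp only [Function.comp_apply, hc1, he (hpT q hq01)])
    (fun t ht => by
      have htI := Ioo_subset_Icc_self ht
      rcases hSint (c t) (hSc ▸ ⟨t, htI, rfl⟩) with h1 | h1 | ⟨z, hz, h1⟩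
      · rw [← hc0] at h1; exact absurd (hci htI (by simp) h1) ht.1.ne'
      · rw [← hc1] at h1; exact absurd (hci htI (by simp) h1) ht.2.ne
      · simp only [Function.comp_apply, ← h1, he (interior_subset hz)]; exact hz)
  have heS : (e ∘ c) '' Icc 0 1 = e '' S := by rw [image_comp, ← hSc]
  have hψeS : ψ '' (e '' S) = S := by
    ext x
    constructor
    · rintro ⟨_, ⟨y, hy, rfl⟩, rfl⟩; rwa [hr y (hSQ hy)]
    · intro hx; exact ⟨e x, ⟨x, hx, rfl⟩, hr x (hSQ hx)⟩
  have himg : ∀ W ⊆ unitSquare, (fun x => ψ (θ (e x))) '' (ψ '' W) = ψ '' (θ '' W) := by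
    intro W hW
    ext x
    constructor
    · rintro ⟨_, ⟨z, hz, rfl⟩, rfl⟩
      simp only [he (hW hz)]
      exact ⟨_, ⟨z, hz, rfl⟩, rfl⟩
    · rintro ⟨_, ⟨z, hz, rfl⟩, rfl⟩
      exact ⟨ψ z, ⟨z, hz, rfl⟩, by simp only [he (hW hz)]⟩
  have hθm : MapsTo θ unitSquare unitSquare := fun z hz => hθT ⟨z, hz, rfl⟩
  have hψθ : ψ '' (θ '' unitSquare) ⊆ ψ '' unitSquare := image_mono hθT
  refine ⟨p, hp, q, hq, S, hS, hSQ, fun x => ψ (θ (e x)), fun x => ψ (ρ (e x)), ?_, ?_, ?_, ?_, ?_,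
    ?_, ?_, ?_, ?_⟩
  · exact h.cont.comp (hθ.comp hec heT) fun x hx => hθm (heT x hx)
  · intro x hx y hy hxy
    have h1 := hθi (heT x hx) (heT y hy) (h.inj (hθm (heT x hx)) (hθm (heT y hy)) hxy)
    rw [← hr x hx, ← hr y hy, h1]
  · exact fun x hx => ⟨_, hθm (heT x hx), rfl⟩
  · intro z hz
    have hzT := isClosed_unitSquare.frontier_subset hz.1
    simp only [he hzT, hθr z hz]
  · rw [himg _ (realSeg_subset_unitSquare hp.1.le hq.2.le)]
    unfold realSeg
    rw [hθs, heS, hψeS]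
  · refine h.cont.comp (hρ.comp hec heT) fun x hx => hθT (hρm (heT x hx))
  · intro x hx
    rw [himg _ le_rfl]
    exact ⟨_, hρm (heT x hx), rfl⟩
  · rw [himg _ le_rfl]
    rintro _ ⟨z, hz, rfl⟩
    simp only [he (hθT hz), hρi hz, id]
  · rw [himg _ le_rfl]
    rintro _ ⟨⟨z, hz, rfl⟩, hx⟩
    rw [← hψeS, ← heS]
    refine ⟨z, hcl ⟨hz, ?_⟩, rfl⟩
    have hsub : ψ '' unitSquare \ ψ '' (θ '' unitSquare) ⊆ ψ '' (unitSquare \ θ '' unitSquare) := by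
      rintro _ ⟨⟨w, hw, rfl⟩, hw'⟩
      exact ⟨w, ⟨hw, fun h' => hw' ⟨w, h', rfl⟩⟩, rfl⟩
    have hclT : closure (unitSquare \ θ '' unitSquare) ⊆ unitSquare :=
      closure_minimal sdiff_subset isClosed_unitSquare
    have hcc : IsClosed (ψ '' closure (unitSquare \ θ '' unitSquare)) :=
      (isCompact_image_of_subset_unitSquare h.cont isClosed_closure hclT).isClosed
    obtain ⟨w, hw, hwz⟩ := closure_minimal (hsub.trans (image_mono subset_closure)) hcc hx
    rwa [← h.inj (hclT hw) (hθT hz) hwz]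

/-- Gluing maps on a locally finite family of closed sets with the identity. -/
theorem continuousOn_glue {X ι : Type*} [TopologicalSpace X] {C : Set X} (hC : IsClosed C)
    {Q : ι → Set X} (hQ : ∀ i, IsClosed (Q i)) (hloc : LocallyFinite Q) {f : X → X}
    (hfC : EqOn f id C) (hf : ∀ i, ContinuousOn f (Q i)) : ContinuousOn f (C ∪ ⋃ i, Q i) :=
  (continuousOn_id.congr hfC).union_of_isClosed (hloc.continuousOn_iUnion hQ hf) hC
    (hloc.isClosed_iUnion hQ)

/-- Cutting a locally finite disjoint family of rectangles in `Y` simultaneously. -/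
theorem exists_cut_family {X ι : Type*} [MetricSpace X] [MeasurableSpace X] [BorelSpace X]
    [LocallyCompactSpace X] {Y : Set X} (hY : IsClosed Y) {ψ : ι → ℂ → X}
    (h : ∀ i, IsRect Y (ψ i)) {m₁ m₂ : ι → ℝ} (hm0 : ∀ i, 0 < m₁ i) (hm : ∀ i, m₁ i < m₂ i)
    (hm1 : ∀ i, m₂ i < 1) (hμ : ∀ i, μH[2] (ψ i '' unitSquare) < ⊤)
    (hloc : LocallyFinite fun i => ψ i '' unitSquare)
    (hdisj : Pairwise fun i k => Disjoint (ψ i '' unitSquare) (ψ k '' unitSquare)) :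
    ∃ (p q : ι → ℝ) (S : ι → Set X) (Φ Ψ R : X → X),
      (∀ i, p i ∈ Ioo 0 (m₁ i)) ∧ (∀ i, q i ∈ Ioo (m₂ i) 1) ∧
      (∀ i, PolyArc (S i) (ψ i (p i : ℝ)) (ψ i (q i : ℝ))) ∧ (∀ i, S i ⊆ ψ i '' unitSquare) ∧
      ContinuousOn Φ Y ∧ LeftInvOn Ψ Φ Y ∧ ContinuousOn Ψ (Φ '' Y) ∧ IsClosed (Φ '' Y) ∧
      Φ '' Y ⊆ Y ∧ ContinuousOn R Y ∧ MapsTo R Y (Φ '' Y) ∧ EqOn R id (Φ '' Y) ∧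
      (∀ i, ∀ x ∈ ψ i '' unitSquare, Φ x ∈ ψ i '' unitSquare ∧ R x ∈ ψ i '' unitSquare) ∧
      (∀ x, (∀ i, x ∉ ψ i '' unitSquare) → Φ x = x ∧ R x = x) ∧
      (∀ i, Φ '' (ψ i '' realSeg (p i) (q i)) = S i) ∧
      (∀ i, ∀ z ∈ crosscutRest (p i) (q i), Φ (ψ i z) = ψ i z) ∧
      Φ '' Y ∩ closure (Y \ Φ '' Y) ⊆ ⋃ i, S i := by
  choose p hp q hq S hS hSQ F P hFc hFi hFm hFr hFS hPc hPm hPi hcl using fun i =>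
    (h i).exists_cut hY (hm0 i) (hm i) (hm1 i) (hμ i)
  set Q : ι → Set X := fun i => ψ i '' unitSquare with hQ
  have hQc : ∀ i, IsCompact (Q i) := fun i => (h i).isCompact
  have huniq : ∀ {i k x}, x ∈ Q i → x ∈ Q k → i = k := fun {i k x} hi hk => by
    by_contra hne
    exact disjoint_left.1 (hdisj hne) hi hk
  classical
  set glue : (ι → X → X) → X → X := fun f x => if hx : ∃ i, x ∈ Q i then f hx.choose x else x
    with hglue
  have hg1 : ∀ (f : ι → X → X) i x, x ∈ Q i → glue f x = f i x := fun f i x hx => by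
    have hex : ∃ i, x ∈ Q i := ⟨i, hx⟩
    simp only [hglue, dif_pos hex]
    rw [huniq hex.choose_spec hx]
  have hg2 : ∀ (f : ι → X → X) x, (∀ i, x ∉ Q i) → glue f x = x := fun f x hx => by
    simp only [hglue]
    rw [dif_neg (not_exists.2 hx)]
  set Φ := glue F with hΦ
  set R := glue P with hR
  set C := closure (Y \ ⋃ i, Q i) with hC
  have hCY : C ⊆ Y := closure_minimal sdiff_subset hY
  have hYC : Y = C ∪ ⋃ i, Q i := by
    refine subset_antisymm (fun x hx => ?_) (union_subset hCY (iUnion_subset fun i => (h i).sub))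
    by_cases hxQ : x ∈ ⋃ i, Q i
    · exact Or.inr hxQ
    · exact Or.inl (subset_closure ⟨hx, hxQ⟩)
  have hC3 : ∀ i, ∀ x ∈ C, x ∈ Q i → x ∈ ψ i '' threeSides := fun i x hxC hxQ =>
    (h i).sides ⟨hxQ, closure_mono (sdiff_subset_sdiff_right (subset_iUnion Q i)) hxC⟩
  have hF3 : ∀ i, ∀ x ∈ ψ i '' threeSides, F i x = x := by
    rintro i _ ⟨z, hz, rfl⟩
    exact hFr i z (threeSides_subset_crosscutRest (hp i).1 (hq i).2 hz)
  have h3Q : ∀ i, ψ i '' threeSides ⊆ Q i := fun i => image_mono fun z hz => hz.1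
  have hP3 : ∀ i, ∀ x ∈ ψ i '' threeSides, P i x = x := fun i x hx =>
    hPi i ⟨x, h3Q i hx, hF3 i x hx⟩
  have hgC : ∀ f : ι → X → X, (∀ i, ∀ x ∈ ψ i '' threeSides, f i x = x) → EqOn (glue f) id C := by
    intro f hf x hx
    by_cases hxQ : ∃ i, x ∈ Q i
    · obtain ⟨i, hi⟩ := hxQ
      rw [hg1 f i x hi, hf i x (hC3 i x hx hi)]; rfl
    · exact hg2 f x (not_exists.1 hxQ)
  have hΦC : EqOn Φ id C := hgC F hF3
  have hRC : EqOn R id C := hgC P hP3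
  have hΦQ : ∀ i, EqOn Φ (F i) (Q i) := fun i x hx => hg1 F i x hx
  have hRQ : ∀ i, EqOn R (P i) (Q i) := fun i x hx => hg1 P i x hx
  have hΦim : ∀ i, Φ '' Q i = F i '' Q i := fun i => (hΦQ i).image_eq
  have hΦc : ContinuousOn Φ Y := by
    rw [hYC]
    exact continuousOn_glue isClosed_closure (fun i => (hQc i).isClosed) hloc hΦC fun i =>
      (hFc i).congr (hΦQ i)
  have hRc : ContinuousOn R Y := by
    rw [hYC]
    exact continuousOn_glue isClosed_closure (fun i => (hQc i).isClosed) hloc hRC fun i =>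
      (hPc i).congr (hRQ i)
  have hΦm : ∀ i, ∀ x ∈ Q i, Φ x ∈ Q i := fun i x hx => by rw [hΦQ i hx]; exact hFm i hx
  have hΦn : ∀ x, (∀ i, x ∉ Q i) → Φ x = x := fun x hx => hg2 F x hx
  have hΦback : ∀ i x, Φ x ∈ Q i → x ∈ Q i := by
    intro i x hx
    by_cases hxQ : ∃ k, x ∈ Q k
    · obtain ⟨k, hk⟩ := hxQ
      rwa [huniq hx (hΦm k x hk)]
    · rwa [hΦn x (not_exists.1 hxQ)] at hx
  have hΦi : InjOn Φ Y := by
    intro x hx y hy hxy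
    by_cases hxQ : ∃ i, x ∈ Q i
    · obtain ⟨i, hi⟩ := hxQ
      have hyi : y ∈ Q i := hΦback i y (hxy ▸ hΦm i x hi)
      rw [hΦQ i hi, hΦQ i hyi] at hxy
      exact hFi i hi hyi hxy
    · have hx' := hΦn x (not_exists.1 hxQ)
      have hyn : ∀ i, y ∉ Q i := fun i hyi => hxQ ⟨i, by rw [← hx', hxy]; exact hΦm i y hyi⟩
      rw [← hx', hxy, hΦn y hyn]
  obtain ⟨Ψ, hΨ⟩ : ∃ Ψ : X → X, LeftInvOn Ψ Φ Y := by
    rcases isEmpty_or_nonempty X with hE | hE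
    · exact ⟨id, fun x => hE.elim x⟩
    · exact ⟨_, hΦi.leftInvOn_invFunOn⟩
  have hFQc : ∀ i, IsCompact (Φ '' Q i) := fun i =>
    (hQc i).image_of_continuousOn (hΦc.mono (h i).sub)
  have hFQsub : ∀ i, Φ '' Q i ⊆ Q i := fun i => by rintro _ ⟨x, hx, rfl⟩; exact hΦm i x hx
  have hloc' : LocallyFinite fun i => Φ '' Q i := hloc.subset hFQsub
  have hΦY : Φ '' Y = C ∪ ⋃ i, Φ '' Q i := by
    conv_lhs => rw [hYC, image_union, image_iUnion, hΦC.image_eq, image_id]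
  have hcutQ : ∀ i x, x ∈ Φ '' Y → x ∈ Q i → x ∈ Φ '' Q i := by
    rintro i _ ⟨x, -, rfl⟩ hx
    exact ⟨x, hΦback i x hx, rfl⟩
  refine ⟨p, q, S, Φ, Ψ, R, hp, hq, hS, hSQ, hΦc, hΨ, ?_, ?_, ?_, hRc, ?_, ?_, ?_, ?_, ?_, ?_, ?_⟩
  · rw [hΦY]
    refine continuousOn_glue isClosed_closure (fun i => (hFQc i).isClosed) hloc' ?_ fun i => ?_
    · intro x hx
      have := hΨ (hCY hx)
      rwa [hΦC hx] at this
    · exact (hQc i).continuousOn_of_leftInvOn (hΦc.mono (h i).sub) (hΨ.mono (h i).sub)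
  · rw [hΦY]
    exact isClosed_closure.union (hloc'.isClosed_iUnion fun i => (hFQc i).isClosed)
  · rw [hΦY]
    exact union_subset hCY (iUnion_subset fun i => (hFQsub i).trans (h i).sub)
  · intro x hx
    rw [hYC] at hx
    rcases hx with hx | hx
    · rw [hRC hx, hΦY]; exact Or.inl hx
    · obtain ⟨i, hi⟩ := mem_iUnion.1 hx
      rw [hRQ i hi]
      have h1 := hPm i hi
      rw [← hΦim i] at h1
      exact image_mono (h i).sub h1
  · intro x hx
    rw [hΦY] at hx
    rcases hx with hx | hx
    · exact hRC hx
    · obtain ⟨i, hi⟩ := mem_iUnion.1 hx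
      rw [hRQ i (hFQsub i hi)]
      exact hPi i (by rw [← hΦim i]; exact hi)
  · intro i x hx
    refine ⟨hΦm i x hx, ?_⟩
    rw [hRQ i hx]
    have h1 := hPm i hx
    rw [← hΦim i] at h1
    exact hFQsub i h1
  · exact fun x hx => ⟨hΦn x hx, hg2 P x hx⟩
  · intro i
    rw [((hΦQ i).mono (image_mono (realSeg_subset_unitSquare (hp i).1.le (hq i).2.le))).image_eq]
    exact hFS i
  · intro i z hz
    rw [hΦQ i ⟨z, isClosed_unitSquare.frontier_subset hz.1, rfl⟩]
    exact hFr i z hz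
  · rintro x ⟨hxY, hx⟩
    have hsub : Y \ Φ '' Y ⊆ ⋃ i, (Q i \ Φ '' Q i) := by
      rintro y ⟨hy, hy'⟩
      rw [hYC] at hy
      rw [hΦY] at hy'
      rcases hy with hy | hy
      · exact absurd (Or.inl hy) hy'
      · obtain ⟨i, hi⟩ := mem_iUnion.1 hy
        exact mem_iUnion.2 ⟨i, hi, fun h' => hy' (Or.inr (mem_iUnion.2 ⟨i, h'⟩))⟩
    have hx2 := closure_mono hsub hx
    rw [(hloc.subset fun i => sdiff_subset).closure_iUnion] at hx2
    obtain ⟨i, hi⟩ := mem_iUnion.1 hx2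
    have hxQ : x ∈ Q i := closure_minimal sdiff_subset (hQc i).isClosed hi
    refine mem_iUnion.2 ⟨i, hcl i ⟨?_, ?_⟩⟩
    · have := hcutQ i x hxY hxQ
      rwa [hΦim] at this
    · rwa [hΦim] at hi

end

section

open Set Metric MeasureTheory Filter Topology
open scoped ENNReal unitInterval

/-- The closed upper half-plane. -/
abbrev ClosedUpperHalfPlane : Type := {z : ℂ // 0 ≤ z.im}

/-- The retraction of the plane onto the closed upper half-plane. -/
noncomputable def toUpper (z : ℂ) : ClosedUpperHalfPlane := ⟨⟨z.re, max z.im 0⟩, le_max_right _ _⟩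

theorem continuous_toUpper : Continuous toUpper := by
  refine Continuous.subtype_mk ?_ _
  have : Continuous fun z : ℂ => ((z.re : ℂ) + ((max z.im 0 : ℝ) : ℂ) * Complex.I) := by fun_prop
  refine this.congr fun z => ?_
  apply Complex.ext <;> simp

theorem toUpper_coe (w : ClosedUpperHalfPlane) : toUpper w = w := by
  apply Subtype.ext
  apply Complex.ext <;> simp [toUpper, w.2]

theorem coe_toUpper {z : ℂ} (hz : 0 ≤ z.im) : (toUpper z : ℂ) = z :=
  congrArg Subtype.val (toUpper_coe ⟨z, hz⟩)

theorem toUpper_image (V : Set ℂ) :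
    toUpper '' (V ∩ {z | 0 ≤ z.im}) = (Subtype.val : ClosedUpperHalfPlane → ℂ) ⁻¹' V := by
  ext w
  constructor
  · rintro ⟨z, hz, rfl⟩
    rw [mem_preimage, coe_toUpper hz.2]
    exact hz.1
  · exact fun hw => ⟨w, ⟨hw, w.2⟩, toUpper_coe w⟩

/-- The model half-space of dimension two as the closed upper half-plane. -/
noncomputable def halfSpaceHomeo : EuclideanHalfSpace 2 ≃ₜ ClosedUpperHalfPlane where
  toFun h := ⟨⟨h.1 1, h.1 0⟩, h.2⟩
  invFun w := ⟨!₂[w.1.im, w.1.re], by simpa using w.2⟩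
  left_inv h := by
    apply Subtype.ext
    ext i
    fin_cases i <;> simp
  right_inv w := by
    apply Subtype.ext
    apply Complex.ext <;> simp
  continuous_toFun := by
    refine Continuous.subtype_mk ?_ _
    have : Continuous fun h : EuclideanHalfSpace 2 =>
        (((h.1 1 : ℝ) : ℂ) + ((h.1 0 : ℝ) : ℂ) * Complex.I) := by
      have h0 : ∀ i, Continuous fun h : EuclideanHalfSpace 2 => h.1 i := fun i =>
        (PiLp.continuous_apply 2 _ i).comp continuous_subtype_val
      exact (Complex.continuous_ofReal.comp (h0 1)).add
        ((Complex.continuous_ofReal.comp (h0 0)).mul continuous_const)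
    refine this.congr fun z => ?_
    apply Complex.ext <;> simp
  continuous_invFun := by
    refine Continuous.subtype_mk ?_ _
    refine (PiLp.continuous_toLp 2 _).comp ?_
    refine continuous_pi fun i => ?_
    fin_cases i
    · exact Complex.continuous_im.comp continuous_subtype_val
    · exact Complex.continuous_re.comp continuous_subtype_val

theorem isClosed_manifoldBoundary (X : Type*) [TopologicalSpace X] :
    IsClosed (manifoldBoundary X) := by
  rw [← isOpen_compl_iff, isOpen_iff_mem_nhds]
  intro x hx
  simp only [manifoldBoundary, mem_compl_iff, mem_ofPred_eq, not_not] at hx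
  obtain ⟨U, hU, hxU, hU'⟩ := hx
  filter_upwards [hU.mem_nhds hxU] with y hy
  simp only [manifoldBoundary, mem_compl_iff, mem_ofPred_eq, not_not]
  exact ⟨U, hU, hy, hU'⟩

theorem IsOpen.image_symm_toUpper {X : Type*} [TopologicalSpace X]
    (e : OpenPartialHomeomorph X ClosedUpperHalfPlane) {V : Set ℂ} (hV : IsOpen V)
    (h : Subtype.val ⁻¹' V ⊆ e.target) :
    IsOpen ((fun z => e.symm (toUpper z)) '' (V ∩ {z | 0 ≤ z.im})) := by
  rw [show (fun z => e.symm (toUpper z)) = e.symm ∘ toUpper from rfl, image_comp, toUpper_image]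
  exact e.symm.isOpen_image_of_subset_source (hV.preimage continuous_subtype_val) h

theorem symm_notMem_manifoldBoundary {X : Type*} [TopologicalSpace X]
    (e : OpenPartialHomeomorph X ClosedUpperHalfPlane) {w : ClosedUpperHalfPlane}
    (hw : w ∈ e.target) (him : 0 < (w : ℂ).im) : e.symm w ∉ manifoldBoundary X := by
  have hnh : ∀ᶠ z in 𝓝 (w : ℂ), toUpper z ∈ e.target ∧ 0 < z.im := by
    refine (continuous_toUpper.continuousAt.eventually ?_).and
      (Complex.continuous_im.continuousAt.eventually (lt_mem_nhds him))
    rw [toUpper_coe]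
    exact e.open_target.mem_nhds hw
  obtain ⟨s, hs, hball⟩ := Metric.eventually_nhds_iff_ball.1 hnh
  set b := OpenPartialHomeomorph.univBall (E := ℂ) (w : ℂ) s
  have hb : ∀ z, b z ∈ ball (w : ℂ) s := fun z => by
    rw [← OpenPartialHomeomorph.univBall_target (w : ℂ) hs]
    exact b.map_source (by simp [b])
  have hbi : Function.Injective b := fun y z h =>
    b.injOn (by simp [b]) (by simp [b]) h
  set f : ℂ → X := fun z => e.symm (toUpper (b z))
  have hf : IsOpenEmbedding f := by
    refine .of_continuous_injective_isOpenMap ?_ ?_ ?_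
    · exact e.symm.continuousOn.comp_continuous (continuous_toUpper.comp
        (OpenPartialHomeomorph.continuous_univBall _ _)) fun z => (hball _ (hb z)).1
    · intro y z h
      have h1 := e.symm.injOn (hball _ (hb y)).1 (hball _ (hb z)).1 h
      apply hbi
      rw [← coe_toUpper (hball _ (hb y)).2.le, h1, coe_toUpper (hball _ (hb z)).2.le]
    · intro V hV
      have hbV : IsOpen (b '' V) := b.isOpen_image_of_subset_source hV (by simp [b])
      have hsub : b '' V ⊆ ball (w : ℂ) s := by rintro _ ⟨z, -, rfl⟩; exact hb z
      have := hbV.image_symm_toUpper e (fun u hu => by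
        have := (hball _ (hsub hu)).1
        rwa [toUpper_coe] at this)
      have hup : b '' V ⊆ {z : ℂ | 0 ≤ z.im} := fun z hz => (hball _ (hsub hz)).2.le
      rw [inter_eq_left.2 hup, ← image_comp] at this
      exact this
  simp only [manifoldBoundary, mem_ofPred_eq, not_not]
  refine ⟨range f, hf.isOpen_range, ⟨0, ?_⟩, ⟨hf.isEmbedding.toHomeomorph.symm⟩⟩
  simp only [f, b, OpenPartialHomeomorph.univBall_apply_zero, toUpper_coe]

theorem symm_mem_manifoldBoundary {X : Type*} [TopologicalSpace X]
    (e : OpenPartialHomeomorph X ClosedUpperHalfPlane) {w : ClosedUpperHalfPlane}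
    (hw : w ∈ e.target) (him : (w : ℂ).im = 0) : e.symm w ∈ manifoldBoundary X := by
  rintro ⟨U, hU, hxU, ⟨g⟩⟩
  classical
  set x := e.symm w with hx
  set G : X → ℂ := fun y => if hy : y ∈ U then g ⟨y, hy⟩ else 0 with hG
  have hGc : ContinuousOn G U := by
    rw [continuousOn_iff_continuous_domRestrict]
    refine g.continuous.congr fun y => ?_
    simp [hG]
  have hGg : ∀ y (hy : y ∈ U), G y = g ⟨y, hy⟩ := fun y hy => by simp [hG, hy]
  set c := G x with hc
  have hnh : ∀ᶠ z in 𝓝 (w : ℂ), toUpper z ∈ e.target ∧ e.symm (toUpper z) ∈ U := by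
    have h1 : Tendsto toUpper (𝓝 (w : ℂ)) (𝓝 w) := by
      have := continuous_toUpper.tendsto (w : ℂ)
      rwa [toUpper_coe] at this
    exact h1.eventually ((e.open_target.eventually_mem hw).and
      ((e.symm.continuousAt hw).eventually (hU.mem_nhds hxU)))
  obtain ⟨s', hs', hball'⟩ := Metric.eventually_nhds_iff_ball.1 hnh
  set s := s' / 2 with hs
  have hs0 : 0 < s := by positivity
  have hball : ∀ z ∈ closedBall (w : ℂ) s, toUpper z ∈ e.target ∧ e.symm (toUpper z) ∈ U :=
    fun z hz => hball' z (closedBall_subset_ball (by linarith) hz)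
  set N := (fun z => e.symm (toUpper z)) '' (ball (w : ℂ) s ∩ {z | 0 ≤ z.im}) with hN
  have hNo : IsOpen N := isOpen_ball.image_symm_toUpper e fun u hu => by
    have := (hball _ (ball_subset_closedBall hu)).1
    rwa [toUpper_coe] at this
  have hxN : x ∈ N := ⟨w, ⟨mem_ball_self hs0, w.2⟩, by simp only [toUpper_coe, hx]⟩
  have hgc : (g.symm c : X) = x := by rw [hc, hGg x hxU]; simp
  have hpre : (fun ζ => (g.symm ζ : X)) ⁻¹' N ∈ 𝓝 c :=
    (continuous_subtype_val.comp g.symm.continuous).continuousAt.preimage_mem_nhds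
      (by simpa only [Function.comp_apply, hgc] using hNo.mem_nhds hxN)
  obtain ⟨t, ht, hct⟩ := Metric.nhds_basis_closedBall.mem_iff.1 hpre
  set a : ℂ → ℂ := fun ζ => (e (g.symm ζ) : ℂ) with ha
  have hgN : ∀ ζ ∈ sphere c t, ∃ z ∈ ball (w : ℂ) s, 0 ≤ z.im ∧
      e.symm (toUpper z) = (g.symm ζ : X) ∧ a ζ = z := by
    intro ζ hζ
    obtain ⟨z, ⟨hz, hz0⟩, hze⟩ := hct (sphere_subset_closedBall hζ)
    dsimp only at hze
    refine ⟨z, hz, hz0, hze, ?_⟩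
    simp only [ha, ← hze]
    rw [e.right_inv (hball z (ball_subset_closedBall hz)).1, coe_toUpper hz0]
  have hac : ContinuousOn a (sphere c t) := by
    refine continuous_subtype_val.comp_continuousOn (e.continuousOn.comp
      (continuous_subtype_val.comp g.symm.continuous).continuousOn fun ζ hζ => ?_)
    obtain ⟨z, hz, -, hze, -⟩ := hgN ζ hζ
    simp only [← hze]
    exact e.map_target (hball z (ball_subset_closedBall hz)).1
  have hane : ∀ ζ ∈ sphere c t, 0 < ‖a ζ - w‖ := by
    intro ζ hζ
    rw [norm_pos_iff, sub_ne_zero]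
    intro h
    obtain ⟨z, hz, -, hze, hz'⟩ := hgN ζ hζ
    rw [← hz', h, toUpper_coe, ← hx, ← hgc, Subtype.val_inj, g.symm.injective.eq_iff] at hze
    rw [← hze] at hζ
    exact ht.ne (by simpa using hζ)
  obtain ⟨ζ₀, hζ₀, hmin⟩ := (isCompact_sphere c t).exists_isMinOn
    (NormedSpace.sphere_nonempty.2 ht.le) (hac.sub continuousOn_const).norm
  set ρ := ‖a ζ₀ - w‖ with hρ
  have hρ0 : 0 < ρ := hane ζ₀ hζ₀
  have hρs : ρ < s := by
    obtain ⟨z, hz, -, -, hz'⟩ := hgN ζ₀ hζ₀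
    rw [hρ, hz', ← dist_eq_norm]
    exact hz
  set F : ℂ → ℂ := fun u => G (e.symm (toUpper (w + Complex.I * Complex.exp u))) - c with hF
  have hFb : ∀ u : ℂ, u.re ∈ Icc (Real.log ρ) (Real.log s) →
      ((w : ℂ) + Complex.I * Complex.exp u) ∈ closedBall (w : ℂ) s := by
    intro u hu
    rw [mem_closedBall, dist_eq_norm, add_sub_cancel_left, norm_mul, Complex.norm_I, one_mul,
      Complex.norm_exp]
    exact (Real.le_log_iff_exp_le hs0).1 hu.2
  have hlog : HasLogOn F {z | z.re ∈ Icc (Real.log ρ) (Real.log s) ∧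
      z.im ∈ Icc (-(Real.pi / 2)) (Real.pi / 2)} := by
    refine hasLogOn_rect (Real.log_le_log hρ0 hρs.le) (by linarith [Real.pi_pos]) ?_ ?_
    · refine ContinuousOn.sub (hGc.comp (e.symm.continuousOn.comp
        (continuous_toUpper.comp (by fun_prop)).continuousOn ?_) ?_) continuousOn_const
      · exact fun u hu => (hball _ (hFb u hu.1)).1
      · exact fun u hu => (hball _ (hFb u hu.1)).2
    · intro u hu h0
      have hb := hball _ (hFb u hu.1)
      rw [hF, sub_eq_zero, hc, hGg _ hb.2, hGg _ hxU, g.injective.eq_iff, Subtype.mk.injEq] at h0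
      have h1 := e.symm.injOn hb.1 hw h0
      have him' : 0 ≤ ((w : ℂ) + Complex.I * Complex.exp u).im := by
        simp only [Complex.add_im, him, Complex.mul_im, Complex.I_re, Complex.I_im, Complex.exp_re]
        have := Real.cos_nonneg_of_mem_Icc hu.2
        have := Real.exp_pos u.re
        simp only [zero_mul, one_mul, zero_add]
        positivity
      have h2 := congrArg Subtype.val h1
      rw [coe_toUpper him'] at h2
      simp [Complex.exp_ne_zero] at h2
  have hlog2 : HasLogOn (fun ζ => ζ - c) (sphere c t) := by
    refine (hlog.comp (f := fun ζ => Complex.log ((a ζ - w) / Complex.I)) ?_ ?_).congr ?_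
    · refine ContinuousOn.clog ((hac.sub continuousOn_const).div_const _) fun ζ hζ => ?_
      obtain ⟨z, -, hz0, -, hz⟩ := hgN ζ hζ
      have hne := norm_pos_iff.1 (hane ζ hζ)
      rw [Complex.mem_slitPlane_iff_not_le_zero, Complex.div_I]
      intro hle
      rw [Complex.le_def] at hle
      simp [hz, him] at hle
      apply hne
      rw [hz]
      apply Complex.ext <;> simp
      · linarith [hle.2]
      · linarith [hle.1]
    · intro ζ hζ
      obtain ⟨z, hzb, hz0, -, hz⟩ := hgN ζ hζ
      have hpos := hane ζ hζ
      have hnorm : ‖(a ζ - w) / Complex.I‖ = ‖a ζ - w‖ := by simp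
      refine ⟨?_, ?_⟩
      · rw [Complex.log_re, hnorm]
        refine ⟨Real.log_le_log hρ0 (hmin hζ), Real.log_le_log hpos ?_⟩
        rw [hz, ← dist_eq_norm]
        exact (mem_ball.1 hzb).le
      · rw [Complex.log_im]
        refine abs_le.1 (Complex.abs_arg_le_pi_div_two_iff.2 ?_)
        rw [Complex.div_I]
        simp [hz, him, hz0]
    · intro ζ hζ
      obtain ⟨z, hzb, hz0, hze, hz⟩ := hgN ζ hζ
      have hne : (a ζ - w) / Complex.I ≠ 0 :=
        div_ne_zero (norm_pos_iff.1 (hane ζ hζ)) Complex.I_ne_zero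
      simp only [hF]
      rw [Complex.exp_log hne, mul_div_cancel₀ _ Complex.I_ne_zero, add_sub_cancel, hz, hze,
        hGg _ (g.symm ζ).2]
      simp
  refine not_hasLogOn_sphere ht ((hlog2.comp (f := fun z => z + c) (by fun_prop) ?_).congr ?_)
  · intro z hz; simpa using hz
  · intro z hz; simp

/-- The closed half-box `[-1,1] × [0,1]`. -/
def halfBox : Set ℂ := {z | z.re ∈ Icc (-1 : ℝ) 1 ∧ z.im ∈ Icc (0 : ℝ) 1}

/-- A chart of a surface near a boundary point, parametrized by a closed half-box. -/
structure IsBoundaryBox {X : Type*} [TopologicalSpace X] (φ : ℂ → X) : Prop where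
  cont : ContinuousOn φ halfBox
  inj : InjOn φ halfBox
  isOpen_image : ∀ V : Set ℂ, IsOpen V → V ∩ {z | 0 ≤ z.im} ⊆ halfBox →
    IsOpen (φ '' (V ∩ {z | 0 ≤ z.im}))
  mem_iff : ∀ z ∈ halfBox, φ z ∈ manifoldBoundary X ↔ z.im = 0

theorem exists_isBoundaryBox {X : Type*} [TopologicalSpace X] (hX : IsMetricSurface X) {x : X}
    (hx : x ∈ manifoldBoundary X) {U : Set X} (hU : U ∈ 𝓝 x) :
    ∃ φ : ℂ → X, IsBoundaryBox φ ∧ φ 0 = x ∧ φ '' halfBox ⊆ U := by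
  obtain ⟨cs⟩ := hX
  set e := (chartAt (EuclideanHalfSpace 2) x).transHomeomorph halfSpaceHomeo
  have hxe : x ∈ e.source := mem_chart_source _ x
  set w := e x
  have hw : w ∈ e.target := e.map_source hxe
  have hwx : e.symm w = x := e.left_inv hxe
  have him : (w : ℂ).im = 0 := by
    by_contra h
    exact symm_notMem_manifoldBoundary e hw (lt_of_le_of_ne w.2 (Ne.symm h)) (hwx.symm ▸ hx)
  have hnh : ∀ᶠ z in 𝓝 (w : ℂ), toUpper z ∈ e.target ∧ e.symm (toUpper z) ∈ U := by
    have h1 : Tendsto toUpper (𝓝 (w : ℂ)) (𝓝 w) := by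
      have := continuous_toUpper.tendsto (w : ℂ)
      rwa [toUpper_coe] at this
    exact h1.eventually ((e.open_target.eventually_mem hw).and
      ((e.symm.continuousAt hw).eventually (hwx.symm ▸ hU)))
  obtain ⟨s, hs, hball⟩ := Metric.eventually_nhds_iff_ball.1 hnh
  set r := s / 3 with hr
  have hr0 : 0 < r := by positivity
  have hbox : ∀ z ∈ halfBox, (w + r * z : ℂ) ∈ ball (w : ℂ) s := by
    intro z hz
    rw [mem_ball, dist_eq_norm, add_sub_cancel_left, norm_mul, Complex.norm_real,
      Real.norm_of_nonneg hr0.le]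
    have h1 : ‖z‖ ≤ 2 := (Complex.norm_le_abs_re_add_abs_im z).trans (by
      have := abs_le.2 hz.1
      have := abs_le.2 ⟨by linarith [hz.2.1], hz.2.2⟩
      linarith)
    nlinarith
  have himz : ∀ z : ℂ, (w + r * z : ℂ).im = r * z.im := fun z => by simp [him]
  refine ⟨fun z => e.symm (toUpper (w + r * z)), ⟨?_, ?_, ?_, ?_⟩, ?_, ?_⟩
  · exact e.symm.continuousOn.comp (continuous_toUpper.comp (by fun_prop)).continuousOn
      fun z hz => (hball _ (hbox z hz)).1
  · intro y hy z hz h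
    have h1 := congrArg Subtype.val
      (e.symm.injOn (hball _ (hbox y hy)).1 (hball _ (hbox z hz)).1 h)
    rw [coe_toUpper (by rw [himz]; exact mul_nonneg hr0.le hy.2.1),
      coe_toUpper (by rw [himz]; exact mul_nonneg hr0.le hz.2.1)] at h1
    simpa [hr0.ne'] using h1
  · intro V hV hVb
    have hr' : (r : ℂ) ≠ 0 := by exact_mod_cast hr0.ne'
    have himg : (fun z : ℂ => (w + r * z : ℂ)) '' V = (fun z : ℂ => (z - w) / r) ⁻¹' V := by
      refine congrFun (image_eq_preimage_of_inverse (fun z => ?_) fun z => ?_) V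
      · field_simp; ring
      · field_simp; ring
    have hVo : IsOpen ((fun z : ℂ => (w + r * z : ℂ)) '' V) := by
      rw [himg]
      exact hV.preimage (by fun_prop)
    have him2 : (fun z : ℂ => (w + r * z : ℂ)) '' V ∩ {z | 0 ≤ z.im} =
        (fun z : ℂ => (w + r * z : ℂ)) '' (V ∩ {z | 0 ≤ z.im}) := by
      ext y
      constructor
      · rintro ⟨⟨z, hz, rfl⟩, hy⟩
        refine ⟨z, ⟨hz, ?_⟩, rfl⟩
        simp only [mem_ofPred_eq, himz] at hy
        exact nonneg_of_mul_nonneg_right hy hr0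
      · rintro ⟨z, ⟨hz, hz0⟩, rfl⟩
        refine ⟨⟨z, hz, rfl⟩, ?_⟩
        simp only [mem_ofPred_eq, himz]
        exact mul_nonneg hr0.le hz0
    have := hVo.image_symm_toUpper e fun u hu => by
      have hu' : (u : ℂ) ∈ (fun z : ℂ => (w + r * z : ℂ)) '' V ∩ {z | 0 ≤ z.im} := ⟨hu, u.2⟩
      rw [him2] at hu'
      obtain ⟨z, hz, hzu⟩ := hu'
      have := (hball _ (hbox z (hVb hz))).1
      dsimp only at hzu
      rwa [hzu, toUpper_coe] at this
    rw [him2, ← image_comp] at this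
    exact this
  · intro z hz
    have hmem := (hball _ (hbox z hz)).1
    have hc : (toUpper (w + r * z) : ℂ).im = r * z.im := by
      rw [coe_toUpper (by rw [himz]; exact mul_nonneg hr0.le hz.2.1), himz]
    constructor
    · intro h
      by_contra hne
      refine symm_notMem_manifoldBoundary e hmem ?_ h
      rw [hc]
      exact mul_pos hr0 (lt_of_le_of_ne hz.2.1 (Ne.symm hne))
    · intro h
      refine symm_mem_manifoldBoundary e hmem ?_
      rw [hc, h, mul_zero]
  · simp only [mul_zero, add_zero, toUpper_coe, hwx]
  · rintro _ ⟨z, hz, rfl⟩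
    exact (hball _ (hbox z hz)).2

/-- The boundary of a surface is invariant under homeomorphisms. -/
theorem Homeomorph.preimage_manifoldBoundary {X Y : Type*} [TopologicalSpace X]
    [TopologicalSpace Y] (e : X ≃ₜ Y) : e ⁻¹' manifoldBoundary Y = manifoldBoundary X := by
  ext x
  simp only [manifoldBoundary, mem_preimage, mem_ofPred_eq, not_iff_not]
  constructor
  · rintro ⟨U, hU, hx, ⟨g⟩⟩
    exact ⟨e ⁻¹' U, hU.preimage e.continuous, hx, ⟨(e.sets rfl).trans g⟩⟩
  · rintro ⟨U, hU, hx, ⟨g⟩⟩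
    exact ⟨e '' U, e.isOpenMap U hU, ⟨x, hx, rfl⟩, ⟨(e.image U).symm.trans g⟩⟩

theorem IsMetricSurface.locallyCompactSpace {X : Type*} [TopologicalSpace X]
    (hX : IsMetricSurface X) : LocallyCompactSpace X := by
  obtain ⟨cs⟩ := hX
  have : LocallyCompactSpace ClosedUpperHalfPlane :=
    (isClosed_le continuous_const Complex.continuous_im).isClosedEmbedding_subtypeVal
      |>.locallyCompactSpace
  have : LocallyCompactSpace (EuclideanHalfSpace 2) :=
    halfSpaceHomeo.isClosedEmbedding.locallyCompactSpace
  exact ChartedSpace.locallyCompactSpace (EuclideanHalfSpace 2) X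

end

section

open Set Metric MeasureTheory Filter Topology
open scoped ENNReal unitInterval

/-- Locally finite disjoint families of closed sets in a metric space have disjoint open
neighbourhoods. -/
theorem exists_disjoint_open_nhds {X ι : Type*} [MetricSpace X] {C : ι → Set X}
    (hC : ∀ i, IsClosed (C i)) (hloc : LocallyFinite C)
    (hdisj : Pairwise fun i k => Disjoint (C i) (C k)) :
    ∃ W : ι → Set X, (∀ i, IsOpen (W i)) ∧ (∀ i, C i ⊆ W i) ∧
      Pairwise fun i k => Disjoint (W i) (W k) := by
  set E : ι → Set X := fun i => ⋃ k : {k // k ≠ i}, C k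
  have hE : ∀ i, IsClosed (E i) := fun i =>
    (hloc.comp_injective Subtype.val_injective).isClosed_iUnion fun k => hC k
  have hCE : ∀ i k, i ≠ k → C i ⊆ E k := fun i k hik x hx => mem_iUnion.2 ⟨⟨i, hik⟩, hx⟩
  refine ⟨fun i => {x | infEDist x (C i) < infEDist x (E i)}, fun i =>
    isOpen_lt continuous_infEDist continuous_infEDist, fun i x hx => ?_, fun i k hik => ?_⟩
  · rw [mem_ofPred_eq, infEDist_zero_of_mem hx, pos_iff_ne_zero, Ne,
      ← mem_iff_infEDist_zero_of_closed (hE i)]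
    intro h
    obtain ⟨k, hk⟩ := mem_iUnion.1 h
    exact disjoint_left.1 (hdisj k.2) hk hx
  · refine disjoint_left.2 fun x hx hx' => ?_
    have h1 : infEDist x (E i) ≤ infEDist x (C k) := infEDist_anti (hCE k i hik.symm)
    have h2 : infEDist x (E k) ≤ infEDist x (C i) := infEDist_anti (hCE i k hik)
    exact lt_irrefl _ (((hx.trans_le h1).trans hx').trans_le h2)

theorem LocallyFinite.comp_of_finite_fibers {X κ ι : Type*} [TopologicalSpace X] {v : κ → Set X}
    (hv : LocallyFinite v) {k : ι → κ} (hk : ∀ j, {i | k i = j}.Finite) :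
    LocallyFinite fun i => v (k i) := by
  intro x
  obtain ⟨N, hN, hf⟩ := hv x
  refine ⟨N, hN, (hf.biUnion fun j _ => hk j).subset fun i hi => ?_⟩
  exact mem_biUnion (x := k i) hi rfl

/-- A locally finite disjoint family of small rectangles whose lower sides are their
intersections with the boundary of the surface, with marked subintervals of the lower sides. -/
structure IsRectFamily {X ι : Type*} [MetricSpace X] (δ : ℝ) (ψ : ι → ℂ → X) (m₁ m₂ : ι → ℝ) :
    Prop where
  rect : ∀ i, IsRect univ (ψ i)
  locallyFinite : LocallyFinite fun i => ψ i '' unitSquare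
  disjoint : Pairwise fun i k => Disjoint (ψ i '' unitSquare) (ψ k '' unitSquare)
  dist_lt : ∀ i, ∀ x ∈ ψ i '' unitSquare, ∀ y ∈ ψ i '' unitSquare, dist x y < δ
  mem_iff : ∀ i, ∀ z ∈ unitSquare, ψ i z ∈ manifoldBoundary X ↔ z.im = 0
  pos : ∀ i, 0 < m₁ i
  lt : ∀ i, m₁ i < m₂ i
  lt_one : ∀ i, m₂ i < 1

theorem ofReal_mem_halfBox {t : ℝ} (h : t ∈ Icc (-1 : ℝ) 1) : (t : ℂ) ∈ halfBox :=
  ⟨by simpa using h, by simp⟩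

theorem IsBoundaryBox.isOpen_strip {X : Type*} [TopologicalSpace X] {φ : ℂ → X}
    (hφ : IsBoundaryBox φ) {a b h : ℝ} (ha : -1 ≤ a) (hb : b ≤ 1) (hh : h ≤ 1) :
    IsOpen (φ '' {z | z.re ∈ Ioo a b ∧ 0 ≤ z.im ∧ z.im < h}) := by
  have hV : IsOpen {z : ℂ | z.re ∈ Ioo a b ∧ z.im < h} :=
    (isOpen_Ioo.preimage Complex.continuous_re).inter (isOpen_lt Complex.continuous_im
      continuous_const)
  have := hφ.isOpen_image _ hV fun z hz => ⟨⟨by linarith [hz.1.1.1], by linarith [hz.1.1.2]⟩,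
    hz.2, by linarith [hz.1.2]⟩
  convert this using 2
  ext z
  simp only [mem_ofPred_eq, mem_inter_iff]
  tauto

/-- Rectangles of small height over disjoint intervals in boundary charts. -/
theorem exists_isRectFamily {X κ ι : Type*} [MetricSpace X] {δ : ℝ} {φ : κ → ℂ → X}
    (hφ : ∀ k, IsBoundaryBox (φ k)) {v : κ → Set X} (hvo : ∀ k, IsOpen (v k))
    (hvl : LocallyFinite v) (hvδ : ∀ k, ∀ x ∈ v k, ∀ y ∈ v k, dist x y < δ)
    (k : ι → κ) (hk : ∀ j, {i | k i = j}.Finite) {a a' b' b : ι → ℝ} (ha : ∀ i, -1 < a i)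
    (haa : ∀ i, a i < a' i) (hab : ∀ i, a' i < b' i) (hbb : ∀ i, b' i < b i) (hb : ∀ i, b i < 1)
    (hC : ∀ i, ∀ t ∈ Icc (a i) (b i), φ (k i) (t : ℝ) ∈ v (k i))
    (hdisj : Pairwise fun i j => Disjoint ((fun t : ℝ => φ (k i) t) '' Icc (a i) (b i))
      ((fun t : ℝ => φ (k j) t) '' Icc (a j) (b j))) :
    ∃ (ψ : ι → ℂ → X) (m₁ m₂ : ι → ℝ), IsRectFamily δ ψ m₁ m₂ ∧
      ∀ i, ∀ s ∈ Icc (a' i) (b' i), φ (k i) (s : ℝ) ∈ ψ i '' realSeg (m₁ i) (m₂ i) := by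
  have hab' : ∀ i, 0 < b i - a i := fun i => by linarith [haa i, hab i, hbb i]
  have hvk := hvl.comp_of_finite_fibers hk
  have hCc : ∀ i, ContinuousOn (fun t : ℝ => φ (k i) t) (Icc (a i) (b i)) := fun i =>
    (hφ (k i)).cont.comp Complex.continuous_ofReal.continuousOn fun t ht =>
      ofReal_mem_halfBox ⟨by linarith [ht.1, ha i], by linarith [ht.2, hb i]⟩
  obtain ⟨W, hWo, hCW, hW⟩ := exists_disjoint_open_nhds
    (fun i => (isCompact_Icc.image_of_continuousOn (hCc i)).isClosed)
    (hvk.subset fun i => image_subset_iff.2 (hC i)) hdisj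
  have hh : ∀ i, ∃ h ∈ Ioo (0 : ℝ) 1, ∀ z : ℂ, z.re ∈ Icc (a i) (b i) → z.im ∈ Icc 0 h →
      φ (k i) z ∈ v (k i) ∩ W i := by
    intro i
    obtain ⟨V, hV, hVφ⟩ := (_root_.continuousOn_iff'.1 (hφ (k i)).cont) _ ((hvo (k i)).inter (hWo i))
    have hsub : Complex.ofReal '' Icc (a i) (b i) ⊆ V := by
      rintro _ ⟨t, ht, rfl⟩
      have : (t : ℂ) ∈ φ (k i) ⁻¹' (v (k i) ∩ W i) ∩ halfBox := ⟨⟨hC i t ht, hCW i ⟨t, ht, rfl⟩⟩,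
        ofReal_mem_halfBox ⟨by linarith [ht.1, ha i], by linarith [ht.2, hb i]⟩⟩
      rw [hVφ] at this
      exact this.1
    obtain ⟨η, hη, hηV⟩ := (isCompact_Icc.image Complex.continuous_ofReal).exists_thickening_subset_open
      hV hsub
    refine ⟨min (η / 2) (1 / 2), ⟨by positivity, (min_le_right _ _).trans_lt (by norm_num)⟩,
      fun z hz hz' => ?_⟩
    have h1 := hz'.2.trans (min_le_left _ _)
    have h2 := hz'.2.trans (min_le_right _ _)
    have : z ∈ V ∩ halfBox := by
      refine ⟨hηV (mem_thickening_iff.2 ⟨_, ⟨z.re, hz, rfl⟩, ?_⟩), ?_, hz'.1, by linarith⟩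
      · rw [dist_eq_norm]
        refine (Complex.norm_le_abs_re_add_abs_im _).trans_lt ?_
        simp only [Complex.sub_re, Complex.sub_im, Complex.ofReal_re, Complex.ofReal_im, sub_self,
          abs_zero, sub_zero, zero_add, abs_of_nonneg hz'.1]
        linarith
      · exact ⟨by linarith [hz.1, ha i], by linarith [hz.2, hb i]⟩
    rw [← hVφ] at this
    exact this.1
  choose h hh0 hhφ using hh
  set A : ι → ℂ → ℂ := fun i z => ⟨a i + z.re * (b i - a i), h i * z.im⟩ with hA
  have hAc : ∀ i, Continuous (A i) := fun i => by
    have : Continuous fun z : ℂ => (((a i + z.re * (b i - a i) : ℝ) : ℂ) +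
      ((h i * z.im : ℝ) : ℂ) * Complex.I) := by fun_prop
    refine this.congr fun z => ?_
    apply Complex.ext <;> simp [hA]
  have hA1 : ∀ i, ∀ z ∈ unitSquare, (A i z).re ∈ Icc (a i) (b i) := fun i z hz =>
    ⟨by simp only [hA]; nlinarith [hz.1.1, hab' i], by simp only [hA]; nlinarith [hz.1.2, hab' i]⟩
  have hA2 : ∀ i, ∀ z ∈ unitSquare, (A i z).im ∈ Icc 0 (h i) := fun i z hz =>
    ⟨mul_nonneg (hh0 i).1.le hz.2.1, by simp only [hA]; nlinarith [hz.2.2, (hh0 i).1]⟩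
  have hAb : ∀ i, MapsTo (A i) unitSquare halfBox := fun i z hz =>
    ⟨⟨by linarith [(hA1 i z hz).1, ha i], by linarith [(hA1 i z hz).2, hb i]⟩, (hA2 i z hz).1,
      by linarith [(hA2 i z hz).2, (hh0 i).2]⟩
  have hsub : ∀ i, (fun z => φ (k i) (A i z)) '' unitSquare ⊆ v (k i) ∩ W i := by
    rintro i _ ⟨z, hz, rfl⟩
    exact hhφ i _ (hA1 i z hz) (hA2 i z hz)
  have hAsurj : ∀ i (w : ℂ), A i ⟨(w.re - a i) / (b i - a i), w.im / h i⟩ = w := fun i w => by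
    have h1 := (hab' i).ne'
    have h2 := (hh0 i).1.ne'
    apply Complex.ext
    · simp only [hA]; field_simp; ring
    · simp only [hA]; field_simp
  refine ⟨fun i z => φ (k i) (A i z), fun i => (a' i - a i) / (b i - a i),
    fun i => (b' i - a i) / (b i - a i), ⟨fun i => ⟨?_, ?_, subset_univ _, ?_, ?_⟩, ?_, ?_, ?_, ?_,
    ?_, ?_, ?_⟩, ?_⟩
  · exact (hφ (k i)).cont.comp (hAc i).continuousOn (hAb i)
  · intro y hy z hz hyz
    have h1 := (hφ (k i)).inj (hAb i hy) (hAb i hz) hyz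
    simp only [hA, Complex.mk.injEq] at h1
    apply Complex.ext
    · exact mul_right_cancel₀ (hab' i).ne' (add_left_cancel h1.1)
    · exact mul_left_cancel₀ (hh0 i).1.ne' h1.2
  · simp
  · rintro _ ⟨⟨z, hz, rfl⟩, hcl⟩
    by_contra hne
    have hz3 : ¬(z.re = 0 ∨ z.re = 1 ∨ z.im = 1) := fun h' => hne ⟨z, ⟨hz, h'⟩, rfl⟩
    push Not at hz3
    have hop := (hφ (k i)).isOpen_strip (ha i).le (hb i).le (hh0 i).2.le
    have hmem : φ (k i) (A i z) ∈ φ (k i) '' {z | z.re ∈ Ioo (a i) (b i) ∧ 0 ≤ z.im ∧ z.im < h i} := by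
      have h0 : 0 < z.re := lt_of_le_of_ne hz.1.1 (Ne.symm hz3.1)
      have h1 : z.re < 1 := lt_of_le_of_ne hz.1.2 hz3.2.1
      have h2 : z.im < 1 := lt_of_le_of_ne hz.2.2 hz3.2.2
      refine ⟨_, ⟨⟨?_, ?_⟩, (hA2 i z hz).1, ?_⟩, rfl⟩ <;> simp only [hA] <;>
        nlinarith [hab' i, (hh0 i).1]
    obtain ⟨_, ⟨w, hw, rfl⟩, hw'⟩ := _root_.mem_closure_iff.1 hcl _ hop hmem
    refine hw'.2 ⟨⟨(w.re - a i) / (b i - a i), w.im / h i⟩, ⟨⟨?_, ?_⟩, ?_, ?_⟩, by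
      dsimp only; rw [hAsurj]⟩
    · exact div_nonneg (by linarith [hw.1.1]) (hab' i).le
    · exact (div_le_one (hab' i)).2 (by linarith [hw.1.2])
    · exact div_nonneg hw.2.1 (hh0 i).1.le
    · exact (div_le_one (hh0 i).1).2 hw.2.2.le
  · exact hvk.subset fun i => (hsub i).trans inter_subset_left
  · exact fun i j hij => (hW hij).mono ((hsub i).trans inter_subset_right)
      ((hsub j).trans inter_subset_right)
  · exact fun i x hx y hy => hvδ (k i) x (hsub i hx).1 y (hsub i hy).1
  · intro i z hz
    rw [(hφ (k i)).mem_iff _ (hAb i hz)]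
    simp only [hA, mul_eq_zero, (hh0 i).1.ne', false_or]
  · exact fun i => div_pos (by linarith [haa i]) (hab' i)
  · exact fun i => div_lt_div_of_pos_right (by linarith [hab i]) (hab' i)
  · exact fun i => (div_lt_one (hab' i)).2 (by linarith [hbb i])
  · intro i s hs
    refine ⟨⟨(s - a i) / (b i - a i), 0⟩, ⟨rfl, ?_, ?_⟩, ?_⟩
    · exact div_le_div_of_nonneg_right (by linarith [hs.1]) (hab' i).le
    · exact div_le_div_of_nonneg_right (by linarith [hs.2]) (hab' i).le
    · have := hAsurj i (s : ℂ)
      simp only [Complex.ofReal_re, Complex.ofReal_im, zero_div] at this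
      dsimp only
      rw [this]

theorem IsBoundaryBox.continuousOn_real {X : Type*} [TopologicalSpace X] {φ : ℂ → X}
    (hφ : IsBoundaryBox φ) : ContinuousOn (fun t : ℝ => φ t) (Icc (-1) 1) :=
  hφ.cont.comp Complex.continuous_ofReal.continuousOn fun _ => ofReal_mem_halfBox

theorem IsBoundaryBox.injOn_real {X : Type*} [TopologicalSpace X] {φ : ℂ → X}
    (hφ : IsBoundaryBox φ) : InjOn (fun t : ℝ => φ t) (Icc (-1) 1) := fun _ hs _ ht h =>
  Complex.ofReal_injective (hφ.inj (ofReal_mem_halfBox hs) (ofReal_mem_halfBox ht) h)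

theorem IsBoundaryBox.exists_Icc_subset {X : Type*} [TopologicalSpace X] {φ : ℂ → X}
    (hφ : IsBoundaryBox φ) {t : ℝ} (ht : t ∈ Ioo (-1 : ℝ) 1) {O : Set X} (hO : IsOpen O)
    (htO : φ t ∈ O) : ∃ η > 0, ∀ s ∈ Icc (t - η) (t + η), s ∈ Ioo (-1 : ℝ) 1 ∧ φ (s : ℝ) ∈ O := by
  have h1 : ∀ᶠ s : ℝ in 𝓝 t, s ∈ Ioo (-1 : ℝ) 1 ∧ φ (s : ℝ) ∈ O :=
    (isOpen_Ioo.eventually_mem ht).and ((hφ.continuousOn_real.continuousAt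
      (Icc_mem_nhds ht.1 ht.2)).eventually (hO.mem_nhds htO))
  obtain ⟨η, hη, h⟩ := Metric.nhds_basis_closedBall.eventually_iff.1 h1
  refine ⟨η, hη, fun s hs => h ?_⟩
  rwa [Real.closedBall_eq_Icc]

theorem IsBoundaryBox.strip_inter_boundary {X : Type*} [TopologicalSpace X] {φ : ℂ → X}
    (hφ : IsBoundaryBox φ) {a b : ℝ} (ha : -1 ≤ a) (hb : b ≤ 1) {y : X}
    (hy : y ∈ φ '' {z | z.re ∈ Ioo a b ∧ 0 ≤ z.im ∧ z.im < 1}) (hyB : y ∈ manifoldBoundary X) :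
    ∃ t ∈ Ioo a b, φ (t : ℝ) = y := by
  obtain ⟨z, ⟨h1, h2, h3⟩, rfl⟩ := hy
  have him := (hφ.mem_iff z ⟨⟨by linarith [h1.1], by linarith [h1.2]⟩, h2, h3.le⟩).1 hyB
  refine ⟨z.re, h1, congrArg φ ?_⟩
  apply Complex.ext <;> simp [him]

/-- The boundary of a surface is covered by the marked intervals of two families of small
disjoint rectangles. -/
theorem exists_boundary_isRectFamily.{u} {X : Type u} [MetricSpace X] (hX : IsMetricSurface X)
    {δ : ℝ} (hδ : 0 < δ) :
    ∃ (ι₁ ι₂ : Type u) (ψ : ι₁ → ℂ → X) (m₁ m₂ : ι₁ → ℝ) (χ : ι₂ → ℂ → X) (n₁ n₂ : ι₂ → ℝ),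
      IsRectFamily δ ψ m₁ m₂ ∧ IsRectFamily δ χ n₁ n₂ ∧
      manifoldBoundary X ⊆ (⋃ i, ψ i '' realSeg (m₁ i) (m₂ i)) ∪
        ⋃ d, χ d '' realSeg (n₁ d) (n₂ d) := by
  set B := manifoldBoundary X with hB
  choose φ hφ hφ0 hφb using fun x : B =>
    exists_isBoundaryBox hX x.2 (ball_mem_nhds (x : X) (half_pos hδ))
  set U : B → Set X := fun x => φ x '' {z | z.re ∈ Ioo (-1 : ℝ) 1 ∧ 0 ≤ z.im ∧ z.im < 1} with hU
  obtain ⟨v, hvo, hBv, hvl, hvU⟩ := precise_refinement_set (isClosed_manifoldBoundary X) U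
    (fun x => (hφ x).isOpen_strip le_rfl le_rfl le_rfl) fun y hy =>
      mem_iUnion.2 ⟨⟨y, hy⟩, 0, by simp, hφ0 ⟨y, hy⟩⟩
  obtain ⟨F, hBF, hFc, hFv⟩ := exists_subset_iUnion_closed_subset (isClosed_manifoldBoundary X) hvo
    (fun y _ => hvl.point_finite y) hBv
  have hvB : ∀ x, ∀ y ∈ v x, y ∈ B → ∃ t ∈ Ioo (-1 : ℝ) 1, φ x (t : ℝ) = y := fun x y hy hyB =>
    (hφ x).strip_inter_boundary le_rfl le_rfl (hvU x hy) hyB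
  have hφB : ∀ x, ∀ t ∈ Icc (-1 : ℝ) 1, φ x (t : ℝ) ∈ B := fun x t ht =>
    ((hφ x).mem_iff _ (ofReal_mem_halfBox ht)).2 (Complex.ofReal_im t)
  have hvδ : ∀ x, ∀ y ∈ v x, ∀ z ∈ v x, dist y z < δ := by
    intro x y hy z hz
    have hm : ∀ w ∈ v x, dist w x < δ / 2 := fun w hw => by
      obtain ⟨u, hu, rfl⟩ := hvU x hw
      exact hφb x ⟨u, ⟨Ioo_subset_Icc_self hu.1, hu.2.1, hu.2.2.le⟩, rfl⟩
    linarith [dist_triangle_right y z x, hm y hy, hm z hz]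
  have hI : ∀ x, ∃ J : Set (ℝ × ℝ), J.Finite ∧ (∀ p ∈ J, p.1 < p.2 ∧
      ∀ t ∈ Icc p.1 p.2, t ∈ Ioo (-1 : ℝ) 1 ∧ φ x (t : ℝ) ∈ v x) ∧
      ∀ y ∈ F x, y ∈ B → ∃ p ∈ J, ∃ t ∈ Icc p.1 p.2, φ x (t : ℝ) = y := by
    intro x
    set K := Icc (-1 : ℝ) 1 ∩ (fun t : ℝ => φ x t) ⁻¹' F x
    have hK : IsCompact K := isCompact_Icc.of_isClosed_subset
      ((hφ x).continuousOn_real.preimage_isClosed_of_isClosed isClosed_Icc (hFc x))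
      inter_subset_left
    have hKI : ∀ t ∈ K, t ∈ Ioo (-1 : ℝ) 1 := by
      intro t ht
      obtain ⟨s, hs, hst⟩ := hvB x _ (hFv x ht.2) (hφB x t ht.1)
      rwa [← (hφ x).injOn_real (Ioo_subset_Icc_self hs) ht.1 hst]
    choose! η hη hηv using fun t (ht : t ∈ K) =>
      (hφ x).exists_Icc_subset (hKI t ht) (hvo x) (hFv x ht.2)
    obtain ⟨T, hT, hKT⟩ := hK.elim_nhds_subcover (fun t => Icc (t - η t) (t + η t)) fun t ht =>
      Icc_mem_nhds (by linarith [hη t ht]) (by linarith [hη t ht])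
    refine ⟨(fun t => (t - η t, t + η t)) '' T, T.finite_toSet.image _, ?_, ?_⟩
    · rintro _ ⟨t, ht, rfl⟩
      exact ⟨by dsimp only; linarith [hη t (hT t ht)], hηv t (hT t ht)⟩
    · intro y hy hyB
      obtain ⟨t, ht, rfl⟩ := hvB x y (hFv x hy) hyB
      obtain ⟨s, hs, hts⟩ := mem_iUnion₂.1 (hKT ⟨Ioo_subset_Icc_self ht, hy⟩)
      exact ⟨_, ⟨s, hs, rfl⟩, t, hts, rfl⟩
  choose J hIf hIv hIF using hI
  set E : B → Set ℝ := fun x => Prod.fst '' J x ∪ Prod.snd '' J x with hE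
  have hEf : ∀ x, (E x).Finite := fun x => ((hIf x).image _).union ((hIf x).image _)
  have hEv : ∀ x, ∀ t ∈ E x, t ∈ Ioo (-1 : ℝ) 1 ∧ φ x (t : ℝ) ∈ v x := by
    rintro x _ (⟨p, hp, rfl⟩ | ⟨p, hp, rfl⟩)
    · exact (hIv x p hp).2 _ ⟨le_rfl, (hIv x p hp).1.le⟩
    · exact (hIv x p hp).2 _ ⟨(hIv x p hp).1.le, le_rfl⟩
  set D : Set X := {y | ∃ x, ∃ t ∈ E x, φ x (t : ℝ) = y} with hD
  have hDK : ∀ K, IsCompact K → (D ∩ K).Finite := by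
    intro K hK
    refine ((hvl.finite_nonempty_inter_compact hK).biUnion fun x _ =>
      (hEf x).image fun t : ℝ => φ x t).subset ?_
    rintro _ ⟨⟨x, t, ht, rfl⟩, hyK⟩
    exact mem_biUnion (x := x) ⟨_, (hEv x t ht).2, hyK⟩ ⟨t, ht, rfl⟩
  have hDx : ∀ x, {t ∈ Icc (-1 : ℝ) 1 | φ x (t : ℝ) ∈ D}.Finite := fun x =>
    Finite.of_injOn (f := fun t : ℝ => φ x t) (t := D ∩ (fun t : ℝ => φ x t) '' Icc (-1) 1)
      (fun t ht => ⟨ht.2, t, ht.1, rfl⟩) ((hφ x).injOn_real.mono fun t ht => ht.1)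
      (hDK _ (isCompact_Icc.image_of_continuousOn (hφ x).continuousOn_real))
  -- the rectangles around the points of `D`
  choose k t htE htd using fun d : D => d.2
  have hkf : ∀ x, {d : D | k d = x}.Finite := fun x => by
    refine Finite.of_injOn (f := t) (t := E x) ?_ ?_ (hEf x)
    · rintro d rfl
      exact htE d
    · rintro d rfl d' hd' h
      apply Subtype.ext
      rw [← htd d, ← htd d', h, show k d' = k d from hd']
  obtain ⟨W, hWo, hdW, hWd⟩ := exists_disjoint_open_nhds (C := fun d : D => {(d : X)})
    (fun d => isClosed_singleton) ((hvl.comp_of_finite_fibers hkf).subset fun d =>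
      singleton_subset_iff.2 (by
        have := (hEv _ _ (htE d)).2
        rwa [htd d] at this)) fun d d' hne => by
      simpa only [disjoint_singleton, Ne, Subtype.val_inj] using hne
  choose η hη hηv using fun d : D => (hφ (k d)).exists_Icc_subset (hEv _ _ (htE d)).1
    ((hvo (k d)).inter (hWo d)) ⟨(hEv _ _ (htE d)).2, by rw [htd d]; exact hdW d rfl⟩
  have hd1 : ∀ d, -1 < t d - η d := fun d => (hηv d _ ⟨le_rfl, by linarith [hη d]⟩).1.1
  have hd2 : ∀ d, t d + η d < 1 := fun d => (hηv d _ ⟨by linarith [hη d], le_rfl⟩).1.2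
  obtain ⟨χ, n₁, n₂, hχ, hχn⟩ := exists_isRectFamily hφ hvo hvl hvδ k hkf
    (a := fun d => t d - η d) (a' := fun d => t d - η d / 3) (b' := fun d => t d + η d / 3)
    (b := fun d => t d + η d) hd1 (fun d => by linarith [hη d]) (fun d => by linarith [hη d])
    (fun d => by linarith [hη d]) hd2 (fun d s hs => (hηv d s hs).2.1) (fun d d' hne =>
      (hWd hne).mono (image_subset_iff.2 fun s hs => (hηv d s hs).2.2)
        (image_subset_iff.2 fun s hs => (hηv d' s hs).2.2))
  set N : D → Set X := fun d =>
    φ (k d) '' {z | z.re ∈ Ioo (t d - η d / 3) (t d + η d / 3) ∧ 0 ≤ z.im ∧ z.im < 1} with hN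
  have hNo : ∀ d, IsOpen (N d) := fun d => (hφ (k d)).isOpen_strip
    (by linarith [hd1 d, hη d]) (by linarith [hd2 d, hη d]) le_rfl
  have hdN : ∀ d : D, (d : X) ∈ N d := fun d => by
    refine ⟨t d, ⟨?_, by simp⟩, htd d⟩
    simp only [Complex.ofReal_re]
    exact ⟨by linarith [hη d], by linarith [hη d]⟩
  have hNχ : ∀ d, ∀ y ∈ N d, y ∈ B → y ∈ χ d '' realSeg (n₁ d) (n₂ d) := by
    intro d y hy hyB
    obtain ⟨s, hs, rfl⟩ := (hφ (k d)).strip_inter_boundary (by linarith [hd1 d, hη d])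
      (by linarith [hd2 d, hη d]) hy hyB
    exact hχn d s (Ioo_subset_Icc_self hs)
  -- the rectangles over the gaps of `D`
  set Gap : B → ℝ → ℝ → Prop := fun x α β => α < β ∧ (∀ s ∈ Icc α β, s ∈ Ioo (-1 : ℝ) 1 ∧
    φ x (s : ℝ) ∈ v x) ∧ φ x α ∈ D ∧ φ x β ∈ D ∧ ∀ s ∈ Ioo α β, φ x (s : ℝ) ∉ D with hGap
  set 𝒮 : Set (Set X) := {S | ∃ x α β, Gap x α β ∧ S = (fun s : ℝ => φ x s) '' Ioo α β} with h𝒮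
  have hsubS : ∀ S ∈ 𝒮, ∀ S' ∈ 𝒮, (S ∩ S').Nonempty → S ⊆ S' := by
    rintro _ ⟨x, α, β, hg, rfl⟩ _ ⟨x', α', β', hg', rfl⟩ ⟨y, hy, s, hs, hsy⟩
    have hP : IsPreconnected ((fun s : ℝ => φ x s) '' Ioo α β) := isPreconnected_Ioo.image _
      ((hφ x).continuousOn_real.mono fun s hs => Ioo_subset_Icc_self
        (hg.2.1 s (Ioo_subset_Icc_self hs)).1)
    have hc1 : IsClosed ((fun s : ℝ => φ x' s) '' Icc α' β') :=
      (isCompact_Icc.image_of_continuousOn ((hφ x').continuousOn_real.mono fun s hs =>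
        Ioo_subset_Icc_self (hg'.2.1 s hs).1)).isClosed
    have ho := (hφ x').isOpen_strip (hg'.2.1 α' ⟨le_rfl, hg'.1.le⟩).1.1.le
      (hg'.2.1 β' ⟨hg'.1.le, le_rfl⟩).1.2.le le_rfl
    have hmem : ∀ r ∈ Ioo α' β', φ x' (r : ℝ) ∈
        φ x' '' {z | z.re ∈ Ioo α' β' ∧ 0 ≤ z.im ∧ z.im < 1} := fun r hr =>
      ⟨r, ⟨by simpa using hr, by simp⟩, rfl⟩
    have hend : ∀ r ∈ Icc α' β', φ x' (r : ℝ) ∉ D → r ∈ Ioo α' β' := fun r hr hrD =>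
      ⟨lt_of_le_of_ne hr.1 fun h => hrD (h ▸ hg'.2.2.1),
        lt_of_le_of_ne hr.2 fun h => hrD (h ▸ hg'.2.2.2.1)⟩
    have hdich := hP.subset_or_subset_of_closed hc1 ho.isClosed_compl ?_ ?_
    · have h1 := hdich.resolve_right fun h => h hy (by
        dsimp only at hsy
        rw [← hsy]
        exact hmem s hs)
      rintro _ ⟨r, hr, rfl⟩
      obtain ⟨r', hr', h'⟩ := h1 ⟨r, hr, rfl⟩
      dsimp only at h' ⊢
      rw [← h']
      exact ⟨r', hend r' hr' (h' ▸ hg.2.2.2.2 r hr), rfl⟩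
    · rintro _ ⟨r, hr, rfl⟩
      refine or_iff_not_imp_right.2 fun hn => ?_
      obtain ⟨r', hr', h'⟩ := (hφ x').strip_inter_boundary
        (hg'.2.1 α' ⟨le_rfl, hg'.1.le⟩).1.1.le (hg'.2.1 β' ⟨hg'.1.le, le_rfl⟩).1.2.le
        (not_not.1 hn) (hφB x r (Ioo_subset_Icc_self (hg.2.1 r (Ioo_subset_Icc_self hr)).1))
      exact ⟨r', Ioo_subset_Icc_self hr', h'⟩
    · rw [eq_empty_iff_forall_notMem]
      rintro _ ⟨⟨r, hr, rfl⟩, ⟨r', hr', h'⟩, hn⟩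
      dsimp only at h' hn
      exact hn (h' ▸ hmem r' (hend r' hr' (h' ▸ hg.2.2.2.2 r hr)))
  choose x α β hg hS using fun S : 𝒮 => S.2
  have hxf : ∀ y, {S : 𝒮 | x S = y}.Finite := fun y => by
    refine Finite.of_injOn (f := fun S => (α S, β S)) ?_ ?_ ((hDx y).prod (hDx y))
    · rintro S rfl
      exact ⟨⟨Ioo_subset_Icc_self ((hg S).2.1 _ ⟨le_rfl, (hg S).1.le⟩).1, (hg S).2.2.1⟩,
        Ioo_subset_Icc_self ((hg S).2.1 _ ⟨(hg S).1.le, le_rfl⟩).1, (hg S).2.2.2.1⟩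
    · rintro S rfl S' hS' h
      apply Subtype.ext
      rw [Prod.mk.injEq] at h
      rw [hS S, hS S', h.1, h.2, show x S' = x S from hS']
  have hα : ∀ S : 𝒮, ∃ r ∈ Ioo (α S) ((α S + β S) / 2), ∀ s ∈ Icc (α S) r,
      φ (x S) (s : ℝ) ∈ N ⟨_, (hg S).2.2.1⟩ := by
    intro S
    have h := (hg S).1
    obtain ⟨η, hη, h1⟩ := (hφ (x S)).exists_Icc_subset
      ((hg S).2.1 (α S) ⟨le_rfl, h.le⟩).1 (hNo ⟨_, (hg S).2.2.1⟩) (hdN ⟨_, (hg S).2.2.1⟩)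
    refine ⟨min (α S + η) ((3 * α S + β S) / 4), ⟨lt_min (by linarith) (by linarith),
      (min_le_right _ _).trans_lt (by linarith)⟩, fun s hs => (h1 s ⟨by linarith [hs.1], ?_⟩).2⟩
    exact hs.2.trans (min_le_left _ _)
  have hβ : ∀ S : 𝒮, ∃ r ∈ Ioo ((α S + β S) / 2) (β S), ∀ s ∈ Icc r (β S),
      φ (x S) (s : ℝ) ∈ N ⟨_, (hg S).2.2.2.1⟩ := by
    intro S
    have h := (hg S).1
    obtain ⟨η, hη, h1⟩ := (hφ (x S)).exists_Icc_subset
      ((hg S).2.1 (β S) ⟨h.le, le_rfl⟩).1 (hNo ⟨_, (hg S).2.2.2.1⟩) (hdN ⟨_, (hg S).2.2.2.1⟩)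
    refine ⟨max (β S - η) ((α S + 3 * β S) / 4), ⟨lt_of_lt_of_le (by linarith) (le_max_right _ _),
      max_lt (by linarith) (by linarith)⟩, fun s hs => (h1 s ⟨?_, by linarith [hs.2]⟩).2⟩
    exact (le_max_left _ _).trans hs.1
  choose α' hα' hαN using hα
  choose β' hβ' hβN using hβ
  have hIccS : ∀ S : 𝒮, (fun s : ℝ => φ (x S) s) '' Icc ((α S + α' S) / 2) ((β' S + β S) / 2) ⊆ S :=
    fun S => by
      conv_rhs => rw [hS S]
      exact image_mono fun s hs => ⟨by linarith [hs.1, (hα' S).1], by linarith [hs.2, (hβ' S).2]⟩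
  obtain ⟨ψ, m₁, m₂, hψ, hψm⟩ := exists_isRectFamily hφ hvo hvl hvδ x hxf
    (a := fun S => (α S + α' S) / 2) (a' := α') (b' := β') (b := fun S => (β' S + β S) / 2)
    (fun S => by linarith [((hg S).2.1 _ ⟨le_rfl, (hg S).1.le⟩).1.1, (hα' S).1])
    (fun S => by linarith [(hα' S).1]) (fun S => (hα' S).2.trans (hβ' S).1)
    (fun S => by linarith [(hβ' S).2])
    (fun S => by linarith [((hg S).2.1 _ ⟨(hg S).1.le, le_rfl⟩).1.2, (hβ' S).2])
    (fun S s hs => ((hg S).2.1 s ⟨by linarith [hs.1, (hα' S).1],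
      by linarith [hs.2, (hβ' S).2]⟩).2) (fun S S' hne => by
        refine Disjoint.mono (hIccS S) (hIccS S') (not_not.1 fun hd => hne ?_)
        rw [not_disjoint_iff_nonempty_inter] at hd
        exact Subtype.ext (subset_antisymm (hsubS S S.2 S' S'.2 hd)
          (hsubS S' S'.2 S S.2 (by rwa [inter_comm]))))
  refine ⟨𝒮, D, ψ, m₁, m₂, χ, n₁, n₂, hψ, hχ, fun y hyB => ?_⟩
  by_cases hyD : y ∈ D
  · exact Or.inr (mem_iUnion.2 ⟨⟨y, hyD⟩, hNχ ⟨y, hyD⟩ y (hdN ⟨y, hyD⟩) hyB⟩)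
  obtain ⟨x₀, hyF⟩ := mem_iUnion.1 (hBF hyB)
  obtain ⟨p, hp, r, hr, rfl⟩ := hIF x₀ y hyF hyB
  have hpv := (hIv x₀ p hp).2
  have hp1 : φ x₀ (p.1 : ℝ) ∈ D := ⟨x₀, p.1, Or.inl ⟨p, hp, rfl⟩, rfl⟩
  have hp2 : φ x₀ (p.2 : ℝ) ∈ D := ⟨x₀, p.2, Or.inr ⟨p, hp, rfl⟩, rfl⟩
  have hfin : ∀ a b, p.1 ≤ a → b ≤ p.2 → {s ∈ Icc a b | φ x₀ (s : ℝ) ∈ D}.Finite :=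
    fun a b ha hb => (hDx x₀).subset fun s hs => ⟨Ioo_subset_Icc_self (hpv s
      ⟨ha.trans hs.1.1, hs.1.2.trans hb⟩).1, hs.2⟩
  obtain ⟨α₀, ⟨hα₀, hα₀D⟩, hmax⟩ := exists_max_image _ id (hfin p.1 r le_rfl hr.2)
    ⟨p.1, ⟨le_rfl, hr.1⟩, hp1⟩
  obtain ⟨β₀, ⟨hβ₀, hβ₀D⟩, hmin⟩ := exists_min_image _ id (hfin r p.2 hr.1 le_rfl)
    ⟨p.2, ⟨hr.2, le_rfl⟩, hp2⟩
  have hrα : α₀ < r := lt_of_le_of_ne hα₀.2 fun h => hyD (h ▸ hα₀D)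
  have hrβ : r < β₀ := lt_of_le_of_ne hβ₀.1 fun h => hyD (h ▸ hβ₀D)
  have hgap : Gap x₀ α₀ β₀ := by
    refine ⟨hrα.trans hrβ, fun s hs => hpv s ⟨hα₀.1.trans hs.1, hs.2.trans hβ₀.2⟩, hα₀D, hβ₀D,
      fun s hs hsD => ?_⟩
    rcases le_total s r with h | h
    · exact absurd (hmax s ⟨⟨hα₀.1.trans hs.1.le, h⟩, hsD⟩) (not_le.2 hs.1)
    · exact absurd (hmin s ⟨⟨h, hs.2.le.trans hβ₀.2⟩, hsD⟩) (not_le.2 hs.2)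
  set S : 𝒮 := ⟨_, x₀, α₀, β₀, hgap, rfl⟩ with hSdef
  have hyS : φ x₀ (r : ℝ) ∈ (S : Set X) := ⟨r, ⟨hrα, hrβ⟩, rfl⟩
  rw [hS S] at hyS
  obtain ⟨s, hs, hsy⟩ := hyS
  dsimp only at hsy
  rw [← hsy] at hyB ⊢
  rcases le_total s (α' S) with h | h
  · exact Or.inr (mem_iUnion.2 ⟨_, hNχ _ _ (hαN S s ⟨hs.1.le, h⟩) hyB⟩)
  rcases le_total (β' S) s with h' | h'
  · exact Or.inr (mem_iUnion.2 ⟨_, hNχ _ _ (hβN S s ⟨h', hs.2.le⟩) hyB⟩)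
  · exact Or.inl (mem_iUnion.2 ⟨S, hψm S s ⟨h, h'⟩⟩)

end

section

open Set Metric MeasureTheory Filter Topology
open scoped ENNReal unitInterval

theorem LocallyFinite.image_of_leftInverse {X ι : Type*} [TopologicalSpace X] {Q : ι → Set X}
    (hQ : LocallyFinite Q) {Φ Ψ : X → X} (hΨ : Function.LeftInverse Ψ Φ)
    (hΨc : ContinuousOn Ψ (range Φ)) (hcl : IsClosed (range Φ)) :
    LocallyFinite fun i => Φ '' Q i := by
  intro y
  by_cases hy : y ∈ range Φ
  · obtain ⟨N, hN, hf⟩ := hQ (Ψ y)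
    obtain ⟨M, hM, hMN⟩ := mem_nhdsWithin_iff_exists_mem_nhds_inter.1
      ((hΨc y hy).preimage_mem_nhdsWithin hN)
    refine ⟨M, hM, hf.subset ?_⟩
    rintro i ⟨_, ⟨x, hx, rfl⟩, hxM⟩
    have : Ψ (Φ x) ∈ N := hMN ⟨hxM, x, rfl⟩
    rw [hΨ x] at this
    exact ⟨x, hx, this⟩
  · refine ⟨_, hcl.isOpen_compl.mem_nhds hy, Finite.subset finite_empty ?_⟩
    rintro i ⟨_, ⟨x, hx, rfl⟩, hxM⟩
    exact hxM ⟨x, rfl⟩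

theorem measure_lt_top_of_isCompact_mu2 {X : Type*} [MetricSpace X] [MeasurableSpace X]
    [BorelSpace X] (hloc : IsLocallyFiniteMeasure (mu2 X)) {K : Set X} (hK : IsCompact K) :
    (μH[2] : Measure X) K < ⊤ := by
  have h := hK.measure_lt_top (μ := mu2 X)
  simp only [mu2, Measure.smul_apply, smul_eq_mul] at h
  refine ENNReal.lt_top_of_mul_ne_top_right h.ne ?_
  simpa using Real.pi_pos

theorem IsClosed.image_of_leftInverse {X : Type*} [TopologicalSpace X] {C : Set X}
    (hC : IsClosed C) {Φ Ψ : X → X} (hΨ : Function.LeftInverse Ψ Φ)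
    (hΨc : ContinuousOn Ψ (range Φ)) (hcl : IsClosed (range Φ)) : IsClosed (Φ '' C) := by
  convert hΨc.preimage_isClosed_of_isClosed hcl hC
  ext y
  constructor
  · rintro ⟨x, hx, rfl⟩
    exact ⟨⟨x, rfl⟩, by rwa [mem_preimage, hΨ x]⟩
  · rintro ⟨⟨x, rfl⟩, hx⟩
    rw [mem_preimage, hΨ x] at hx
    exact ⟨x, hx, rfl⟩

theorem ofReal_mem_unitSquare {t : ℝ} (ht : t ∈ Icc (0 : ℝ) 1) : (t : ℂ) ∈ unitSquare :=
  ⟨by simpa using ht, by simp⟩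

/-- Every surface retracts, with small displacement, onto a homeomorphic closed subset whose
boundary is composed of a locally finite family of polygonal arcs; the family `A` parametrizes
arcs covering the boundary of the surface. -/
theorem exists_polygonal_embedding.{u} {X : Type u} [MetricSpace X] [MeasurableSpace X]
    [BorelSpace X] (hX : IsMetricSurface X) (hloc : IsLocallyFiniteMeasure (mu2 X)) {δ : ℝ}
    (hδ : 0 < δ) :
    ∃ (Φ Ψ R : X → X) (ι : Type u) (S : ι → Set X) (a b : ι → X) (A : ι → ℝ → X),
      Continuous Φ ∧ Function.LeftInverse Ψ Φ ∧ ContinuousOn Ψ (range Φ) ∧ IsClosed (range Φ) ∧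
      Continuous R ∧ (∀ x, R x ∈ range Φ) ∧ EqOn R id (range Φ) ∧ (∀ x, dist (R x) x < 4 * δ) ∧
      (∀ i, PolyArc (S i) (a i) (b i)) ∧ LocallyFinite S ∧
      (∀ P ⊆ Φ '' manifoldBoundary X, P.Nonempty → IsPreconnected P →
        (∀ i, a i ∉ P ∧ b i ∉ P) → ∃ i, P ⊆ S i) ∧
      (∀ i, ContinuousOn (A i) (Icc 0 1)) ∧ (∀ i, InjOn (A i) (Icc 0 1)) ∧
      (LocallyFinite fun i => A i '' Icc 0 1) ∧ ⋃ i, A i '' Icc 0 1 = manifoldBoundary X := by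
  have hlc := hX.locallyCompactSpace
  obtain ⟨ι₁, ι₂, ψ, m₁, m₂, χ, n₁, n₂, hψ, hχ, hcov⟩ := exists_boundary_isRectFamily hX hδ
  obtain ⟨p, q, S, Φ₁, Ψ₁, R₁, hp, hq, hS, hSQ, hΦ₁, hΨ₁, hΨ₁c, hY, -, hR₁, hR₁m, hR₁i, hQ₁, hout₁,
    hΦS, -, hcl⟩ := exists_cut_family isClosed_univ hψ.rect hψ.pos hψ.lt hψ.lt_one
      (fun i => measure_lt_top_of_isCompact_mu2 hloc (hψ.rect i).isCompact) hψ.locallyFinite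
      hψ.disjoint
  rw [image_univ] at hΨ₁c hY hR₁m hR₁i hcl
  have hL : Function.LeftInverse Ψ₁ Φ₁ := fun x => hΨ₁ (mem_univ x)
  have hΦc : Continuous Φ₁ := continuousOn_univ.1 hΦ₁
  have hbot : ∀ i, ∀ z ∈ realSeg (p i) (q i), ψ i z ∈ manifoldBoundary X := fun i z hz =>
    (hψ.mem_iff i z (realSeg_subset_unitSquare (hp i).1.le (hq i).2.le hz)).2 hz.1
  have himg : ∀ d, (Φ₁ ∘ χ d) '' unitSquare = Φ₁ '' (χ d '' unitSquare) := fun d =>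
    image_comp _ _ _
  have hrect : ∀ d, IsRect (range Φ₁) (Φ₁ ∘ χ d) := by
    intro d
    have hd := hχ.rect d
    refine ⟨hΦc.comp_continuousOn hd.cont, hL.injective.comp_injOn hd.inj, ?_, ?_, ?_⟩
    · rintro _ ⟨z, -, rfl⟩
      exact ⟨_, rfl⟩
    · intro z hz hfr
      have h1 : Φ₁ (χ d z) ∈ closure (univ \ range Φ₁) := by
        rw [← compl_eq_univ_sdiff]
        rw [frontier_eq_closure_inter_closure] at hfr
        exact hfr.2
      obtain ⟨i, hi⟩ := mem_iUnion.1 (hcl ⟨⟨_, rfl⟩, h1⟩)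
      rw [← hΦS i] at hi
      obtain ⟨_, ⟨w, hw, rfl⟩, hwz⟩ := hi
      have hzB := hbot i w hw
      rw [hL.injective hwz, hχ.mem_iff d z hz] at hzB
      exact (mem_frontier_unitSquare hz).2 (Or.inr (Or.inr (Or.inl hzB)))
    · rw [himg]
      rintro _ ⟨⟨x, hx, rfl⟩, hcx⟩
      have hsub : range Φ₁ \ Φ₁ '' (χ d '' unitSquare) ⊆ Φ₁ '' (univ \ χ d '' unitSquare) := by
        rintro _ ⟨⟨y, rfl⟩, hy⟩
        exact ⟨y, ⟨mem_univ y, fun h => hy ⟨y, h, rfl⟩⟩, rfl⟩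
      have h2 := ((hΨ₁c _ ⟨x, rfl⟩).mono (image_subset_range Φ₁ _)).mem_closure_image
        (closure_mono hsub hcx)
      rw [hL x, ← image_comp, hL.comp_eq_id, image_id] at h2
      obtain ⟨z, hz, rfl⟩ := hd.sides ⟨hx, h2⟩
      exact ⟨z, hz, rfl⟩
  have hloc₂ : LocallyFinite fun d => (Φ₁ ∘ χ d) '' unitSquare := by
    simp only [himg]
    exact hχ.locallyFinite.image_of_leftInverse hL hΨ₁c hY
  obtain ⟨p', q', S', Φ₂, Ψ₂, R₂, hp', hq', hS', hSQ', hΦ₂, hΨ₂, hΨ₂c, hY', hYY, hR₂, hR₂m, hR₂i,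
    hQ₂, hout₂, hΦS', hfix, -⟩ := exists_cut_family hY hrect hχ.pos hχ.lt hχ.lt_one
      (fun d => measure_lt_top_of_isCompact_mu2 hloc (hrect d).isCompact) hloc₂
      (fun d d' hne => by
        dsimp only
        rw [himg, himg]
        exact (disjoint_image_iff hL.injective).2 (hχ.disjoint hne))
  have hrange : range (Φ₂ ∘ Φ₁) = Φ₂ '' range Φ₁ := range_comp _ _
  have hd₁ : ∀ x, dist (Φ₁ x) x < δ ∧ dist (R₁ x) x < δ := by
    intro x
    by_cases hx : ∃ i, x ∈ ψ i '' unitSquare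
    · obtain ⟨i, hi⟩ := hx
      exact ⟨hψ.dist_lt i _ (hQ₁ i x hi).1 _ hi, hψ.dist_lt i _ (hQ₁ i x hi).2 _ hi⟩
    · obtain ⟨h1, h2⟩ := hout₁ x (not_exists.1 hx)
      rw [h1, h2, dist_self]
      exact ⟨hδ, hδ⟩
  have hd₂ : ∀ y, dist (R₂ y) y < 3 * δ := by
    intro y
    by_cases hy : ∃ d, y ∈ (Φ₁ ∘ χ d) '' unitSquare
    · obtain ⟨d, hd⟩ := hy
      obtain ⟨z, hz, h1⟩ := (hQ₂ d y hd).2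
      obtain ⟨w, hw, rfl⟩ := hd
      rw [← h1]
      have h2 := hχ.dist_lt d _ ⟨z, hz, rfl⟩ _ ⟨w, hw, rfl⟩
      have h3 := dist_triangle4_right (Φ₁ (χ d z)) (Φ₁ (χ d w)) (χ d z) (χ d w)
      simp only [Function.comp_apply]
      linarith [(hd₁ (χ d z)).1, (hd₁ (χ d w)).1]
    · rw [(hout₂ y (not_exists.1 hy)).2, dist_self]
      linarith
  have hLI : Function.LeftInverse (Ψ₁ ∘ Ψ₂) (Φ₂ ∘ Φ₁) := fun x => by
    simp only [Function.comp_apply]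
    rw [hΨ₂ ⟨x, rfl⟩, hL x]
  have hΨc : ContinuousOn (Ψ₁ ∘ Ψ₂) (range (Φ₂ ∘ Φ₁)) := by
    rw [hrange]
    refine hΨ₁c.comp hΨ₂c ?_
    rintro _ ⟨y, hy, rfl⟩
    rwa [hΨ₂ hy]
  have hS'mem : ∀ d, ∀ z ∈ realSeg (p' d) (q' d), Φ₂ (Φ₁ (χ d z)) ∈ S' d := fun d z hz => by
    rw [← hΦS' d]
    exact ⟨_, ⟨z, hz, rfl⟩, rfl⟩
  have hcover : ∀ x ∈ manifoldBoundary X, (∃ i, Φ₂ (Φ₁ x) ∈ S i) ∨ ∃ d, Φ₂ (Φ₁ x) ∈ S' d := by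
    intro x hxB
    rcases hcov hxB with hx | hx
    · obtain ⟨i, z, hz, rfl⟩ := mem_iUnion.1 hx
      have h1 : Φ₁ (ψ i z) ∈ S i := by
        rw [← hΦS i]
        exact ⟨_, ⟨z, ⟨hz.1, (hp i).2.le.trans hz.2.1, hz.2.2.trans (hq i).1.le⟩, rfl⟩, rfl⟩
      by_cases hy : ∃ d, Φ₁ (ψ i z) ∈ (Φ₁ ∘ χ d) '' unitSquare
      · obtain ⟨d, w, hw, hwz⟩ := hy
        have hwz' : χ d w = ψ i z := hL.injective hwz
        have hw0 : w.im = 0 := (hχ.mem_iff d w hw).1 (hwz' ▸ hxB)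
        simp only [Function.comp_apply] at hwz ⊢
        by_cases hwI : w.re ∈ Icc (p' d) (q' d)
        · rw [← hwz]
          exact Or.inr ⟨d, hS'mem d w ⟨hw0, hwI⟩⟩
        · have h3 := hfix d w ⟨(mem_frontier_unitSquare hw).2 (Or.inr (Or.inr (Or.inl hw0))),
            fun h => hwI (Ioo_subset_Icc_self h.2)⟩
          simp only [Function.comp_apply] at h3
          rw [← hwz, h3, hwz]
          exact Or.inl ⟨i, h1⟩
      · rw [(hout₂ _ (not_exists.1 hy)).1]
        exact Or.inl ⟨i, h1⟩
    · obtain ⟨d, z, hz, rfl⟩ := mem_iUnion.1 hx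
      exact Or.inr ⟨d, hS'mem d z
        ⟨hz.1, (hp' d).2.le.trans hz.2.1, hz.2.2.trans (hq' d).1.le⟩⟩
  have hrest : ∀ d, ∀ z ∈ unitSquare, z.im = 0 → z.re ∉ Ioo (p' d) (q' d) →
      Φ₂ (Φ₁ (χ d z)) = Φ₁ (χ d z) := fun d z hz hz0 hzI =>
    hfix d z ⟨(mem_frontier_unitSquare hz).2 (Or.inr (Or.inr (Or.inl hz0))), fun h => hzI h.2⟩
  have hS'cl : ∀ d, ∀ P ⊆ (Φ₂ ∘ Φ₁) '' manifoldBoundary X, IsPreconnected P →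
      Φ₁ (χ d (p' d : ℝ)) ∉ P → Φ₁ (χ d (q' d : ℝ)) ∉ P → P ⊆ S' d ∨ Disjoint P (S' d) := by
    intro d P hPM hP hpP hqP
    have hd := hχ.rect d
    set T : Set ℂ := {z ∈ unitSquare | ¬(z.re ∈ Ioo (p' d) (q' d) ∧ z.im < 1)} with hT
    have hTc : IsClosed T := isClosed_unitSquare.sdiff
      ((isOpen_Ioo.preimage Complex.continuous_re).inter
        (isOpen_lt Complex.continuous_im continuous_const))
    set Z := (Φ₂ ∘ Φ₁) '' (manifoldBoundary X ∩
      (χ d '' T ∪ closure (univ \ χ d '' unitSquare))) with hZ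
    have hZc : IsClosed Z := ((isClosed_manifoldBoundary X).inter
      ((isCompact_image_of_subset_unitSquare hd.cont hTc fun z hz => hz.1).isClosed.union
        isClosed_closure)).image_of_leftInverse hLI hΨc (hrange ▸ hY')
    have hPZ : P ∩ (S' d ∩ Z) = ∅ := by
      rw [eq_empty_iff_forall_notMem]
      rintro y ⟨hyP, hyS, x, ⟨hxB, hxT⟩, rfl⟩
      rw [← hΦS' d] at hyS
      obtain ⟨_, ⟨z, hz, rfl⟩, hzx⟩ := hyS
      have hzT := realSeg_subset_unitSquare (hp' d).1.le (hq' d).2.le hz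
      have hx : χ d z = x := hLI.injective hzx
      subst hx
      have hz' : z.re ∉ Ioo (p' d) (q' d) := by
        rcases hxT with ⟨w, hw, hwz⟩ | hxT
        · rw [hd.inj hw.1 hzT hwz] at hw
          exact fun h => hw.2 ⟨h, by rw [hz.1]; exact one_pos⟩
        · obtain ⟨w, hw, hwz⟩ := hd.sides ⟨⟨z, hzT, rfl⟩, hxT⟩
          rw [hd.inj hw.1 hzT hwz] at hw
          rcases hw.2 with h | h | h
          · linarith [hz.2.1, (hp' d).1]
          · linarith [hz.2.2, (hq' d).2]
          · linarith [hz.1]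
      have hzr : z = (z.re : ℂ) := by apply Complex.ext <;> simp [hz.1]
      simp only [Function.comp_apply, hrest d z hzT hz.1 hz'] at hyP
      rcases hz.2.1.eq_or_lt with h | h
      · rw [h, ← hzr] at hpP
        exact hpP hyP
      · rw [le_antisymm (not_lt.1 fun h' => hz' ⟨h, h'⟩) hz.2.2, ← hzr] at hqP
        exact hqP hyP
    refine (hP.subset_or_subset_of_closed (hS' d).isCompact.isClosed hZc ?_ hPZ).imp_right ?_
    · intro y hy
      obtain ⟨x, hx, rfl⟩ := hPM hy
      by_cases hxQ : x ∈ χ d '' unitSquare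
      · obtain ⟨z, hz, rfl⟩ := hxQ
        have hz0 := (hχ.mem_iff d z hz).1 hx
        by_cases hzI : z.re ∈ Icc (p' d) (q' d)
        · exact Or.inl (hS'mem d z ⟨hz0, hzI⟩)
        · exact Or.inr ⟨_, ⟨hx, Or.inl ⟨z, ⟨hz, fun h => hzI (Ioo_subset_Icc_self h.1)⟩, rfl⟩⟩, rfl⟩
      · exact Or.inr ⟨x, ⟨hx, Or.inr (subset_closure ⟨mem_univ x, hxQ⟩)⟩, rfl⟩
    · intro hPZ'
      refine disjoint_left.2 fun y hy hyS => ?_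
      rw [eq_empty_iff_forall_notMem] at hPZ
      exact hPZ y ⟨hy, hyS, hPZ' hy⟩
  refine ⟨Φ₂ ∘ Φ₁, Ψ₁ ∘ Ψ₂, R₂ ∘ R₁, ι₁ ⊕ ι₂, Sum.elim S S', Sum.elim (fun i => ψ i (p i : ℝ))
    (fun d => (Φ₁ ∘ χ d) (p' d : ℝ)), Sum.elim (fun i => ψ i (q i : ℝ))
    (fun d => (Φ₁ ∘ χ d) (q' d : ℝ)), Sum.elim (fun i t => ψ i (t : ℝ)) (fun d t => χ d (t : ℝ)),
    hΦ₂.comp_continuous hΦc fun x => ⟨x, rfl⟩, hLI, hΨc, hrange ▸ hY', ?_, fun x => ?_, ?_,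
    fun x => ?_, ?_, ?_, ?_, ?_, ?_, ?_, ?_⟩
  · exact hR₂.comp_continuous (continuousOn_univ.1 hR₁) fun x => hR₁m (mem_univ x)
  · rw [hrange]
    exact hR₂m (hR₁m (mem_univ x))
  · rw [hrange]
    intro y hy
    simp only [Function.comp_apply]
    rw [hR₁i (hYY hy)]
    exact hR₂i hy
  · have := dist_triangle (R₂ (R₁ x)) (R₁ x) x
    simp only [Function.comp_apply]
    linarith [hd₂ (R₁ x), (hd₁ x).2]
  · rintro (i | d)
    · exact hS i
    · exact hS' d
  · refine LocallyFinite.sumElim ?_ ?_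
    · exact hψ.locallyFinite.subset hSQ
    · exact hloc₂.subset hSQ'
  · intro P hPM hne hP hend
    by_cases hex : ∃ d, P ⊆ S' d
    · obtain ⟨d, hd⟩ := hex
      exact ⟨Sum.inr d, hd⟩
    have hdis : ∀ d, Disjoint P (S' d) := fun d =>
      (hS'cl d P hPM hP (hend (Sum.inr d)).1 (hend (Sum.inr d)).2).resolve_left fun h => hex ⟨d, h⟩
    have hPS : ∀ y ∈ P, ∃ i, y ∈ S i := by
      intro y hy
      obtain ⟨x, hx, rfl⟩ := hPM hy
      exact (hcover x hx).resolve_right fun ⟨d, h⟩ => disjoint_left.1 (hdis d) hy h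
    obtain ⟨y, hy⟩ := hne
    obtain ⟨i, hi⟩ := hPS y hy
    have hSl : LocallyFinite fun j : {j // j ≠ i} => S j :=
      (hψ.locallyFinite.subset hSQ).comp_injective Subtype.val_injective
    have hSd : ∀ j : {j // j ≠ i}, Disjoint (S j) (S i) := fun j =>
      (hψ.disjoint j.2).mono (hSQ j) (hSQ i)
    have h1 := hP.subset_or_subset_of_closed (hS i).isCompact.isClosed
      (hSl.isClosed_iUnion fun j => (hS j).isCompact.isClosed) ?_ ?_
    · refine ⟨Sum.inl i, h1.resolve_right fun h => ?_⟩
      obtain ⟨j, hj⟩ := mem_iUnion.1 (h hy)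
      exact disjoint_left.1 (hSd j) hj hi
    · intro z hz
      obtain ⟨j, hj⟩ := hPS z hz
      by_cases hji : j = i
      · exact Or.inl (hji ▸ hj)
      · exact Or.inr (mem_iUnion.2 ⟨⟨j, hji⟩, hj⟩)
    · rw [eq_empty_iff_forall_notMem]
      rintro z ⟨-, hzi, hz⟩
      obtain ⟨j, hj⟩ := mem_iUnion.1 hz
      exact disjoint_left.1 (hSd j) hj hzi
  · rintro (i | d)
    · exact (hψ.rect i).cont.comp Complex.continuous_ofReal.continuousOn fun _ =>
        ofReal_mem_unitSquare
    · exact (hχ.rect d).cont.comp Complex.continuous_ofReal.continuousOn fun _ =>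
        ofReal_mem_unitSquare
  · rintro (i | d) s hs t ht hst
    · exact Complex.ofReal_injective
        ((hψ.rect i).inj (ofReal_mem_unitSquare hs) (ofReal_mem_unitSquare ht) hst)
    · exact Complex.ofReal_injective
        ((hχ.rect d).inj (ofReal_mem_unitSquare hs) (ofReal_mem_unitSquare ht) hst)
  · refine (hψ.locallyFinite.sumElim hχ.locallyFinite).subset ?_
    rintro (i | d)
    · rintro _ ⟨t, ht, rfl⟩
      exact ⟨t, ofReal_mem_unitSquare ht, rfl⟩
    · rintro _ ⟨t, ht, rfl⟩
      exact ⟨t, ofReal_mem_unitSquare ht, rfl⟩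
  · refine subset_antisymm (iUnion_subset ?_) fun x hx => ?_
    · rintro (i | d) _ ⟨t, ht, rfl⟩
      · exact (hψ.mem_iff i _ (ofReal_mem_unitSquare ht)).2 (Complex.ofReal_im t)
      · exact (hχ.mem_iff d _ (ofReal_mem_unitSquare ht)).2 (Complex.ofReal_im t)
    · have hz' : ∀ z : ℂ, z.im = 0 → ((z.re : ℝ) : ℂ) = z := fun z hz => by
        apply Complex.ext <;> simp [hz]
      rcases hcov hx with h | h
      · obtain ⟨i, z, hz, rfl⟩ := mem_iUnion.1 h
        refine mem_iUnion.2 ⟨Sum.inl i, z.re, ⟨(hψ.pos i).le.trans hz.2.1,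
          hz.2.2.trans (hψ.lt_one i).le⟩, ?_⟩
        simp only [Sum.elim_inl, hz' z hz.1]
      · obtain ⟨d, z, hz, rfl⟩ := mem_iUnion.1 h
        refine mem_iUnion.2 ⟨Sum.inr d, z.re, ⟨(hχ.pos d).le.trans hz.2.1,
          hz.2.2.trans (hχ.lt_one d).le⟩, ?_⟩
        simp only [Sum.elim_inr, hz' z hz.1]

end

section

open Set Metric MeasureTheory Filter Topology
open scoped ENNReal unitInterval

/-- A nondegenerate arc contained in a geodesic arc is a geodesic arc. -/
theorem GeoSet.isGeodesicArc_of_subset {X : Type*} [MetricSpace X] {G : Set X} {p q : X}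
    (hG : GeoSet G p q) {K : Set X} (hK : IsCompact K) (hKc : IsConnected K) (hKn : K.Nontrivial)
    (hKG : K ⊆ G) : ∃ p q, IsGeodesicArc K p q := by
  obtain ⟨γ, D, hγ, rfl, rfl, rfl⟩ := hG
  set e := Function.invFunOn γ (Icc 0 1)
  have he : LeftInvOn e γ (Icc 0 1) := hγ.injOn.leftInvOn_invFunOn
  have hec : ContinuousOn e (γ '' Icc 0 1) :=
    isCompact_Icc.continuousOn_of_leftInvOn hγ.continuousOn he
  have hr : ∀ x ∈ K, γ (e x) = x := fun x hx => Function.invFunOn_eq (hKG hx)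
  have hm : e '' K ⊆ Icc 0 1 := by
    rintro _ ⟨x, hx, rfl⟩
    exact Function.invFunOn_mem (hKG hx)
  have hKe : K = γ '' (e '' K) := by
    rw [← image_comp]
    exact ((image_congr hr).trans (image_id' K)).symm
  have hI := eq_Icc_of_connected_compact (hKc.image e (hec.mono hKG))
    (hK.image_of_continuousOn (hec.mono hKG))
  have hne : (e '' K).Nontrivial := hKn.image_of_injOn fun x hx y hy h => by
    rw [← hr x hx, ← hr y hy, h]
  rw [hI] at hne hm hKe
  have hlt : sInf (e '' K) < sSup (e '' K) :=
    lt_of_not_ge fun h => hne.not_subsingleton (subsingleton_Icc_of_ge h)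
  rw [hKe]
  exact ⟨_, _, (hγ.geoSet_Icc (hm ⟨le_rfl, hlt.le⟩).1 hlt (hm ⟨hlt.le, le_rfl⟩).2).isGeodesicArc⟩

theorem exists_gap {F : Set ℝ} (hF : F.Finite) (h0 : (0 : ℝ) ∈ F) (h1 : (1 : ℝ) ∈ F) {r : ℝ}
    (hr : r ∈ Icc (0 : ℝ) 1) :
    ∃ s ∈ F, ∃ t ∈ F, s < t ∧ 0 ≤ s ∧ t ≤ 1 ∧ r ∈ Icc s t ∧ ∀ u ∈ Ioo s t, u ∉ F := by
  rcases hr.2.lt_or_eq with hr1 | rfl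
  · obtain ⟨s, ⟨hsF, hs⟩, hmax⟩ := exists_max_image (F ∩ Icc 0 r) id
      (hF.subset inter_subset_left) ⟨0, h0, le_rfl, hr.1⟩
    obtain ⟨t, ⟨htF, ht⟩, hmin⟩ := exists_min_image (F ∩ Ioc r 1) id
      (hF.subset inter_subset_left) ⟨1, h1, hr1, le_rfl⟩
    refine ⟨s, hsF, t, htF, hs.2.trans_lt ht.1, hs.1, ht.2, ⟨hs.2, ht.1.le⟩, fun u hu huF => ?_⟩
    rcases le_or_gt u r with h | h
    · exact absurd (hmax u ⟨huF, hs.1.trans hu.1.le, h⟩) (not_le.2 hu.1)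
    · exact absurd (hmin u ⟨huF, h, hu.2.le.trans ht.2⟩) (not_le.2 hu.2)
  · obtain ⟨s, ⟨hsF, hs⟩, hmax⟩ := exists_max_image (F ∩ Ico 0 1) id
      (hF.subset inter_subset_left) ⟨0, h0, le_rfl, one_pos⟩
    exact ⟨s, hsF, 1, h1, hs.2, hs.1, le_rfl, ⟨hs.2.le, le_rfl⟩, fun u hu huF =>
      absurd (hmax u ⟨huF, hs.1.trans hu.1.le, hu.2⟩) (not_le.2 hu.1)⟩

/-- A locally finite union of arcs composed of polygonal arcs has piecewise geodesic connected
components. -/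
theorem isPiecewiseGeodesic_connectedComponentIn {X ι κ : Type*} [MetricSpace X] {M : Set X}
    {A : κ → ℝ → X} (hA : ∀ j, ContinuousOn (A j) (Icc 0 1)) (hAi : ∀ j, InjOn (A j) (Icc 0 1))
    (hAl : LocallyFinite fun j => A j '' Icc 0 1) (hM : ⋃ j, A j '' Icc 0 1 = M)
    {S : ι → Set X} {a b : ι → X} (hS : ∀ i, PolyArc (S i) (a i) (b i)) (hSl : LocallyFinite S)
    (hP : ∀ P ⊆ M, P.Nonempty → IsPreconnected P → (∀ i, a i ∉ P ∧ b i ∉ P) → ∃ i, P ⊆ S i)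
    (y : X) : IsPiecewiseGeodesic (connectedComponentIn M y) := by
  choose V hVf haV hbV hV using fun i => (hS i).exists_vertices
  set W : Set X := ⋃ i, V i ∩ S i with hW
  have hWK : ∀ K, IsCompact K → (W ∩ K).Finite := by
    intro K hK
    refine ((hSl.finite_nonempty_inter_compact hK).biUnion fun i _ => hVf i).subset ?_
    rintro x ⟨hx, hxK⟩
    obtain ⟨i, hi⟩ := mem_iUnion.1 hx
    exact mem_biUnion (x := i) ⟨x, hi.2, hxK⟩ hi.1
  have hab : ∀ i, a i ∈ W ∧ b i ∈ W := fun i => by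
    obtain ⟨c, -, -, h0, h1, hc⟩ := (hS i).exists_param
    refine ⟨mem_iUnion.2 ⟨i, haV i, ?_⟩, mem_iUnion.2 ⟨i, hbV i, ?_⟩⟩
    · rw [hc, ← h0]; exact ⟨0, by simp, rfl⟩
    · rw [hc, ← h1]; exact ⟨1, by simp, rfl⟩
  set F : κ → Set ℝ := fun j => {t ∈ Icc (0 : ℝ) 1 | A j t ∈ W} ∪ {0, 1} with hF
  have hFf : ∀ j, (F j).Finite := fun j => by
    refine Finite.union (Finite.of_injOn (f := A j) (t := W ∩ A j '' Icc 0 1)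
      (fun t ht => ⟨ht.2, t, ht.1, rfl⟩) ((hAi j).mono fun t ht => ht.1)
      (hWK _ (isCompact_Icc.image_of_continuousOn (hA j)))) (by simp)
  have hFI : ∀ j, F j ⊆ Icc 0 1 := by
    rintro j t (ht | rfl | rfl)
    · exact ht.1
    · simp
    · simp
  set 𝒢 : κ → Set (Set X) := fun j => {G | ∃ s ∈ F j, ∃ t ∈ F j, s < t ∧
    (∀ u ∈ Ioo s t, u ∉ F j) ∧ G = A j '' Icc s t} with h𝒢
  have h𝒢f : ∀ j, (𝒢 j).Finite := fun j => by
    refine (((hFf j).prod (hFf j)).image fun p => A j '' Icc p.1 p.2).subset ?_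
    rintro _ ⟨s, hs, t, ht, -, -, rfl⟩
    exact ⟨(s, t), ⟨hs, ht⟩, rfl⟩
  have h𝒢A : ∀ j, ∀ G ∈ 𝒢 j, G ⊆ A j '' Icc 0 1 := by
    rintro j _ ⟨s, hs, t, ht, -, -, rfl⟩
    exact image_mono (Icc_subset_Icc (hFI j hs).1 (hFI j ht).2)
  have h𝒢c : ∀ j, ∀ G ∈ 𝒢 j, IsPreconnected G := by
    rintro j _ ⟨s, hs, t, ht, -, -, rfl⟩
    exact isPreconnected_Icc.image _ ((hA j).mono (Icc_subset_Icc (hFI j hs).1 (hFI j ht).2))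
  have h𝒢g : ∀ j, ∀ G ∈ 𝒢 j, ∃ p q, IsGeodesicArc G p q := by
    rintro j _ ⟨s, hs, t, ht, hst, hgap, rfl⟩
    have hI : Icc s t ⊆ Icc 0 1 := Icc_subset_Icc (hFI j hs).1 (hFI j ht).2
    have hPW : ∀ x ∈ A j '' Ioo s t, x ∉ W := by
      rintro _ ⟨u, hu, rfl⟩ hx
      exact hgap u hu (Or.inl ⟨hI (Ioo_subset_Icc_self hu), hx⟩)
    have hPc : IsPreconnected (A j '' Ioo s t) :=
      isPreconnected_Ioo.image _ ((hA j).mono (Ioo_subset_Icc_self.trans hI))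
    obtain ⟨i, hi⟩ := hP (A j '' Ioo s t) (hM ▸ (image_mono (Ioo_subset_Icc_self.trans hI)).trans
      (subset_iUnion (fun j => A j '' Icc 0 1) j)) ((nonempty_Ioo.2 hst).image _) hPc
      fun i => ⟨fun h => hPW _ h (hab i).1, fun h => hPW _ h (hab i).2⟩
    obtain ⟨G, -, p, q, hG, hPG⟩ := hV i _ hPc fun x hx =>
      ⟨hi hx, fun h => hPW x hx (mem_iUnion.2 ⟨i, h, hi hx⟩)⟩
    refine hG.isGeodesicArc_of_subset (isCompact_Icc.image_of_continuousOn ((hA j).mono hI))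
      ⟨(nonempty_Icc.2 hst.le).image _, h𝒢c j _ ⟨s, hs, t, ht, hst, hgap, rfl⟩⟩ ?_ ?_
    · exact Set.Nontrivial.image_of_injOn ⟨s, ⟨le_rfl, hst.le⟩, t, ⟨hst.le, le_rfl⟩, hst.ne⟩
        ((hAi j).mono hI)
    · rw [← closure_Ioo hst.ne]
      refine (ContinuousOn.image_closure ?_).trans (closure_minimal hPG hG.isCompact.isClosed)
      rw [closure_Ioo hst.ne]
      exact (hA j).mono hI
  have h𝒢M : ∀ x ∈ M, ∃ j, ∃ G ∈ 𝒢 j, x ∈ G := by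
    intro x hx
    rw [← hM] at hx
    obtain ⟨j, r, hr, rfl⟩ := mem_iUnion.1 hx
    obtain ⟨s, hs, t, ht, hst, -, -, hrst, hgap⟩ := exists_gap (hFf j) (Or.inr (Or.inl rfl))
      (Or.inr (Or.inr rfl)) hr
    exact ⟨j, _, ⟨s, hs, t, ht, hst, hgap, rfl⟩, r, hrst, rfl⟩
  refine ⟨{G | (∃ j, G ∈ 𝒢 j) ∧ G ⊆ connectedComponentIn M y}, ?_, ?_, ?_⟩
  · rintro G ⟨⟨j, hj⟩, -⟩
    exact h𝒢g j G hj
  · refine subset_antisymm (fun x hx => ?_) (sUnion_subset fun G hG => hG.2)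
    obtain ⟨j, G, hG, hxG⟩ := h𝒢M x (connectedComponentIn_subset M y hx)
    refine ⟨G, ⟨⟨j, hG⟩, ?_⟩, hxG⟩
    rw [connectedComponentIn_eq hx]
    exact (h𝒢c j G hG).subset_connectedComponentIn hxG
      ((h𝒢A j G hG).trans (hM ▸ subset_iUnion (fun j => A j '' Icc 0 1) j))
  · intro x _
    obtain ⟨N, hN, hf⟩ := hAl x
    refine ⟨N, hN, (hf.biUnion fun j _ => h𝒢f j).subset ?_⟩
    rintro G ⟨⟨⟨j, hj⟩, -⟩, hGN⟩
    exact mem_biUnion (x := j) (hGN.mono (inter_subset_inter_left _ (h𝒢A j G hj))) hj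

end

/-- **Retraction onto a subsurface with piecewise geodesic boundary.**  Let `X` be a
metric surface of locally finite Hausdorff 2-measure and `ε > 0`.  There is a subset
`X̃ ⊆ X` homeomorphic to `X`, each of whose boundary components is a piecewise
`d̄`-geodesic curve, such that the inclusion `X̃ ↪ X` is proper, together with a
continuous retraction `R : X → X̃` that is an `ε`-isometry. -/
theorem retraction_onto_polygonal_subsurface
    {X : Type*} [MetricSpace X] [MeasurableSpace X] [BorelSpace X]
    (hX : IsMetricSurface X) (hloc : IsLocallyFiniteMeasure (mu2 X))
    (ε : ℝ) (hε : 0 < ε) :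
    ∃ Xt : Set X,
      Nonempty (↥Xt ≃ₜ X) ∧
      (∀ y ∈ Subtype.val '' manifoldBoundary ↥Xt,
        IsPiecewiseGeodesic
          (connectedComponentIn (Subtype.val '' manifoldBoundary ↥Xt) y)) ∧
      IsProperMap (Subtype.val : ↥Xt → X) ∧
      ∃ R : X → X,
        Continuous R ∧ (∀ x : X, R x ∈ Xt) ∧ (∀ x ∈ Xt, R x = x) ∧
        (∀ x y : X, |dist (R x) (R y) - dist x y| < ε) ∧
        ∀ z ∈ Xt, ∃ x : X, dist z (R x) < ε := by
  obtain ⟨Φ, Ψ, R, ι, S, a, b, A, hΦ, hL, hΨ, hcl, hR, hRm, hRi, hRd, hS, hSl, hP, hA, hAi, hAl,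
    hAB⟩ := exists_polygonal_embedding hX hloc (δ := ε / 8) (by positivity)
  have hΨΦ : ∀ x ∈ range Φ, Φ (Ψ x) = x := by
    rintro _ ⟨x, rfl⟩
    rw [hL x]
  let e : X ≃ₜ range Φ :=
    { toFun := fun x => ⟨Φ x, x, rfl⟩
      invFun := fun y => Ψ y
      left_inv := hL
      right_inv := fun y => Subtype.ext (hΨΦ y y.2)
      continuous_toFun := hΦ.subtype_mk _
      continuous_invFun := continuousOn_iff_continuous_domRestrict.1 hΨ }
  have hM : Subtype.val '' manifoldBoundary (range Φ) = Φ '' manifoldBoundary X := by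
    rw [← e.symm.preimage_manifoldBoundary, ← e.image_eq_preimage_symm, image_image]
    rfl
  refine ⟨range Φ, ⟨e.symm⟩, fun y _ => ?_, hcl.isClosedEmbedding_subtypeVal.isProperMap, R, hR, hRm,
    fun x hx => hRi hx, fun x y => ?_, fun z hz => ⟨z, ?_⟩⟩
  · rw [hM]
    refine isPiecewiseGeodesic_connectedComponentIn (A := fun j => Φ ∘ A j)
      (fun j => hΦ.comp_continuousOn (hA j)) (fun j => hL.injective.comp_injOn (hAi j)) ?_ ?_ hS hSl
      hP y
    · simp only [image_comp]
      exact hAl.image_of_leftInverse hL hΨ hcl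
    · simp only [image_comp]
      rw [← image_iUnion, hAB]
  · rw [abs_lt]
    have h1 := dist_triangle4_right (R x) (R y) x y
    have h2 := dist_triangle4 x (R x) (R y) y
    rw [dist_comm x (R x)] at h2
    constructor <;> linarith [hRd x, hRd y]
  · rw [hRi hz, id, dist_self]
    exact hε
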